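/- (Boundedness of the even-order Riesz transforms of the Gru\v{s}in operator.) Fix integers n, m ≥ 1, N ≥ 1, let p ∈ (1,∞), let s ≥ 1 be an integer and let α be a word of elements of 𝒳 with |α| = 2s. Then there exists a constant c > 0 such that ‖X^α φ‖_p ≤ c · ‖H_N^s φ‖_p for all φ ∈ C_c^∞(ℝ^(n+m)), where H_N^s denotes the s-fold composition of H_N. -/

import Mathlib

open MeasureTheory
open scoped ENNReal NNReal

/-- Points of `ℝ^(n+m)`, written `(x, y)` with `x ∈ ℝⁿ`, `y ∈ ℝᵐ`. -/
abbrev Pt (n m : ℕ) := (Fin n → ℝ) × (Fin m → ℝ)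

/-- The partial derivative operator `∂_{x_j}`. -/
noncomputable def Dx (n m : ℕ) (j : Fin n) (f : Pt n m → ℝ) : Pt n m → ℝ :=
  fun z => fderiv ℝ f z (Pi.single j 1, 0)

/-- The partial derivative operator `∂_{y_k}`. -/
noncomputable def Dy (n m : ℕ) (k : Fin m) (f : Pt n m → ℝ) : Pt n m → ℝ :=
  fun z => fderiv ℝ f z (0, Pi.single k 1)

/-- Index set for the family `𝒳`: either `j ∈ {1,…,n}` (giving `X_j = ∂_{x_j}`) or a pair
of a multi-index `ν ∈ ℕⁿ` with `|ν| = N` and `k ∈ {1,…,m}` (giving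
`X_{ν,k} = (N!/ν!)^(1/2) x^ν ∂_{y_k}`). -/
def XIdx (n m N : ℕ) := Fin n ⊕ ({ν : Fin n → ℕ // ∑ i, ν i = N} × Fin m)

/-- The family `𝒳` of first-order operators `X_j = ∂_{x_j}` and
`X_{ν,k} = (N!/ν!)^(1/2) x^ν ∂_{y_k}` for `|ν| = N`. -/
noncomputable def Xop (n m N : ℕ) : XIdx n m N → (Pt n m → ℝ) → (Pt n m → ℝ)
  | Sum.inl j => Dx n m j
  | Sum.inr (ν, k) => fun f z =>
      Real.sqrt ((Nat.factorial N : ℝ) / ∏ i, (Nat.factorial (ν.1 i) : ℝ)) *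
        (∏ i, z.1 i ^ ν.1 i) * Dy n m k f z

/-- Composition `Z_1 ∘ Z_2 ∘ ⋯ ∘ Z_s` of a word of operators. -/
def compOps {n m : ℕ} (l : List ((Pt n m → ℝ) → (Pt n m → ℝ))) :
    (Pt n m → ℝ) → (Pt n m → ℝ) :=
  l.foldr (· ∘ ·) id

/-- `X^α` for a word `α` of elements of `𝒳`. -/
noncomputable def Xw {n m N M : ℕ} (α : Fin M → XIdx n m N) :
    (Pt n m → ℝ) → (Pt n m → ℝ) :=
  compOps (List.ofFn fun i => Xop n m N (α i))

/-- The Gru\v{s}in operator `H_N = −Δ_x − |x|^(2N) Δ_y`. -/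
noncomputable def grusin (n m N : ℕ) (f : Pt n m → ℝ) : Pt n m → ℝ :=
  fun z => -(∑ j, Dx n m j (Dx n m j f) z) -
    (∑ i, z.1 i ^ 2) ^ N * ∑ k, Dy n m k (Dy n m k f) z

/-- The operators `Y_j = ∂_{x_j}` for `j ≤ n` and `Y_{n+l} = |x|^N ∂_{y_l}` for `l ≤ m`. -/
noncomputable def Yop (n m N : ℕ) : (Fin n ⊕ Fin m) → (Pt n m → ℝ) → (Pt n m → ℝ)
  | Sum.inl j => Dx n m j
  | Sum.inr l => fun f z => Real.sqrt (∑ i, z.1 i ^ 2) ^ N * Dy n m l f z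

/-- `Y^α` for a word `α ∈ {1,…,n+m}^M`. -/
noncomputable def Yw {n m N M : ℕ} (α : Fin M → (Fin n ⊕ Fin m)) :
    (Pt n m → ℝ) → (Pt n m → ℝ) :=
  compOps (List.ofFn fun i => Yop n m N (α i))

section CotlarStein

variable {ι 𝔄 : Type*} [NormedRing 𝔄] [StarRing 𝔄]

/-- The product of the operators `T_i† T_j` over a list of pairs `(i, j)`. -/
noncomputable def pairWord (T : ι → 𝔄) : List (ι × ι) → 𝔄
  | [] => 1
  | q :: l => (star (T q.1) * T q.2) * pairWord T l

/-- The product of `a` over the pairs of a list. -/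
noncomputable def pairInner (a : ι → ι → ℝ) : List (ι × ι) → ℝ
  | [] => 1
  | q :: l => a q.1 q.2 * pairInner a l

/-- The product of `a` over the links between consecutive pairs, starting from `j`. -/
noncomputable def pairLink (a : ι → ι → ℝ) : ι → List (ι × ι) → ℝ
  | _, [] => 1
  | j, q :: l => a j q.1 * pairLink a q.2 l

variable {T : ι → 𝔄} {a : ι → ι → ℝ} {A : ℝ}

theorem norm_pairWord_le_inner (h0 : ‖(1 : 𝔄)‖ ≤ 1)
    (h₁ : ∀ i j, ‖star (T i) * T j‖ ≤ a i j ^ 2) (l : List (ι × ι)) :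
    ‖pairWord T l‖ ≤ pairInner a l ^ 2 := by
  induction l with
  | nil => simpa [pairWord, pairInner] using h0
  | cons q l ih =>
    rw [pairWord, pairInner, mul_pow]
    exact (norm_mul_le _ _).trans (mul_le_mul (h₁ _ _) ih (norm_nonneg _) (by positivity))

theorem norm_mul_pairWord_le_link (hA : ∀ i, ‖T i‖ ≤ A)
    (h₂ : ∀ i j, ‖T i * star (T j)‖ ≤ a i j ^ 2) (l : List (ι × ι)) (j : ι) :
    ‖T j * pairWord T l‖ ≤ pairLink a j l ^ 2 * A := by
  induction l generalizing j with
  | nil => simpa [pairWord, pairLink] using hA j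
  | cons q l ih =>
    rw [pairWord, pairLink, mul_pow, mul_assoc, mul_assoc, ← mul_assoc (T j)]
    exact (norm_mul_le _ _).trans (mul_le_mul (h₂ _ _) (ih _) (norm_nonneg _) (by positivity))

theorem norm_pairWord_cons_le [CStarRing 𝔄] (h0 : ‖(1 : 𝔄)‖ ≤ 1) (ha : ∀ i j, 0 ≤ a i j) (hA0 : 0 ≤ A) (hA : ∀ i, ‖T i‖ ≤ A)
    (h₁ : ∀ i j, ‖star (T i) * T j‖ ≤ a i j ^ 2)
    (h₂ : ∀ i j, ‖T i * star (T j)‖ ≤ a i j ^ 2) (q : ι × ι) (l : List (ι × ι)) :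
    ‖pairWord T (q :: l)‖ ≤ A * (pairInner a (q :: l) * pairLink a q.2 l) := by
  have hn1 : ∀ l, 0 ≤ pairInner a l := by
    intro l; induction l with
    | nil => simp [pairInner]
    | cons q l ih => exact mul_nonneg (ha _ _) ih
  have hn2 : ∀ l j, 0 ≤ pairLink a j l := by
    intro l; induction l with
    | nil => simp [pairLink]
    | cons q l ih => exact fun j => mul_nonneg (ha _ _) (ih _)
  have e1 := norm_pairWord_le_inner h0 h₁ (q :: l)
  have e2 : ‖pairWord T (q :: l)‖ ≤ A * (pairLink a q.2 l ^ 2 * A) := by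
    rw [pairWord, mul_assoc]
    refine (norm_mul_le _ _).trans (mul_le_mul ?_ (norm_mul_pairWord_le_link hA h₂ l q.2)
      (norm_nonneg _) hA0)
    rw [norm_star]; exact hA _
  refine le_of_sq_le_sq ?_ (mul_nonneg hA0 (mul_nonneg (hn1 _) (hn2 _ _)))
  calc ‖pairWord T (q :: l)‖ ^ 2 = ‖pairWord T (q :: l)‖ * ‖pairWord T (q :: l)‖ := sq _
    _ ≤ pairInner a (q :: l) ^ 2 * (A * (pairLink a q.2 l ^ 2 * A)) :=
        mul_le_mul e1 e2 (norm_nonneg _) (by positivity)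
    _ = _ := by ring

/-- **Cotlar–Stein lemma** for finite sums. -/
theorem norm_sum_le_of_almost_orthogonal [CStarRing 𝔄] [Fintype ι] (h0 : ‖(1 : 𝔄)‖ ≤ 1)
    (ha : ∀ i j, 0 ≤ a i j)
    (hsymm : ∀ i j, a i j = a j i) (hA : ∀ i, ∑ j, a i j ≤ A) (hA0 : 0 ≤ A)
    (h₁ : ∀ i j, ‖star (T i) * T j‖ ≤ a i j ^ 2)
    (h₂ : ∀ i j, ‖T i * star (T j)‖ ≤ a i j ^ 2) :
    ‖∑ i, T i‖ ≤ A := by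
  have hT : ∀ i, ‖T i‖ ≤ A := by
    intro i
    have h := h₁ i i
    rw [CStarRing.norm_star_mul_self, ← sq] at h
    have h' := le_of_sq_le_sq h (ha i i)
    exact h'.trans ((Finset.single_le_sum (fun j _ => ha i j) (Finset.mem_univ i)).trans (hA i))
  set V : 𝔄 := star (∑ i, T i) * ∑ i, T i with hV
  have hVs : V = ∑ q : ι × ι, star (T q.1) * T q.2 := by
    rw [hV, star_sum, Finset.sum_mul_sum, Fintype.sum_prod_type]
  have hn1 : ∀ l, 0 ≤ pairInner a l := by
    intro l; induction l with
    | nil => simp [pairInner]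
    | cons q l ih => exact mul_nonneg (ha _ _) ih
  have hn2 : ∀ l j, 0 ≤ pairLink a j l := by
    intro l; induction l with
    | nil => simp [pairLink]
    | cons q l ih => exact fun j => mul_nonneg (ha _ _) (ih _)
  have key : ∀ (k : ℕ) (q : ι × ι) (l : List (ι × ι)),
      ‖V ^ k * pairWord T (q :: l)‖ ≤
        A * A ^ (2 * k) * (pairInner a (q :: l) * pairLink a q.2 l) := by
    intro k
    induction k with
    | zero => intro q l; simpa using norm_pairWord_cons_le h0 ha hA0 hT h₁ h₂ q l
    | succ k ih =>
      intro q l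
      have e : V ^ (k + 1) * pairWord T (q :: l) =
          ∑ r : ι × ι, V ^ k * pairWord T (r :: q :: l) := by
        rw [pow_succ, mul_assoc, ← Finset.mul_sum]
        congr 1
        rw [hVs, Finset.sum_mul]
        rfl
      rw [e]
      refine (norm_sum_le _ _).trans ((Finset.sum_le_sum fun r _ => ih r (q :: l)).trans ?_)
      have e2 : ∑ r : ι × ι, A * A ^ (2 * k) *
            (pairInner a (r :: q :: l) * pairLink a r.2 (q :: l)) =
          (A * A ^ (2 * k) * (pairInner a (q :: l) * pairLink a q.2 l)) *
            ∑ r : ι × ι, a r.1 r.2 * a r.2 q.1 := by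
        rw [Finset.mul_sum]
        refine Finset.sum_congr rfl fun r _ => ?_
        rw [pairInner, pairLink]; ring
      have e3 : ∑ r : ι × ι, a r.1 r.2 * a r.2 q.1 ≤ A * A := by
        rw [Fintype.sum_prod_type, Finset.sum_comm]
        calc ∑ y, ∑ x, a x y * a y q.1 = ∑ y, (∑ x, a y x) * a q.1 y := by
              refine Finset.sum_congr rfl fun y _ => ?_
              rw [Finset.sum_mul]
              exact Finset.sum_congr rfl fun x _ => by rw [hsymm x y, hsymm y q.1]
          _ ≤ ∑ y, A * a q.1 y := Finset.sum_le_sum fun y _ =>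
              mul_le_mul_of_nonneg_right (hA y) (ha _ _)
          _ = A * ∑ y, a q.1 y := by rw [Finset.mul_sum]
          _ ≤ A * A := mul_le_mul_of_nonneg_left (hA _) hA0
      rw [e2]
      refine (mul_le_mul_of_nonneg_left e3 (mul_nonneg (by positivity)
        (mul_nonneg (hn1 _) (hn2 _ _)))).trans (le_of_eq ?_)
      ring
  set C : ℝ := ∑ q : ι × ι, A * a q.1 q.2 with hC
  have hCn : 0 ≤ C := Finset.sum_nonneg fun q _ => mul_nonneg hA0 (ha _ _)
  have hpow : ∀ k : ℕ, ‖V ^ (k + 1)‖ ≤ C * A ^ (2 * k) := by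
    intro k
    have e : V ^ (k + 1) = ∑ r : ι × ι, V ^ k * pairWord T [r] := by
      rw [pow_succ, ← Finset.mul_sum]
      congr 1
      rw [hVs]
      simp [pairWord]
    rw [e, hC, Finset.sum_mul]
    refine (norm_sum_le _ _).trans (Finset.sum_le_sum fun r _ => (key k r []).trans (le_of_eq ?_))
    simp only [pairInner, pairLink]; ring
  by_contra hlt
  push Not at hlt
  have hVn : ‖V‖ = ‖∑ i, T i‖ ^ 2 := by rw [hV, CStarRing.norm_star_mul_self, sq]
  have hVsa : IsSelfAdjoint V := IsSelfAdjoint.star_mul_self _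
  have hV2 : ∀ k : ℕ, ‖V‖ ^ (2 ^ k) ≤ C * A ^ (2 * (2 ^ k - 1)) := by
    intro k
    have e := hVsa.norm_pow_two_pow k
    rw [← e]
    have h2 : 2 ^ k = (2 ^ k - 1) + 1 := (Nat.sub_add_cancel Nat.one_le_two_pow).symm
    conv_lhs => rw [h2]
    exact hpow _
  have hpos : 0 < ‖∑ i, T i‖ := lt_of_le_of_lt hA0 hlt
  have hVpos : 0 < ‖V‖ := by rw [hVn]; positivity
  have hr1 : A ^ 2 / ‖V‖ < 1 := by
    rw [div_lt_one hVpos, hVn]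
    exact pow_lt_pow_left₀ hlt hA0 two_ne_zero
  have hbound : ∀ k : ℕ, ‖V‖ ≤ C * (A ^ 2 / ‖V‖) ^ (2 ^ k - 1) := by
    intro k
    have h := hV2 k
    have h2 : 2 ^ k = (2 ^ k - 1) + 1 := (Nat.sub_add_cancel Nat.one_le_two_pow).symm
    rw [h2, pow_succ] at h
    simp only [Nat.add_sub_cancel] at h
    rw [div_pow, ← pow_mul, ← mul_div_assoc, le_div_iff₀ (by positivity), mul_comm]
    exact h
  have hlim : Filter.Tendsto (fun k : ℕ => C * (A ^ 2 / ‖V‖) ^ (2 ^ k - 1)) Filter.atTop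
      (nhds (C * 0)) := by
    refine Filter.Tendsto.const_mul _ ((tendsto_pow_atTop_nhds_zero_of_lt_one
      (by positivity) hr1).comp ?_)
    exact (Filter.tendsto_sub_atTop_nat 1).comp (tendsto_pow_atTop_atTop_of_one_lt one_lt_two)
  have := ge_of_tendsto' hlim hbound
  linarith [hVpos]

end CotlarStein

section ConvolutionKernels

variable {G : Type*} [Group G] [MeasurableSpace G]

/-- A homogeneous quasi-norm on a group with an invariant measure: balls of radius `r` have
measure `c r ^ D`. -/
structure HomNorm (μ : Measure G) where
  N : G → ℝ
  meas : Measurable N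
  nonneg : ∀ g, 0 ≤ N g
  inv : ∀ g, N g⁻¹ = N g
  one : N 1 = 0
  κ : ℝ
  one_le : 1 ≤ κ
  mul_le : ∀ g h, N (g * h) ≤ κ * (N g + N h)
  D : ℕ
  c : ℝ
  c_pos : 0 < c
  vol : ∀ r, 0 < r → μ {g | N g < r} = ENNReal.ofReal (c * r ^ D)

variable {μ : Measure G} (ν : HomNorm μ)

/-- Bounded measurable functions supported in a ball. -/
structure IsKer (k : G → ℝ) : Prop where
  meas : Measurable k
  bdd : ∃ A, ∀ g, |k g| ≤ A
  supp : ∃ R, ∀ g, R ≤ ν.N g → k g = 0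

/-- Group convolution. -/
noncomputable def gconv (μ : Measure G) (f k : G → ℝ) (x : G) : ℝ := ∫ h, f (x * h⁻¹) * k h ∂μ

variable {ν}

theorem HomNorm.vol_lt_top (r : ℝ) : μ {g | ν.N g < r} < ∞ := by
  rcases le_or_gt r 0 with h | h
  · have : {g | ν.N g < r} = ∅ := by
      ext g; simp only [Set.mem_ofPred_eq, Set.mem_empty_iff_false, iff_false, not_lt]
      exact h.trans (ν.nonneg g)
    simp [this]
  · rw [ν.vol r h]; exact ENNReal.ofReal_lt_top

theorem HomNorm.measurableSet (r : ℝ) : MeasurableSet {g | ν.N g < r} :=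
  measurableSet_lt ν.meas measurable_const

theorem IsKer.integrable {k : G → ℝ} (hk : IsKer ν k) : Integrable k μ := by
  obtain ⟨A, hA⟩ := hk.bdd
  obtain ⟨R, hR⟩ := hk.supp
  have h1 : IntegrableOn k {g | ν.N g < R} μ := by
    refine Measure.integrableOn_of_bounded (M := A) (HomNorm.vol_lt_top R).ne
      hk.meas.aestronglyMeasurable (Filter.Eventually.of_forall fun g => ?_)
    exact hA g
  refine (integrableOn_iff_integrable_of_support_subset ?_).1 h1
  intro g hg
  by_contra h
  exact hg (hR g (not_lt.1 h))

theorem IsKer.add {k l : G → ℝ} (hk : IsKer ν k) (hl : IsKer ν l) :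
    IsKer ν (fun g => k g + l g) := by
  obtain ⟨A, hA⟩ := hk.bdd
  obtain ⟨R, hR⟩ := hk.supp
  obtain ⟨A', hA'⟩ := hl.bdd
  obtain ⟨R', hR'⟩ := hl.supp
  refine ⟨hk.meas.add hl.meas, ⟨A + A', fun g => (abs_add_le _ _).trans (add_le_add (hA g) (hA' g))⟩,
    ⟨max R R', fun g hg => ?_⟩⟩
  rw [hR g ((le_max_left _ _).trans hg), hR' g ((le_max_right _ _).trans hg), add_zero]

theorem IsKer.const_mul {k : G → ℝ} (hk : IsKer ν k) (a : ℝ) : IsKer ν (fun g => a * k g) := by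
  obtain ⟨A, hA⟩ := hk.bdd
  obtain ⟨R, hR⟩ := hk.supp
  refine ⟨hk.meas.const_mul a, ⟨|a| * A, fun g => ?_⟩, ⟨R, fun g hg => by rw [hR g hg, mul_zero]⟩⟩
  rw [abs_mul]; exact mul_le_mul_of_nonneg_left (hA g) (abs_nonneg a)

theorem IsKer.zero : IsKer ν (fun _ => (0 : ℝ)) :=
  ⟨measurable_const, ⟨0, fun _ => by simp⟩, ⟨0, fun _ _ => rfl⟩⟩

theorem IsKer.sum {ι : Type*} (s : Finset ι) {k : ι → G → ℝ} (hk : ∀ i ∈ s, IsKer ν (k i)) :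
    IsKer ν (fun g => ∑ i ∈ s, k i g) := by
  classical
  induction s using Finset.induction_on with
  | empty => simpa using IsKer.zero
  | insert i s hi ih =>
    simp only [Finset.sum_insert hi]
    exact (hk i (Finset.mem_insert_self _ _)).add
      (ih fun j hj => hk j (Finset.mem_insert_of_mem hj))

theorem IsKer.indicator {k : G → ℝ} (hk : IsKer ν k) {s : Set G} (hs : MeasurableSet s) :
    IsKer ν (s.indicator k) := by
  obtain ⟨A, hA⟩ := hk.bdd
  obtain ⟨R, hR⟩ := hk.supp
  refine ⟨hk.meas.indicator hs, ⟨A, fun g => ?_⟩, ⟨R, fun g hg => ?_⟩⟩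
  · by_cases h : g ∈ s
    · rw [Set.indicator_of_mem h]; exact hA g
    · rw [Set.indicator_of_notMem h, abs_zero]; exact (abs_nonneg _).trans (hA g)
  · by_cases h : g ∈ s
    · rw [Set.indicator_of_mem h]; exact hR g hg
    · rw [Set.indicator_of_notMem h]

theorem IsKer.memLp {k : G → ℝ} (hk : IsKer ν k) {p : ℝ≥0∞} : MemLp k p μ := by
  obtain ⟨A, hA⟩ := hk.bdd
  obtain ⟨R, hR⟩ := hk.supp
  have h1 : MemLp k p (μ.restrict {g | ν.N g < R}) := by
    haveI : IsFiniteMeasure (μ.restrict {g | ν.N g < R}) :=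
      ⟨by rw [Measure.restrict_apply_univ]; exact HomNorm.vol_lt_top R⟩
    exact MemLp.of_bound hk.meas.aestronglyMeasurable A (Filter.Eventually.of_forall hA)
  rw [← memLp_indicator_iff_restrict (HomNorm.measurableSet R)] at h1
  convert h1 using 1
  symm
  rw [Set.indicator_eq_self]
  intro g hg
  by_contra h
  exact hg (hR g (not_lt.1 h))

variable [MeasurableMul₂ G] [MeasurableInv G]

theorem IsKer.inv {k : G → ℝ} (hk : IsKer ν k) : IsKer ν (fun g => k g⁻¹) := by
  obtain ⟨A, hA⟩ := hk.bdd
  obtain ⟨R, hR⟩ := hk.supp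
  exact ⟨hk.meas.comp measurable_inv, ⟨A, fun g => hA _⟩, ⟨R, fun g hg => hR _ (by rwa [ν.inv])⟩⟩

variable [SFinite μ] [μ.IsMulLeftInvariant] [μ.IsMulRightInvariant] [μ.IsInvInvariant]

theorem gconv_eq_swap (f k : G → ℝ) (x : G) :
    gconv μ f k x = ∫ y, f y * k (y⁻¹ * x) ∂μ := by
  rw [gconv, ← integral_inv_eq_self (μ := μ), ← integral_mul_left_eq_self (μ := μ) _ x⁻¹]
  simp

theorem gconv_congr_ae {f f' : G → ℝ} (h : f =ᵐ[μ] f') (k : G → ℝ) : gconv μ f k = gconv μ f' k := by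
  ext x
  rw [gconv_eq_swap, gconv_eq_swap]
  refine integral_congr_ae ?_
  filter_upwards [h] with y hy
  rw [hy]

theorem measurable_gconv {f k : G → ℝ} (hf : Measurable f) (hk : Measurable k) :
    Measurable (gconv μ f k) := by
  refine (StronglyMeasurable.integral_prod_right
    (f := fun (x : G) (h : G) => f (x * h⁻¹) * k h) ?_).measurable
  refine Measurable.stronglyMeasurable ?_
  exact (hf.comp (measurable_fst.mul measurable_snd.inv)).mul (hk.comp measurable_snd)

theorem sq_lintegral_mul_le (F k : G → ℝ≥0∞) (hF : AEMeasurable F μ) (hk : AEMeasurable k μ) :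
    (∫⁻ h, F h * k h ∂μ) ^ 2 ≤ (∫⁻ h, k h ∂μ) * ∫⁻ h, F h ^ 2 * k h ∂μ := by
  have hpq : (2 : ℝ).HolderConjugate 2 := by
    rw [Real.holderConjugate_iff]; norm_num
  have h := ENNReal.lintegral_mul_le_Lp_mul_Lq μ hpq
    (f := fun h => F h * k h ^ (1 / 2 : ℝ)) (g := fun h => k h ^ (1 / 2 : ℝ))
    (hF.mul (hk.pow_const _)) (hk.pow_const _)
  have e : ∀ a : ℝ≥0∞, a ^ (1 / 2 : ℝ) * a ^ (1 / 2 : ℝ) = a := by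
    intro a
    rw [← ENNReal.rpow_add_of_nonneg _ _ (by norm_num) (by norm_num)]; norm_num
  have e2 : ∀ a : ℝ≥0∞, (a ^ (1 / 2 : ℝ)) ^ (2 : ℝ) = a := by
    intro a
    rw [← ENNReal.rpow_mul]; norm_num
  simp only [Pi.mul_apply, ENNReal.mul_rpow_of_nonneg _ _ (zero_le_two (α := ℝ)), e2, mul_assoc, e] at h
  calc (∫⁻ h, F h * k h ∂μ) ^ 2 ≤ ((∫⁻ a, F a ^ (2 : ℝ) * k a ∂μ) ^ (1 / 2 : ℝ) *
        (∫⁻ a, k a ∂μ) ^ (1 / 2 : ℝ)) ^ 2 := by gcongr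
    _ = (∫⁻ h, k h ∂μ) * ∫⁻ h, F h ^ 2 * k h ∂μ := by
        rw [mul_pow, sq, sq, e, e, mul_comm]; simp

/-- Young's inequality `‖f * k‖₂ ≤ ‖k‖₁ ‖f‖₂`. -/
theorem lintegral_gconv_sq_le {f k : G → ℝ} (hf : Measurable f) (hk : Measurable k) :
    ∫⁻ x, ‖gconv μ f k x‖ₑ ^ 2 ∂μ ≤ (∫⁻ h, ‖k h‖ₑ ∂μ) ^ 2 * ∫⁻ x, ‖f x‖ₑ ^ 2 ∂μ := by
  have h1 : ∀ x, ‖gconv μ f k x‖ₑ ^ 2 ≤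
      (∫⁻ h, ‖k h‖ₑ ∂μ) * ∫⁻ h, ‖f (x * h⁻¹)‖ₑ ^ 2 * ‖k h‖ₑ ∂μ := by
    intro x
    refine le_trans ?_ (sq_lintegral_mul_le (fun h => ‖f (x * h⁻¹)‖ₑ) (fun h => ‖k h‖ₑ) ?_ ?_)
    · gcongr
      refine (enorm_integral_le_lintegral_enorm _).trans (le_of_eq ?_)
      simp only [enorm_mul]
    · exact (hf.comp (measurable_inv.const_mul x)).enorm.aemeasurable
    · exact hk.enorm.aemeasurable
  refine (lintegral_mono h1).trans ?_
  rw [lintegral_const_mul]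
  · rw [lintegral_lintegral_swap]
    · have h2 : ∀ h : G, ∫⁻ x, ‖f (x * h⁻¹)‖ₑ ^ 2 * ‖k h‖ₑ ∂μ =
          (∫⁻ x, ‖f x‖ₑ ^ 2 ∂μ) * ‖k h‖ₑ := by
        intro h
        have hm : Measurable fun x => ‖f (x * h⁻¹)‖ₑ ^ 2 :=
          (hf.comp (measurable_mul_const _)).enorm.pow_const 2
        rw [lintegral_mul_const _ hm, lintegral_mul_right_eq_self (fun x => ‖f x‖ₑ ^ 2) h⁻¹]
      simp only [h2]
      rw [lintegral_const_mul _ hk.enorm]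
      apply le_of_eq; ring
    · refine Measurable.aemeasurable ?_
      exact ((hf.comp (measurable_fst.mul measurable_snd.inv)).enorm.pow_const 2).mul
        (hk.comp measurable_snd).enorm
  · refine Measurable.lintegral_prod_right' (f := fun z : G × G => ‖f (z.1 * z.2⁻¹)‖ₑ ^ 2 * ‖k z.2‖ₑ) ?_
    exact ((hf.comp (measurable_fst.mul measurable_snd.inv)).enorm.pow_const 2).mul
        (hk.comp measurable_snd).enorm

theorem IsKer.abs_gconv_le {f k : G → ℝ} {A : ℝ} (hf : ∀ g, |f g| ≤ A) (hk : IsKer ν k) (x : G) :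
    |gconv μ f k x| ≤ A * ∫ h, |k h| ∂μ := by
  rw [gconv, ← integral_const_mul]
  refine (abs_integral_le_integral_abs).trans (integral_mono_of_nonneg
    (Filter.Eventually.of_forall fun _ => abs_nonneg _) (hk.integrable.abs.const_mul A)
    (Filter.Eventually.of_forall fun h => ?_))
  simp only [abs_mul]
  exact mul_le_mul_of_nonneg_right (hf _) (abs_nonneg _)

theorem IsKer.gconv {f k : G → ℝ} (hf : IsKer ν f) (hk : IsKer ν k) : IsKer ν (gconv μ f k) := by
  obtain ⟨A, hA⟩ := hf.bdd
  obtain ⟨R, hR⟩ := hf.supp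
  obtain ⟨R', hR'⟩ := hk.supp
  refine ⟨measurable_gconv hf.meas hk.meas, ⟨_, fun x => hk.abs_gconv_le hA x⟩,
    ⟨ν.κ * (R + R'), fun x hx => ?_⟩⟩
  rw [_root_.gconv]
  refine integral_eq_zero_of_ae (Filter.Eventually.of_forall fun h => ?_)
  by_cases h1 : R ≤ ν.N (x * h⁻¹)
  · simp [hR _ h1]
  by_cases h2 : R' ≤ ν.N h
  · simp [hR' _ h2]
  exfalso
  have := ν.mul_le (x * h⁻¹) h
  rw [inv_mul_cancel_right] at this
  have h3 : ν.κ * (ν.N (x * h⁻¹) + ν.N h) < ν.κ * (R + R') :=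
    mul_lt_mul_of_pos_left (by linarith) (by linarith [ν.one_le])
  linarith

theorem memLp_gconv {f k : G → ℝ} (hf : MemLp f 2 μ) (hk : IsKer ν k) :
    MemLp (gconv μ f k) 2 μ ∧
      eLpNorm (gconv μ f k) 2 μ ≤ ENNReal.ofReal (∫ h, |k h| ∂μ) * eLpNorm f 2 μ := by
  obtain ⟨g, hg, hfg⟩ := hf.1
  rw [gconv_congr_ae hfg, eLpNorm_congr_ae hfg]
  have h := lintegral_gconv_sq_le (μ := μ) hg.measurable hk.meas
  have e : ∀ u : G → ℝ, eLpNorm u 2 μ = (∫⁻ x, ‖u x‖ₑ ^ 2 ∂μ) ^ (1 / 2 : ℝ) := by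
    intro u
    rw [eLpNorm_eq_lintegral_rpow_enorm_toReal (by norm_num) (by norm_num)]
    simp
  have e3 : ENNReal.ofReal (∫ h, |k h| ∂μ) = ∫⁻ h, ‖k h‖ₑ ∂μ := by
    simpa [Real.norm_eq_abs] using ofReal_integral_norm_eq_lintegral_enorm hk.integrable
  have h2 : eLpNorm (gconv μ g k) 2 μ ≤ ENNReal.ofReal (∫ h, |k h| ∂μ) * eLpNorm g 2 μ := by
    rw [e, e, e3]
    calc _ ≤ ((∫⁻ h, ‖k h‖ₑ ∂μ) ^ 2 * ∫⁻ x, ‖g x‖ₑ ^ 2 ∂μ) ^ (1 / 2 : ℝ) := by gcongr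
      _ = _ := by
        rw [ENNReal.mul_rpow_of_nonneg _ _ (by norm_num), ← ENNReal.rpow_natCast, ← ENNReal.rpow_mul]
        norm_num
  refine ⟨⟨(measurable_gconv hg.measurable hk.meas).aestronglyMeasurable, ?_⟩, h2⟩
  refine h2.trans_lt (ENNReal.mul_lt_top ENNReal.ofReal_lt_top ?_)
  rw [← eLpNorm_congr_ae hfg]; exact hf.2

/-- Functions in `L²` are integrable against translated kernels. -/
theorem IsKer.integrable_translate_mul {f k : G → ℝ} (hf : MemLp f 2 μ) (hk : IsKer ν k) (x : G) :
    Integrable (fun h => f (x * h⁻¹) * k h) μ := by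
  have h1 : MemLp (fun h => f (x * h⁻¹)) 2 μ := by
    have hp : MeasurePreserving (fun h : G => x * h⁻¹) μ μ :=
      (measurePreserving_mul_left μ x).comp (Measure.measurePreserving_inv μ)
    exact hf.comp_measurePreserving hp
  exact (h1.integrable_mul (hk.memLp (p := 2)))

/-- Right convolution by a kernel as an operator on `L²`. -/
noncomputable def convL (k : G → ℝ) (hk : IsKer ν k) : Lp ℝ 2 μ →L[ℝ] Lp ℝ 2 μ :=
  LinearMap.mkContinuous
    { toFun := fun f => (memLp_gconv (Lp.memLp f) hk).1.toLp
      map_add' := by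
        intro f g
        rw [← MemLp.toLp_add]
        refine MemLp.toLp_congr _ _ (Filter.EventuallyEq.of_eq ?_)
        rw [gconv_congr_ae (Lp.coeFn_add f g)]
        ext x
        simp only [gconv, Pi.add_apply, add_mul]
        exact integral_add (hk.integrable_translate_mul (Lp.memLp f) x)
          (hk.integrable_translate_mul (Lp.memLp g) x)
      map_smul' := by
        intro c f
        rw [RingHom.id_apply, ← MemLp.toLp_const_smul]
        refine MemLp.toLp_congr _ _ (Filter.EventuallyEq.of_eq ?_)
        rw [gconv_congr_ae (Lp.coeFn_smul c f)]
        ext x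
        simp only [gconv, Pi.smul_apply, smul_eq_mul, mul_assoc]
        exact integral_const_mul _ _ }
    (∫ h, |k h| ∂μ) (by
      intro f
      change ‖(memLp_gconv (Lp.memLp f) hk).1.toLp‖ ≤ _
      rw [Lp.norm_toLp, Lp.norm_def, ← ENNReal.toReal_ofReal
        (integral_nonneg (μ := μ) fun h => abs_nonneg (k h)), ← ENNReal.toReal_mul]
      exact ENNReal.toReal_mono (ENNReal.mul_ne_top ENNReal.ofReal_ne_top (Lp.memLp f).2.ne)
        (memLp_gconv (Lp.memLp f) hk).2)

theorem norm_convL_le {k : G → ℝ} (hk : IsKer ν k) : ‖convL k hk‖ ≤ ∫ h, |k h| ∂μ :=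
  LinearMap.mkContinuous_norm_le _ (integral_nonneg fun _ => abs_nonneg _) _

theorem convL_coe {k : G → ℝ} (hk : IsKer ν k) (f : Lp ℝ 2 μ) :
    convL k hk f =ᵐ[μ] gconv μ f k :=
  MemLp.coeFn_toLp (memLp_gconv (Lp.memLp f) hk).1

theorem gconv_assoc {f k l : G → ℝ} (hf : MemLp f 2 μ) (hk : IsKer ν k) (hl : IsKer ν l) (x : G) :
    gconv μ (gconv μ f k) l x = gconv μ f (gconv μ k l) x := by
  obtain ⟨f', hf', hff'⟩ := hf.1
  rw [gconv_congr_ae hff', gconv_congr_ae hff']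
  replace hf : MemLp f' 2 μ := (memLp_congr_ae hff').1 hf
  obtain ⟨A, hA⟩ := hk.bdd
  obtain ⟨R, hR⟩ := hk.supp
  obtain ⟨R', hR'⟩ := hl.supp
  have e1 : ∀ h, gconv μ f' k (x * h⁻¹) * l h = ∫ g, f' (x * g⁻¹) * k (g * h⁻¹) * l h ∂μ := by
    intro h
    rw [integral_mul_const, _root_.gconv,
      ← integral_mul_right_eq_self (μ := μ) (fun g => f' (x * g⁻¹) * k (g * h⁻¹)) h]
    simp [mul_assoc]
  have e2 : ∀ g, f' (x * g⁻¹) * gconv μ k l g = ∫ h, f' (x * g⁻¹) * k (g * h⁻¹) * l h ∂μ := by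
    intro g
    rw [_root_.gconv, ← integral_const_mul]
    simp [mul_assoc]
  rw [_root_.gconv, _root_.gconv]
  simp only [e1, e2]
  refine integral_integral_swap ?_
  set K : G → ℝ := {g | ν.N g < ν.κ * (R + R')}.indicator fun _ => A with hK
  have hKk : IsKer ν K := by
    refine ⟨measurable_const.indicator (HomNorm.measurableSet _), ⟨|A|, fun g => ?_⟩,
      ⟨ν.κ * (R + R'), fun g hg => ?_⟩⟩
    · by_cases h : g ∈ {g | ν.N g < ν.κ * (R + R')}
      · rw [hK, Set.indicator_of_mem h]
      · rw [hK, Set.indicator_of_notMem h]; simp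
    · rw [hK, Set.indicator_of_notMem]
      simpa using hg
  have hfint := (hl.integrable.abs).mul_prod ((hKk.integrable_translate_mul hf x).abs)
  refine hfint.mono ?_ (Filter.Eventually.of_forall fun z => ?_)
  · refine Measurable.aestronglyMeasurable ?_
    exact ((hf'.measurable.comp (measurable_snd.inv.const_mul x)).mul
      (hk.meas.comp (measurable_snd.mul measurable_fst.inv))).mul (hl.meas.comp measurable_fst)
  · rcases z with ⟨h, g⟩
    simp only [Function.uncurry, Real.norm_eq_abs, abs_mul, abs_abs]
    by_cases h2 : R' ≤ ν.N h
    · simp [hR' _ h2]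
    by_cases h1 : R ≤ ν.N (g * h⁻¹)
    · rw [hR _ h1]; simp only [abs_zero, mul_zero, zero_mul]; positivity
    have h3 : ν.N g < ν.κ * (R + R') := by
      have := ν.mul_le (g * h⁻¹) h
      rw [inv_mul_cancel_right] at this
      have h3 : ν.κ * (ν.N (g * h⁻¹) + ν.N h) < ν.κ * (R + R') :=
        mul_lt_mul_of_pos_left (by linarith) (by linarith [ν.one_le])
      linarith
    have h4 : K g = A := by rw [hK, Set.indicator_of_mem]; exact h3
    rw [h4, mul_comm |l h|]
    exact mul_le_mul_of_nonneg_right (mul_le_mul_of_nonneg_left ((hA _).trans (le_abs_self A))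
      (abs_nonneg _)) (abs_nonneg _)

theorem convL_mul {k l : G → ℝ} (hk : IsKer ν k) (hl : IsKer ν l) :
    convL l hl * convL k hk = convL (gconv μ k l) (hk.gconv hl) := by
  ext1 f
  refine Lp.ext ?_
  refine (convL_coe hl _).trans ((Filter.EventuallyEq.of_eq ?_).trans (convL_coe _ f).symm)
  refine (gconv_congr_ae (convL_coe hk f) l).trans ?_
  ext x
  exact gconv_assoc (Lp.memLp f) hk hl x

theorem integrable_conv_pairing {f g k : G → ℝ} (hf : MemLp f 2 μ) (hg : MemLp g 2 μ)
    (hfm : Measurable f) (hgm : Measurable g) (hk : IsKer ν k) :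
    Integrable (fun z : G × G => f (z.2 * z.1⁻¹) * k z.1 * g z.2) (μ.prod μ) := by
  have hf2 := hf.integrable_sq
  have hg2 := hg.integrable_sq
  have hm : AEStronglyMeasurable (fun z : G × G => f (z.2 * z.1⁻¹) * k z.1 * g z.2) (μ.prod μ) :=
    (((hfm.comp (measurable_snd.mul measurable_fst.inv)).mul
      (hk.meas.comp measurable_fst)).mul (hgm.comp measurable_snd)).aestronglyMeasurable
  have hdom : ∀ h x, ‖f (x * h⁻¹) * k h * g x‖ ≤ |k h| * (f (x * h⁻¹) ^ 2 + g x ^ 2) := by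
    intro h x
    rw [Real.norm_eq_abs, abs_mul, abs_mul, mul_comm |f _|, mul_assoc]
    refine mul_le_mul_of_nonneg_left ?_ (abs_nonneg _)
    nlinarith [sq_nonneg (|f (x * h⁻¹)| - |g x|), sq_abs (f (x * h⁻¹)), sq_abs (g x),
      sq_nonneg (f (x * h⁻¹)), sq_nonneg (g x)]
  have hi : ∀ h, Integrable (fun x => |k h| * (f (x * h⁻¹) ^ 2 + g x ^ 2)) μ := fun h =>
    ((hf2.comp_mul_right h⁻¹).add hg2).const_mul _
  refine (integrable_prod_iff hm).2 ⟨Filter.Eventually.of_forall fun h => ?_, ?_⟩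
  · refine (hi h).mono' ?_ (Filter.Eventually.of_forall fun x => hdom h x)
    change AEStronglyMeasurable (fun x => f (x * h⁻¹) * k h * g x) μ
    exact (((hfm.comp (measurable_mul_const _)).mul measurable_const).mul hgm).aestronglyMeasurable
  · refine ((hk.integrable.abs).mul_const (∫ x, f x ^ 2 ∂μ + ∫ x, g x ^ 2 ∂μ)).mono'
      hm.norm.integral_prod_right' (Filter.Eventually.of_forall fun h => ?_)
    rw [Real.norm_of_nonneg (integral_nonneg fun _ => norm_nonneg _)]
    refine (integral_mono_of_nonneg (Filter.Eventually.of_forall fun _ => norm_nonneg _) (hi h)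
      (Filter.Eventually.of_forall fun x => hdom h x)).trans (le_of_eq ?_)
    rw [integral_const_mul, integral_add (hf2.comp_mul_right h⁻¹) hg2,
      integral_mul_right_eq_self (fun x => f x ^ 2)]

/-- The transpose of right convolution by `k` is right convolution by `k(·⁻¹)`. -/
theorem integral_gconv_mul {f g k : G → ℝ} (hf : MemLp f 2 μ) (hg : MemLp g 2 μ) (hk : IsKer ν k) :
    ∫ x, gconv μ f k x * g x ∂μ = ∫ x, f x * gconv μ g (fun h => k h⁻¹) x ∂μ := by
  obtain ⟨f', hf', hff'⟩ := hf.1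
  obtain ⟨g', hg', hgg'⟩ := hg.1
  rw [gconv_congr_ae hff', gconv_congr_ae hgg']
  have e1 : ∫ x, gconv μ f' k x * g x ∂μ = ∫ x, gconv μ f' k x * g' x ∂μ :=
    integral_congr_ae (by filter_upwards [hgg'] with x hx; rw [hx])
  have e2 : ∫ x, f x * gconv μ g' (fun h => k h⁻¹) x ∂μ =
      ∫ x, f' x * gconv μ g' (fun h => k h⁻¹) x ∂μ :=
    integral_congr_ae (by filter_upwards [hff'] with x hx; rw [hx])
  rw [e1, e2]
  replace hf := (memLp_congr_ae hff').1 hf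
  replace hg := (memLp_congr_ae hgg').1 hg
  have hfint := integrable_conv_pairing hf hg hf'.measurable hg'.measurable hk
  calc ∫ x, gconv μ f' k x * g' x ∂μ = ∫ x, ∫ h, f' (x * h⁻¹) * k h * g' x ∂μ ∂μ := by
        simp only [_root_.gconv, integral_mul_const]
    _ = ∫ h, ∫ x, f' (x * h⁻¹) * k h * g' x ∂μ ∂μ := (integral_integral_swap hfint).symm
    _ = ∫ h, ∫ x, f' x * k h * g' (x * h) ∂μ ∂μ := by
        congr 1; ext h
        rw [← integral_mul_right_eq_self (μ := μ) (fun x => f' (x * h⁻¹) * k h * g' x) h]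
        simp
    _ = ∫ h, ∫ x, f' x * k h⁻¹ * g' (x * h⁻¹) ∂μ ∂μ := by
        rw [← integral_inv_eq_self (μ := μ)]
    _ = ∫ x, ∫ h, f' x * k h⁻¹ * g' (x * h⁻¹) ∂μ ∂μ := by
        refine integral_integral_swap ?_
        have := integrable_conv_pairing hg hf hg'.measurable hf'.measurable hk.inv
        refine this.congr (Filter.Eventually.of_forall fun z => ?_)
        simp only [Function.uncurry]; ring
    _ = _ := by
        simp only [_root_.gconv, ← integral_const_mul]
        congr 1; ext x; congr 1; ext h; ring

theorem star_convL {k : G → ℝ} (hk : IsKer ν k) : star (convL k hk) = convL _ hk.inv := by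
  symm
  refine (ContinuousLinearMap.eq_adjoint_iff _ _).2 fun f g => ?_
  rw [L2.inner_def, L2.inner_def]
  have e1 : ∫ a, inner ℝ ((convL _ hk.inv f) a) (g a) ∂μ =
      ∫ a, gconv μ f (fun h => k h⁻¹) a * g a ∂μ := by
    refine integral_congr_ae ?_
    filter_upwards [convL_coe hk.inv f] with x hx
    rw [hx]; simp [mul_comm]
  have e2 : ∫ a, inner ℝ (f a) ((convL _ hk g) a) ∂μ = ∫ a, f a * gconv μ g k a ∂μ := by
    refine integral_congr_ae ?_
    filter_upwards [convL_coe hk g] with x hx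
    rw [hx]; simp [mul_comm]
  rw [e1, e2, integral_gconv_mul (Lp.memLp f) (Lp.memLp g) hk.inv]
  simp

end ConvolutionKernels

section AlmostOrthogonality

variable {G : Type*} [Group G] [MeasurableSpace G] {μ : Measure G}

/-- Mean-zero Lipschitz functions adapted to the ball of radius `t` about the identity. -/
structure IsBump (ν : HomNorm μ) (A t : ℝ) (ψ : G → ℝ) : Prop where
  meas : Measurable ψ
  supp : ∀ g, t ≤ ν.N g → ψ g = 0
  bdd : ∀ g, |ψ g| ≤ A / t ^ ν.D
  lipR : ∀ g h, |ψ (g * h) - ψ g| ≤ A / t ^ (ν.D + 1) * ν.N h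
  lipL : ∀ g h, |ψ (h * g) - ψ g| ≤ A / t ^ (ν.D + 1) * ν.N h
  mean : ∫ g, ψ g ∂μ = 0

variable {ν : HomNorm μ} {A t t' : ℝ} {ψ ψ' : G → ℝ}

theorem IsBump.isKer (h : IsBump ν A t ψ) : IsKer ν ψ := ⟨h.meas, ⟨_, h.bdd⟩, ⟨t, h.supp⟩⟩

theorem HomNorm.measureReal (r : ℝ) (hr : 0 < r) : μ.real {g | ν.N g < r} = ν.c * r ^ ν.D := by
  rw [Measure.real, ν.vol r hr, ENNReal.toReal_ofReal]
  exact mul_nonneg ν.c_pos.le (by positivity)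

theorem HomNorm.abs_integral_le {F : G → ℝ} {M r : ℝ} (hr : 0 < r) (h1 : ∀ g, |F g| ≤ M)
    (h2 : ∀ g, r ≤ ν.N g → F g = 0) : |∫ g, F g ∂μ| ≤ M * (ν.c * r ^ ν.D) := by
  rw [← setIntegral_eq_integral_of_forall_compl_eq_zero (s := {g | ν.N g < r})]
  · rw [← HomNorm.measureReal r hr]
    exact norm_setIntegral_le_of_norm_le_const (f := F) (C := M) (HomNorm.vol_lt_top r)
      fun g _ => h1 g
  · intro g hg; exact h2 g (not_lt.1 hg)

variable [MeasurableMul₂ G] [MeasurableInv G]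
variable [SFinite μ] [μ.IsMulLeftInvariant] [μ.IsMulRightInvariant] [μ.IsInvInvariant]

theorem IsBump.inv (h : IsBump ν A t ψ) : IsBump ν A t (fun g => ψ g⁻¹) where
  meas := h.meas.comp measurable_inv
  supp g hg := h.supp _ (by rwa [ν.inv])
  bdd g := h.bdd _
  lipR g k := by rw [mul_inv_rev, ← ν.inv k]; exact h.lipL _ _
  lipL g k := by rw [mul_inv_rev, ← ν.inv k]; exact h.lipR _ _
  mean := by rw [integral_inv_eq_self]; exact h.mean

theorem IsBump.abs_gconv_le (h : IsBump ν A t ψ) (h' : IsBump ν A t' ψ') (hA : 0 ≤ A)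
    (ht' : 0 < t') (htt : t' ≤ t) (x : G) :
    |gconv μ ψ ψ' x| ≤ A ^ 2 * ν.c * (t' / t) / t ^ ν.D := by
  have ht : 0 < t := ht'.trans_le htt
  have e : gconv μ ψ ψ' x = ∫ k, (ψ (x * k⁻¹) - ψ x) * ψ' k ∂μ := by
    simp only [sub_mul]
    rw [integral_sub, integral_const_mul, h'.mean, mul_zero, sub_zero]
    · rfl
    · exact h'.isKer.integrable_translate_mul h.isKer.memLp x
    · exact h'.isKer.integrable.const_mul _
  rw [e]
  have hM : ∀ k, |(ψ (x * k⁻¹) - ψ x) * ψ' k| ≤ A / t ^ (ν.D + 1) * t' * (A / t' ^ ν.D) := by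
    intro k
    by_cases hk : t' ≤ ν.N k
    · rw [h'.supp k hk, mul_zero, abs_zero]; positivity
    · rw [abs_mul]
      refine mul_le_mul ((h.lipR _ _).trans ?_) (h'.bdd _) (abs_nonneg _) (by positivity)
      rw [ν.inv]
      exact mul_le_mul_of_nonneg_left (not_le.1 hk).le (by positivity)
  refine (HomNorm.abs_integral_le (ν := ν) ht' hM fun k hk => ?_).trans (le_of_eq ?_)
  · rw [h'.supp k hk, mul_zero]
  · field_simp
    ring

theorem IsBump.integral_abs_gconv_le (h : IsBump ν A t ψ) (h' : IsBump ν A t' ψ') (hA : 0 ≤ A)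
    (ht' : 0 < t') (htt : t' ≤ t) :
    ∫ x, |gconv μ ψ ψ' x| ∂μ ≤ A ^ 2 * ν.c ^ 2 * (2 * ν.κ) ^ ν.D * (t' / t) := by
  have ht : 0 < t := ht'.trans_le htt
  have hκ := ν.one_le
  refine (le_abs_self _).trans ((HomNorm.abs_integral_le (ν := ν) (r := 2 * ν.κ * t)
    (M := A ^ 2 * ν.c * (t' / t) / t ^ ν.D) (by positivity)
    (fun x => ?_) fun x hx => ?_).trans (le_of_eq ?_))
  · rw [abs_abs]; exact h.abs_gconv_le h' hA ht' htt x
  · rw [abs_eq_zero, gconv]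
    refine integral_eq_zero_of_ae (Filter.Eventually.of_forall fun k => ?_)
    by_cases h1 : t ≤ ν.N (x * k⁻¹)
    · simp [h.supp _ h1]
    by_cases h2 : t' ≤ ν.N k
    · simp [h'.supp _ h2]
    exfalso
    have := ν.mul_le (x * k⁻¹) k
    rw [inv_mul_cancel_right] at this
    have h3 : ν.κ * (ν.N (x * k⁻¹) + ν.N k) < ν.κ * (t + t) :=
      mul_lt_mul_of_pos_left (by linarith) (by linarith [ν.one_le])
    linarith
  · rw [mul_pow]; field_simp

theorem gconv_inv (f k : G → ℝ) (x : G) :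
    gconv μ f k x⁻¹ = gconv μ (fun g => k g⁻¹) (fun g => f g⁻¹) x := by
  rw [gconv_eq_swap, gconv, ← integral_inv_eq_self (μ := μ)]
  congr 1; ext h; simp [mul_comm]

theorem IsBump.integral_abs_gconv_le' (h : IsBump ν A t ψ) (h' : IsBump ν A t' ψ') (hA : 0 ≤ A)
    (ht : 0 < t) (htt : t ≤ t') :
    ∫ x, |gconv μ ψ ψ' x| ∂μ ≤ A ^ 2 * ν.c ^ 2 * (2 * ν.κ) ^ ν.D * (t / t') := by
  rw [← integral_inv_eq_self (μ := μ)]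
  simp only [gconv_inv]
  exact h'.inv.integral_abs_gconv_le h.inv hA ht htt

theorem sum_pow_natAbs_le (F : Finset ℤ) (i : ℤ) {r : ℝ} (h0 : 0 ≤ r) (h1 : r < 1) :
    ∑ j ∈ F, r ^ (i - j).natAbs ≤ 2 / (1 - r) := by
  have hs : Summable fun k : ℕ => r ^ k := summable_geometric_of_lt_one h0 h1
  have key : ∀ F' : Finset ℤ, Set.InjOn (fun j : ℤ => (i - j).natAbs) F' →
      ∑ j ∈ F', r ^ (i - j).natAbs ≤ 1 / (1 - r) := by
    intro F' hF'
    rw [← Finset.sum_image (f := fun k : ℕ => r ^ k) hF', one_div, ← tsum_geometric_of_lt_one h0 h1]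
    exact hs.sum_le_tsum _ fun k _ => pow_nonneg h0 k
  rw [← Finset.sum_filter_add_sum_filter_not F (fun j => j ≤ i)]
  have a1 := key (F.filter fun j => j ≤ i) (by
    intro a ha b hb hab
    simp only [Finset.coe_filter, Set.mem_ofPred_eq] at ha hb
    simp only at hab
    omega)
  have a2 := key (F.filter fun j => ¬ j ≤ i) (by
    intro a ha b hb hab
    simp only [Finset.coe_filter, Set.mem_ofPred_eq] at ha hb
    simp only at hab
    omega)
  calc _ ≤ 1 / (1 - r) + 1 / (1 - r) := add_le_add a1 a2
    _ = 2 / (1 - r) := by ring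

theorem coeFn_sum_Lp {ι : Type*} (s : Finset ι) (u : ι → Lp ℝ 2 μ) :
    ((∑ i ∈ s, u i : Lp ℝ 2 μ) : G → ℝ) =ᵐ[μ] fun x => ∑ i ∈ s, u i x := by
  classical
  induction s using Finset.induction_on with
  | empty =>
    simp only [Finset.sum_empty]
    exact Lp.coeFn_zero _ _ _
  | insert a s ha ih =>
    rw [Finset.sum_insert ha]
    filter_upwards [Lp.coeFn_add (u a) (∑ i ∈ s, u i), ih] with x h1 h2
    rw [h1, Pi.add_apply, h2, Finset.sum_insert ha]

/-- `L²`-boundedness of sums of dyadic bumps. -/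
theorem eLpNorm_sum_bump_two_le (ν : HomNorm μ) {A : ℝ} (hA : 0 ≤ A) :
    ∃ C : ℝ, 0 ≤ C ∧ ∀ (F : Finset ℤ) (ψ : ℤ → G → ℝ), (∀ j, IsBump ν A ((2 : ℝ) ^ j) (ψ j)) →
      ∀ f : G → ℝ, MemLp f 2 μ →
        eLpNorm (fun x => ∑ j ∈ F, gconv μ f (ψ j) x) 2 μ ≤ ENNReal.ofReal C * eLpNorm f 2 μ := by
  set B : ℝ := A ^ 2 * ν.c ^ 2 * (2 * ν.κ) ^ ν.D with hB
  have hB0 : 0 ≤ B := by have := ν.one_le; positivity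
  set r : ℝ := Real.sqrt (1 / 2) with hr
  have hr0 : 0 ≤ r := Real.sqrt_nonneg _
  have hr2 : r ^ 2 = 1 / 2 := Real.sq_sqrt (by norm_num)
  have hr1 : r < 1 := by nlinarith
  refine ⟨Real.sqrt B * (2 / (1 - r)), by
    have : 0 < 1 - r := by linarith
    positivity, ?_⟩
  intro F ψ hψ f hf
  have hconv : ∀ (φ : ℤ → G → ℝ), (∀ j, IsBump ν A ((2 : ℝ) ^ j) (φ j)) →
      ∀ φ' : ℤ → G → ℝ, (∀ j, IsBump ν A ((2 : ℝ) ^ j) (φ' j)) → ∀ i j,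
      ∫ x, |gconv μ (φ i) (φ' j) x| ∂μ ≤ (Real.sqrt B * r ^ (i - j).natAbs) ^ 2 := by
    intro φ hφ φ' hφ' i j
    have e : (Real.sqrt B * r ^ (i - j).natAbs) ^ 2 = B * (1 / 2) ^ (i - j).natAbs := by
      rw [mul_pow, Real.sq_sqrt hB0, ← pow_mul, mul_comm _ 2, pow_mul, hr2]
    rw [e]
    rcases le_total j i with hij | hij
    · refine ((hφ i).integral_abs_gconv_le (hφ' j) hA (by positivity)
        (zpow_le_zpow_right₀ one_le_two hij)).trans (le_of_eq ?_)
      rw [hB]; congr 1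
      rw [← zpow_sub₀ two_ne_zero, one_div, inv_pow, ← zpow_natCast, ← zpow_neg]
      congr 1; omega
    · refine ((hφ i).integral_abs_gconv_le' (hφ' j) hA (by positivity)
        (zpow_le_zpow_right₀ one_le_two hij)).trans (le_of_eq ?_)
      rw [hB]; congr 1
      rw [← zpow_sub₀ two_ne_zero, one_div, inv_pow, ← zpow_natCast, ← zpow_neg]
      congr 1; omega
  have hone : ‖(1 : Lp ℝ 2 μ →L[ℝ] Lp ℝ 2 μ)‖ ≤ 1 := ContinuousLinearMap.norm_id_le
  set T : F → (Lp ℝ 2 μ →L[ℝ] Lp ℝ 2 μ) := fun j => convL (ψ j) (hψ j).isKer with hT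
  have hmain : ‖∑ j, T j‖ ≤ Real.sqrt B * (2 / (1 - r)) := by
    refine norm_sum_le_of_almost_orthogonal (a := fun i j : F => Real.sqrt B * r ^ ((i : ℤ) - j).natAbs)
      hone (fun i j => by positivity) (fun i j => ?_) (fun i => ?_) ?_ (fun i j => ?_) fun i j => ?_
    · rw [← Int.natAbs_neg, neg_sub]
    · rw [← Finset.mul_sum]
      refine mul_le_mul_of_nonneg_left ?_ (Real.sqrt_nonneg _)
      rw [Finset.sum_coe_sort F (fun j : ℤ => r ^ ((i : ℤ) - j).natAbs)]
      exact sum_pow_natAbs_le F i hr0 hr1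
    · have : 0 < 1 - r := by linarith
      positivity
    · rw [hT]; simp only
      rw [star_convL, convL_mul]
      refine (norm_convL_le _).trans ((hconv ψ hψ (fun j g => ψ j g⁻¹) (fun j => (hψ j).inv) j i).trans
        (le_of_eq ?_))
      rw [← Int.natAbs_neg, neg_sub]
    · rw [hT]; simp only
      rw [star_convL, convL_mul]
      refine (norm_convL_le _).trans ((hconv (fun j g => ψ j g⁻¹) (fun j => (hψ j).inv) ψ hψ j i).trans
        (le_of_eq ?_))
      rw [← Int.natAbs_neg, neg_sub]
  have hcoe : (∑ j, T j) hf.toLp =ᵐ[μ] fun x => ∑ j ∈ F, gconv μ f (ψ j) x := by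
    rw [sum_apply]
    refine (coeFn_sum_Lp _ _).trans ?_
    have h1 : ∀ j : F, (T j hf.toLp : G → ℝ) =ᵐ[μ] gconv μ f (ψ j) := fun j =>
      (convL_coe (hψ j).isKer _).trans
        (Filter.EventuallyEq.of_eq (gconv_congr_ae hf.coeFn_toLp _))
    filter_upwards [ae_all_iff.2 h1] with x hx
    rw [← Finset.sum_coe_sort F]
    exact Finset.sum_congr rfl fun j _ => hx j
  rw [← eLpNorm_congr_ae hcoe, ← eLpNorm_congr_ae hf.coeFn_toLp]
  have h2 := (∑ j, T j).le_of_opNorm_le hmain hf.toLp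
  rw [Lp.norm_def, Lp.norm_def] at h2
  rw [← ENNReal.ofReal_toReal (Lp.memLp ((∑ j, T j) hf.toLp)).2.ne,
    ← ENNReal.ofReal_toReal (Lp.memLp hf.toLp).2.ne, ← ENNReal.ofReal_mul (by
      have : 0 < 1 - r := by linarith
      positivity)]
  exact ENNReal.ofReal_le_ofReal h2

end AlmostOrthogonality

section LocalEstimate

variable {G : Type*} [Group G] [MeasurableSpace G] {μ : Measure G} {ν : HomNorm μ}

theorem IsKer.mul {k l : G → ℝ} (hk : IsKer ν k) (hl : IsKer ν l) :
    IsKer ν (fun g => k g * l g) := by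
  obtain ⟨A, hA⟩ := hk.bdd
  obtain ⟨B, hB⟩ := hl.bdd
  obtain ⟨R, hR⟩ := hk.supp
  refine ⟨hk.meas.mul hl.meas, ⟨A * B, fun g => ?_⟩, ⟨R, fun g hg => by rw [hR g hg, zero_mul]⟩⟩
  rw [abs_mul]
  exact mul_le_mul (hA g) (hB g) (abs_nonneg _) ((abs_nonneg _).trans (hA g))

theorem IsKer.sq {k : G → ℝ} (hk : IsKer ν k) : IsKer ν (fun g => k g ^ 2) := by
  simpa only [pow_two] using hk.mul hk

theorem eLpNorm_two_sq {f : G → ℝ} (hf : MemLp f 2 μ) :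
    eLpNorm f 2 μ = ENNReal.ofReal (Real.sqrt (∫ x, f x ^ 2 ∂μ)) := by
  rw [hf.eLpNorm_eq_integral_rpow_norm two_ne_zero (by simp)]
  congr 1
  rw [Real.sqrt_eq_rpow]
  simp

theorem integral_sq_le_of_eLpNorm_le {f g : G → ℝ} (hf : MemLp f 2 μ) (hg : MemLp g 2 μ) {C : ℝ}
    (hC : 0 ≤ C) (h : eLpNorm g 2 μ ≤ ENNReal.ofReal C * eLpNorm f 2 μ) :
    ∫ x, g x ^ 2 ∂μ ≤ C ^ 2 * ∫ x, f x ^ 2 ∂μ := by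
  rw [eLpNorm_two_sq hf, eLpNorm_two_sq hg, ← ENNReal.ofReal_mul hC,
    ENNReal.ofReal_le_ofReal_iff (by positivity)] at h
  have hf0 : 0 ≤ ∫ x, f x ^ 2 ∂μ := integral_nonneg fun x => sq_nonneg _
  have hg0 : 0 ≤ ∫ x, g x ^ 2 ∂μ := integral_nonneg fun x => sq_nonneg _
  have := pow_le_pow_left₀ (Real.sqrt_nonneg _) h 2
  rwa [Real.sq_sqrt hg0, mul_pow, Real.sq_sqrt hf0] at this

/-- Left-translated balls of the homogeneous norm. -/
def HomNorm.ball (ν : HomNorm μ) (x : G) (r : ℝ) : Set G := {y | ν.N (x⁻¹ * y) < r}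

theorem HomNorm.mem_ball {x y : G} {r : ℝ} : y ∈ ν.ball x r ↔ ν.N (x⁻¹ * y) < r := Iff.rfl

theorem HomNorm.comm (x y : G) : ν.N (x⁻¹ * y) = ν.N (y⁻¹ * x) := by
  rw [← ν.inv]; simp

theorem HomNorm.triangle (x y z : G) :
    ν.N (x⁻¹ * z) ≤ ν.κ * (ν.N (x⁻¹ * y) + ν.N (y⁻¹ * z)) := by
  simpa [mul_assoc] using ν.mul_le (x⁻¹ * y) (y⁻¹ * z)

variable [MeasurableMul₂ G] [MeasurableInv G]
variable [SFinite μ] [μ.IsMulLeftInvariant] [μ.IsMulRightInvariant] [μ.IsInvInvariant]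

theorem HomNorm.measurableSet_ball (x : G) (r : ℝ) : MeasurableSet (ν.ball x r) :=
  measurableSet_lt (ν.meas.comp (measurable_const_mul _)) measurable_const

theorem HomNorm.measure_ball (x : G) {r : ℝ} (hr : 0 < r) :
    μ (ν.ball x r) = ENNReal.ofReal (ν.c * r ^ ν.D) := by
  rw [← ν.vol r hr]
  exact measure_preimage_mul μ x⁻¹ {g | ν.N g < r}

theorem HomNorm.measureReal_ball (x : G) {r : ℝ} (hr : 0 < r) :
    μ.real (ν.ball x r) = ν.c * r ^ ν.D := by
  rw [Measure.real, ν.measure_ball x hr, ENNReal.toReal_ofReal]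
  exact mul_nonneg ν.c_pos.le (by positivity)

theorem HomNorm.measure_ball_ne_top (x : G) {r : ℝ} (hr : 0 < r) : μ (ν.ball x r) ≠ ∞ := by
  rw [ν.measure_ball x hr]; exact ENNReal.ofReal_ne_top

/-- Averages of `|f|` are controlled by averages of `f²`. -/
theorem HomNorm.setIntegral_abs_le {f : G → ℝ} (hf : IsKer ν f) (x : G) {r s : ℝ} (hr : 0 < r)
    (hs : 0 < s) (h : ∫ y in ν.ball x r, f y ^ 2 ∂μ ≤ s ^ 2 * (ν.c * r ^ ν.D)) :
    ∫ y in ν.ball x r, |f y| ∂μ ≤ s * (ν.c * r ^ ν.D) := by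
  have h1 : ∫ y in ν.ball x r, |f y| ∂μ ≤ ∫ y in ν.ball x r, (s / 2 + f y ^ 2 * (2 * s)⁻¹) ∂μ := by
    refine integral_mono hf.integrable.abs.integrableOn ?_ fun y => ?_
    · exact (integrable_const_iff_isFiniteMeasure (by positivity) |>.2
        (isFiniteMeasure_restrict.2 (ν.measure_ball_ne_top x hr))).add
        (hf.sq.integrable.integrableOn.mul_const _)
    · have : 0 ≤ (|f y| - s) ^ 2 := sq_nonneg _
      have e : s / 2 + f y ^ 2 * (2 * s)⁻¹ - |f y| = (|f y| - s) ^ 2 * (2 * s)⁻¹ := by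
        rw [← sq_abs (f y)]; field_simp; ring
      have : 0 ≤ (|f y| - s) ^ 2 * (2 * s)⁻¹ := by positivity
      simp only
      linarith
  refine h1.trans ?_
  have : IsFiniteMeasure (μ.restrict (ν.ball x r)) :=
    isFiniteMeasure_restrict.2 (ν.measure_ball_ne_top x hr)
  rw [integral_add (integrable_const _) (hf.sq.integrable.integrableOn.mul_const _),
    integral_const, integral_mul_const, measureReal_restrict_apply_univ, ν.measureReal_ball x hr]
  have := mul_le_mul_of_nonneg_right h (show 0 ≤ (2 * s)⁻¹ by positivity)
  refine (add_le_add_right this _).trans (le_of_eq ?_)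
  rw [smul_eq_mul]; field_simp; ring

theorem IsBump.gconv_sub_le {A r : ℝ} {f ψ : G → ℝ} {i j : ℤ} (hψ : IsBump ν A ((2 : ℝ) ^ j) ψ)
    (hA : 0 ≤ A) (hf : IsKer ν f) {a : ℝ} (ha : 1 ≤ a) {e : ℕ} (he : ν.κ * (a + 1) ≤ 2 ^ e)
    {x z : G} (hr : r = (2 : ℝ) ^ i)
    (hz : ν.N (x⁻¹ * z) < a * r) (hf0 : ∀ y, ν.N (x⁻¹ * y) < 2 ^ e * r → f y = 0)
    {s : ℝ} (hs : 0 < s) (H : ∀ j, i < j →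
      ∫ y in ν.ball x ((2 : ℝ) ^ j), f y ^ 2 ∂μ ≤ s ^ 2 * (ν.c * ((2 : ℝ) ^ j) ^ ν.D)) :
    |gconv μ f ψ z - gconv μ f ψ x| ≤
      A * a * ν.c * (2 ^ e) ^ ν.D * s * (1 / 2) ^ (i - j).natAbs := by
  have hκ := ν.one_le
  have hc := ν.c_pos
  have hr0 : 0 < r := by rw [hr]; positivity
  have hfint : ∀ w, Integrable (fun y => f y * ψ (y⁻¹ * w)) μ := by
    intro w
    have h1 := hψ.isKer.integrable_translate_mul hf.memLp w
    have h2 := (Measure.measurePreserving_inv μ).integrable_comp_emb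
      (MeasurableEquiv.inv G).measurableEmbedding (g := fun h => f (w * h⁻¹) * ψ h)
    have h3 := (measurePreserving_mul_left μ w⁻¹).integrable_comp_emb
      (MeasurableEquiv.mulLeft w⁻¹).measurableEmbedding (g := fun h => f (w * h) * ψ h⁻¹)
    have h4 : Integrable (fun h => f (w * h) * ψ h⁻¹) μ := by
      have := h2.2 h1
      simpa [Function.comp_def] using this
    have := h3.2 h4
    simpa [Function.comp_def] using this
  have hnear : ∀ y w, ν.N (x⁻¹ * w) < a * r → f y ≠ 0 → r ≤ ν.N (y⁻¹ * w) := by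
    intro y w hw hy
    have h1 : 2 ^ e * r ≤ ν.N (x⁻¹ * y) := by
      by_contra h; exact hy (hf0 y (not_le.1 h))
    have h2 := ν.triangle x w y
    rw [ν.comm w y] at h2
    have h3 : ν.κ * (a + 1) * r ≤ 2 ^ e * r := by gcongr
    have h4 : ν.κ * ((a + 1) * r) ≤ ν.κ * (a * r + ν.N (y⁻¹ * w)) := by
      calc _ = ν.κ * (a + 1) * r := by ring
        _ ≤ _ := h3.trans (h1.trans (h2.trans (by gcongr)))
    have := le_of_mul_le_mul_left h4 (by linarith)
    linarith
  have hx : ν.N (x⁻¹ * x) < a * r := by rw [inv_mul_cancel, ν.one]; positivity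
  rcases le_or_gt j i with hji | hij
  · have h0 : ∀ w, ν.N (x⁻¹ * w) < a * r → gconv μ f ψ w = 0 := by
      intro w hw
      rw [gconv_eq_swap]
      refine integral_eq_zero_of_ae (Filter.Eventually.of_forall fun y => ?_)
      by_cases hy : f y = 0
      · simp [hy]
      · have := hψ.supp (y⁻¹ * w) (((zpow_le_zpow_right₀ one_le_two hji).trans hr.ge).trans
          (hnear y w hw hy))
        simp [this]
    rw [h0 z hz, h0 x hx, sub_zero, abs_zero]
    positivity
  rw [gconv_eq_swap, gconv_eq_swap, ← integral_sub (hfint z) (hfint x)]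
  set t : ℝ := (2 : ℝ) ^ j with ht
  have ht0 : 0 < t := by positivity
  have hrt : r ≤ t := by rw [hr]; exact zpow_le_zpow_right₀ one_le_two hij.le
  set M : ℝ := A / t ^ (ν.D + 1) * (a * r) with hM
  have hM0 : 0 ≤ M := by positivity
  have hpt : ∀ y, ‖f y * ψ (y⁻¹ * z) - f y * ψ (y⁻¹ * x)‖ ≤
      (ν.ball x (2 ^ e * t)).indicator (fun y => M * |f y|) y := by
    intro y
    by_cases hy : y ∈ ν.ball x (2 ^ e * t)
    · rw [Set.indicator_of_mem hy, ← mul_sub, Real.norm_eq_abs, abs_mul, mul_comm]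
      refine mul_le_mul_of_nonneg_right ?_ (abs_nonneg _)
      have := hψ.lipR (y⁻¹ * x) (x⁻¹ * z)
      rw [show y⁻¹ * x * (x⁻¹ * z) = y⁻¹ * z by group] at this
      exact this.trans (mul_le_mul_of_nonneg_left hz.le (by positivity))
    · rw [Set.indicator_of_notMem hy]
      have hfar : ∀ w, ν.N (x⁻¹ * w) < a * r → ψ (y⁻¹ * w) = 0 := by
        intro w hw
        refine hψ.supp _ ?_
        by_contra h
        refine hy (HomNorm.mem_ball.2 ?_)
        have h2 := ν.triangle x w y
        rw [ν.comm w y] at h2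
        calc _ ≤ _ := h2
          _ < ν.κ * (a * r + t) := mul_lt_mul_of_pos_left (add_lt_add hw (not_le.1 h)) (by linarith)
          _ ≤ ν.κ * (a * t + t) := by gcongr
          _ = ν.κ * (a + 1) * t := by ring
          _ ≤ 2 ^ e * t := by gcongr
      rw [hfar z hz, hfar x hx]; simp
  have hR : (2 : ℝ) ^ e * t = (2 : ℝ) ^ ((e : ℤ) + j) := by
    rw [zpow_add₀ two_ne_zero, zpow_natCast]
  have hR0 : 0 < (2 : ℝ) ^ e * t := by positivity
  have hfi : ∫ y in ν.ball x (2 ^ e * t), |f y| ∂μ ≤ s * (ν.c * (2 ^ e * t) ^ ν.D) := by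
    refine ν.setIntegral_abs_le hf x hR0 hs ?_
    rw [hR]; exact H _ (by omega)
  have hnab : (1 / 2 : ℝ) ^ (i - j).natAbs = r / t := by
    rw [hr, ht, ← zpow_sub₀ two_ne_zero, one_div, inv_pow, ← zpow_natCast, ← zpow_neg]
    congr 1; omega
  calc |∫ y, (f y * ψ (y⁻¹ * z) - f y * ψ (y⁻¹ * x)) ∂μ|
      ≤ ∫ y, (ν.ball x (2 ^ e * t)).indicator (fun y => M * |f y|) y ∂μ :=
        norm_integral_le_of_norm_le ((hf.integrable.abs.const_mul M).indicator
          (ν.measurableSet_ball x _)) (Filter.Eventually.of_forall hpt)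
    _ = M * ∫ y in ν.ball x (2 ^ e * t), |f y| ∂μ := by
        rw [integral_indicator (ν.measurableSet_ball x _), integral_const_mul]
    _ ≤ M * (s * (ν.c * (2 ^ e * t) ^ ν.D)) := mul_le_mul_of_nonneg_left hfi hM0
    _ = _ := by
        rw [hnab, hM, mul_pow]; field_simp; ring

theorem sq_le_of_sub_sq_le {u v X S : ℝ} (h : (u - v - X) ^ 2 ≤ S) :
    X ^ 2 ≤ 4 * u ^ 2 + 4 * v ^ 2 + 2 * S := by
  linarith [sq_nonneg (2 * (u - v) - X), sq_nonneg (u + v)]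

theorem sq_le_two_mul_add (z x : ℝ) : z ^ 2 ≤ 2 * x ^ 2 + 2 * (z - x) ^ 2 := by
  linarith [sq_nonneg (2 * x - z)]

set_option maxHeartbeats 1000000 in
/-- A set on which a sum of dyadic bumps is large has small measure in a ball whose dilates carry
little of the mass of `f`. -/
theorem measure_local_le (ν : HomNorm μ) {A : ℝ} (hA : 0 ≤ A) : ∃ K C : ℝ, 8 ≤ K ∧ 0 ≤ C ∧
    ∀ (F : Finset ℤ) (ψ : ℤ → G → ℝ), (∀ j, IsBump ν A ((2 : ℝ) ^ j) (ψ j)) →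
    ∀ f : G → ℝ, IsKer ν f → ∀ (τ δ : ℝ), 0 < τ → 0 < δ → δ ≤ 1 → ∀ (i : ℤ) (x : G),
    (∀ j, i < j → ∫ y in ν.ball x ((2 : ℝ) ^ j), f y ^ 2 ∂μ ≤
      (δ * τ) ^ 2 * (ν.c * ((2 : ℝ) ^ j) ^ ν.D)) →
    (∫ y in ν.ball x ((2 : ℝ) ^ (i + 1)), (∑ j ∈ F, gconv μ f (ψ j) y) ^ 2 ∂μ ≤
      τ ^ 2 * (ν.c * ((2 : ℝ) ^ (i + 1)) ^ ν.D)) →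
    μ {z | z ∈ ν.ball x (4 * ν.κ * (2 : ℝ) ^ i) ∧ K * τ ^ 2 < (∑ j ∈ F, gconv μ f (ψ j) z) ^ 2} ≤
      ENNReal.ofReal (C * δ ^ 2 * ((2 : ℝ) ^ i) ^ ν.D) := by
  have hκ := ν.one_le
  have hc := ν.c_pos
  obtain ⟨C₂, hC₂, hL2⟩ := eLpNorm_sum_bump_two_le ν hA
  set a : ℝ := 4 * ν.κ with ha
  have ha1 : 1 ≤ a := by linarith
  obtain ⟨e, he⟩ := pow_unbounded_of_one_lt (ν.κ * (a + 1)) (one_lt_two (α := ℝ))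
  set E : ℝ := (2 ^ e) ^ ν.D with hE
  have hE0 : 0 < E := by positivity
  set C₁ : ℝ := 4 * (A * a * ν.c * E) with hC₁
  have hC₁0 : 0 ≤ C₁ := by positivity
  set C₃ : ℝ := 4 + 4 * C₂ ^ 2 * E + 2 * C₁ ^ 2 with hC₃
  set C₄ : ℝ := 2 * C₃ + 2 * C₁ ^ 2 with hC₄
  have hC₃0 : 4 ≤ C₃ := by rw [hC₃]; have : 0 ≤ 4 * C₂ ^ 2 * E + 2 * C₁ ^ 2 := by positivity
                           linarith
  have hC₄0 : 8 ≤ C₄ := by rw [hC₄]; have : 0 ≤ 2 * C₁ ^ 2 := by positivity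
                           linarith
  refine ⟨4 * C₄, C₂ ^ 2 * ν.c * E, by linarith, by positivity, ?_⟩
  intro F ψ hψ f hf τ δ hτ hδ hδ1 i x H1 H2
  set r : ℝ := (2 : ℝ) ^ i with hr
  have hr0 : 0 < r := by positivity
  have h2r : (2 : ℝ) ^ (i + 1) = 2 * r := by rw [zpow_add₀ two_ne_zero, zpow_one, mul_comm]
  have her : (2 : ℝ) ^ e * r = (2 : ℝ) ^ ((e : ℤ) + i) := by
    rw [zpow_add₀ two_ne_zero, zpow_natCast]
  have he0 : 0 < e := by
    rcases Nat.eq_zero_or_pos e with h | h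
    · rw [h] at he; nlinarith
    · exact h
  set T : (G → ℝ) → G → ℝ := fun f z => ∑ j ∈ F, gconv μ f (ψ j) z with hT
  set B₀ := ν.ball x (2 ^ e * r) with hB₀
  have hB₀m : MeasurableSet B₀ := ν.measurableSet_ball x _
  set f₁ := B₀.indicator f with hf₁
  set f₂ := B₀ᶜ.indicator f with hf₂
  have hk₁ : IsKer ν f₁ := hf.indicator hB₀m
  have hk₂ : IsKer ν f₂ := hf.indicator hB₀m.compl
  have hTk : ∀ g, IsKer ν g → IsKer ν (T g) := fun g hg =>
    IsKer.sum F fun j _ => hg.gconv (hψ j).isKer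
  have hf12 : ∀ y, f y = f₁ y + f₂ y := fun y => by
    rw [hf₁, hf₂, ← Pi.add_apply, Set.indicator_self_add_compl]
  have hsplit : ∀ z, T f z = T f₁ z + T f₂ z := by
    intro z
    simp only [hT]
    rw [← Finset.sum_add_distrib]
    refine Finset.sum_congr rfl fun j _ => ?_
    simp only [gconv]
    rw [← integral_add ((hψ j).isKer.integrable_translate_mul hk₁.memLp z)
      ((hψ j).isKer.integrable_translate_mul hk₂.memLp z)]
    congr 1; ext h; rw [hf12]; ring
  have hosc : ∀ z, ν.N (x⁻¹ * z) < a * r → |T f₂ z - T f₂ x| ≤ C₁ * (δ * τ) := by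
    intro z hz
    simp only [hT]
    rw [← Finset.sum_sub_distrib]
    refine (Finset.abs_sum_le_sum_abs _ _).trans ?_
    refine (Finset.sum_le_sum fun j _ => (hψ j).gconv_sub_le hA hk₂ ha1 he.le hr hz
      (fun y hy => ?_) (s := δ * τ) (by positivity) fun j hj => ?_).trans ?_
    · rw [hf₂, Set.indicator_of_notMem]; exact fun h => h hy
    · refine le_trans ?_ (H1 j hj)
      refine integral_mono hk₂.sq.integrable.integrableOn hf.sq.integrable.integrableOn fun y => ?_
      simp only [hf₂, Set.indicator]
      split_ifs
      · exact le_rfl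
      · rw [zero_pow two_ne_zero]; positivity
    · rw [← Finset.mul_sum]
      have := sum_pow_natAbs_le F i (r := 1 / 2) (by norm_num) (by norm_num)
      calc _ ≤ A * a * ν.c * (2 ^ e) ^ ν.D * (δ * τ) * (2 / (1 - 1 / 2)) := by gcongr
        _ = _ := by rw [hC₁, hE]; ring
  have hi1 : ∫ y, f₁ y ^ 2 ∂μ ≤ (δ * τ) ^ 2 * (ν.c * (E * r ^ ν.D)) := by
    have e1 : (fun y => f₁ y ^ 2) = B₀.indicator fun y => f y ^ 2 := by
      ext y; simp only [hf₁, Set.indicator]; split_ifs <;> simp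
    rw [e1, integral_indicator hB₀m, hB₀, her]
    refine (H1 _ (by omega)).trans (le_of_eq ?_)
    rw [← her, hE, mul_pow (2 ^ e) r]
  have hT1 : ∫ y, T f₁ y ^ 2 ∂μ ≤ C₂ ^ 2 * ((δ * τ) ^ 2 * (ν.c * (E * r ^ ν.D))) :=
    (integral_sq_le_of_eLpNorm_le hk₁.memLp (hTk _ hk₁).memLp hC₂
      (hL2 F ψ hψ f₁ hk₁.memLp)).trans (by gcongr)
  have hδτ : (δ * τ) ^ 2 ≤ τ ^ 2 := by
    rw [mul_pow]
    have : δ ^ 2 ≤ 1 := by nlinarith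
    nlinarith [sq_nonneg τ]
  set B₂ := ν.ball x (2 * r) with hB₂
  have hV : 0 < ν.c * (2 * r) ^ ν.D := by positivity
  have hT2x : T f₂ x ^ 2 ≤ C₃ * τ ^ 2 := by
    have : IsFiniteMeasure (μ.restrict B₂) :=
      isFiniteMeasure_restrict.2 (ν.measure_ball_ne_top x (by positivity))
    have i1 : Integrable (fun y => 4 * T f y ^ 2) (μ.restrict B₂) :=
      (hTk _ hf).sq.integrable.integrableOn.const_mul 4
    have i2 : Integrable (fun y => 4 * T f₁ y ^ 2) (μ.restrict B₂) :=
      (hTk _ hk₁).sq.integrable.integrableOn.const_mul 4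
    have i12 : Integrable (fun y => 4 * T f y ^ 2 + 4 * T f₁ y ^ 2) (μ.restrict B₂) := i1.add i2
    have h1 : ∫ y in B₂, T f₂ x ^ 2 ∂μ ≤
        ∫ y in B₂, (4 * T f y ^ 2 + 4 * T f₁ y ^ 2 + 2 * (C₁ * (δ * τ)) ^ 2) ∂μ := by
      refine setIntegral_mono_on (integrable_const _) ?_ (ν.measurableSet_ball x _) fun y hy => ?_
      · exact i12.add (integrable_const _)
      · have h2 := hosc y (lt_of_lt_of_le hy (by rw [ha]; nlinarith))
        have h3 : (T f₂ y - T f₂ x) ^ 2 ≤ (C₁ * (δ * τ)) ^ 2 := by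
          rw [← sq_abs]; exact pow_le_pow_left₀ (abs_nonneg _) h2 2
        have h4 := hsplit y
        have h5 : T f₂ y = T f y - T f₁ y := by linarith
        rw [h5] at h3
        exact sq_le_of_sub_sq_le h3
    rw [integral_const, measureReal_restrict_apply_univ, ν.measureReal_ball x (by positivity),
      integral_add i12 (integrable_const _), integral_add i1 i2, integral_const_mul,
      integral_const_mul, integral_const, measureReal_restrict_apply_univ,
      ν.measureReal_ball x (by positivity), smul_eq_mul, smul_eq_mul] at h1
    rw [h2r] at H2
    have h6 : ∫ y in B₂, T f₁ y ^ 2 ∂μ ≤ C₂ ^ 2 * (τ ^ 2 * (E * (ν.c * (2 * r) ^ ν.D))) := by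
      refine (setIntegral_le_integral (hTk _ hk₁).sq.integrable
        (Filter.Eventually.of_forall fun y => sq_nonneg _)).trans (hT1.trans ?_)
      have : r ^ ν.D ≤ (2 * r) ^ ν.D := pow_le_pow_left₀ hr0.le (by linarith) _
      calc _ ≤ C₂ ^ 2 * (τ ^ 2 * (ν.c * (E * (2 * r) ^ ν.D))) := by gcongr
        _ = _ := by ring
    have h7 : ν.c * (2 * r) ^ ν.D * (2 * (C₁ * (δ * τ)) ^ 2) ≤
        ν.c * (2 * r) ^ ν.D * (2 * (C₁ ^ 2 * τ ^ 2)) := by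
      rw [mul_pow C₁]; gcongr
    have h8 : ν.c * (2 * r) ^ ν.D * T f₂ x ^ 2 ≤ ν.c * (2 * r) ^ ν.D * (C₃ * τ ^ 2) := by
      calc _ ≤ _ := h1
        _ ≤ 4 * (τ ^ 2 * (ν.c * (2 * r) ^ ν.D)) +
            4 * (C₂ ^ 2 * (τ ^ 2 * (E * (ν.c * (2 * r) ^ ν.D)))) +
            ν.c * (2 * r) ^ ν.D * (2 * (C₁ ^ 2 * τ ^ 2)) :=
          add_le_add (add_le_add (mul_le_mul_of_nonneg_left H2 (by norm_num))
            (mul_le_mul_of_nonneg_left h6 (by norm_num))) h7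
        _ = _ := by rw [hC₃]; ring
    exact le_of_mul_le_mul_left h8 hV
  have hT2 : ∀ z, ν.N (x⁻¹ * z) < a * r → T f₂ z ^ 2 ≤ C₄ * τ ^ 2 := by
    intro z hz
    have h3 : (T f₂ z - T f₂ x) ^ 2 ≤ (C₁ * (δ * τ)) ^ 2 := by
      rw [← sq_abs]; exact pow_le_pow_left₀ (abs_nonneg _) (hosc z hz) 2
    have h4 : (C₁ * (δ * τ)) ^ 2 ≤ C₁ ^ 2 * τ ^ 2 := by rw [mul_pow C₁]; gcongr
    rw [hC₄]
    linarith [sq_nonneg (T f₂ z - 2 * T f₂ x), sq_le_two_mul_add (T f₂ z) (T f₂ x)]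
  have hsub : {z | z ∈ ν.ball x (a * r) ∧ 4 * C₄ * τ ^ 2 < T f z ^ 2} ⊆
      {z | τ ^ 2 ≤ T f₁ z ^ 2} := by
    rintro z ⟨hz, hz2⟩
    have h1 := hT2 z hz
    rw [hsplit z] at hz2
    have h2 : 0 < τ ^ 2 := by positivity
    show τ ^ 2 ≤ T f₁ z ^ 2
    have h3 : 8 * τ ^ 2 ≤ C₄ * τ ^ 2 := mul_le_mul_of_nonneg_right hC₄0 h2.le
    have h4 := sq_nonneg (T f₁ z - T f₂ z)
    have h5 : (T f₁ z + T f₂ z) ^ 2 = 2 * T f₁ z ^ 2 + 2 * T f₂ z ^ 2 - (T f₁ z - T f₂ z) ^ 2 := by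
      ring
    linarith
  have hch := mul_meas_ge_le_integral_of_nonneg (μ := μ) (f := fun z => T f₁ z ^ 2)
    (Filter.Eventually.of_forall fun y => sq_nonneg _) (hTk _ hk₁).sq.integrable (τ ^ 2)
  have hτ2 : 0 < τ ^ 2 := by positivity
  have hfin : μ {z | τ ^ 2 ≤ T f₁ z ^ 2} ≠ ∞ :=
    ((hTk _ hk₁).sq.integrable.measure_ge_lt_top hτ2).ne
  refine (measure_mono hsub).trans ?_
  rw [← ENNReal.ofReal_toReal hfin]
  refine ENNReal.ofReal_le_ofReal ?_
  have h9 := hch.trans hT1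
  have : τ ^ 2 * (μ {z | τ ^ 2 ≤ T f₁ z ^ 2}).toReal ≤
      τ ^ 2 * (C₂ ^ 2 * ν.c * E * δ ^ 2 * r ^ ν.D) := by
    refine h9.trans (le_of_eq ?_); ring
  exact le_of_mul_le_mul_left this hτ2

end LocalEstimate

section GoodLambda

variable {G : Type*} [Group G] [MeasurableSpace G] {μ : Measure G} {ν : HomNorm μ}
variable [MeasurableMul₂ G] [MeasurableInv G]
variable [SFinite μ] [μ.IsMulLeftInvariant] [μ.IsMulRightInvariant] [μ.IsInvInvariant]

theorem integrable_mul_inv_mul {f ψ : G → ℝ} (hf : IsKer ν f) (hψ : IsKer ν ψ) (w : G) :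
    Integrable (fun y => f y * ψ (y⁻¹ * w)) μ := by
  have h1 := hψ.integrable_translate_mul hf.memLp w
  have h2 := (Measure.measurePreserving_inv μ).integrable_comp_emb
    (MeasurableEquiv.inv G).measurableEmbedding (g := fun h => f (w * h⁻¹) * ψ h)
  have h3 := (measurePreserving_mul_left μ w⁻¹).integrable_comp_emb
    (MeasurableEquiv.mulLeft w⁻¹).measurableEmbedding (g := fun h => f (w * h) * ψ h⁻¹)
  have h4 : Integrable (fun h => f (w * h) * ψ h⁻¹) μ := by
    have := h2.2 h1
    simpa [Function.comp_def] using this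
  have := h3.2 h4
  simpa [Function.comp_def] using this

theorem exists_lipschitz_sum_gconv {A : ℝ} (hA : 0 ≤ A) (F : Finset ℤ) {ψ : ℤ → G → ℝ}
    (hψ : ∀ j, IsBump ν A ((2 : ℝ) ^ j) (ψ j)) {f : G → ℝ} (hf : IsKer ν f) :
    ∃ L, 0 ≤ L ∧ ∀ x y, |∑ j ∈ F, gconv μ f (ψ j) y - ∑ j ∈ F, gconv μ f (ψ j) x| ≤
      L * ν.N (x⁻¹ * y) := by
  have hone : ∀ j, ∀ x y, |gconv μ f (ψ j) y - gconv μ f (ψ j) x| ≤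
      A / ((2 : ℝ) ^ j) ^ (ν.D + 1) * (∫ y, |f y| ∂μ) * ν.N (x⁻¹ * y) := by
    intro j x y
    rw [gconv_eq_swap, gconv_eq_swap,
      ← integral_sub (integrable_mul_inv_mul hf (hψ j).isKer y)
        (integrable_mul_inv_mul hf (hψ j).isKer x), mul_right_comm, ← integral_const_mul]
    rw [← Real.norm_eq_abs]
    refine norm_integral_le_of_norm_le (hf.integrable.abs.const_mul _)
      (Filter.Eventually.of_forall fun w => ?_)
    rw [← mul_sub, Real.norm_eq_abs, abs_mul, mul_comm]
    refine mul_le_mul_of_nonneg_right ?_ (abs_nonneg _)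
    have := (hψ j).lipR (w⁻¹ * x) (x⁻¹ * y)
    rwa [show w⁻¹ * x * (x⁻¹ * y) = w⁻¹ * y by group] at this
  refine ⟨∑ j ∈ F, A / ((2 : ℝ) ^ j) ^ (ν.D + 1) * (∫ y, |f y| ∂μ), ?_, fun x y => ?_⟩
  · have : 0 ≤ ∫ y, |f y| ∂μ := integral_nonneg fun y => abs_nonneg _
    exact Finset.sum_nonneg fun j _ => by positivity
  · rw [← Finset.sum_sub_distrib, Finset.sum_mul]
    exact (Finset.abs_sum_le_sum_abs _ _).trans (Finset.sum_le_sum fun j _ => hone j x y)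

set_option maxHeartbeats 1000000 in
/-- The good-`λ` inequality for sums of dyadic bumps. -/
theorem good_lambda (ν : HomNorm μ) (hD : 1 ≤ ν.D) {A : ℝ} (hA : 0 ≤ A) :
    ∃ K C : ℝ, 8 ≤ K ∧ 0 ≤ C ∧
    ∀ (F : Finset ℤ) (ψ : ℤ → G → ℝ), (∀ j, IsBump ν A ((2 : ℝ) ^ j) (ψ j)) →
    ∀ f : G → ℝ, IsKer ν f → ∀ (τ δ : ℝ), 0 < τ → 0 < δ → δ ≤ 1 →
    μ {z | K * τ ^ 2 < (∑ j ∈ F, gconv μ f (ψ j) z) ^ 2} ≤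
      ENNReal.ofReal (C * δ ^ 2 / τ ^ 2) *
        ∫⁻ z in {z | τ ^ 2 / 2 < (∑ j ∈ F, gconv μ f (ψ j) z) ^ 2 + (δ ^ 2)⁻¹ * f z ^ 2},
          ENNReal.ofReal ((∑ j ∈ F, gconv μ f (ψ j) z) ^ 2 + (δ ^ 2)⁻¹ * f z ^ 2) ∂μ := by
  have hκ := ν.one_le
  have hc := ν.c_pos
  obtain ⟨K, C, hK, hC, hloc⟩ := measure_local_le ν hA
  refine ⟨K, 2 * C / ν.c, hK, by positivity, ?_⟩
  intro F ψ hψ f hf τ δ hτ hδ hδ1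
  set u : G → ℝ := fun z => ∑ j ∈ F, gconv μ f (ψ j) z with hu
  have huk : IsKer ν u := IsKer.sum F fun j _ => hf.gconv (hψ j).isKer
  set W : G → ℝ := fun z => u z ^ 2 + (δ ^ 2)⁻¹ * f z ^ 2 with hW
  have hWk : IsKer ν W := huk.sq.add (hf.sq.const_mul _)
  have hW0 : ∀ z, 0 ≤ W z := fun z => by rw [hW]; positivity
  have huW : ∀ z, u z ^ 2 ≤ W z := fun z => by
    rw [hW]; simp only [le_add_iff_nonneg_right]; positivity
  have hfW : ∀ z, f z ^ 2 ≤ δ ^ 2 * W z := fun z => by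
    have : δ ^ 2 * W z = δ ^ 2 * u z ^ 2 + f z ^ 2 := by rw [hW]; field_simp
    rw [this]; have : 0 ≤ δ ^ 2 * u z ^ 2 := by positivity
    linarith
  have hτ2 : 0 < τ ^ 2 := by positivity
  set S : Set G := {z | K * τ ^ 2 < u z ^ 2} with hS
  set P : G → ℤ → Prop := fun x k =>
    τ ^ 2 * (ν.c * ((2 : ℝ) ^ k) ^ ν.D) < ∫ y in ν.ball x ((2 : ℝ) ^ k), W y ∂μ with hP
  have hbd : ∃ b : ℤ, ∀ x k, P x k → k ≤ b := by
    obtain ⟨n, hn⟩ := pow_unbounded_of_one_lt ((∫ y, W y ∂μ) / (τ ^ 2 * ν.c)) (one_lt_two (α := ℝ))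
    refine ⟨n, fun x k hk => ?_⟩
    by_contra hkn
    have h1 : (2 : ℝ) ^ n ≤ 2 ^ k := by
      rw [← zpow_natCast]; exact zpow_le_zpow_right₀ one_le_two (by omega)
    have h2 : (2 : ℝ) ^ k ≤ ((2 : ℝ) ^ k) ^ ν.D :=
      le_self_pow₀ ((one_le_pow₀ one_le_two).trans h1) (by omega)
    have h3 : ∫ y in ν.ball x ((2 : ℝ) ^ k), W y ∂μ ≤ ∫ y, W y ∂μ :=
      setIntegral_le_integral hWk.integrable (Filter.Eventually.of_forall hW0)
    rw [div_lt_iff₀ (by positivity)] at hn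
    have h4 : (2 : ℝ) ^ n * (τ ^ 2 * ν.c) ≤ ((2 : ℝ) ^ k) ^ ν.D * (τ ^ 2 * ν.c) :=
      mul_le_mul_of_nonneg_right (h1.trans h2) (by positivity)
    have h5 : τ ^ 2 * (ν.c * ((2 : ℝ) ^ k) ^ ν.D) = ((2 : ℝ) ^ k) ^ ν.D * (τ ^ 2 * ν.c) := by ring
    have h6 : τ ^ 2 * (ν.c * ((2 : ℝ) ^ k) ^ ν.D) < ∫ y in ν.ball x ((2 : ℝ) ^ k), W y ∂μ := hk
    linarith
  obtain ⟨b, hb⟩ := hbd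
  have hinh : ∀ x ∈ S, ∃ k, P x k := by
    intro x hx
    obtain ⟨L, hL0, hL⟩ := exists_lipschitz_sum_gconv hA F hψ hf
    obtain ⟨n, hn⟩ := pow_unbounded_of_one_lt (L / τ) (one_lt_two (α := ℝ))
    refine ⟨-n, ?_⟩
    set r : ℝ := (2 : ℝ) ^ (-n : ℤ) with hr
    have hr0 : 0 < r := by positivity
    have hLr : L * r ≤ τ := by
      rw [hr, zpow_neg, zpow_natCast, ← div_eq_mul_inv, div_le_iff₀ (by positivity)]
      rw [div_lt_iff₀ hτ] at hn
      linarith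
    have hlow : ∀ y ∈ ν.ball x r, 3 * τ ^ 2 ≤ W y := by
      intro y hy
      have h1 : |u y - u x| ≤ τ := (hL x y).trans
        ((mul_le_mul_of_nonneg_left (HomNorm.mem_ball.1 hy).le hL0).trans hLr)
      have h2 : (u y - u x) ^ 2 ≤ τ ^ 2 := by
        rw [← sq_abs]; exact pow_le_pow_left₀ (abs_nonneg _) h1 2
      have h3 := sq_le_two_mul_add (u x) (u y)
      have h4 : (u x - u y) ^ 2 = (u y - u x) ^ 2 := by ring
      have h5 : K * τ ^ 2 < u x ^ 2 := hx
      have h6 := mul_le_mul_of_nonneg_right hK hτ2.le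
      have := huW y
      linarith
    have : IsFiniteMeasure (μ.restrict (ν.ball x r)) :=
      isFiniteMeasure_restrict.2 (ν.measure_ball_ne_top x hr0)
    have h7 : ∫ y in ν.ball x r, 3 * τ ^ 2 ∂μ ≤ ∫ y in ν.ball x r, W y ∂μ :=
      setIntegral_mono_on (integrable_const _) hWk.integrable.integrableOn
        (ν.measurableSet_ball x r) hlow
    rw [integral_const, measureReal_restrict_apply_univ, ν.measureReal_ball x hr0,
      smul_eq_mul] at h7
    show τ ^ 2 * (ν.c * r ^ ν.D) < ∫ y in ν.ball x r, W y ∂μ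
    have : 0 < ν.c * r ^ ν.D * τ ^ 2 := by positivity
    linarith
  have hgreat : ∀ x, ∃ k, x ∈ S → P x k ∧ ∀ j, k < j → ¬ P x j := by
    intro x
    by_cases hx : x ∈ S
    · obtain ⟨k, hk, hk'⟩ := Int.exists_greatest_of_bdd ⟨b, hb x⟩ (hinh x hx)
      exact ⟨k, fun _ => ⟨hk, fun j hj hPj => by have := hk' j hPj; omega⟩⟩
    · exact ⟨0, fun h => absurd h hx⟩
  choose k hk using hgreat
  obtain ⟨U, hUS, hUd, hUc⟩ := Vitali.exists_disjoint_subfamily_covering_enlargement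
    (fun x => ν.ball x ((2 : ℝ) ^ k x)) S (fun x => (2 : ℝ) ^ k x) 2 one_lt_two
    (fun x _ => by positivity) ((2 : ℝ) ^ b)
    (fun x hx => zpow_le_zpow_right₀ one_le_two (hb x _ (hk x hx).1))
    (fun x _ => ⟨x, by rw [HomNorm.mem_ball, inv_mul_cancel, ν.one]; positivity⟩)
  set V : Set G := {z | τ ^ 2 / 2 < W z} with hV
  have hVm : MeasurableSet V := measurableSet_lt measurable_const hWk.meas
  have hUcount : U.Countable := by
    have h1 := Measure.countable_meas_pos_of_disjoint_iUnion (μ := μ)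
      (As := fun x : U => ν.ball (x : G) ((2 : ℝ) ^ k x)) (fun x => ν.measurableSet_ball _ _)
      (fun x y hxy => hUd x.2 y.2 (fun h => hxy (Subtype.ext h)))
    have h2 : {x : U | 0 < μ (ν.ball (x : G) ((2 : ℝ) ^ k x))} = Set.univ := by
      ext x
      simp only [Set.mem_ofPred_eq, Set.mem_univ, iff_true]
      rw [ν.measure_ball _ (by positivity)]
      exact ENNReal.ofReal_pos.2 (by positivity)
    rw [h2] at h1
    exact Set.countable_coe_iff.1 (Set.countable_univ_iff.1 h1)
  have hcov : S ⊆ ⋃ x ∈ U, {z | z ∈ ν.ball x (4 * ν.κ * (2 : ℝ) ^ k x) ∧ K * τ ^ 2 < u z ^ 2} := by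
    intro z hz
    obtain ⟨x, hxU, ⟨y, hy1, hy2⟩, hle⟩ := hUc z hz
    simp only [Set.mem_iUnion]
    refine ⟨x, hxU, ?_, hz⟩
    rw [HomNorm.mem_ball] at hy1 hy2 ⊢
    have h1 := ν.triangle x y z
    rw [ν.comm y z] at h1
    have h2 : (0 : ℝ) < 2 ^ k x := by positivity
    calc _ ≤ _ := h1
      _ ≤ ν.κ * ((2 : ℝ) ^ k x + 2 * (2 : ℝ) ^ k x) := by
        gcongr; linarith
      _ < _ := by nlinarith
  have hmass : ∀ x ∈ U, ENNReal.ofReal (C * δ ^ 2 * ((2 : ℝ) ^ k x) ^ ν.D) ≤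
      ENNReal.ofReal (2 * C / ν.c * δ ^ 2 / τ ^ 2) *
        ∫⁻ z in ν.ball x ((2 : ℝ) ^ k x) ∩ V, ENNReal.ofReal (W z) ∂μ := by
    intro x hx
    have hPx : τ ^ 2 * (ν.c * ((2 : ℝ) ^ k x) ^ ν.D) < ∫ y in ν.ball x ((2 : ℝ) ^ k x), W y ∂μ :=
      (hk x (hUS hx)).1
    set r : ℝ := (2 : ℝ) ^ k x with hr
    have hr0 : 0 < r := by positivity
    have : IsFiniteMeasure (μ.restrict (ν.ball x r)) :=
      isFiniteMeasure_restrict.2 (ν.measure_ball_ne_top x hr0)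
    have h1 : ∫ y in ν.ball x r, W y ∂μ ≤ ∫ y in ν.ball x r, (V.indicator W y + τ ^ 2 / 2) ∂μ := by
      refine integral_mono hWk.integrable.integrableOn
        ((hWk.integrable.indicator hVm).integrableOn.add (integrable_const _)) fun y => ?_
      by_cases hy : y ∈ V
      · simp only [Set.indicator_of_mem hy, le_add_iff_nonneg_right]; positivity
      · simp only [Set.indicator_of_notMem hy, zero_add]
        exact not_lt.1 hy
    rw [integral_add (hWk.integrable.indicator hVm).integrableOn (integrable_const _),
      integral_const, measureReal_restrict_apply_univ, ν.measureReal_ball x hr0,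
      setIntegral_indicator hVm, smul_eq_mul] at h1
    rw [← ofReal_integral_eq_lintegral_ofReal hWk.integrable.integrableOn
      (Filter.Eventually.of_forall hW0), ← ENNReal.ofReal_mul (by positivity)]
    refine ENNReal.ofReal_le_ofReal ?_
    have h2 : τ ^ 2 / 2 * (ν.c * r ^ ν.D) ≤ ∫ z in ν.ball x r ∩ V, W z ∂μ := by linarith
    calc C * δ ^ 2 * r ^ ν.D = 2 * C / ν.c * δ ^ 2 / τ ^ 2 * (τ ^ 2 / 2 * (ν.c * r ^ ν.D)) := by
          field_simp
      _ ≤ _ := mul_le_mul_of_nonneg_left h2 (by positivity)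
  have hlocal : ∀ x ∈ U, μ {z | z ∈ ν.ball x (4 * ν.κ * (2 : ℝ) ^ k x) ∧ K * τ ^ 2 < u z ^ 2} ≤
      ENNReal.ofReal (C * δ ^ 2 * ((2 : ℝ) ^ k x) ^ ν.D) := by
    intro x hx
    have hnot : ∀ j, k x < j → ∫ y in ν.ball x ((2 : ℝ) ^ j), W y ∂μ ≤
        τ ^ 2 * (ν.c * ((2 : ℝ) ^ j) ^ ν.D) := fun j hj => not_lt.1 ((hk x (hUS hx)).2 j hj)
    refine hloc F ψ hψ f hf τ δ hτ hδ hδ1 (k x) x (fun j hj => ?_) ?_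
    · calc ∫ y in ν.ball x ((2 : ℝ) ^ j), f y ^ 2 ∂μ
          ≤ ∫ y in ν.ball x ((2 : ℝ) ^ j), δ ^ 2 * W y ∂μ :=
            integral_mono hf.sq.integrable.integrableOn
              (hWk.integrable.integrableOn.const_mul _) hfW
        _ = δ ^ 2 * ∫ y in ν.ball x ((2 : ℝ) ^ j), W y ∂μ := integral_const_mul _ _
        _ ≤ δ ^ 2 * (τ ^ 2 * (ν.c * ((2 : ℝ) ^ j) ^ ν.D)) := by gcongr; exact hnot j hj
        _ = _ := by ring
    · exact (integral_mono huk.sq.integrable.integrableOn hWk.integrable.integrableOn huW).trans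
        (hnot _ (by omega))
  calc μ S ≤ μ (⋃ x ∈ U, {z | z ∈ ν.ball x (4 * ν.κ * (2 : ℝ) ^ k x) ∧ K * τ ^ 2 < u z ^ 2}) :=
        measure_mono hcov
    _ ≤ ∑' x : U, μ {z | z ∈ ν.ball (x : G) (4 * ν.κ * (2 : ℝ) ^ k x) ∧ K * τ ^ 2 < u z ^ 2} :=
        measure_biUnion_le μ hUcount _
    _ ≤ ∑' x : U, ENNReal.ofReal (2 * C / ν.c * δ ^ 2 / τ ^ 2) *
        ∫⁻ z in ν.ball (x : G) ((2 : ℝ) ^ k x) ∩ V, ENNReal.ofReal (W z) ∂μ :=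
        ENNReal.tsum_le_tsum fun x => (hlocal x x.2).trans (hmass x x.2)
    _ = ENNReal.ofReal (2 * C / ν.c * δ ^ 2 / τ ^ 2) *
        ∫⁻ z in ⋃ x : U, ν.ball (x : G) ((2 : ℝ) ^ k x) ∩ V, ENNReal.ofReal (W z) ∂μ := by
        have : Countable U := hUcount
        rw [ENNReal.tsum_mul_left, lintegral_iUnion
          (fun x => (ν.measurableSet_ball _ _).inter hVm) fun x y hxy =>
          (hUd x.2 y.2 (fun h => hxy (Subtype.ext h))).mono Set.inter_subset_left
            Set.inter_subset_left]
    _ ≤ _ := by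
        gcongr
        exact Set.iUnion_subset fun x => Set.inter_subset_right

end GoodLambda

section LpBound

variable {G : Type*} [Group G] [MeasurableSpace G] {μ : Measure G} {ν : HomNorm μ}

theorem IsKer.rpow {k : G → ℝ} (hk : IsKer ν k) (h0 : ∀ g, 0 ≤ k g) {q : ℝ} (hq : 0 < q) :
    IsKer ν (fun g => k g ^ q) := by
  obtain ⟨A, hA⟩ := hk.bdd
  obtain ⟨R, hR⟩ := hk.supp
  refine ⟨hk.meas.pow_const q, ⟨A ^ q, fun g => ?_⟩, ⟨R, fun g hg => by
    simp only [hR g hg, Real.zero_rpow hq.ne']⟩⟩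
  rw [abs_of_nonneg (Real.rpow_nonneg (h0 g) q)]
  exact Real.rpow_le_rpow (h0 g) ((le_abs_self _).trans (hA g)) hq.le

theorem IsKer.eLpNorm_eq {g : G → ℝ} (hg : IsKer ν g) {p : ℝ} (hp : 0 < p) :
    eLpNorm g (ENNReal.ofReal p) μ = ENNReal.ofReal ((∫ x, (g x ^ 2) ^ (p / 2) ∂μ) ^ p⁻¹) := by
  rw [(hg.memLp (p := ENNReal.ofReal p)).eLpNorm_eq_integral_rpow_norm
    (by simpa using hp) ENNReal.ofReal_ne_top, ENNReal.toReal_ofReal hp.le]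
  congr 3
  ext x
  rw [← sq_abs, ← Real.rpow_natCast, ← Real.rpow_mul (abs_nonneg _), Real.norm_eq_abs]
  congr 1; push_cast; ring

theorem add_rpow_le_two_rpow {a b q : ℝ} (ha : 0 ≤ a) (hb : 0 ≤ b) (hq : 0 ≤ q) :
    (a + b) ^ q ≤ 2 ^ q * (a ^ q + b ^ q) := by
  have h2 : (0 : ℝ) ≤ 2 ^ q := by positivity
  have ha' := Real.rpow_nonneg ha q
  have hb' := Real.rpow_nonneg hb q
  rcases le_total a b with h | h
  · calc (a + b) ^ q ≤ (2 * b) ^ q := Real.rpow_le_rpow (by positivity) (by linarith) hq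
      _ = 2 ^ q * b ^ q := Real.mul_rpow two_pos.le hb
      _ ≤ _ := mul_le_mul_of_nonneg_left (by linarith) h2
  · calc (a + b) ^ q ≤ (2 * a) ^ q := Real.rpow_le_rpow (by positivity) (by linarith) hq
      _ = 2 ^ q * a ^ q := Real.mul_rpow two_pos.le ha
      _ ≤ _ := mul_le_mul_of_nonneg_left (by linarith) h2

variable [MeasurableMul₂ G] [MeasurableInv G]
variable [SFinite μ] [μ.IsMulLeftInvariant] [μ.IsMulRightInvariant] [μ.IsInvInvariant]

/-- Layer-cake consequence of a good-`λ` inequality. -/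
theorem lintegral_rpow_le_of_good_lambda {u W : G → ℝ} (hu : Measurable u) (hW : Measurable W)
    (hW0 : ∀ z, 0 ≤ W z) {K B q : ℝ} (hK : 0 < K) (hB : 0 ≤ B) (hq : 1 < q)
    (H : ∀ τ, 0 < τ → μ {z | K * τ ^ 2 < u z ^ 2} ≤
      ENNReal.ofReal (B / τ ^ 2) * ∫⁻ z in {z | τ ^ 2 / 2 < W z}, ENNReal.ofReal (W z) ∂μ) :
    ∫⁻ z, ENNReal.ofReal ((u z ^ 2 / K) ^ q) ∂μ ≤
      ENNReal.ofReal (q / (q - 1) * B * 2 ^ (q - 1)) * ∫⁻ z, ENNReal.ofReal (W z ^ q) ∂μ := by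
  have hq1 : 0 < q - 1 := by linarith
  set m : Measure G := μ.withDensity fun z => ENNReal.ofReal (W z) with hm
  have h1 := lintegral_rpow_eq_lintegral_meas_lt_mul μ (f := fun z => u z ^ 2 / K)
    (Filter.Eventually.of_forall fun z => by positivity)
    ((hu.pow_const 2).div_const K).aemeasurable (p := q) (by linarith)
  have h2 := lintegral_rpow_eq_lintegral_meas_lt_mul m (f := fun z => 2 * W z)
    (Filter.Eventually.of_forall fun z => by have := hW0 z; positivity)
    (hW.const_mul 2).aemeasurable (p := q - 1) hq1
  have h3 : ∫⁻ z, ENNReal.ofReal ((2 * W z) ^ (q - 1)) ∂m =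
      ENNReal.ofReal (2 ^ (q - 1)) * ∫⁻ z, ENNReal.ofReal (W z ^ q) ∂μ := by
    rw [hm, lintegral_withDensity_eq_lintegral_mul _ hW.ennreal_ofReal
      ((hW.const_mul 2).pow_const _).ennreal_ofReal, ← lintegral_const_mul _
      (hW.pow_const _).ennreal_ofReal]
    refine lintegral_congr fun z => ?_
    simp only [Pi.mul_apply]
    rw [← ENNReal.ofReal_mul (hW0 z), ← ENNReal.ofReal_mul (by positivity)]
    congr 1
    rw [Real.mul_rpow two_pos.le (hW0 z)]
    rcases (hW0 z).eq_or_lt with h | h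
    · rw [← h, Real.zero_rpow (by linarith : q ≠ 0)]; ring
    · rw [Real.rpow_sub h, Real.rpow_one]; field_simp
  have hpt : ∀ t ∈ Set.Ioi (0 : ℝ), μ {z | t < u z ^ 2 / K} * ENNReal.ofReal (t ^ (q - 1)) ≤
      ENNReal.ofReal B * (m {z | t < 2 * W z} * ENNReal.ofReal (t ^ (q - 1 - 1))) := by
    intro t ht
    have ht0 : 0 < t := ht
    have hτ := H (Real.sqrt t) (Real.sqrt_pos.2 ht0)
    rw [Real.sq_sqrt ht0.le] at hτ
    have e1 : {z | t < u z ^ 2 / K} = {z | K * t < u z ^ 2} := by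
      ext z; simp only [Set.mem_ofPred_eq]; rw [lt_div_iff₀ hK, mul_comm]
    have e2 : {z | t / 2 < W z} = {z | t < 2 * W z} := by
      ext z; simp only [Set.mem_ofPred_eq]; rw [div_lt_iff₀ two_pos, mul_comm]
    rw [e2, ← withDensity_apply _ (measurableSet_lt measurable_const (hW.const_mul 2))] at hτ
    rw [e1]
    calc _ ≤ ENNReal.ofReal (B / t) * m {z | t < 2 * W z} * ENNReal.ofReal (t ^ (q - 1)) := by
          gcongr
      _ = (ENNReal.ofReal (B / t) * ENNReal.ofReal (t ^ (q - 1))) * m {z | t < 2 * W z} := by ring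
      _ = (ENNReal.ofReal B * ENNReal.ofReal (t ^ (q - 1 - 1))) * m {z | t < 2 * W z} := by
          rw [← ENNReal.ofReal_mul (by positivity), ← ENNReal.ofReal_mul hB,
            Real.rpow_sub ht0 (q - 1), Real.rpow_one]
          congr 2; field_simp
      _ = _ := by ring
  rw [h1]
  calc _ ≤ ENNReal.ofReal q * ∫⁻ t in Set.Ioi (0 : ℝ),
        ENNReal.ofReal B * (m {z | t < 2 * W z} * ENNReal.ofReal (t ^ (q - 1 - 1))) := by
        gcongr 1
        exact setLIntegral_mono' measurableSet_Ioi hpt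
    _ = ENNReal.ofReal (q / (q - 1) * B) * ∫⁻ z, ENNReal.ofReal ((2 * W z) ^ (q - 1)) ∂m := by
        rw [lintegral_const_mul' _ _ ENNReal.ofReal_ne_top, h2, ← mul_assoc, ← mul_assoc,
          ← ENNReal.ofReal_mul (by linarith), ← ENNReal.ofReal_mul (by positivity)]
        congr 2; field_simp
    _ = _ := by
        rw [h3, ← mul_assoc, ← ENNReal.ofReal_mul (by positivity)]

set_option maxHeartbeats 1000000 in
/-- `Lᵖ`-boundedness, `p ≥ 2`, of sums of dyadic bumps. -/
theorem eLpNorm_sum_bump_le (ν : HomNorm μ) (hD : 1 ≤ ν.D) {A : ℝ} (hA : 0 ≤ A) {p : ℝ}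
    (hp : 2 ≤ p) :
    ∃ C : ℝ, 0 ≤ C ∧ ∀ (F : Finset ℤ) (ψ : ℤ → G → ℝ), (∀ j, IsBump ν A ((2 : ℝ) ^ j) (ψ j)) →
      ∀ f : G → ℝ, IsKer ν f →
        eLpNorm (fun x => ∑ j ∈ F, gconv μ f (ψ j) x) (ENNReal.ofReal p) μ ≤
          ENNReal.ofReal C * eLpNorm f (ENNReal.ofReal p) μ := by
  rcases hp.eq_or_lt with h2 | h2
  · obtain ⟨C, hC, h⟩ := eLpNorm_sum_bump_two_le ν hA
    refine ⟨C, hC, fun F ψ hψ f hf => ?_⟩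
    rw [← h2, show ENNReal.ofReal 2 = 2 by simp]
    exact h F ψ hψ f hf.memLp
  obtain ⟨K, C, hK, hC, H⟩ := good_lambda ν hD hA
  set q : ℝ := p / 2 with hq
  have hq1 : 1 < q := by rw [hq]; linarith
  have hq10 : 0 < q - 1 := by linarith
  have hq0 : 0 < q := by linarith
  set B : ℝ := q / (q - 1) * C * 2 ^ (q - 1) * 2 ^ q with hB
  have hB0 : 0 ≤ B := by positivity
  have hKq : 0 < K ^ q := by have : 0 < K := by linarith
                             positivity
  set δ : ℝ := min 1 (Real.sqrt (2 * (B + 1) * K ^ q)⁻¹) with hδ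
  have hδ0 : 0 < δ := by
    rw [hδ]; exact lt_min one_pos (Real.sqrt_pos.2 (by positivity))
  have hδ1 : δ ≤ 1 := min_le_left _ _
  have hδB : B * δ ^ 2 ≤ (2 * K ^ q)⁻¹ := by
    have h3 : δ ^ 2 ≤ (2 * (B + 1) * K ^ q)⁻¹ := by
      have := pow_le_pow_left₀ hδ0.le (min_le_right 1 (Real.sqrt (2 * (B + 1) * K ^ q)⁻¹)) 2
      rwa [Real.sq_sqrt (by positivity)] at this
    calc B * δ ^ 2 ≤ (B + 1) * (2 * (B + 1) * K ^ q)⁻¹ := by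
          gcongr; linarith
      _ = _ := by field_simp
  set M : ℝ := ((δ ^ 2)⁻¹) ^ q with hM
  have hM0 : 0 ≤ M := by positivity
  refine ⟨M ^ p⁻¹, by positivity, fun F ψ hψ f hf => ?_⟩
  set u : G → ℝ := fun x => ∑ j ∈ F, gconv μ f (ψ j) x with hu
  have huk : IsKer ν u := IsKer.sum F fun j _ => hf.gconv (hψ j).isKer
  set W : G → ℝ := fun z => u z ^ 2 + (δ ^ 2)⁻¹ * f z ^ 2 with hW
  have hWk : IsKer ν W := huk.sq.add (hf.sq.const_mul _)
  have hW0 : ∀ z, 0 ≤ W z := fun z => by rw [hW]; positivity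
  have huq := huk.sq.rpow (fun z => sq_nonneg _) hq0
  have hfq := hf.sq.rpow (fun z => sq_nonneg _) hq0
  have hWq := hWk.rpow hW0 hq0
  have hmain := lintegral_rpow_le_of_good_lambda (μ := μ) huk.meas hWk.meas hW0 (K := K)
    (B := C * δ ^ 2) (by linarith) (by positivity) hq1
    (fun τ hτ => H F ψ hψ f hf τ δ hτ hδ0 hδ1)
  have hdiv : ∀ z, (u z ^ 2 / K) ^ q = (K ^ q)⁻¹ * (u z ^ 2) ^ q := fun z => by
    rw [Real.div_rpow (sq_nonneg _) (by linarith), div_eq_inv_mul]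
  simp only [hdiv] at hmain
  rw [← ofReal_integral_eq_lintegral_ofReal (huq.integrable.const_mul _)
    (Filter.Eventually.of_forall fun z => by positivity),
    ← ofReal_integral_eq_lintegral_ofReal hWq.integrable
    (Filter.Eventually.of_forall fun z => Real.rpow_nonneg (hW0 z) q),
    ← ENNReal.ofReal_mul (by positivity), ENNReal.ofReal_le_ofReal_iff
    (mul_nonneg (by positivity) (integral_nonneg fun z => Real.rpow_nonneg (hW0 z) q)),
    integral_const_mul] at hmain
  set X : ℝ := ∫ z, (u z ^ 2) ^ q ∂μ with hX
  set Y : ℝ := ∫ z, (f z ^ 2) ^ q ∂μ with hY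
  have hX0 : 0 ≤ X := integral_nonneg fun z => by positivity
  have hY0 : 0 ≤ Y := integral_nonneg fun z => by positivity
  have hWXY : ∫ z, W z ^ q ∂μ ≤ 2 ^ q * (X + M * Y) := by
    rw [hX, hY, ← integral_const_mul M, ← integral_add huq.integrable (hfq.integrable.const_mul M),
      ← integral_const_mul]
    refine integral_mono hWq.integrable
      ((huq.integrable.add (hfq.integrable.const_mul M)).const_mul _) fun z => ?_
    refine (add_rpow_le_two_rpow (sq_nonneg _) (by positivity) hq0.le).trans (le_of_eq ?_)
    rw [Real.mul_rpow (by positivity) (sq_nonneg _)]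
  have hfin : X ≤ M * Y := by
    have h3 : (K ^ q)⁻¹ * X ≤ B * δ ^ 2 * (X + M * Y) := by
      refine hmain.trans ?_
      calc _ ≤ q / (q - 1) * (C * δ ^ 2) * 2 ^ (q - 1) * (2 ^ q * (X + M * Y)) := by gcongr
        _ = _ := by rw [hB]; ring
    have h4 : (K ^ q)⁻¹ * X ≤ (2 * K ^ q)⁻¹ * (X + M * Y) := h3.trans (by gcongr)
    have h5 : K ^ q * ((K ^ q)⁻¹ * X) ≤ K ^ q * ((2 * K ^ q)⁻¹ * (X + M * Y)) :=
      mul_le_mul_of_nonneg_left h4 hKq.le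
    have h6 : K ^ q * ((K ^ q)⁻¹ * X) = X := by field_simp
    have h7 : K ^ q * ((2 * K ^ q)⁻¹ * (X + M * Y)) = (X + M * Y) / 2 := by field_simp
    linarith
  rw [huk.eLpNorm_eq (by linarith), hf.eLpNorm_eq (by linarith),
    ← ENNReal.ofReal_mul (by positivity), ← Real.mul_rpow hM0 hY0]
  exact ENNReal.ofReal_le_ofReal (Real.rpow_le_rpow hX0 hfin (by have : 0 < p := by linarith
                                                                 positivity))

end LpBound

/-- A graded unipotent polynomial action of `ℝⁿ` on `ℝ^ι`, with a generating family of
weight-one vectors. -/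
structure Shear (n : ℕ) (ι β : Type) [Fintype ι] [Fintype β] where
  ρ : (Fin n → ℝ) → (ι → ℝ) →L[ℝ] (ι → ℝ)
  zero : ∀ q, ρ 0 q = q
  add : ∀ x y q, ρ (x + y) q = ρ x (ρ y q)
  smooth : ContDiff ℝ (⊤ : ℕ∞) ρ
  w : ι → ℕ
  w_pos : ∀ i, 1 ≤ w i
  dil : ∀ (r : ℝ) x q, ρ (r • x) (fun i => r ^ w i * q i) = fun i => r ^ w i * ρ x q i
  v : β → ι → ℝ
  v_hom : ∀ b (r : ℝ) i, r ^ w i * v b i = r * v b i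
  span : Submodule.span ℝ (Set.range fun p : (Fin n → ℝ) × β => ρ p.1 (v p.2)) = ⊤

/-- The semidirect product `ℝⁿ ⋉ ℝ^ι` attached to a shear action. -/
def Gr {n : ℕ} {ι β : Type} [Fintype ι] [Fintype β] (_ : Shear n ι β) : Type :=
  (Fin n → ℝ) × (ι → ℝ)

namespace Gr

variable {n : ℕ} {ι β : Type} [Fintype ι] [Fintype β] {S : Shear n ι β}

noncomputable instance : NormedAddCommGroup (Gr S) :=
  inferInstanceAs (NormedAddCommGroup ((Fin n → ℝ) × (ι → ℝ)))
noncomputable instance : NormedSpace ℝ (Gr S) :=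
  inferInstanceAs (NormedSpace ℝ ((Fin n → ℝ) × (ι → ℝ)))
instance : FiniteDimensional ℝ (Gr S) :=
  inferInstanceAs (FiniteDimensional ℝ ((Fin n → ℝ) × (ι → ℝ)))
noncomputable instance : MeasureSpace (Gr S) :=
  inferInstanceAs (MeasureSpace ((Fin n → ℝ) × (ι → ℝ)))
instance : BorelSpace (Gr S) :=
  inferInstanceAs (BorelSpace ((Fin n → ℝ) × (ι → ℝ)))
instance : (volume : Measure (Gr S)).IsAddHaarMeasure :=
  Measure.prod.instIsAddHaarMeasure (volume : Measure (Fin n → ℝ)) (volume : Measure (ι → ℝ))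
instance : SecondCountableTopology (Gr S) :=
  inferInstanceAs (SecondCountableTopology ((Fin n → ℝ) × (ι → ℝ)))

theorem cont_rho (S : Shear n ι β) : Continuous S.ρ := S.smooth.continuous

/-- Group law. -/
noncomputable instance : Mul (Gr S) := ⟨fun g h => (g.1 + h.1, g.2 + S.ρ g.1 h.2)⟩
noncomputable instance : One (Gr S) := ⟨((0 : Fin n → ℝ), (0 : ι → ℝ))⟩
noncomputable instance : Inv (Gr S) := ⟨fun g => (-g.1, - S.ρ (-g.1) g.2)⟩

theorem one_eq_zero : (1 : Gr S) = 0 := rfl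

theorem ext' {g h : Gr S} (h1 : g.1 = h.1) (h2 : g.2 = h.2) : g = h := Prod.ext h1 h2

theorem mul_fst (g h : Gr S) : (g * h).1 = g.1 + h.1 := rfl
theorem mul_snd (g h : Gr S) : (g * h).2 = g.2 + S.ρ g.1 h.2 := rfl
theorem inv_fst (g : Gr S) : (g⁻¹).1 = -g.1 := rfl
theorem inv_snd (g : Gr S) : (g⁻¹).2 = - S.ρ (-g.1) g.2 := rfl
theorem one_fst : (1 : Gr S).1 = 0 := rfl
theorem one_snd : (1 : Gr S).2 = 0 := rfl
theorem add_fst (g h : Gr S) : (g + h).1 = g.1 + h.1 := rfl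
theorem add_snd (g h : Gr S) : (g + h).2 = g.2 + h.2 := rfl
theorem smul_fst (r : ℝ) (h : Gr S) : (r • h).1 = r • h.1 := rfl
theorem smul_snd (r : ℝ) (h : Gr S) : (r • h).2 = r • h.2 := rfl

theorem rho_rho_neg (S : Shear n ι β) (x : Fin n → ℝ) (q : ι → ℝ) : S.ρ x (S.ρ (-x) q) = q := by
  rw [← S.add, add_neg_cancel, S.zero]

noncomputable instance : Group (Gr S) := Group.ofLeftAxioms
  (fun a b c => ext' (by simp only [mul_fst, add_assoc])
    (by simp only [mul_fst, mul_snd, S.add, map_add, add_assoc]))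
  (fun a => ext' (by simp only [mul_fst, one_fst, zero_add])
    (by simp only [mul_snd, one_fst, one_snd, S.zero, zero_add]))
  (fun a => ext' (by simp only [mul_fst, inv_fst, one_fst, neg_add_cancel])
    (by simp only [mul_snd, inv_fst, inv_snd, one_snd, neg_add_cancel]))

theorem contDiff_fst : ContDiff ℝ (⊤ : ℕ∞) (fun g : Gr S => g.1) :=
  _root_.contDiff_fst (E := Fin n → ℝ) (F := ι → ℝ)
theorem contDiff_snd : ContDiff ℝ (⊤ : ℕ∞) (fun g : Gr S => g.2) :=
  _root_.contDiff_snd (E := Fin n → ℝ) (F := ι → ℝ)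

theorem contDiff_mk {E : Type*} [NormedAddCommGroup E] [NormedSpace ℝ E]
    {a : E → Fin n → ℝ} {b : E → ι → ℝ} (ha : ContDiff ℝ (⊤ : ℕ∞) a)
    (hb : ContDiff ℝ (⊤ : ℕ∞) b) :
    ContDiff ℝ (⊤ : ℕ∞) (fun e => ((a e, b e) : Gr S)) :=
  ContDiff.prodMk (E := E) (F := Fin n → ℝ) (G := ι → ℝ) ha hb

theorem contDiff_rho {E : Type*} [NormedAddCommGroup E] [NormedSpace ℝ E] (S : Shear n ι β)
    {a : E → Fin n → ℝ} {b : E → ι → ℝ} (ha : ContDiff ℝ (⊤ : ℕ∞) a)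
    (hb : ContDiff ℝ (⊤ : ℕ∞) b) :
    ContDiff ℝ (⊤ : ℕ∞) (fun e => S.ρ (a e) (b e)) :=
  (S.smooth.comp ha).clm_apply hb

theorem contDiff_mul {E : Type*} [NormedAddCommGroup E] [NormedSpace ℝ E]
    {a b : E → Gr S} (ha : ContDiff ℝ (⊤ : ℕ∞) a) (hb : ContDiff ℝ (⊤ : ℕ∞) b) :
    ContDiff ℝ (⊤ : ℕ∞) (fun e => a e * b e) :=
  contDiff_mk ((contDiff_fst.comp ha).add (contDiff_fst.comp hb))
    ((contDiff_snd.comp ha).add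
      (contDiff_rho S (contDiff_fst.comp ha) (contDiff_snd.comp hb)))

theorem contDiff_inv {E : Type*} [NormedAddCommGroup E] [NormedSpace ℝ E]
    {a : E → Gr S} (ha : ContDiff ℝ (⊤ : ℕ∞) a) :
    ContDiff ℝ (⊤ : ℕ∞) (fun e => (a e)⁻¹) :=
  contDiff_mk (contDiff_fst.comp ha).neg
    (contDiff_rho S (contDiff_fst.comp ha).neg (contDiff_snd.comp ha)).neg

instance : ContinuousMul (Gr S) :=
  ⟨(contDiff_mul (E := Gr S × Gr S) _root_.contDiff_fst _root_.contDiff_snd).continuous⟩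
instance : ContinuousInv (Gr S) := ⟨(contDiff_inv contDiff_id).continuous⟩
instance : MeasurableMul₂ (Gr S) := ContinuousMul.measurableMul₂
instance : MeasurableInv (Gr S) := ⟨continuous_inv.measurable⟩

/-- Fibre dilation. -/
noncomputable def dilV (S : Shear n ι β) (r : ℝ) : (ι → ℝ) →ₗ[ℝ] (ι → ℝ) :=
  LinearMap.pi fun i => (r ^ S.w i) • LinearMap.proj i

theorem dilV_apply (r : ℝ) (q : ι → ℝ) : dilV S r q = fun i => r ^ S.w i * q i := by
  ext i; simp [dilV]

theorem det_dilV (r : ℝ) : LinearMap.det (dilV S r) = r ^ ∑ i, S.w i := by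
  classical
  have : dilV S r = Matrix.toLin' (Matrix.diagonal fun i => r ^ S.w i) := by
    ext i j; simp [dilV, Matrix.toLin'_apply, Matrix.mulVec_diagonal]
  rw [this, LinearMap.det_toLin', Matrix.det_diagonal, Finset.prod_pow_eq_pow_sum]

theorem det_rho (S : Shear n ι β) (x : Fin n → ℝ) :
    LinearMap.det (S.ρ x : (ι → ℝ) →ₗ[ℝ] (ι → ℝ)) = 1 := by
  have h0 : ∀ x, LinearMap.det (S.ρ x : (ι → ℝ) →ₗ[ℝ] (ι → ℝ)) ≠ 0 := by
    intro x h
    have : ((S.ρ x : (ι → ℝ) →ₗ[ℝ] (ι → ℝ))) ∘ₗ (S.ρ (-x) : (ι → ℝ) →ₗ[ℝ] (ι → ℝ)) = LinearMap.id := by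
      ext i : 2
      simp [rho_rho_neg]
    have := congrArg LinearMap.det this
    rw [LinearMap.det_comp, h, LinearMap.det_id] at this
    simp at this
  have h2 : (S.ρ ((2 : ℝ) • x) : (ι → ℝ) →ₗ[ℝ] (ι → ℝ))
      = (S.ρ x : (ι → ℝ) →ₗ[ℝ] (ι → ℝ)) ∘ₗ (S.ρ x : (ι → ℝ) →ₗ[ℝ] (ι → ℝ)) := by
    refine LinearMap.ext fun q => ?_
    rw [two_smul]
    simp only [ContinuousLinearMap.coe_coe, LinearMap.comp_apply, S.add]
  have h3 : (S.ρ ((2 : ℝ) • x) : (ι → ℝ) →ₗ[ℝ] (ι → ℝ)) ∘ₗ dilV S 2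
      = dilV S 2 ∘ₗ (S.ρ x : (ι → ℝ) →ₗ[ℝ] (ι → ℝ)) := by
    refine LinearMap.ext fun q => ?_
    simp only [ContinuousLinearMap.coe_coe, LinearMap.comp_apply, dilV_apply, S.dil]
  have e2 := congrArg LinearMap.det h2
  have e3 := congrArg LinearMap.det h3
  rw [LinearMap.det_comp] at e2
  rw [LinearMap.det_comp, LinearMap.det_comp, det_dilV, mul_comm] at e3
  have hp : (2 : ℝ) ^ (∑ i, S.w i) ≠ 0 := by positivity
  have e4 := mul_left_cancel₀ hp e3
  rw [e2] at e4
  exact mul_left_cancel₀ (h0 x) (by rw [e4, mul_one])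

theorem mp_lin {f : (ι → ℝ) →ₗ[ℝ] (ι → ℝ)} (hf : |LinearMap.det f| = 1) :
    Measure.map f (volume : Measure (ι → ℝ)) = volume := by
  have h0 : LinearMap.det f ≠ 0 := by
    intro h; simp [h] at hf
  rw [Measure.map_linearMap_addHaar_eq_smul_addHaar _ h0, abs_inv, hf]; simp

theorem mp_rho (S : Shear n ι β) (x : Fin n → ℝ) :
    Measure.map (S.ρ x) (volume : Measure (ι → ℝ)) = volume :=
  mp_lin (f := (S.ρ x : (ι → ℝ) →ₗ[ℝ] (ι → ℝ))) (by rw [det_rho]; simp)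

theorem mp_skew {f : (Fin n → ℝ) → (Fin n → ℝ)} (hf : MeasurePreserving f volume volume)
    {g : (Fin n → ℝ) → (ι → ℝ) → (ι → ℝ)}
    (hgm : Continuous fun p : (Fin n → ℝ) × (ι → ℝ) => g p.1 p.2)
    (hg : ∀ a, Measure.map (g a) volume = volume) :
    MeasurePreserving (fun p : Gr S => ((f p.1, g p.1 p.2) : Gr S)) volume volume :=
  MeasurePreserving.skew_product hf (g := g) hgm.measurable (Filter.Eventually.of_forall hg)

theorem cont_rho_app (S : Shear n ι β) {X : Type*} [TopologicalSpace X] {a : X → Fin n → ℝ}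
    {b : X → ι → ℝ} (ha : Continuous a) (hb : Continuous b) :
    Continuous fun e => S.ρ (a e) (b e) :=
  ((cont_rho S).comp ha).clm_apply hb

instance : (volume : Measure (Gr S)).IsMulLeftInvariant := ⟨fun g => by
  refine (mp_skew (S := S) (f := fun x => g.1 + x) (g := fun x q => g.2 + S.ρ g.1 q)
    (measurePreserving_add_left _ _) ?_ ?_).map_eq
  · exact continuous_const.add (cont_rho_app S continuous_const continuous_snd)
  · intro a
    have h1 : MeasurePreserving (S.ρ g.1) (volume : Measure (ι → ℝ)) volume :=
      ⟨(S.ρ g.1).continuous.measurable, mp_rho S _⟩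
    exact ((measurePreserving_add_left volume g.2).comp h1).map_eq⟩

instance : (volume : Measure (Gr S)).IsMulRightInvariant := ⟨fun g => by
  refine (mp_skew (S := S) (f := fun x => x + g.1) (g := fun x q => q + S.ρ x g.2)
    (measurePreserving_add_right _ _) ?_ ?_).map_eq
  · exact continuous_snd.add (cont_rho_app S continuous_fst continuous_const)
  · intro a
    exact (measurePreserving_add_right volume _).map_eq⟩

instance : (volume : Measure (Gr S)).IsInvInvariant := ⟨by
  refine (mp_skew (S := S) (f := fun x => - x) (g := fun x q => - S.ρ (-x) q)
    (Measure.measurePreserving_neg _) ?_ ?_).map_eq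
  · exact (cont_rho_app S continuous_fst.neg continuous_snd).neg
  · intro a
    have h1 : MeasurePreserving (S.ρ (-a)) (volume : Measure (ι → ℝ)) volume :=
      ⟨(S.ρ _).continuous.measurable, mp_rho S _⟩
    exact ((Measure.measurePreserving_neg _).comp h1).map_eq⟩

end Gr

namespace Gr

variable {n : ℕ} {ι β : Type} [Fintype ι] [Fintype β] {S : Shear n ι β}

/-- The dilations of the group. -/
noncomputable def dil (S : Shear n ι β) (r : ℝ) : Gr S →ₗ[ℝ] Gr S :=
  LinearMap.prodMap (r • LinearMap.id) (dilV S r)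

theorem dil_fst (r : ℝ) (g : Gr S) : (dil S r g).1 = r • g.1 := rfl
theorem dil_snd (r : ℝ) (g : Gr S) : (dil S r g).2 = fun i => r ^ S.w i * g.2 i := by
  rw [← dilV_apply]; rfl

theorem dil_mul (r : ℝ) (g h : Gr S) : dil S r (g * h) = dil S r g * dil S r h := by
  refine ext' ?_ ?_
  · simp only [mul_fst, dil_fst, smul_add]
  · rw [mul_snd, dil_snd, dil_snd, dil_snd, dil_fst, S.dil, mul_snd]
    ext i; simp [mul_add]

theorem dil_one (r : ℝ) : dil S r (1 : Gr S) = 1 := map_zero _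

theorem dil_inv (r : ℝ) (g : Gr S) : dil S r g⁻¹ = (dil S r g)⁻¹ := by
  rw [eq_inv_iff_mul_eq_one, ← dil_mul, inv_mul_cancel, dil_one]

theorem dil_dil (r s : ℝ) (g : Gr S) : dil S r (dil S s g) = dil S (r * s) g := by
  refine ext' ?_ ?_
  · simp only [dil_fst, smul_smul]
  · simp only [dil_snd]
    ext i; rw [mul_pow, mul_assoc]

theorem dil_id (g : Gr S) : dil S 1 g = g := by
  refine ext' ?_ ?_
  · simp only [dil_fst, one_smul]
  · simp only [dil_snd, one_pow, one_mul]

theorem dil_inv_dil {r : ℝ} (hr : r ≠ 0) (g : Gr S) : dil S r⁻¹ (dil S r g) = g := by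
  rw [dil_dil, inv_mul_cancel₀ hr, dil_id]

theorem dil_dil_inv {r : ℝ} (hr : r ≠ 0) (g : Gr S) : dil S r (dil S r⁻¹ g) = g := by
  rw [dil_dil, mul_inv_cancel₀ hr, dil_id]

/-- The homogeneous dimension. -/
def hdim (S : Shear n ι β) : ℕ := n + ∑ i, S.w i

theorem det_dil (r : ℝ) : LinearMap.det (dil S r) = r ^ hdim S := by
  have : LinearMap.det (dil S r) = LinearMap.det (r • (LinearMap.id : (Fin n → ℝ) →ₗ[ℝ] (Fin n → ℝ)))
    * LinearMap.det (dilV S r) := LinearMap.det_prodMap _ _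
  rw [this, det_dilV, LinearMap.det_smul, LinearMap.det_id, hdim, pow_add]
  simp

theorem contDiff_dil (r : ℝ) : ContDiff ℝ (⊤ : ℕ∞) (dil S r) :=
  (LinearMap.toContinuousLinearMap (dil S r)).contDiff

theorem continuous_dil (r : ℝ) : Continuous (dil S r) := (contDiff_dil r).continuous

theorem volume_dil_preimage {r : ℝ} (hr : 0 < r) (s : Set (Gr S)) :
    volume (dil S r ⁻¹' s) = ENNReal.ofReal ((r ^ hdim S)⁻¹) * volume s := by
  rw [Measure.addHaar_preimage_linearMap _ (by rw [det_dil]; positivity), det_dil,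
    abs_of_pos (by positivity)]

theorem map_dil {r : ℝ} (hr : 0 < r) :
    Measure.map (dil S r) volume = ENNReal.ofReal ((r ^ hdim S)⁻¹) • (volume : Measure (Gr S)) := by
  rw [Measure.map_linearMap_addHaar_eq_smul_addHaar _ (by rw [det_dil]; positivity), det_dil,
    abs_of_pos (by positivity)]

theorem integral_dil {r : ℝ} (hr : 0 < r) (f : Gr S → ℝ) :
    ∫ g, f (dil S r g) = (r ^ hdim S)⁻¹ * ∫ g, f g := by
  have he : MeasurableEmbedding (dil S r : Gr S → Gr S) := by
    refine (Homeomorph.mk (Equiv.mk (dil S r : Gr S → Gr S) (dil S r⁻¹ : Gr S → Gr S) ?_ ?_) ?_ ?_).measurableEmbedding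
    · exact fun g => dil_inv_dil hr.ne' g
    · exact fun g => dil_dil_inv hr.ne' g
    · exact continuous_dil r
    · exact continuous_dil r⁻¹
  rw [← he.integral_map, map_dil hr, integral_smul_measure, ENNReal.toReal_ofReal (by positivity)]
  rfl

/-- Homogeneous gauge before symmetrisation. -/
noncomputable def N0 (g : Gr S) : ℝ := ∑ i, |g.1 i| + ∑ i, |g.2 i| ^ ((S.w i : ℝ)⁻¹)

/-- Symmetric homogeneous gauge. -/
noncomputable def NN (g : Gr S) : ℝ := N0 g + N0 g⁻¹

theorem N0_nonneg (g : Gr S) : 0 ≤ N0 g := by unfold N0; positivity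
theorem N0_le_NN (g : Gr S) : N0 g ≤ NN g := by
  have := N0_nonneg g⁻¹; unfold NN; linarith

theorem continuous_N0 : Continuous (N0 : Gr S → ℝ) := by
  unfold N0
  refine Continuous.add ?_ ?_
  · exact continuous_finsetSum _ fun i _ => ((continuous_apply i).comp contDiff_fst.continuous).abs
  · refine continuous_finsetSum _ fun i _ => Continuous.rpow_const
      ((continuous_apply i).comp contDiff_snd.continuous).abs fun g => Or.inr (by positivity)

theorem continuous_NN : Continuous (NN : Gr S → ℝ) :=
  continuous_N0.add (continuous_N0.comp continuous_inv)

theorem N0_dil {r : ℝ} (hr : 0 ≤ r) (g : Gr S) : N0 (dil S r g) = r * N0 g := by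
  unfold N0
  rw [mul_add, Finset.mul_sum, Finset.mul_sum]
  congr 1
  · refine Finset.sum_congr rfl fun i _ => ?_
    rw [dil_fst]; simp [abs_mul, abs_of_nonneg hr]
  · refine Finset.sum_congr rfl fun i _ => ?_
    have hw : S.w i ≠ 0 := (Nat.one_le_iff_ne_zero.mp (S.w_pos i))
    rw [dil_snd, abs_mul, Real.mul_rpow (abs_nonneg _) (abs_nonneg _), abs_of_nonneg (by positivity),
      Real.pow_rpow_inv_natCast hr hw]

theorem NN_dil {r : ℝ} (hr : 0 ≤ r) (g : Gr S) : NN (dil S r g) = r * NN g := by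
  unfold NN
  rw [← dil_inv, N0_dil hr, N0_dil hr]; ring

theorem N0_zero : N0 (0 : Gr S) = 0 := by
  have := N0_dil (S := S) le_rfl (0 : Gr S)
  rwa [map_zero, zero_mul] at this

theorem abs_fst_le (g : Gr S) (i) : |g.1 i| ≤ N0 g := by
  have h1 : |g.1 i| ≤ ∑ i, |g.1 i| :=
    Finset.single_le_sum (f := fun i => |g.1 i|) (fun i _ => abs_nonneg _) (Finset.mem_univ i)
  have : 0 ≤ ∑ i, |g.2 i| ^ ((S.w i : ℝ)⁻¹) := by positivity
  unfold N0; linarith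

theorem abs_snd_le (g : Gr S) (i) : |g.2 i| ≤ N0 g ^ S.w i := by
  have hw : S.w i ≠ 0 := (Nat.one_le_iff_ne_zero.mp (S.w_pos i))
  have h1 : |g.2 i| ^ ((S.w i : ℝ)⁻¹) ≤ ∑ i, |g.2 i| ^ ((S.w i : ℝ)⁻¹) :=
    Finset.single_le_sum (f := fun i => |g.2 i| ^ ((S.w i : ℝ)⁻¹)) (fun i _ => by positivity)
      (Finset.mem_univ i)
  have h2 : 0 ≤ ∑ i, |g.1 i| := by positivity
  calc |g.2 i| = (|g.2 i| ^ ((S.w i : ℝ)⁻¹)) ^ S.w i :=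
        (Real.rpow_inv_natCast_pow (abs_nonneg _) hw).symm
    _ ≤ _ := pow_le_pow_left₀ (by positivity) (by unfold N0; linarith) _

theorem norm_le_of_N0 {g : Gr S} {R : ℝ} (hR : 1 ≤ R) (h : N0 g ≤ R) :
    ‖g‖ ≤ R ^ (1 + ∑ i, S.w i) := by
  have h0 := N0_nonneg g
  have key : ∀ k, k ≤ 1 + ∑ i, S.w i → R ^ k ≤ R ^ (1 + ∑ i, S.w i) := fun k hk =>
    pow_le_pow_right₀ hR hk
  refine max_le ((pi_norm_le_iff_of_nonneg (by positivity)).2 fun i => ?_)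
    ((pi_norm_le_iff_of_nonneg (by positivity)).2 fun i => ?_)
  · have := key 1 (by lia)
    rw [pow_one] at this
    rw [Real.norm_eq_abs]
    exact ((abs_fst_le g i).trans h).trans this
  · rw [Real.norm_eq_abs]
    refine (abs_snd_le g i).trans ((pow_le_pow_left₀ h0 h _).trans (key _ ?_))
    have := Finset.single_le_sum (f := S.w) (fun i _ => Nat.zero_le _) (Finset.mem_univ i)
    lia

theorem norm_le_NN {g : Gr S} (h : NN g ≤ 1) : ‖g‖ ≤ NN g := by
  have h0 := N0_nonneg g
  have h1 := N0_le_NN g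
  refine max_le ((pi_norm_le_iff_of_nonneg (by linarith)).2 fun i => ?_)
    ((pi_norm_le_iff_of_nonneg (by linarith)).2 fun i => ?_)
  · rw [Real.norm_eq_abs]
    exact (abs_fst_le g i).trans h1
  · rw [Real.norm_eq_abs]
    exact ((abs_snd_le g i).trans (pow_le_of_le_one h0 (h1.trans h)
      (Nat.one_le_iff_ne_zero.mp (S.w_pos i)))).trans h1

theorem NN_zero : NN (0 : Gr S) = 0 := by
  unfold NN
  rw [← one_eq_zero, inv_one, one_eq_zero, N0_zero, add_zero]

theorem NN_inv (g : Gr S) : NN g⁻¹ = NN g := by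
  unfold NN; rw [inv_inv, add_comm]

theorem NN_nonneg (g : Gr S) : 0 ≤ NN g := (N0_nonneg g).trans (N0_le_NN g)

theorem isBounded_NN (R : ℝ) : Bornology.IsBounded {g : Gr S | NN g ≤ R} := by
  refine (Metric.isBounded_closedBall (x := (0 : Gr S)) (r := max R 1 ^ (1 + ∑ i, S.w i))).subset ?_
  intro g hg
  rw [mem_closedBall_zero_iff]
  exact norm_le_of_N0 (le_max_right _ _) ((N0_le_NN g).trans (hg.trans (le_max_left _ _)))

theorem isCompact_NN (R : ℝ) : IsCompact {g : Gr S | NN g ≤ R} :=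
  Metric.isCompact_of_isClosed_isBounded (isClosed_le continuous_NN continuous_const)
    (isBounded_NN R)

theorem eq_zero_of_NN {g : Gr S} (h : NN g = 0) : g = 0 := by
  have := norm_le_NN (g := g) (by linarith)
  rw [h] at this
  exact norm_le_zero_iff.mp this

theorem NN_mul_le (S : Shear n ι β) : ∃ κ, 1 ≤ κ ∧ ∀ g h : Gr S, NN (g * h) ≤ κ * (NN g + NN h) := by
  obtain ⟨C, hC⟩ := (((isCompact_NN (S := S) 1).prod (isCompact_NN (S := S) 1)).image
    (f := fun p : Gr S × Gr S => NN (p.1 * p.2))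
    (continuous_NN.comp continuous_mul)).isBounded.subset_closedBall 0
  refine ⟨max C 1, le_max_right _ _, fun g h => ?_⟩
  set t := NN g + NN h with ht
  have hg := NN_nonneg g
  have hh := NN_nonneg h
  rcases (add_nonneg hg hh).eq_or_lt with h0 | h0
  · have e1 : g = 0 := eq_zero_of_NN (by linarith)
    have e2 : h = 0 := eq_zero_of_NN (by linarith)
    rw [← ht] at h0
    rw [← h0, e1, e2, ← one_eq_zero, one_mul, one_eq_zero, NN_zero]; simp
  · rw [← ht] at h0
    have hp : 0 ≤ t⁻¹ := by positivity
    have hm : t⁻¹ * t = 1 := inv_mul_cancel₀ h0.ne'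
    have a1 : NN (dil S t⁻¹ g) ≤ 1 := by
      rw [NN_dil hp, ← hm]; exact mul_le_mul_of_nonneg_left (by linarith) hp
    have a2 : NN (dil S t⁻¹ h) ≤ 1 := by
      rw [NN_dil hp, ← hm]; exact mul_le_mul_of_nonneg_left (by linarith) hp
    have := hC ⟨(dil S t⁻¹ g, dil S t⁻¹ h), ⟨a1, a2⟩, rfl⟩
    simp only [← dil_mul, NN_dil hp, mem_closedBall_zero_iff, Real.norm_eq_abs] at this
    have h3 := (le_abs_self _).trans this
    rw [inv_mul_le_iff₀ h0] at h3
    calc _ ≤ t * C := h3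
      _ ≤ max C 1 * t := by rw [mul_comm]; exact mul_le_mul_of_nonneg_right (le_max_left _ _) h0.le

theorem volume_NN_lt {r : ℝ} (hr : 0 < r) : volume {g : Gr S | NN g < r}
    = ENNReal.ofReal ((volume {g : Gr S | NN g < 1}).toReal * r ^ hdim S) := by
  have h : {g : Gr S | NN g < r} = dil S r⁻¹ ⁻¹' {g : Gr S | NN g < 1} := by
    ext g
    simp only [Set.mem_preimage, Set.mem_ofPred_eq, NN_dil (inv_nonneg.2 hr.le)]
    rw [inv_mul_lt_iff₀ hr, mul_one]
  have hfin : volume {g : Gr S | NN g < 1} ≠ ∞ :=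
    ((isBounded_NN 1).subset fun g (hg : NN g < 1) => hg.le).measure_lt_top.ne
  rw [h, volume_dil_preimage (inv_pos.2 hr), inv_pow, inv_inv, mul_comm,
    ENNReal.ofReal_mul ENNReal.toReal_nonneg, ENNReal.ofReal_toReal hfin]

/-- The homogeneous norm used on the group. -/
noncomputable def hn (S : Shear n ι β) : HomNorm (volume : Measure (Gr S)) where
  N := NN
  meas := continuous_NN.measurable
  nonneg := NN_nonneg
  inv := NN_inv
  one := by rw [one_eq_zero, NN_zero]
  κ := (NN_mul_le S).choose
  one_le := (NN_mul_le S).choose_spec.1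
  mul_le := (NN_mul_le S).choose_spec.2
  D := hdim S
  c := (volume {g : Gr S | NN g < 1}).toReal
  c_pos := by
    refine ENNReal.toReal_pos ?_ ?_
    · refine (IsOpen.measure_pos _ (isOpen_lt continuous_NN continuous_const) ⟨0, ?_⟩).ne'
      simp [NN_zero]
    · exact ((isBounded_NN 1).subset fun g (hg : NN g < 1) => hg.le).measure_lt_top.ne
  vol := fun r hr => volume_NN_lt hr

end Gr

/-- Smooth compactly supported functions. -/
structure TF {E : Type*} [NormedAddCommGroup E] [NormedSpace ℝ E] (f : E → ℝ) : Prop where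
  sm : ContDiff ℝ (⊤ : ℕ∞) f
  cs : HasCompactSupport f

section Fields

variable {E : Type*} [NormedAddCommGroup E] [NormedSpace ℝ E]

/-- The derivation attached to a vector field. -/
noncomputable def VF (η : E → E) (f : E → ℝ) : E → ℝ := fun g => fderiv ℝ f g (η g)

variable {η ξ : E → E} {f g : E → ℝ}

theorem sm_ne_zero : ((⊤ : ℕ∞) : WithTop ℕ∞) ≠ 0 := by simp

theorem sm_diff (hf : ContDiff ℝ (⊤ : ℕ∞) f) : Differentiable ℝ f := hf.differentiable (by simp)

theorem sm_fderiv {F : Type*} [NormedAddCommGroup F] [NormedSpace ℝ F] {f : E → F}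
    (hf : ContDiff ℝ (⊤ : ℕ∞) f) : ContDiff ℝ (⊤ : ℕ∞) (fderiv ℝ f) :=
  hf.fderiv_right (by simp)

theorem VF_sm (hη : ContDiff ℝ (⊤ : ℕ∞) η) (hf : ContDiff ℝ (⊤ : ℕ∞) f) :
    ContDiff ℝ (⊤ : ℕ∞) (VF η f) := (sm_fderiv hf).clm_apply hη

theorem VF_tsupport : tsupport (VF η f) ⊆ tsupport f := by
  refine (closure_mono ?_).trans (tsupport_fderiv_subset ℝ (f := f))
  intro x hx h
  exact hx (by simp only [VF]; rw [h]; rfl)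

theorem VF_eq_zero {x : E} (hx : x ∉ tsupport f) : VF η f x = 0 := by
  by_contra h
  exact hx (VF_tsupport (subset_tsupport _ h))

theorem VF_TF (hη : ContDiff ℝ (⊤ : ℕ∞) η) (hf : TF f) : TF (VF η f) :=
  ⟨VF_sm hη hf.sm, hf.cs.mono' (subset_tsupport _ |>.trans VF_tsupport)⟩

theorem VF_congr {x : E} (h : f =ᶠ[nhds x] g) : VF η f x = VF η g x := by
  simp only [VF]; rw [h.fderiv_eq]

theorem VF_add (hf : ContDiff ℝ (⊤ : ℕ∞) f) (hg : ContDiff ℝ (⊤ : ℕ∞) g) :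
    VF η (fun x => f x + g x) = fun x => VF η f x + VF η g x := by
  ext x; simp only [VF]
  rw [show (fun x => f x + g x) = f + g from rfl, fderiv_add (sm_diff hf x) (sm_diff hg x)]; rfl

theorem VF_sub (hf : ContDiff ℝ (⊤ : ℕ∞) f) (hg : ContDiff ℝ (⊤ : ℕ∞) g) :
    VF η (fun x => f x - g x) = fun x => VF η f x - VF η g x := by
  ext x; simp only [VF]
  rw [show (fun x => f x - g x) = f - g from rfl, fderiv_sub (sm_diff hf x) (sm_diff hg x)]; rfl

theorem VF_mul (hf : ContDiff ℝ (⊤ : ℕ∞) f) (hg : ContDiff ℝ (⊤ : ℕ∞) g) :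
    VF η (fun x => f x * g x) = fun x => VF η f x * g x + f x * VF η g x := by
  ext x; simp only [VF]
  rw [show (fun x => f x * g x) = f * g from rfl, fderiv_mul (sm_diff hf x) (sm_diff hg x)]
  simp; ring

theorem VF_const_mul (c : ℝ) (hf : ContDiff ℝ (⊤ : ℕ∞) f) :
    VF η (fun x => c * f x) = fun x => c * VF η f x := by
  ext x; simp only [VF]
  rw [fderiv_const_mul (sm_diff hf x)]; rfl

theorem VF_neg : VF η (fun x => - f x) = fun x => - VF η f x := by
  ext x; simp only [VF]
  rw [fderiv_fun_neg]; rfl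

theorem VF_sum {ι : Type*} (s : Finset ι) {F : ι → E → ℝ}
    (hf : ∀ i ∈ s, ContDiff ℝ (⊤ : ℕ∞) (F i)) :
    VF η (fun x => ∑ i ∈ s, F i x) = fun x => ∑ i ∈ s, VF η (F i) x := by
  ext x; simp only [VF]
  rw [fderiv_fun_sum fun i hi => sm_diff (hf i hi) x]
  simp

theorem VF_comm (hη : ContDiff ℝ (⊤ : ℕ∞) η) (hξ : ContDiff ℝ (⊤ : ℕ∞) ξ)
    (h : ∀ x, fderiv ℝ ξ x (η x) = fderiv ℝ η x (ξ x)) (hf : ContDiff ℝ (⊤ : ℕ∞) f) :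
    VF η (VF ξ f) = VF ξ (VF η f) := by
  ext x
  have key : ∀ {ξ η : E → E} (_ : ContDiff ℝ (⊤ : ℕ∞) ξ), VF η (VF ξ f) x
      = fderiv ℝ (fderiv ℝ f) x (η x) (ξ x) + fderiv ℝ f x (fderiv ℝ ξ x (η x)) := by
    intro ξ η hξ
    have h1 : VF ξ f = fun y => (fderiv ℝ f y) (ξ y) := rfl
    rw [VF, h1, fderiv_clm_apply ((sm_fderiv hf).differentiable (by simp) x)
      (hξ.differentiable (by simp) x)]
    simp [add_comm]
  rw [key hξ, key hη, h x]
  congr 1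
  have : IsSymmSndFDerivAt ℝ f x :=
    hf.contDiffAt.isSymmSndFDerivAt (by
      rw [minSmoothness_of_isRCLikeNormedField]; exact WithTop.coe_le_coe.2 (le_top : (2 : ℕ∞) ≤ ⊤))
  exact this.eq _ _

theorem TF.add (hf : TF f) (hg : TF g) : TF (fun x => f x + g x) :=
  ⟨hf.sm.add hg.sm, hf.cs.add hg.cs⟩
theorem TF.neg (hf : TF f) : TF (fun x => - f x) :=
  ⟨hf.sm.neg, hf.cs.neg⟩
theorem TF.sub (hf : TF f) (hg : TF g) : TF (fun x => f x - g x) :=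
  ⟨hf.sm.sub hg.sm, by simpa only [sub_eq_add_neg] using (hf.add hg.neg).cs⟩
theorem TF.mul_left (hf : TF f) (hg : ContDiff ℝ (⊤ : ℕ∞) g) : TF (fun x => g x * f x) :=
  ⟨hg.mul hf.sm, hf.cs.mul_left⟩
theorem TF.mul_right (hf : TF f) (hg : ContDiff ℝ (⊤ : ℕ∞) g) : TF (fun x => f x * g x) :=
  ⟨hf.sm.mul hg, hf.cs.mul_right⟩
theorem TF.const_mul (hf : TF f) (c : ℝ) : TF (fun x => c * f x) :=
  hf.mul_left contDiff_const
theorem TF.zero : TF (fun _ : E => (0 : ℝ)) := ⟨contDiff_const, HasCompactSupport.zero⟩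
theorem TF.sum {ι : Type*} (s : Finset ι) {F : ι → E → ℝ} (hf : ∀ i ∈ s, TF (F i)) :
    TF (fun x => ∑ i ∈ s, F i x) := by
  classical
  induction s using Finset.induction_on with
  | empty => simpa using TF.zero
  | insert a s ha ih =>
    simp only [Finset.sum_insert ha]
    exact (hf a (by simp)).add (ih fun i hi => hf i (by simp [hi]))

theorem TF.continuous (hf : TF f) : Continuous f := hf.sm.continuous

theorem TF.integrable [MeasurableSpace E] [BorelSpace E] {μ : Measure E}
    [IsFiniteMeasureOnCompacts μ] (hf : TF f) : Integrable f μ :=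
  hf.continuous.integrable_of_hasCompactSupport hf.cs

theorem TF.memLp [MeasurableSpace E] [BorelSpace E] {μ : Measure E}
    [IsFiniteMeasureOnCompacts μ] (hf : TF f) (p : ℝ≥0∞) : MemLp f p μ :=
  hf.continuous.memLp_of_hasCompactSupport hf.cs

theorem TF.bdd (hf : TF f) : ∃ C, ∀ x, |f x| ≤ C := hf.cs.exists_bound_of_continuous hf.continuous

/-- Integral of `a ∂_v f` when `a` is constant in direction `v`. -/
theorem integral_mul_fderiv_eq_zero [FiniteDimensional ℝ E] [MeasurableSpace E] [BorelSpace E]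
    {μ : Measure E} [μ.IsAddHaarMeasure] {a : E → ℝ} (ha : ContDiff ℝ (⊤ : ℕ∞) a) (v : E)
    (hav : ∀ x, fderiv ℝ a x v = 0) (hf : TF f) : ∫ x, a x * fderiv ℝ f x v ∂μ = 0 := by
  have hd : TF (fun x => fderiv ℝ f x v) := VF_TF (η := fun _ => v) contDiff_const hf
  rw [integral_mul_fderiv_eq_neg_fderiv_mul_of_integrable (μ := μ)]
  · simp [hav]
  · simp [hav]
  · exact (hd.mul_left ha).integrable
  · exact (hf.mul_left ha).integrable
  · exact fun x _ => sm_diff ha x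
  · exact fun x _ => sm_diff hf.sm x

end Fields

namespace Gr

variable {n : ℕ} {ι β : Type} [Fintype ι] [Fintype β] {S : Shear n ι β}

/-- Left-invariant fields. -/
def fld (v g : Gr S) : Gr S := (v.1, S.ρ g.1 v.2)

theorem fld_fst (v g : Gr S) : (fld v g).1 = v.1 := rfl
theorem fld_snd (v g : Gr S) : (fld v g).2 = S.ρ g.1 v.2 := rfl

theorem fld_sm (v : Gr S) : ContDiff ℝ (⊤ : ℕ∞) (fld v) :=
  contDiff_mk contDiff_const (contDiff_rho S contDiff_fst contDiff_const)

theorem mul_smul_eq (g v : Gr S) (t : ℝ) : g * (t • v) = g + t • fld v g :=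
  ext' rfl (by simp only [mul_snd, smul_snd, add_snd, fld_snd, map_smul])

/-- The basis of weight-one directions. -/
def bv (S : Shear n ι β) : Fin n ⊕ β → Gr S
  | Sum.inl j => ((Pi.single j 1, 0) : (Fin n → ℝ) × (ι → ℝ))
  | Sum.inr b => ((0, S.v b) : (Fin n → ℝ) × (ι → ℝ))

/-- The basic left-invariant fields acting on functions. -/
noncomputable def Xb (S : Shear n ι β) (i : Fin n ⊕ β) : (Gr S → ℝ) → Gr S → ℝ := VF (fld (bv S i))

/-- The sub-Laplacian. -/
noncomputable def L (f : Gr S → ℝ) : Gr S → ℝ := fun g => - ∑ i, Xb S i (Xb S i f) g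

theorem Xb_sm (i) {f : Gr S → ℝ} (hf : ContDiff ℝ (⊤ : ℕ∞) f) : ContDiff ℝ (⊤ : ℕ∞) (Xb S i f) :=
  VF_sm (fld_sm _) hf

theorem Xb_TF (i) {f : Gr S → ℝ} (hf : TF f) : TF (Xb S i f) := VF_TF (fld_sm _) hf

theorem Xb_add (i) {f g : Gr S → ℝ} (hf : ContDiff ℝ (⊤ : ℕ∞) f) (hg : ContDiff ℝ (⊤ : ℕ∞) g) :
    Xb S i (fun x => f x + g x) = fun x => Xb S i f x + Xb S i g x := VF_add hf hg

theorem Xb_const_mul (i) (c : ℝ) {f : Gr S → ℝ} (hf : ContDiff ℝ (⊤ : ℕ∞) f) :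
    Xb S i (fun x => c * f x) = fun x => c * Xb S i f x := VF_const_mul c hf

theorem Xb_mul (i) {f g : Gr S → ℝ} (hf : ContDiff ℝ (⊤ : ℕ∞) f) (hg : ContDiff ℝ (⊤ : ℕ∞) g) :
    Xb S i (fun x => f x * g x) = fun x => Xb S i f x * g x + f x * Xb S i g x := VF_mul hf hg

theorem L_sm {f : Gr S → ℝ} (hf : ContDiff ℝ (⊤ : ℕ∞) f) : ContDiff ℝ (⊤ : ℕ∞) (L f) :=
  (ContDiff.sum fun i _ => Xb_sm i (Xb_sm i hf)).neg

theorem L_TF {f : Gr S → ℝ} (hf : TF f) : TF (L f) :=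
  (TF.sum _ fun i _ => Xb_TF i (Xb_TF i hf)).neg

theorem Lpow_sm (k : ℕ) {f : Gr S → ℝ} (hf : ContDiff ℝ (⊤ : ℕ∞) f) :
    ContDiff ℝ (⊤ : ℕ∞) (L^[k] f) := by
  induction k with
  | zero => exact hf
  | succ k ih => rw [Function.iterate_succ_apply']; exact L_sm ih

theorem Lpow_TF (k : ℕ) {f : Gr S → ℝ} (hf : TF f) : TF (L^[k] f) := by
  induction k with
  | zero => exact hf
  | succ k ih => rw [Function.iterate_succ_apply']; exact L_TF ih

theorem L_tsupport (f : Gr S → ℝ) : tsupport (L f) ⊆ tsupport f := by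
  refine closure_minimal ?_ (isClosed_tsupport f)
  intro x hx
  by_contra h
  refine hx ?_
  simp only [L, neg_eq_zero]
  exact Finset.sum_eq_zero fun i _ => VF_eq_zero fun h' => h (VF_tsupport h')

theorem Lpow_tsupport (k : ℕ) (f : Gr S → ℝ) : tsupport (L^[k] f) ⊆ tsupport f := by
  induction k with
  | zero => exact subset_rfl
  | succ k ih => rw [Function.iterate_succ_apply']; exact (L_tsupport _).trans ih

theorem L_add {f g : Gr S → ℝ} (hf : ContDiff ℝ (⊤ : ℕ∞) f) (hg : ContDiff ℝ (⊤ : ℕ∞) g) :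
    L (fun x => f x + g x) = fun x => L f x + L g x := by
  ext x
  simp only [L, Xb_add _ hf hg, Xb_add _ (Xb_sm _ hf) (Xb_sm _ hg), Finset.sum_add_distrib]
  ring

theorem L_const_mul (c : ℝ) {f : Gr S → ℝ} (hf : ContDiff ℝ (⊤ : ℕ∞) f) :
    L (fun x => c * f x) = fun x => c * L f x := by
  ext x
  have : ∀ i, Xb S i (Xb S i (fun x => c * f x)) x = c * Xb S i (Xb S i f) x := fun i => by
    rw [Xb_const_mul i c hf, Xb_const_mul i c (Xb_sm i hf)]
  simp only [L, this, ← Finset.mul_sum]; ring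

theorem L_sub {f g : Gr S → ℝ} (hf : ContDiff ℝ (⊤ : ℕ∞) f) (hg : ContDiff ℝ (⊤ : ℕ∞) g) :
    L (fun x => f x - g x) = fun x => L f x - L g x := by
  have := L_add hf (g := fun x => -1 * g x) (contDiff_const.mul hg)
  rw [L_const_mul _ hg] at this
  simpa [sub_eq_add_neg] using this

theorem Lpow_sub (k : ℕ) {f g : Gr S → ℝ} (hf : ContDiff ℝ (⊤ : ℕ∞) f)
    (hg : ContDiff ℝ (⊤ : ℕ∞) g) :
    L^[k] (fun x => f x - g x) = fun x => L^[k] f x - L^[k] g x := by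
  induction k with
  | zero => rfl
  | succ k ih =>
    rw [Function.iterate_succ_apply', ih, L_sub (Lpow_sm k hf) (Lpow_sm k hg)]
    simp only [Function.iterate_succ_apply']

theorem Lpow_const_mul (k : ℕ) (c : ℝ) {f : Gr S → ℝ} (hf : ContDiff ℝ (⊤ : ℕ∞) f) :
    L^[k] (fun x => c * f x) = fun x => c * L^[k] f x := by
  induction k with
  | zero => rfl
  | succ k ih =>
    rw [Function.iterate_succ_apply', ih, L_const_mul c (Lpow_sm k hf)]
    simp only [Function.iterate_succ_apply']

theorem L_congr {f g : Gr S → ℝ} {U : Set (Gr S)} (hU : IsOpen U) (h : ∀ x ∈ U, f x = g x) :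
    ∀ x ∈ U, L f x = L g x := by
  intro x hx
  simp only [L]
  congr 1
  refine Finset.sum_congr rfl fun i _ => VF_congr ?_
  filter_upwards [hU.mem_nhds hx] with y hy
  exact VF_congr (by filter_upwards [hU.mem_nhds hy] with z hz using h z hz)

theorem Lpow_congr (k : ℕ) {f g : Gr S → ℝ} {U : Set (Gr S)} (hU : IsOpen U)
    (h : ∀ x ∈ U, f x = g x) : ∀ x ∈ U, L^[k] f x = L^[k] g x := by
  induction k with
  | zero => exact h
  | succ k ih => simp only [Function.iterate_succ_apply']; exact L_congr hU ih

theorem integral_fld_eq_zero (v : Gr S) {f : Gr S → ℝ} (hf : TF f) : ∫ g, VF (fld v) f g = 0 := by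
  classical
  let e : ι → Gr S := fun i => ((0, Pi.single i 1) : (Fin n → ℝ) × (ι → ℝ))
  let u : Gr S := ((v.1, 0) : (Fin n → ℝ) × (ι → ℝ))
  let a : ι → Gr S → ℝ := fun i g => S.ρ g.1 v.2 i
  have ha : ∀ i, ContDiff ℝ (⊤ : ℕ∞) (a i) := fun i =>
    (contDiff_apply ℝ ℝ i).comp (contDiff_rho S contDiff_fst contDiff_const)
  have hdec : ∀ g : Gr S, fld v g = u + ∑ i, a i g • e i := by
    intro g
    have h2 : ∀ s : Finset ι, (∑ i ∈ s, a i g • e i).1 = 0 := by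
      intro s; induction s using Finset.induction_on with
      | empty => rfl
      | insert x s hx ih => rw [Finset.sum_insert hx, add_fst, ih, smul_fst]; simp [e]
    have h3 : ∀ s : Finset ι, (∑ i ∈ s, a i g • e i).2 = ∑ i ∈ s, a i g • Pi.single i (1 : ℝ) := by
      intro s; induction s using Finset.induction_on with
      | empty => rfl
      | insert x s hx ih => rw [Finset.sum_insert hx, add_snd, ih, smul_snd, Finset.sum_insert hx]
    refine ext' ?_ ?_
    · rw [add_fst, h2]; simp [u, fld_fst]
    · rw [add_snd, h3, fld_snd]
      ext i
      simp [u, a, Finset.sum_apply, Pi.single_apply]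
  have hV : ∀ g, VF (fld v) f g = (1 : ℝ) * fderiv ℝ f g u + ∑ i, a i g * fderiv ℝ f g (e i) := by
    intro g
    simp only [VF, hdec, map_add, map_sum, map_smul, smul_eq_mul, one_mul]
  have hder : ∀ i g, fderiv ℝ (a i) g (e i) = 0 := by
    intro i g
    have h1 : a i = (fun x : Fin n → ℝ => S.ρ x v.2 i) ∘ (fun g : Gr S => g.1) := rfl
    have hs : ContDiff ℝ (⊤ : ℕ∞) (fun x : Fin n → ℝ => S.ρ x v.2 i) :=
      (contDiff_apply ℝ ℝ i).comp (contDiff_rho S contDiff_id contDiff_const)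
    rw [h1, fderiv_comp _ (sm_diff hs _) (contDiff_fst.differentiable (by simp) _)]
    have h4 : fderiv ℝ (fun g : Gr S => g.1) g (e i) = 0 := by
      have : fderiv ℝ (fun g : Gr S => g.1) g
        = ContinuousLinearMap.fst ℝ (Fin n → ℝ) (ι → ℝ) :=
        (ContinuousLinearMap.fst ℝ (Fin n → ℝ) (ι → ℝ)).hasFDerivAt.fderiv
      rw [this]; rfl
    simp only [ContinuousLinearMap.comp_apply]
    rw [h4, map_zero]
  simp only [hV]
  have hd : ∀ w : Gr S, TF (fun x => fderiv ℝ f x w) := fun w =>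
    VF_TF (η := fun _ => w) contDiff_const hf
  rw [integral_add, integral_finsetSum]
  · rw [integral_mul_fderiv_eq_zero contDiff_const u (by simp) hf]
    rw [Finset.sum_eq_zero fun i _ => integral_mul_fderiv_eq_zero (ha i) (e i) (hder i) hf, add_zero]
  · exact fun i _ => ((hd _).mul_left (ha i)).integrable
  · exact ((hd _).const_mul 1).integrable
  · exact (TF.sum _ fun i _ => (hd _).mul_left (ha i)).integrable

/-- Integration by parts. -/
theorem integral_Xb_mul (i) {f g : Gr S → ℝ} (hf : ContDiff ℝ (⊤ : ℕ∞) f) (hg : TF g) :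
    ∫ x, Xb S i f x * g x = - ∫ x, f x * Xb S i g x := by
  have h := integral_fld_eq_zero (bv S i) (hg.mul_left hf)
  rw [VF_mul hf hg.sm, integral_add] at h
  · simp only [Xb]; linarith
  · exact (hg.mul_left (Xb_sm i hf)).integrable
  · exact ((Xb_TF i hg).mul_left hf).integrable

theorem integral_L_mul {f g : Gr S → ℝ} (hf : ContDiff ℝ (⊤ : ℕ∞) f) (hg : TF g) :
    ∫ x, L f x * g x = ∑ i, ∫ x, Xb S i f x * Xb S i g x := by
  simp only [L, neg_mul, Finset.sum_mul]
  rw [integral_neg, integral_finsetSum, ← Finset.sum_neg_distrib]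
  · refine Finset.sum_congr rfl fun i _ => ?_
    rw [integral_Xb_mul i (Xb_sm i hf) hg, neg_neg]
  · exact fun i _ => (hg.mul_left (Xb_sm i (Xb_sm i hf))).integrable

theorem integral_L_mul' {f g : Gr S → ℝ} (hf : TF f) (hg : ContDiff ℝ (⊤ : ℕ∞) g) :
    ∫ x, L f x * g x = ∑ i, ∫ x, Xb S i f x * Xb S i g x := by
  simp only [L, neg_mul, Finset.sum_mul]
  rw [integral_neg, integral_finsetSum, ← Finset.sum_neg_distrib]
  · refine Finset.sum_congr rfl fun i _ => ?_
    have := integral_Xb_mul i hg (Xb_TF i hf)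
    simp only [mul_comm (g _)] at this
    rw [← this]
    exact integral_congr_ae (.of_forall fun x => mul_comm _ _)
  · exact fun i _ => ((Xb_TF i (Xb_TF i hf)).mul_right hg).integrable

theorem integral_L_symm {f g : Gr S → ℝ} (hf : ContDiff ℝ (⊤ : ℕ∞) f) (hg : TF g) :
    ∫ x, L f x * g x = ∫ x, f x * L g x := by
  rw [integral_L_mul hf hg]
  have := integral_L_mul' hg hf
  rw [show (fun x => f x * L g x) = fun x => L g x * f x from funext fun x => mul_comm _ _, this]
  exact Finset.sum_congr rfl fun i _ => integral_congr_ae (.of_forall fun x => mul_comm _ _)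

theorem integral_Lpow_symm (k : ℕ) {f g : Gr S → ℝ} (hf : ContDiff ℝ (⊤ : ℕ∞) f) (hg : TF g) :
    ∫ x, L^[k] f x * g x = ∫ x, f x * L^[k] g x := by
  induction k generalizing g with
  | zero => rfl
  | succ k ih =>
    rw [Function.iterate_succ_apply', integral_L_symm (Lpow_sm k hf) hg, ih (L_TF hg)]
    rfl

theorem energy {f : Gr S → ℝ} (hf : TF f) : ∑ i, ∫ x, Xb S i f x ^ 2 = ∫ x, f x * L f x := by
  rw [← integral_L_symm hf.sm hf, integral_L_mul hf.sm hf]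
  simp only [pow_two]

theorem L_mul {f g : Gr S → ℝ} (hf : ContDiff ℝ (⊤ : ℕ∞) f) (hg : ContDiff ℝ (⊤ : ℕ∞) g) :
    L (fun x => f x * g x) = fun x => f x * L g x - 2 * ∑ i, Xb S i f x * Xb S i g x + L f x * g x := by
  ext x
  have : ∀ i, Xb S i (Xb S i (fun x => f x * g x)) x
      = f x * Xb S i (Xb S i g) x + 2 * (Xb S i f x * Xb S i g x) + Xb S i (Xb S i f) x * g x := by
    intro i
    have h1 : Xb S i (fun x => f x * g x) = fun x => Xb S i f x * g x + f x * Xb S i g x :=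
      VF_mul hf hg
    have h2 : Xb S i (fun x => Xb S i f x * g x + f x * Xb S i g x) = _ :=
      VF_add ((Xb_sm i hf).mul hg) (hf.mul (Xb_sm i hg))
    rw [h1, h2, VF_mul (Xb_sm i hf) hg, VF_mul hf (Xb_sm i hg)]
    simp only [Xb]; ring
  simp only [L, this, Finset.sum_add_distrib, ← Finset.mul_sum, ← Finset.sum_mul]
  ring

/-- Left translations commute with left-invariant fields. -/
theorem VF_fld_mul_left (v h : Gr S) {f : Gr S → ℝ} (hf : Differentiable ℝ f) :
    VF (fld v) (fun g => f (h * g)) = fun g => VF (fld v) f (h * g) := by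
  ext g
  have hA : HasFDerivAt (fun g : Gr S => h * g)
      ((ContinuousLinearMap.fst ℝ (Fin n → ℝ) (ι → ℝ)).prod
        ((S.ρ h.1).comp (ContinuousLinearMap.snd ℝ (Fin n → ℝ) (ι → ℝ)))) g := by
    have h1 : HasFDerivAt (fun g : (Fin n → ℝ) × (ι → ℝ) => h.1 + g.1)
      (ContinuousLinearMap.fst ℝ (Fin n → ℝ) (ι → ℝ)) g := hasFDerivAt_fst.const_add _
    have h2 : HasFDerivAt (fun g : (Fin n → ℝ) × (ι → ℝ) => h.2 + S.ρ h.1 g.2)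
      ((S.ρ h.1).comp (ContinuousLinearMap.snd ℝ (Fin n → ℝ) (ι → ℝ))) g :=
      ((S.ρ h.1).hasFDerivAt.comp g hasFDerivAt_snd).const_add _
    exact h1.prodMk h2
  have hc : HasFDerivAt (fun g => f (h * g)) _ g := (hf (h * g)).hasFDerivAt.comp g hA
  simp only [VF]
  rw [hc.fderiv]
  refine congrArg (fderiv ℝ f (h * g)) (ext' rfl ?_)
  rw [fld_snd, mul_fst, S.add]
  rfl

theorem Xb_mul_left (i) (h : Gr S) {f : Gr S → ℝ} (hf : ContDiff ℝ (⊤ : ℕ∞) f) :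
    Xb S i (fun g => f (h * g)) = fun g => Xb S i f (h * g) :=
  VF_fld_mul_left _ h (sm_diff hf)

theorem sm_mul_left (h : Gr S) {f : Gr S → ℝ} (hf : ContDiff ℝ (⊤ : ℕ∞) f) :
    ContDiff ℝ (⊤ : ℕ∞) (fun g => f (h * g)) := hf.comp (contDiff_mul contDiff_const contDiff_id)

theorem TF_mul_left (h : Gr S) {f : Gr S → ℝ} (hf : TF f) : TF (fun g => f (h * g)) :=
  ⟨sm_mul_left h hf.sm, hf.cs.comp_homeomorph (Homeomorph.mulLeft h)⟩

theorem TF_mul_right (h : Gr S) {f : Gr S → ℝ} (hf : TF f) : TF (fun g => f (g * h)) :=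
  ⟨hf.sm.comp (contDiff_mul contDiff_id contDiff_const),
    hf.cs.comp_homeomorph (Homeomorph.mulRight h)⟩

theorem TF_inv {f : Gr S → ℝ} (hf : TF f) : TF (fun g => f g⁻¹) :=
  ⟨hf.sm.comp (contDiff_inv contDiff_id), hf.cs.comp_homeomorph (Homeomorph.inv (Gr S))⟩

theorem L_mul_left (h : Gr S) {f : Gr S → ℝ} (hf : ContDiff ℝ (⊤ : ℕ∞) f) :
    L (fun g => f (h * g)) = fun g => L f (h * g) := by
  ext g
  simp only [L, Xb_mul_left _ h hf, Xb_mul_left _ h (Xb_sm _ hf)]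

theorem Lpow_mul_left (k : ℕ) (h : Gr S) {f : Gr S → ℝ} (hf : ContDiff ℝ (⊤ : ℕ∞) f) :
    L^[k] (fun g => f (h * g)) = fun g => L^[k] f (h * g) := by
  induction k with
  | zero => rfl
  | succ k ih => rw [Function.iterate_succ_apply', ih, L_mul_left h (Lpow_sm k hf)]
                 simp only [Function.iterate_succ_apply']

theorem dil_bv (r : ℝ) (i) : dil S r (bv S i) = r • bv S i := by
  rcases i with j | b
  · refine ext' rfl ?_
    rw [dil_snd, smul_snd]; ext i; simp [bv]
  · refine ext' rfl ?_
    rw [dil_snd, smul_snd]; ext i; simp [bv, S.v_hom]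

theorem Xb_dil (i) (r : ℝ) {f : Gr S → ℝ} (hf : ContDiff ℝ (⊤ : ℕ∞) f) :
    Xb S i (fun g => f (dil S r g)) = fun g => r * Xb S i f (dil S r g) := by
  ext g
  have hA : HasFDerivAt (dil S r) (LinearMap.toContinuousLinearMap (dil S r)) g :=
    (LinearMap.toContinuousLinearMap (dil S r)).hasFDerivAt
  have hc : HasFDerivAt (fun g => f (dil S r g)) _ g := ((sm_diff hf) (dil S r g)).hasFDerivAt.comp g hA
  simp only [VF, Xb]
  rw [hc.fderiv, ContinuousLinearMap.comp_apply, ← smul_eq_mul, ← map_smul]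
  congr 1
  have h1 : dil S r (fld (bv S i) g) = fld (dil S r (bv S i)) (dil S r g) := by
    refine ext' rfl ?_
    rw [dil_snd, fld_snd, fld_snd, dil_snd, dil_fst, S.dil]
  rw [LinearMap.coe_toContinuousLinearMap', h1, dil_bv]
  exact ext' rfl (by simp only [fld_snd, smul_snd, map_smul])

theorem sm_dil (r : ℝ) {f : Gr S → ℝ} (hf : ContDiff ℝ (⊤ : ℕ∞) f) :
    ContDiff ℝ (⊤ : ℕ∞) (fun g => f (dil S r g)) := hf.comp (contDiff_dil r)

theorem L_dil (r : ℝ) {f : Gr S → ℝ} (hf : ContDiff ℝ (⊤ : ℕ∞) f) :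
    L (fun g => f (dil S r g)) = fun g => r ^ 2 * L f (dil S r g) := by
  ext g
  have : ∀ i, Xb S i (Xb S i (fun g => f (dil S r g))) g
      = r ^ 2 * Xb S i (Xb S i f) (dil S r g) := fun i => by
    rw [Xb_dil i r hf, Xb_const_mul i r (sm_dil r (Xb_sm i hf)), Xb_dil i r (Xb_sm i hf)]
    ring
  simp only [L, this, ← Finset.mul_sum]; ring

theorem Lpow_dil (k : ℕ) (r : ℝ) {f : Gr S → ℝ} (hf : ContDiff ℝ (⊤ : ℕ∞) f) :
    L^[k] (fun g => f (dil S r g)) = fun g => r ^ (2 * k) * L^[k] f (dil S r g) := by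
  induction k with
  | zero => simp
  | succ k ih =>
    rw [Function.iterate_succ_apply', ih, L_const_mul _ (sm_dil r (Lpow_sm k hf)),
      L_dil r (Lpow_sm k hf)]
    simp only [Function.iterate_succ_apply']
    ext g; ring

theorem TF_dil {r : ℝ} (hr : r ≠ 0) {f : Gr S → ℝ} (hf : TF f) : TF (fun g => f (dil S r g)) := by
  refine ⟨sm_dil r hf.sm, hf.cs.comp_homeomorph
    (Homeomorph.mk (Equiv.mk (dil S r : Gr S → Gr S) (dil S r⁻¹ : Gr S → Gr S) ?_ ?_) ?_ ?_)⟩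
  · exact fun g => dil_inv_dil hr g
  · exact fun g => dil_dil_inv hr g
  · exact continuous_dil r
  · exact continuous_dil r⁻¹

end Gr

/-- Squared `L²` norm. -/
noncomputable def q2 {E : Type*} [MeasureSpace E] (f : E → ℝ) : ℝ≥0∞ := ∫⁻ x, ‖f x‖ₑ ^ 2

theorem enorm_add_sq_le (a b : ℝ) : ‖a + b‖ₑ ^ 2 ≤ 2 * ‖a‖ₑ ^ 2 + 2 * ‖b‖ₑ ^ 2 := by
  have h : ∀ x : ℝ, ‖x‖ₑ ^ 2 = ENNReal.ofReal (x ^ 2) := fun x => by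
    rw [← ofReal_norm, ← ENNReal.ofReal_pow (norm_nonneg _), Real.norm_eq_abs, sq_abs]
  rw [h, h, h, show (2 : ℝ≥0∞) = ENNReal.ofReal 2 by simp, ← ENNReal.ofReal_mul (by norm_num),
    ← ENNReal.ofReal_mul (by norm_num), ← ENNReal.ofReal_add (by positivity) (by positivity)]
  exact ENNReal.ofReal_le_ofReal (by nlinarith [sq_nonneg (a - b)])

theorem enorm_sq_eq (x : ℝ) : ‖x‖ₑ ^ 2 = ENNReal.ofReal (x ^ 2) := by
  rw [← ofReal_norm, ← ENNReal.ofReal_pow (norm_nonneg _), Real.norm_eq_abs, sq_abs]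

theorem q2_add_le {E : Type*} [MeasureSpace E] {f g : E → ℝ} (hf : Measurable f) :
    q2 (fun x => f x + g x) ≤ 2 * q2 f + 2 * q2 g := by
  unfold q2
  have hm : Measurable fun x => 2 * ‖f x‖ₑ ^ 2 := (hf.enorm.pow_const 2).const_mul 2
  refine (lintegral_mono fun x => enorm_add_sq_le (f x) (g x)).trans ?_
  rw [lintegral_add_left hm, lintegral_const_mul _ (hf.enorm.pow_const 2),
    lintegral_const_mul' _ _ (by simp)]

theorem q2_eq_ofReal {E : Type*} [MeasureSpace E] {f : E → ℝ} (hf : Integrable fun x => f x ^ 2) :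
    q2 f = ENNReal.ofReal (∫ x, f x ^ 2) := by
  unfold q2
  simp only [enorm_sq_eq]
  rw [ofReal_integral_eq_lintegral_ofReal hf (.of_forall fun x => sq_nonneg _)]

/-- Cauchy-Schwarz on the unit interval. -/
theorem lintegral_unit_sq_le {f : ℝ → ℝ≥0∞} (hf : Measurable f) :
    (∫⁻ s in Set.Ioc (0 : ℝ) 1, f s) ^ 2 ≤ ∫⁻ s in Set.Ioc (0 : ℝ) 1, f s ^ 2 := by
  have h := ENNReal.lintegral_mul_le_Lp_mul_Lq (volume.restrict (Set.Ioc (0 : ℝ) 1))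
    Real.HolderConjugate.two_two hf.aemeasurable (aemeasurable_const (b := (1 : ℝ≥0∞)))
  simp only [Pi.mul_apply, mul_one, ENNReal.one_rpow, lintegral_const, Measure.restrict_apply,
    MeasurableSet.univ, Set.univ_inter, Real.volume_Ioc, sub_zero, ENNReal.ofReal_one] at h
  calc _ ≤ ((∫⁻ s in Set.Ioc (0 : ℝ) 1, f s ^ (2 : ℝ)) ^ (1 / 2 : ℝ)) ^ 2 := by gcongr
    _ = ∫⁻ s in Set.Ioc (0 : ℝ) 1, f s ^ 2 := by
      rw [← ENNReal.rpow_natCast, ← ENNReal.rpow_mul]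
      norm_num

namespace Gr

variable {n : ℕ} {ι β : Type} [Fintype ι] [Fintype β] {S : Shear n ι β}

/-- Element of the group from its components. -/
def mk (x : Fin n → ℝ) (q : ι → ℝ) : Gr S := (x, q)

theorem mk_fst (x : Fin n → ℝ) (q : ι → ℝ) : (mk x q : Gr S).1 = x := rfl
theorem mk_snd (x : Fin n → ℝ) (q : ι → ℝ) : (mk x q : Gr S).2 = q := rfl
theorem bv_inl_fst (j) : (bv S (Sum.inl j)).1 = Pi.single j 1 := rfl
theorem bv_inl_snd (j) : (bv S (Sum.inl j)).2 = 0 := rfl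
theorem bv_inr_fst (b) : (bv S (Sum.inr b)).1 = 0 := rfl
theorem bv_inr_snd (b) : (bv S (Sum.inr b)).2 = S.v b := rfl

/-- Sum of the squared norms of the horizontal derivatives. -/
noncomputable def En (u : Gr S → ℝ) : ℝ≥0∞ := ∑ i, q2 (Xb S i u)

theorem hasDerivAt_flow (i) {u : Gr S → ℝ} (hu : ContDiff ℝ (⊤ : ℕ∞) u) (g : Gr S) (s : ℝ) :
    HasDerivAt (fun s : ℝ => u (g * (s • bv S i))) (Xb S i u (g * (s • bv S i))) s := by
  have h1 : ∀ t : ℝ, g * (t • bv S i) = g + t • fld (bv S i) g := fun t => mul_smul_eq _ _ _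
  have h2 : HasDerivAt (fun t : ℝ => g * (t • bv S i)) (fld (bv S i) g) s := by
    rw [show (fun t : ℝ => g * (t • bv S i)) = fun t => g + t • fld (bv S i) g from funext h1]
    simpa using ((hasDerivAt_id s).smul_const (fld (bv S i) g)).const_add g
  have h3 := (sm_diff hu (g * (s • bv S i))).hasFDerivAt.comp_hasDerivAt s h2
  refine h3.congr_deriv ?_
  change fderiv ℝ u _ _ = fderiv ℝ u _ _
  refine congrArg _ (Eq.symm ?_)
  rcases i with j | b
  · exact ext' rfl (by simp [mul_fst, smul_fst, bv_inl_fst, bv_inl_snd, fld_snd])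
  · refine ext' rfl ?_
    simp [mul_fst, smul_fst, bv_inr_fst, bv_inr_snd, fld_snd]

theorem continuous_mul_smul (v : Gr S) : Continuous fun p : Gr S × ℝ => p.1 * (p.2 • v) :=
  continuous_fst.mul (continuous_snd.smul continuous_const)

theorem q2_flow_le (i) (t : ℝ) {u : Gr S → ℝ} (hu : TF u) :
    q2 (fun g => u (g * (t • bv S i)) - u g) ≤ ENNReal.ofReal (t ^ 2) * q2 (Xb S i u) := by
  set F : Gr S × ℝ → ℝ := fun p => t * Xb S i u (p.1 * ((t * p.2) • bv S i)) with hF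
  have hFc : Continuous F := by
    refine continuous_const.mul ((Xb_TF i hu).continuous.comp ?_)
    exact (continuous_mul_smul (bv S i)).comp
      (continuous_fst.prodMk (continuous_const.mul continuous_snd))
  have h1 : ∀ g, u (g * (t • bv S i)) - u g = ∫ s in (0 : ℝ)..1, F (g, s) := by
    intro g
    have hd : ∀ s ∈ Set.uIcc (0 : ℝ) 1, HasDerivAt (fun s : ℝ => u (g * ((t * s) • bv S i))) (F (g, s)) s := by
      intro s _
      have h5 : HasDerivAt (fun s : ℝ => t * s) t s := by
        simpa using (hasDerivAt_id s).const_mul t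
      have := (hasDerivAt_flow i hu.sm g (t * s)).comp s h5
      rw [mul_comm] at this
      exact this
    rw [intervalIntegral.integral_eq_sub_of_hasDerivAt hd
      ((hFc.comp (continuous_const.prodMk continuous_id)).intervalIntegrable _ _)]
    simp [← one_eq_zero]
  have h2 : ∀ g, ‖u (g * (t • bv S i)) - u g‖ₑ ^ 2 ≤ ∫⁻ s in Set.Ioc (0 : ℝ) 1, ‖F (g, s)‖ₑ ^ 2 := by
    intro g
    rw [h1, intervalIntegral.integral_of_le zero_le_one]
    refine (pow_le_pow_left' (enorm_integral_le_lintegral_enorm _) 2).trans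
      (lintegral_unit_sq_le ?_)
    exact (hFc.comp (continuous_const.prodMk continuous_id)).measurable.enorm
  calc q2 (fun g => u (g * (t • bv S i)) - u g)
      ≤ ∫⁻ g, ∫⁻ s in Set.Ioc (0 : ℝ) 1, ‖F (g, s)‖ₑ ^ 2 := lintegral_mono h2
    _ = ∫⁻ s in Set.Ioc (0 : ℝ) 1, ∫⁻ g, ‖F (g, s)‖ₑ ^ 2 :=
        lintegral_lintegral_swap (hFc.measurable.enorm.pow_const 2).aemeasurable
    _ = ∫⁻ s in Set.Ioc (0 : ℝ) 1, ENNReal.ofReal (t ^ 2) * q2 (Xb S i u) := by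
        refine lintegral_congr fun s => ?_
        simp only [hF, enorm_mul, mul_pow]
        rw [lintegral_const_mul' _ _ (by simp), enorm_sq_eq,
          lintegral_mul_right_eq_self (fun g => ‖Xb S i u g‖ₑ ^ 2)]
        rfl
    _ = _ := by simp

/-- A family of right translations is controlled by horizontal derivatives. -/
def Good {I : Type*} (y : I → Gr S) : Prop :=
  ∃ C : ℝ≥0, ∀ i, ∀ u : Gr S → ℝ, TF u → q2 (fun g => u (g * y i) - u g) ≤ C * En u

theorem Good.mul {I : Type*} {y z : I → Gr S} (hy : Good y) (hz : Good z) :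
    Good fun i => y i * z i := by
  obtain ⟨C, hC⟩ := hy
  obtain ⟨C', hC'⟩ := hz
  refine ⟨2 * C' + 2 * C, fun i u hu => ?_⟩
  have h1 : (fun g => u (g * (y i * z i)) - u g)
      = fun g => (u (g * y i * z i) - u (g * y i)) + (u (g * y i) - u g) := by
    ext g; rw [mul_assoc]; ring
  rw [h1]
  have hm : Measurable fun g => u (g * y i * z i) - u (g * y i) :=
    (((TF_mul_right (z i) hu).sub hu).continuous.comp (continuous_id.mul continuous_const)).measurable
  refine (q2_add_le hm).trans ?_
  have h2 : q2 (fun g => u (g * y i * z i) - u (g * y i)) = q2 (fun g => u (g * z i) - u g) :=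
    lintegral_mul_right_eq_self (fun g => ‖u (g * z i) - u g‖ₑ ^ 2) (y i)
  rw [h2]
  push_cast
  rw [add_mul, mul_assoc, mul_assoc]
  gcongr
  · exact hC' i u hu
  · exact hC i u hu

theorem Good.one {I : Type*} : Good fun _ : I => (1 : Gr S) := ⟨0, fun i u hu => by simp [q2]⟩

theorem Good.bv {I : Type*} (i) {t : I → ℝ} {T : ℝ} (ht : ∀ k, |t k| ≤ T) :
    Good fun k => t k • bv S i := by
  refine ⟨Real.toNNReal (T ^ 2), fun k u hu => (q2_flow_le i (t k) hu).trans ?_⟩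
  refine mul_le_mul' (ENNReal.ofReal_le_ofReal ?_)
    (Finset.single_le_sum (f := fun i => q2 (Xb S i u)) (fun _ _ => zero_le) (Finset.mem_univ i))
  rw [← sq_abs]; exact pow_le_pow_left₀ (abs_nonneg _) (ht k) 2

theorem Good.fst {I : Type*} {a : I → Fin n → ℝ} {T : ℝ} (ha : ∀ k, ‖a k‖ ≤ T) :
    Good fun k => (mk (a k) 0 : Gr S) := by
  classical
  have key : ∀ s : Finset (Fin n), Good fun k => (mk (∑ j ∈ s, a k j • Pi.single j 1) 0 : Gr S) := by
    intro s
    induction s using Finset.induction_on with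
    | empty => exact Good.one
    | insert j s hj ih =>
      have := (Good.bv (S := S) (Sum.inl j) (t := fun k => a k j) (T := T)
        fun k => (norm_le_pi_norm (a k) j).trans (ha k)).mul ih
      convert this using 2 with k
      refine ext' ?_ ?_
      · rw [mul_fst, smul_fst]; simp only [mk_fst, bv_inl_fst, Finset.sum_insert hj]
      · rw [mul_snd, smul_snd]; simp [mk, Gr.bv]
  convert key Finset.univ using 3 with k
  ext j; simp [Finset.sum_apply, Pi.single_apply]

theorem Good.rho {I : Type*} (x : Fin n → ℝ) (b : β) {t : I → ℝ} {T : ℝ} (ht : ∀ k, |t k| ≤ T) :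
    Good fun k => (mk 0 (t k • S.ρ x (S.v b)) : Gr S) := by
  have := ((Good.fst (S := S) (I := I) (a := fun _ => x) (T := ‖x‖) fun _ => le_rfl).mul
    (Good.bv (S := S) (Sum.inr b) ht)).mul
    (Good.fst (S := S) (I := I) (a := fun _ => -x) (T := ‖-x‖) fun _ => le_rfl)
  convert this using 2 with k
  refine ext' ?_ ?_
  · simp [mul_fst, smul_fst, mk_fst, bv_inr_fst]
  · simp [mul_fst, mul_snd,
      smul_fst, smul_snd, mk_fst, mk_snd, bv_inr_fst, bv_inr_snd]

theorem mk_mul_mk (p q : ι → ℝ) : (mk 0 p * mk 0 q : Gr S) = mk 0 (p + q) := by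
  refine ext' ?_ ?_
  · simp [mul_fst, mk_fst]
  · simp [mul_snd, mk_fst, mk_snd, S.zero]

theorem Good.snd {I : Type*} {q : I → ι → ℝ} {T : ℝ} (hq : ∀ k, ‖q k‖ ≤ T) :
    Good fun k => (mk 0 (q k) : Gr S) := by
  classical
  have hspan : ∀ i : ι, ∃ c : ((Fin n → ℝ) × β) →₀ ℝ,
      (c.sum fun p a => a • S.ρ p.1 (S.v p.2)) = Pi.single i 1 := fun i =>
    Finsupp.mem_span_range_iff_exists_finsupp.1 (by rw [S.span]; trivial)
  choose c hc using hspan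
  have h1 : ∀ i, ∀ s : Finset ((Fin n → ℝ) × β),
      Good fun k => (mk 0 (∑ p ∈ s, (q k i * c i p) • S.ρ p.1 (S.v p.2)) : Gr S) := by
    intro i s
    induction s using Finset.induction_on with
    | empty => exact Good.one
    | insert p s hp ih =>
      have := (Good.rho (S := S) p.1 p.2 (t := fun k => q k i * c i p) (T := T * |c i p|)
        fun k => by
          rw [abs_mul]
          exact mul_le_mul_of_nonneg_right ((norm_le_pi_norm (q k) i).trans (hq k))
            (abs_nonneg _)).mul ih
      simp only [mk_mul_mk] at this
      simpa only [Finset.sum_insert hp] using this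
  have h2 : ∀ s : Finset ι, Good fun k => (mk 0 (∑ i ∈ s, q k i • Pi.single i 1) : Gr S) := by
    intro s
    induction s using Finset.induction_on with
    | empty => exact Good.one
    | insert i s hi ih =>
      have := (h1 i (c i).support).mul ih
      simp only [mk_mul_mk] at this
      simp only [Finset.sum_insert hi]
      convert this using 5 with k
      rw [← hc i, Finsupp.sum, Finset.smul_sum]
      exact Finset.sum_congr rfl fun p _ => smul_smul _ _ _
  convert h2 Finset.univ using 3 with k
  ext j; simp [Finset.sum_apply, Pi.single_apply]

theorem good_ball (S : Shear n ι β) : ∃ C : ℝ≥0, ∀ y : Gr S, NN y ≤ 1 → ∀ u : Gr S → ℝ, TF u →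
    q2 (fun g => u (g * y) - u g) ≤ C * En u := by
  have h1 := (Good.snd (S := S) (I := {y : Gr S // NN y ≤ 1}) (q := fun y => y.1.2) (T := 1)
    fun y => (le_max_right _ _).trans ((norm_le_NN y.2).trans y.2)).mul
    (Good.fst (S := S) (a := fun y => y.1.1) (T := 1)
    fun y => (le_max_left _ _).trans ((norm_le_NN y.2).trans y.2))
  obtain ⟨C, hC⟩ := h1
  refine ⟨C, fun y hy u hu => ?_⟩
  have := hC ⟨y, hy⟩ u hu
  convert this using 6
  refine ext' ?_ ?_
  · simp [mul_fst, mk_fst]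
  · simp [mul_snd, mk_fst, mk_snd, S.zero]

theorem lintegral_dil {r : ℝ} (hr : 0 < r) {f : Gr S → ℝ≥0∞} (hf : Measurable f) :
    ∫⁻ g, f (dil S r g) = ENNReal.ofReal ((r ^ hdim S)⁻¹) * ∫⁻ g, f g := by
  rw [← lintegral_map hf (continuous_dil r).measurable, map_dil hr, lintegral_smul_measure]; rfl

theorem En_dil {r : ℝ} (hr : 0 < r) {u : Gr S → ℝ} (hu : TF u) :
    En (fun g => u (dil S r g)) = ENNReal.ofReal (r ^ 2) * (ENNReal.ofReal ((r ^ hdim S)⁻¹) * En u) := by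
  unfold En
  rw [Finset.mul_sum, Finset.mul_sum]
  refine Finset.sum_congr rfl fun i _ => ?_
  rw [Xb_dil i r hu.sm]
  unfold q2
  simp only [enorm_mul, mul_pow]
  rw [lintegral_const_mul' _ _ (by simp), enorm_sq_eq,
    lintegral_dil hr ((Xb_TF i hu).continuous.measurable.enorm.pow_const 2)]

/-- Right translations by elements of a ball of radius `t`. -/
theorem translation_le (S : Shear n ι β) : ∃ C : ℝ≥0, ∀ t : ℝ, 0 < t → ∀ y : Gr S, NN y ≤ t →
    ∀ u : Gr S → ℝ, TF u → q2 (fun g => u (g * y) - u g) ≤ C * ENNReal.ofReal (t ^ 2) * En u := by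
  obtain ⟨C, hC⟩ := good_ball S
  refine ⟨C, fun t ht y hy u hu => ?_⟩
  have h1 := hC (dil S t⁻¹ y) (by
    rw [NN_dil (inv_nonneg.2 ht.le)]; rwa [inv_mul_le_iff₀ ht, mul_one]) _ (TF_dil ht.ne' hu)
  simp only [dil_mul, dil_dil_inv ht.ne'] at h1
  have h2 : q2 (fun g => u (dil S t g * y) - u (dil S t g))
      = ENNReal.ofReal ((t ^ hdim S)⁻¹) * q2 (fun g => u (g * y) - u g) :=
    lintegral_dil ht (f := fun g => ‖u (g * y) - u g‖ₑ ^ 2)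
      (((TF_mul_right y hu).sub hu).continuous.measurable.enorm.pow_const 2)
  rw [h2, En_dil ht hu] at h1
  have h0 : ENNReal.ofReal ((t ^ hdim S)⁻¹) ≠ 0 := by
    rw [Ne, ENNReal.ofReal_eq_zero, not_le]; positivity
  rw [← ENNReal.mul_le_mul_iff_right h0 ENNReal.ofReal_ne_top]
  refine h1.trans (le_of_eq ?_)
  ring

end Gr

namespace Gr

variable {n : ℕ} {ι β : Type} [Fintype ι] [Fintype β] {S : Shear n ι β}

open Classical in
/-- Vertical coordinate vector of length `τ`. -/
noncomputable def vt (S : Shear n ι β) (c : ι) (τ : ℝ) : Gr S := mk 0 (Pi.single c τ)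

theorem vt_fst (c : ι) (τ : ℝ) : (vt S c τ).1 = 0 := rfl

theorem vt_mul_fst (c : ι) (τ : ℝ) (g : Gr S) : (vt S c τ * g).1 = g.1 := by
  rw [mul_fst, vt_fst, zero_add]

theorem NN_conj_vt (c : ι) {K : ℕ} (hK : ∀ i, S.w i ≤ K) (R : ℝ) : ∃ C, 1 ≤ C ∧ ∀ r : ℝ, 0 < r → r ≤ 1 →
    ∀ g : Gr S, ‖g.1‖ ≤ R → NN (g⁻¹ * (vt S c (r ^ K))⁻¹ * g) ≤ C * r := by
  classical
  have hc : Continuous fun x : Fin n → ℝ => S.ρ (-x) (Pi.single c (1 : ℝ)) :=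
    cont_rho_app S continuous_neg continuous_const
  obtain ⟨M, hM⟩ := (isCompact_closedBall (0 : Fin n → ℝ) R).exists_bound_of_continuousOn hc.continuousOn
  have hN : Continuous fun q : ι → ℝ => NN (mk 0 q : Gr S) :=
    continuous_NN.comp (continuous_const.prodMk continuous_id)
  obtain ⟨C, hC⟩ := (isCompact_closedBall (0 : ι → ℝ) M).exists_bound_of_continuousOn hN.continuousOn
  refine ⟨max C 1, le_max_right _ _, fun r h0 h1 g hg => ?_⟩
  set e := S.ρ (-g.1) (Pi.single c (1 : ℝ)) with he
  have heM : ‖e‖ ≤ M := hM g.1 (by simpa using hg)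
  have hM0 : 0 ≤ M := (norm_nonneg _).trans heM
  have h2 : g⁻¹ * (vt S c (r ^ K))⁻¹ * g = dil S r (mk 0 (fun i => -(r ^ (K - S.w i) * e i))) := by
    refine ext' ?_ ?_
    · simp [mul_fst, inv_fst, vt_fst, dil_fst, mk_fst]
    · rw [dil_snd, mk_snd, mul_snd, mul_snd, inv_snd, inv_snd, mul_fst, inv_fst, inv_fst, vt_fst]
      rw [neg_zero, add_zero, S.zero, map_neg]
      have h3 : (vt S c (r ^ K)).2 = (r ^ K) • Pi.single c (1 : ℝ) := by
        rw [← Pi.single_smul', smul_eq_mul, mul_one]; rfl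
      rw [h3]
      funext i
      have : r ^ S.w i * r ^ (K - S.w i) = r ^ K := by rw [← pow_add, Nat.add_sub_cancel' (hK i)]
      rw [map_smul, ← he]
      simp only [Pi.add_apply, Pi.neg_apply, Pi.smul_apply, smul_eq_mul]
      linear_combination (e i) * this
  rw [h2, NN_dil h0.le, mul_comm]
  refine mul_le_mul_of_nonneg_right ?_ h0.le
  refine (le_abs_self _).trans ((hC _ ?_).trans (le_max_left _ _))
  rw [mem_closedBall_zero_iff, pi_norm_le_iff_of_nonneg hM0]
  intro i
  rw [norm_neg, norm_mul, Real.norm_of_nonneg (by positivity)]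
  exact (mul_le_of_le_one_left (norm_nonneg _) (pow_le_one₀ h0.le h1)).trans ((norm_le_pi_norm e i).trans heM)

/-- Left translations by vertical elements. -/
theorem left_translation_le (c : ι) {K : ℕ} (hK : ∀ i, S.w i ≤ K) (R : ℝ) : ∃ C : ℝ≥0, ∀ r : ℝ, 0 < r → r ≤ 1 →
    ∀ u : Gr S → ℝ, TF u → (∀ g, R < ‖g.1‖ → u g = 0) →
    q2 (fun g => u (vt S c (r ^ K) * g) - u g) ≤ C * ENNReal.ofReal (r ^ 2) * En u := by
  obtain ⟨A, hA1, hA⟩ := NN_conj_vt (S := S) c hK R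
  obtain ⟨k, hk1, hk⟩ := NN_mul_le S
  obtain ⟨C, hC⟩ := translation_le S
  set B : ℝ := k * (A + 1) with hB
  have hB1 : 1 ≤ B := by nlinarith
  refine ⟨4 * Real.toNNReal (B ^ hdim S * B ^ 2) * C, fun r h0 h1 u hu hs => ?_⟩
  set v := vt S c (r ^ K) with hv
  set F : Gr S → Gr S → ℝ≥0∞ := fun g y => ‖u (g * y) - u g‖ₑ ^ 2 with hF
  have hFm : Measurable (fun p : Gr S × Gr S => F p.1 p.2) :=
    (((hu.continuous.comp continuous_mul).sub (hu.continuous.comp continuous_fst)).measurable.enorm.pow_const 2)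
  have hBm : ∀ t : ℝ, MeasurableSet {z : Gr S | NN z < t} := fun t =>
    (isOpen_lt continuous_NN continuous_const).measurableSet
  have hpt : ∀ g, volume {z : Gr S | NN z < r} * ‖u (v * g) - u g‖ₑ ^ 2
      ≤ 2 * (∫⁻ y in {z : Gr S | NN z < B * r}, F (v * g) y) + 2 * ∫⁻ z in {z : Gr S | NN z < B * r}, F g z := by
    intro g
    by_cases hg : ‖g.1‖ ≤ R
    · have e1 : ∀ z, ‖u (v * g) - u g‖ₑ ^ 2 ≤ 2 * F (v * g) ((g⁻¹ * v⁻¹ * g) * z) + 2 * F g z := by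
        intro z
        have : v * g * (g⁻¹ * v⁻¹ * g * z) = g * z := by group
        simp only [hF, this]
        have h3 := enorm_add_sq_le (u (v * g) - u (g * z)) (u (g * z) - u g)
        rw [sub_add_sub_cancel] at h3
        rwa [← enorm_neg (u (v * g) - u (g * z)), neg_sub] at h3
      rw [mul_comm, ← setLIntegral_const]
      refine (lintegral_mono e1).trans ?_
      have hm2 : Measurable fun z => 2 * F g z :=
        (hFm.comp (measurable_const.prodMk measurable_id)).const_mul 2
      rw [lintegral_add_right _ hm2,
        lintegral_const_mul' _ _ (by simp), lintegral_const_mul' _ _ (by simp)]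
      refine add_le_add (mul_le_mul_right ?_ _) (mul_le_mul_right ?_ _)
      · rw [← lintegral_indicator (hBm _), ← lintegral_indicator (hBm _),
          ← lintegral_mul_left_eq_self ({z : Gr S | NN z < B * r}.indicator _) (g⁻¹ * v⁻¹ * g)]
        refine lintegral_mono fun z => ?_
        by_cases hz : NN z < r
        · rw [Set.indicator_of_mem (by exact hz), Set.indicator_of_mem]
          change NN (_ * z) < B * r
          have h4 := hA r h0 h1 g hg
          have h5 := hk (g⁻¹ * v⁻¹ * g) z
          rw [← hv] at h4
          have : k * (NN (g⁻¹ * v⁻¹ * g) + NN z) < k * (A * r + r) :=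
            mul_lt_mul_of_pos_left (by linarith) (by linarith)
          calc _ ≤ _ := h5
            _ < _ := this
            _ = B * r := by rw [hB]; ring
        · rw [Set.indicator_of_notMem (by exact hz)]; exact zero_le
      · refine lintegral_mono_set ?_
        intro z (hz : NN z < r)
        exact hz.trans_le (le_mul_of_one_le_left h0.le hB1)
    · rw [hs g (not_le.1 hg), hs (v * g) (by rw [hv, vt_mul_fst]; exact not_le.1 hg)]
      simp
  have hsw : ∫⁻ g, ∫⁻ y in {z : Gr S | NN z < B * r}, F g y
      ≤ volume {z : Gr S | NN z < B * r} * (C * ENNReal.ofReal ((B * r) ^ 2) * En u) := by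
    rw [lintegral_lintegral_swap hFm.aemeasurable]
    calc _ ≤ ∫⁻ y in {z : Gr S | NN z < B * r}, (C * ENNReal.ofReal ((B * r) ^ 2) * En u) := by
          refine setLIntegral_mono' (hBm _) fun y hy => ?_
          exact hC (B * r) (by positivity) y (le_of_lt hy) u hu
      _ = _ := by rw [setLIntegral_const, mul_comm]
  have hinn : Measurable fun g => ∫⁻ y in {z : Gr S | NN z < B * r}, F g y := hFm.lintegral_prod_right'
  have htot : volume {z : Gr S | NN z < r} * q2 (fun g => u (v * g) - u g)
      ≤ 4 * (volume {z : Gr S | NN z < B * r} * (C * ENNReal.ofReal ((B * r) ^ 2) * En u)) := by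
    unfold q2
    have hfin : volume {z : Gr S | NN z < r} ≠ ∞ :=
      ((isCompact_NN r).measure_lt_top.trans_le' (measure_mono fun z (hz : NN z < r) => hz.le)).ne
    rw [← lintegral_const_mul' _ _ hfin]
    refine (lintegral_mono hpt).trans ?_
    rw [lintegral_add_right _ (hinn.const_mul 2), lintegral_const_mul' _ _ (by simp),
      lintegral_const_mul' _ _ (by simp),
      lintegral_mul_left_eq_self (fun g => ∫⁻ y in {z : Gr S | NN z < B * r}, F g y) v, ← add_mul]
    calc _ ≤ (2 + 2) * _ := mul_le_mul_right hsw _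
      _ = _ := by norm_num
  have hB0 : 0 < B := by linarith
  clear_value B
  rw [volume_NN_lt h0, volume_NN_lt (by positivity : 0 < B * r)] at htot
  have hm := (hn S).c_pos
  change 0 < (volume {g : Gr S | NN g < 1}).toReal at hm
  set m := (volume {g : Gr S | NN g < 1}).toReal
  have hmr : ENNReal.ofReal (m * r ^ hdim S) ≠ 0 := by
    rw [Ne, ENNReal.ofReal_eq_zero, not_le]; positivity
  rw [← ENNReal.mul_le_mul_iff_right hmr ENNReal.ofReal_ne_top]
  refine htot.trans (le_of_eq ?_)
  clear_value m
  have e1 : m * (B * r) ^ hdim S = (m * r ^ hdim S) * B ^ hdim S := by ring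
  have e2 : ((4 * Real.toNNReal (B ^ hdim S * B ^ 2) * C : ℝ≥0) : ℝ≥0∞)
      = 4 * (ENNReal.ofReal (B ^ hdim S) * ENNReal.ofReal (B ^ 2)) * C := by
    rw [← ENNReal.ofReal_mul (by positivity)]; rfl
  rw [e1, ENNReal.ofReal_mul (by positivity), mul_pow, ENNReal.ofReal_mul (p := B ^ 2) (by positivity), e2]
  ring

end Gr

namespace Gr

variable {n : ℕ} {ι β : Type} [Fintype ι] [Fintype β] {S : Shear n ι β}

/-- Left difference operator. -/
noncomputable def Dl (v : Gr S) : (Gr S → ℝ) →ₗ[ℝ] (Gr S → ℝ) where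
  toFun f := fun g => f (v * g) - f g
  map_add' f g := by funext x; simp only [Pi.add_apply]; ring
  map_smul' c f := by funext x; simp only [Pi.smul_apply, smul_eq_mul, RingHom.id_apply]; ring

theorem Dl_apply (v : Gr S) (f : Gr S → ℝ) (g) : Dl v f g = f (v * g) - f g := rfl

theorem Dlpow_succ (v : Gr S) (k : ℕ) (f : Gr S → ℝ) : (Dl v ^ (k + 1)) f = Dl v ((Dl v ^ k) f) := by
  rw [pow_succ']; rfl

theorem Dl_TF (v : Gr S) {f : Gr S → ℝ} (hf : TF f) : TF (Dl v f) := (TF_mul_left v hf).sub hf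

theorem Dlpow_TF (v : Gr S) (k : ℕ) {f : Gr S → ℝ} (hf : TF f) : TF ((Dl v ^ k) f) := by
  induction k with
  | zero => exact hf
  | succ k ih => rw [Dlpow_succ]; exact Dl_TF v ih

theorem VF_Dl {η : Gr S → Gr S} (v : Gr S)
    (h : ∀ f : Gr S → ℝ, ContDiff ℝ (⊤ : ℕ∞) f → VF η (fun g => f (v * g)) = fun g => VF η f (v * g))
    {f : Gr S → ℝ} (hf : ContDiff ℝ (⊤ : ℕ∞) f) : VF η (Dl v f) = Dl v (VF η f) := by
  have h1 : VF η (fun g => f (v * g) - f g) = _ := VF_sub (η := η) (sm_mul_left v hf) hf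
  rw [h f hf] at h1
  exact h1

theorem Xb_Dlpow (i) (v : Gr S) (k : ℕ) {f : Gr S → ℝ} (hf : TF f) :
    Xb S i ((Dl v ^ k) f) = (Dl v ^ k) (Xb S i f) := by
  induction k with
  | zero => rfl
  | succ k ih =>
    rw [Dlpow_succ, Dlpow_succ, ← ih]
    exact VF_Dl v (fun f hf => Xb_mul_left i v hf) (Dlpow_TF v k hf).sm

theorem L_eq_sum (f : Gr S → ℝ) : L f = - ∑ i, Xb S i (Xb S i f) := by
  funext g; simp [L, Finset.sum_apply]

theorem L_Dlpow (v : Gr S) (k : ℕ) {f : Gr S → ℝ} (hf : TF f) :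
    L ((Dl v ^ k) f) = (Dl v ^ k) (L f) := by
  rw [L_eq_sum, L_eq_sum, map_neg, map_sum]
  congr 1
  refine Finset.sum_congr rfl fun i _ => ?_
  rw [Xb_Dlpow i v k hf, Xb_Dlpow i v k (Xb_TF i hf)]

theorem Dlpow_fst_zero (c : ι) (τ : ℝ) (k : ℕ) {R : ℝ} {f : Gr S → ℝ} (hf : ∀ g, R < ‖g.1‖ → f g = 0) :
    ∀ g, R < ‖g.1‖ → (Dl (vt S c τ) ^ k) f g = 0 := by
  induction k with
  | zero => exact hf
  | succ k ih =>
    intro g hg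
    rw [Dlpow_succ, Dl_apply, ih g hg, ih _ (by rwa [vt_mul_fst]), sub_zero]

/-- Local square norms of the powers of `L`. -/
noncomputable def Qs (Ω : Set (Gr S)) (k : ℕ) (u : Gr S → ℝ) : ℝ :=
  ∑ j ∈ Finset.range (k + 1), ∫ x in Ω, (L^[j] u x) ^ 2

theorem Qs_nonneg (Ω : Set (Gr S)) (k : ℕ) (u : Gr S → ℝ) : 0 ≤ Qs Ω k u :=
  Finset.sum_nonneg fun _ _ => integral_nonneg fun _ => sq_nonneg _

theorem Qs_mono {Ω Ω' : Set (Gr S)} (h : Ω ⊆ Ω') {k k' : ℕ} (hk : k ≤ k') {u : Gr S → ℝ} (hu : TF u) :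
    Qs Ω k u ≤ Qs Ω' k' u := by
  unfold Qs
  refine (Finset.sum_le_sum_of_subset_of_nonneg (Finset.range_mono (by omega))
    fun _ _ _ => integral_nonneg fun _ => sq_nonneg _).trans (Finset.sum_le_sum fun j _ => ?_)
  refine setIntegral_mono_set ?_ (.of_forall fun _ => sq_nonneg _) h.eventuallyLE
  have := Lpow_TF j hu
  simp only [sq]
  exact (this.mul_left this.sm).integrable.integrableOn

theorem Qs_L_le (Ω : Set (Gr S)) (k : ℕ) (u : Gr S → ℝ) : Qs Ω k (L u) ≤ Qs Ω (k + 1) u := by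
  unfold Qs
  rw [Finset.sum_range_succ' _ (k + 1)]
  simp only [Function.iterate_succ, Function.comp]
  have : 0 ≤ ∫ x in Ω, (L^[0] u x) ^ 2 := integral_nonneg fun _ => sq_nonneg _
  linarith

theorem _root_.TF.int_sq {E : Type*} [NormedAddCommGroup E] [NormedSpace ℝ E] [MeasurableSpace E] [BorelSpace E]
    {μ : Measure E} [IsFiniteMeasureOnCompacts μ] {f : E → ℝ} (hf : TF f) :
    Integrable (fun x => f x ^ 2) μ := by
  simp only [sq]; exact (hf.mul_left hf.sm).integrable

theorem integral_mul_le_sq {f g : Gr S → ℝ} (hf : TF f) (hg : TF g) {a : ℝ} (ha : 0 < a) :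
    ∫ x, f x * g x ≤ a * (∫ x, f x ^ 2) + (4 * a)⁻¹ * ∫ x, g x ^ 2 := by
  rw [← integral_const_mul, ← integral_const_mul, ← integral_add (hf.int_sq.const_mul _) (hg.int_sq.const_mul _)]
  refine integral_mono (hg.mul_left hf.sm).integrable ((hf.int_sq.const_mul _).add (hg.int_sq.const_mul _))
    fun x => ?_
  have h : a * f x ^ 2 + (4 * a)⁻¹ * g x ^ 2 - f x * g x = (4 * a)⁻¹ * (2 * a * f x - g x) ^ 2 := by
    field_simp; ring
  have : 0 ≤ (4 * a)⁻¹ * (2 * a * f x - g x) ^ 2 := by positivity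
  change f x * g x ≤ a * f x ^ 2 + (4 * a)⁻¹ * g x ^ 2
  linarith

theorem L_mul' {χ u : Gr S → ℝ} (hχ : ContDiff ℝ (⊤ : ℕ∞) χ) (hu : ContDiff ℝ (⊤ : ℕ∞) u) :
    L (fun g => χ g * u g) = (fun g => χ g * L u g) - (fun g => L χ g * u g)
      - (2 : ℝ) • ∑ i, Xb S i (fun g => Xb S i χ g * u g) := by
  rw [L_mul hχ hu]
  funext g
  have : ∀ i, Xb S i (fun g => Xb S i χ g * u g) g
      = Xb S i (Xb S i χ) g * u g + Xb S i χ g * Xb S i u g := fun i =>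
    congrFun (VF_mul (Xb_sm i hχ) hu) g
  simp only [Pi.sub_apply, Pi.smul_apply, Finset.sum_apply, smul_eq_mul, this,
    Finset.sum_add_distrib, ← Finset.sum_mul]
  have h2 : ∑ i, Xb S i (Xb S i χ) g = - L χ g := by simp [L]
  rw [h2]; ring

theorem left_translation_real (c : ι) {K : ℕ} (hK : ∀ i, S.w i ≤ K) (R : ℝ) : ∃ C : ℝ, 0 ≤ C ∧ ∀ r : ℝ, 0 < r → r ≤ 1 →
    ∀ u : Gr S → ℝ, TF u → (∀ g, R < ‖g.1‖ → u g = 0) →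
    ∫ g, Dl (vt S c (r ^ K)) u g ^ 2 ≤ C * r ^ 2 * ∫ g, u g * L u g := by
  obtain ⟨C, hC⟩ := left_translation_le c hK R
  refine ⟨C, C.2, fun r h0 h1 u hu hs => ?_⟩
  have h : q2 (Dl (vt S c (r ^ K)) u) ≤ C * ENNReal.ofReal (r ^ 2) * En u := hC r h0 h1 u hu hs
  have hE : En u = ENNReal.ofReal (∫ g, u g * L u g) := by
    rw [← energy hu, ENNReal.ofReal_sum_of_nonneg fun i _ => integral_nonneg fun _ => sq_nonneg _]
    exact Finset.sum_congr rfl fun i _ => q2_eq_ofReal (Xb_TF i hu).int_sq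
  have hnn : 0 ≤ ∫ g, u g * L u g := by
    rw [← energy hu]; exact Finset.sum_nonneg fun i _ => integral_nonneg fun _ => sq_nonneg _
  rw [hE, q2_eq_ofReal (Dl_TF _ hu).int_sq, ← ENNReal.ofReal_coe_nnreal,
    ← ENNReal.ofReal_mul C.coe_nonneg, ← ENNReal.ofReal_mul (mul_nonneg C.coe_nonneg (sq_nonneg r))] at h
  exact (ENNReal.ofReal_le_ofReal_iff (mul_nonneg (mul_nonneg C.2 (sq_nonneg r)) hnn)).1 h

theorem energy_step (c : ι) {K : ℕ} (k : ℕ)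
    (ih : ∀ χ : Gr S → ℝ, TF χ → ∀ Ω, MeasurableSet Ω → tsupport χ ⊆ Ω → ∃ C, 0 ≤ C ∧ ∀ u : Gr S → ℝ, TF u →
      ∀ r : ℝ, 0 < r → r ≤ 1 → ∫ g, (Dl (vt S c (r ^ K)) ^ k) (fun g => χ g * u g) g ^ 2 ≤ C * r ^ (2 * k) * Qs Ω k u)
    {χ : Gr S → ℝ} (hχ : TF χ) {Ω : Set (Gr S)} (hΩ : MeasurableSet Ω) (hs : tsupport χ ⊆ Ω) :
    ∃ C, 0 ≤ C ∧ ∀ u : Gr S → ℝ, TF u → ∀ r : ℝ, 0 < r → r ≤ 1 →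
      ∫ g, (Dl (vt S c (r ^ K)) ^ k) (fun g => χ g * u g) g * L ((Dl (vt S c (r ^ K)) ^ k) (fun g => χ g * u g)) g
        ≤ C * r ^ (2 * k) * Qs Ω (k + 1) u := by
  obtain ⟨C0, hC0, h0⟩ := ih χ hχ Ω hΩ hs
  obtain ⟨C1, hC1, h1⟩ := ih (L χ) (L_TF hχ) Ω hΩ ((L_tsupport χ).trans hs)
  have hb := fun b => ih (Xb S b χ) (Xb_TF b hχ) Ω hΩ (VF_tsupport.trans hs)
  choose Cb hCb hb using hb
  refine ⟨2 * (C0 + C0 / 2 + C1 / 2 + 2 * ∑ b, Cb b), by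
    have := Finset.sum_nonneg fun b (_ : b ∈ Finset.univ) => hCb b
    positivity, fun u hu r hr0 hr1 => ?_⟩
  set v := vt S c (r ^ K)
  set f := (Dl v ^ k) (fun g => χ g * u g) with hf
  have hχu : TF (fun g => χ g * u g) := hχ.mul_right hu.sm
  have hfT : TF f := Dlpow_TF v k hχu
  have hLu := L_TF hu
  have hA1T : TF (fun g => χ g * L u g) := hχ.mul_right hLu.sm
  have hA2T : TF (fun g => L χ g * u g) := (L_TF hχ).mul_right hu.sm
  have hBT : ∀ b, TF (fun g => Xb S b χ g * u g) := fun b => (Xb_TF b hχ).mul_right hu.sm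
  have hLf : L f = (Dl v ^ k) (fun g => χ g * L u g) - (Dl v ^ k) (fun g => L χ g * u g)
      - (2 : ℝ) • ∑ b, Xb S b ((Dl v ^ k) (fun g => Xb S b χ g * u g)) := by
    rw [hf, L_Dlpow v k hχu, L_mul' hχ.sm hu.sm, map_sub, map_sub, map_smul, map_sum]
    congr 2
    exact Finset.sum_congr rfl fun b _ => (Xb_Dlpow b v k (hBT b)).symm
  set A1 := (Dl v ^ k) (fun g => χ g * L u g)
  set A2 := (Dl v ^ k) (fun g => L χ g * u g)
  set B := fun b => (Dl v ^ k) (fun g => Xb S b χ g * u g) with hB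
  have tA1 : TF A1 := Dlpow_TF v k hA1T
  have tA2 : TF A2 := Dlpow_TF v k hA2T
  have tB : ∀ b, TF (B b) := fun b => Dlpow_TF v k (hBT b)
  have hsplit : ∫ g, f g * L f g = (∫ g, f g * A1 g) - (∫ g, f g * A2 g) + 2 * ∑ b, ∫ g, Xb S b f g * B b g := by
    have e1 : ∀ g, f g * L f g = f g * A1 g - f g * A2 g - 2 * ∑ b, f g * Xb S b (B b) g := by
      intro g
      rw [hLf]
      simp only [Pi.sub_apply, Pi.smul_apply, Finset.sum_apply, smul_eq_mul, ← Finset.mul_sum]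
      ring
    have i1 : Integrable (fun g => f g * A1 g) := (tA1.mul_left hfT.sm).integrable
    have i2 : Integrable (fun g => f g * A2 g) := (tA2.mul_left hfT.sm).integrable
    have i3 : ∀ b, Integrable (fun g => f g * Xb S b (B b) g) := fun b =>
      ((Xb_TF b (tB b)).mul_left hfT.sm).integrable
    simp only [e1]
    have i12 : Integrable (fun g => f g * A1 g - f g * A2 g) := i1.sub i2
    rw [integral_sub i12 ((integrable_finsetSum _ fun b _ => i3 b).const_mul 2),
      integral_sub i1 i2, integral_const_mul, integral_finsetSum _ fun b _ => i3 b]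
    have e2 : ∀ b, ∫ g, f g * Xb S b (B b) g = - ∫ g, Xb S b f g * B b g := by
      intro b
      rw [integral_Xb_mul b hfT.sm (tB b), neg_neg]
    simp only [e2, Finset.sum_neg_distrib]
    ring
  have en := energy hfT
  have j1 := integral_mul_le_sq hfT tA1 (a := 1 / 2) (by norm_num)
  have j2 := integral_mul_le_sq hfT tA2.neg (a := 1 / 2) (by norm_num)
  have j3 := fun b => integral_mul_le_sq (Xb_TF b hfT) (tB b) (a := 1 / 4) (by norm_num)
  have j4 := Finset.sum_le_sum fun b (_ : b ∈ Finset.univ) => j3 b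
  rw [Finset.sum_add_distrib, ← Finset.mul_sum, ← Finset.mul_sum, en] at j4
  simp only [mul_neg, integral_neg, neg_sq] at j2
  have m0 := Qs_mono (Ω := Ω) subset_rfl (Nat.le_succ k) hu
  have m1 := Qs_L_le Ω k u
  have hr : (0 : ℝ) ≤ r ^ (2 * k) := by positivity
  have k0 : ∫ g, f g ^ 2 ≤ C0 * r ^ (2 * k) * Qs Ω (k + 1) u :=
    (h0 u hu r hr0 hr1).trans (mul_le_mul_of_nonneg_left m0 (by positivity))
  have k1 : ∫ g, A1 g ^ 2 ≤ C0 * r ^ (2 * k) * Qs Ω (k + 1) u :=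
    (h0 _ hLu r hr0 hr1).trans (mul_le_mul_of_nonneg_left m1 (by positivity))
  have k2 : ∫ g, A2 g ^ 2 ≤ C1 * r ^ (2 * k) * Qs Ω (k + 1) u :=
    (h1 _ hu r hr0 hr1).trans (mul_le_mul_of_nonneg_left m0 (by positivity))
  have k3 : ∑ b, ∫ g, B b g ^ 2 ≤ (∑ b, Cb b) * r ^ (2 * k) * Qs Ω (k + 1) u := by
    rw [Finset.sum_mul, Finset.sum_mul]
    exact Finset.sum_le_sum fun b _ => (hb b u hu r hr0 hr1).trans
      (mul_le_mul_of_nonneg_left m0 (mul_nonneg (hCb b) hr))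
  rw [show (4 * (1 / 2 : ℝ))⁻¹ = 1 / 2 by norm_num] at j1 j2
  rw [show (4 * (1 / 4 : ℝ))⁻¹ = 1 by norm_num] at j4
  have : 2 * (C0 + C0 / 2 + C1 / 2 + 2 * ∑ b, Cb b) * r ^ (2 * k) * Qs Ω (k + 1) u
    = 2 * (C0 * r ^ (2 * k) * Qs Ω (k + 1) u) + (C0 * r ^ (2 * k) * Qs Ω (k + 1) u)
     + (C1 * r ^ (2 * k) * Qs Ω (k + 1) u) + 4 * ((∑ b, Cb b) * r ^ (2 * k) * Qs Ω (k + 1) u) := by ring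
  linarith

/-- Iterated vertical differences are controlled by powers of `L`. -/
theorem diff_le (c : ι) {K : ℕ} (hK : ∀ i, S.w i ≤ K) (k : ℕ) :
    ∀ χ : Gr S → ℝ, TF χ → ∀ Ω, MeasurableSet Ω → tsupport χ ⊆ Ω → ∃ C, 0 ≤ C ∧ ∀ u : Gr S → ℝ, TF u →
      ∀ r : ℝ, 0 < r → r ≤ 1 → ∫ g, (Dl (vt S c (r ^ K)) ^ k) (fun g => χ g * u g) g ^ 2 ≤ C * r ^ (2 * k) * Qs Ω k u := by
  induction k with
  | zero =>
    intro χ hχ Ω hΩ hs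
    obtain ⟨M, hM⟩ := hχ.bdd
    refine ⟨M ^ 2, sq_nonneg _, fun u hu r _ _ => ?_⟩
    have e : Qs Ω 0 u = ∫ g in Ω, u g ^ 2 := by simp [Qs]
    simp only [e, mul_zero, pow_zero, mul_one, Module.End.one_apply]
    rw [← integral_indicator hΩ, ← integral_const_mul]
    refine integral_mono (TF.int_sq (hχ.mul_right hu.sm)) ((hu.int_sq.indicator hΩ).const_mul _) fun g => ?_
    by_cases hg : g ∈ Ω
    · simp only [Set.indicator_of_mem hg, mul_pow]
      exact mul_le_mul_of_nonneg_right (sq_le_sq' (abs_le.1 (hM g)).1 (abs_le.1 (hM g)).2) (sq_nonneg _)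
    · have : χ g = 0 := by
        by_contra h
        exact hg (hs (subset_tsupport _ h))
      simp [this, hg]
  | succ k ih =>
    intro χ hχ Ω hΩ hs
    obtain ⟨C, hC, h1⟩ := energy_step c k ih hχ hΩ hs
    obtain ⟨R, hR⟩ := hχ.cs.isCompact.isBounded.exists_norm_le
    obtain ⟨C', hC', h2⟩ := left_translation_real c hK R
    refine ⟨C' * C, mul_nonneg hC' hC, fun u hu r hr0 hr1 => ?_⟩
    have hz : ∀ g : Gr S, R < ‖g.1‖ → χ g * u g = 0 := by
      intro g hg
      have : χ g = 0 := by
        by_contra h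
        exact absurd ((norm_fst_le g).trans (hR g (subset_tsupport _ h))) (not_le.2 hg)
      rw [this, zero_mul]
    rw [Dlpow_succ]
    refine (h2 r hr0 hr1 _ (Dlpow_TF _ k (hχ.mul_right hu.sm)) (Dlpow_fst_zero c _ k hz)).trans ?_
    refine (mul_le_mul_of_nonneg_left (h1 u hu r hr0 hr1) (by positivity)).trans (le_of_eq ?_)
    ring

end Gr

section Marchaud

variable {E : Type*} [NormedAddCommGroup E] [NormedSpace ℝ E]

theorem two_pow_mul_norm_le {T : Module.End ℝ E} (hT : ∀ x, ‖T x‖ ≤ ‖x‖) (j : ℕ) (x : E) :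
    (2 : ℝ) ^ j * ‖x‖ ≤ ‖((1 + T) ^ j) x‖ + j * 2 ^ j * ‖(T - 1) x‖ := by
  have h1 : ∀ y, ‖(1 + T) y‖ ≤ 2 * ‖y‖ := fun y => by
    have : (1 + T) y = y + T y := rfl
    rw [this]
    linarith [norm_add_le y (T y), hT y]
  have h2 : ∀ (j : ℕ) y, ‖((1 + T) ^ j) y‖ ≤ 2 ^ j * ‖y‖ := by
    intro j
    induction j with
    | zero => intro y; simp
    | succ j ih =>
      intro y
      rw [pow_succ', Module.End.mul_apply, pow_succ']
      linarith [h1 (((1 + T) ^ j) y), ih y]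
  induction j with
  | zero => simp
  | succ j ih =>
    have hc : (T - 1) (((1 + T) ^ j) x) = ((1 + T) ^ j) ((T - 1) x) := by
      rw [← Module.End.mul_apply, ← Module.End.mul_apply]
      congr 1
      refine Commute.pow_right ?_ j
      exact ((Commute.one_right _).add_right ((Commute.refl T).sub_left (Commute.one_left T)))
    have h3 : 2 * ‖((1 + T) ^ j) x‖ ≤ ‖((1 + T) ^ (j + 1)) x‖ + ‖(T - 1) (((1 + T) ^ j) x)‖ := by
      rw [pow_succ', Module.End.mul_apply]
      set y := ((1 + T) ^ j) x
      have e : (2 : ℝ) • y = (1 + T) y - (T - 1) y := by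
        simp only [LinearMap.add_apply, LinearMap.sub_apply, Module.End.one_apply, two_smul]; abel
      calc 2 * ‖y‖ = ‖(2 : ℝ) • y‖ := by rw [norm_smul]; norm_num
        _ ≤ _ := by rw [e]; exact norm_sub_le _ _
    rw [hc] at h3
    have h4 := h2 j ((T - 1) x)
    have h5 : (0 : ℝ) ≤ 2 ^ j * ‖(T - 1) x‖ := by positivity
    have h6 : 0 ≤ (j : ℝ) * 2 ^ j * ‖(T - 1) x‖ := by positivity
    push_cast
    have e1 : (2 : ℝ) ^ (j + 1) * ‖x‖ = 2 * (2 ^ j * ‖x‖) := by ring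
    have e2 : ((j : ℝ) + 1) * 2 ^ (j + 1) * ‖(T - 1) x‖
      = 2 * (j * 2 ^ j * ‖(T - 1) x‖) + 2 * (2 ^ j * ‖(T - 1) x‖) := by ring
    linarith

/-- A Marchaud-type inequality: decay of high differences along dyadic scales
controls the first differences. -/
theorem marchaud (k : ℕ) : ∃ C : ℝ, 0 ≤ C ∧ ∀ (T : ℕ → Module.End ℝ E) (_ : ∀ i x, ‖T i x‖ ≤ ‖x‖)
    (_ : ∀ i, T i = T (i + 1) ^ 2) (x : E) (B : ℝ) (_ : 0 ≤ B)
    (_ : ∀ i, ‖((T i - 1) ^ (k + 2)) x‖ ≤ B * (3 / 8) ^ i),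
    ∀ i, ‖(T i - 1) x‖ ≤ C * (1 / 2) ^ i * (B + ‖x‖) := by
  have hrec : ∀ (T : ℕ → Module.End ℝ E) (_ : ∀ i x, ‖T i x‖ ≤ ‖x‖)
    (_ : ∀ i, T i = T (i + 1) ^ 2) (x : E) (k i : ℕ), (2 : ℝ) ^ k * ‖((T (i + 1) - 1) ^ k) x‖
      ≤ ‖((T i - 1) ^ k) x‖ + k * 2 ^ k * ‖((T (i + 1) - 1) ^ (k + 1)) x‖ := by
    intro T hT h2 x k i
    have := two_pow_mul_norm_le (hT (i + 1)) k (((T (i + 1) - 1) ^ k) x)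
    rw [← Module.End.mul_apply, ← Module.End.mul_apply, ← pow_succ'] at this
    convert this using 4
    have hc : Commute (1 + T (i + 1)) (T (i + 1) - 1) :=
      ((Commute.one_left _).add_left ((Commute.refl _).sub_right (Commute.one_right _)))
    rw [← hc.mul_pow, h2 i]
    congr 1
    noncomm_ring
  have hb0 : ∀ (T : ℕ → Module.End ℝ E) (_ : ∀ i x, ‖T i x‖ ≤ ‖x‖) (x : E) (k : ℕ),
      ‖((T 0 - 1) ^ k) x‖ ≤ 2 ^ k * ‖x‖ := by
    intro T hT x k
    induction k with
    | zero => simp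
    | succ k ih =>
      rw [pow_succ', Module.End.mul_apply, pow_succ', LinearMap.sub_apply, Module.End.one_apply]
      have := norm_sub_le (T 0 (((T 0 - 1) ^ k) x)) (((T 0 - 1) ^ k) x)
      linarith [hT 0 (((T 0 - 1) ^ k) x)]
  induction k with
  | zero =>
    refine ⟨8, by norm_num, fun T hT h2 x B hB h i => ?_⟩
    have key : ∀ i, (2 : ℝ) ^ i * ‖(T i - 1) x‖ ≤ 2 * ‖x‖ + 4 * B * (1 - (3 / 4) ^ i) := by
      intro i
      induction i with
      | zero => simpa using hb0 T hT x 1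
      | succ i ih =>
        have h3 := hrec T hT h2 x 1 i
        have h4 := h (i + 1)
        simp only [pow_one, Nat.cast_one, one_mul, zero_add, one_add_one_eq_two] at h3 h4
        have e1 : (2 : ℝ) ^ (i + 1) * ‖(T (i + 1) - 1) x‖ = 2 ^ i * (2 * ‖(T (i + 1) - 1) x‖) := by ring
        have h5 : (2 : ℝ) ^ i * (2 * ‖(T (i + 1) - 1) x‖)
          ≤ 2 ^ i * (‖(T i - 1) x‖ + 2 * (B * (3 / 8) ^ (i + 1))) :=
          mul_le_mul_of_nonneg_left (by linarith) (by positivity)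
        have e2 : (2 : ℝ) ^ i * (2 * (B * (3 / 8) ^ (i + 1))) = B * (3 / 4) ^ (i + 1) := by
          rw [show (3 / 4 : ℝ) = 2 * (3 / 8) by norm_num, mul_pow]; ring
        rw [e1]
        have e3 : B * (3 / 4 : ℝ) ^ (i + 1) = B * (3 / 4) ^ i * (3 / 4) := by ring
        have e4 : 4 * B * (1 - (3 / 4 : ℝ) ^ (i + 1)) = 4 * B - 3 * (B * (3 / 4) ^ i) := by ring
        have h6 : 0 ≤ B * (3 / 4 : ℝ) ^ i := by positivity
        nlinarith
    have h3 := key i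
    have h4 : 0 ≤ B * (3 / 4 : ℝ) ^ i := by positivity
    have e : 8 * (1 / 2 : ℝ) ^ i * (B + ‖x‖) = (1 / 2) ^ i * (8 * (B + ‖x‖)) := by ring
    have h5 : ‖(T i - 1) x‖ = (1 / 2) ^ i * (2 ^ i * ‖(T i - 1) x‖) := by
      rw [← mul_assoc, ← mul_pow]; norm_num
    rw [e, h5]
    refine mul_le_mul_of_nonneg_left ?_ (by positivity)
    linarith [norm_nonneg x]
  | succ k ih =>
    obtain ⟨C, hC, ih⟩ := ih
    set a : ℝ := 2 ^ (k + 2) + 3 * (k + 2) with ha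
    have ha0 : 0 ≤ a := by positivity
    refine ⟨C * (a + 1), by positivity, fun T hT h2 x B hB h i => ?_⟩
    have key : ∀ i, ‖((T i - 1) ^ (k + 2)) x‖ ≤ a * (B + ‖x‖) * (3 / 8) ^ i := by
      intro i
      induction i with
      | zero =>
        refine (hb0 T hT x (k + 2)).trans ?_
        rw [pow_zero, mul_one]
        refine mul_le_mul ?_ (by linarith [norm_nonneg x]) (norm_nonneg _) ha0
        rw [ha]; have : (0 : ℝ) ≤ 3 * (k + 2) := by positivity
        linarith
      | succ i ihi =>
        have h3 := hrec T hT h2 x (k + 2) i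
        have h4 := h (i + 1)
        push_cast at h3
        have p : (0 : ℝ) < 2 ^ (k + 2) := by positivity
        have h5 : (2 : ℝ) ^ (k + 2) * ‖((T (i + 1) - 1) ^ (k + 2)) x‖ ≤ 2 ^ (k + 2) * (a * (B + ‖x‖) * (3 / 8) ^ i / 4
            + (k + 2) * (B * (3 / 8) ^ (i + 1))) := by
          have p4 : (4 : ℝ) ≤ 2 ^ (k + 2) := by
            rw [pow_add]; have : (1 : ℝ) ≤ 2 ^ k := one_le_pow₀ (by norm_num)
            linarith
          have q : 0 ≤ a * (B + ‖x‖) * (3 / 8) ^ i := by positivity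
          have h6 : ((k : ℝ) + 2) * 2 ^ (k + 2) * ‖((T (i + 1) - 1) ^ (k + 2 + 1)) x‖
            ≤ ((k : ℝ) + 2) * 2 ^ (k + 2) * (B * (3 / 8) ^ (i + 1)) :=
            mul_le_mul_of_nonneg_left h4 (by positivity)
          have h7 : a * (B + ‖x‖) * (3 / 8) ^ i ≤ 2 ^ (k + 2) * (a * (B + ‖x‖) * (3 / 8) ^ i / 4) := by
            have := mul_le_mul_of_nonneg_right p4 q
            linarith
          rw [mul_add]
          refine (h3.trans (add_le_add (ihi.trans h7) h6)).trans (le_of_eq ?_)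
          ring
        have h8 := le_of_mul_le_mul_left h5 p
        refine h8.trans ?_
        have q : 0 ≤ (3 / 8 : ℝ) ^ (i + 1) := by positivity
        have h9 : ((k : ℝ) + 2) * B ≤ a * (B + ‖x‖) / 3 := by
          have n1 : 3 * ((k : ℝ) + 2) ≤ a := by rw [ha]; linarith
          have := mul_le_mul n1 (show B ≤ B + ‖x‖ by linarith [norm_nonneg x]) hB ha0
          linarith
        have h10 := mul_le_mul_of_nonneg_right h9 q
        have e1 : a * (B + ‖x‖) * (3 / 8) ^ i / 4 = (2 / 3) * (a * (B + ‖x‖) * (3 / 8) ^ (i + 1)) := by ring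
        rw [e1]
        linarith
    have hx := norm_nonneg x
    refine (ih T hT h2 x (a * (B + ‖x‖)) (by positivity) key i).trans ?_
    have : C * (a + 1) * (1 / 2 : ℝ) ^ i * (B + ‖x‖) = C * (1 / 2) ^ i * (a * (B + ‖x‖) + (B + ‖x‖)) := by ring
    rw [this]
    refine mul_le_mul_of_nonneg_left (by linarith) (by positivity)

end Marchaud

namespace Gr

variable {n : ℕ} {ι β : Type} [Fintype ι] [Fintype β] {S : Shear n ι β}

open Classical in
theorem vt_mul (c : ι) (τ : ℝ) (g : Gr S) : vt S c τ * g = g + τ • vt S c 1 := by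
  refine Gr.ext' ?_ ?_
  · rw [vt_mul_fst, add_fst, smul_fst, vt_fst, smul_zero, add_zero]
  · rw [mul_snd, add_snd, smul_snd, vt_fst, S.zero, vt, vt, mk_snd, mk_snd, add_comm,
      ← Pi.single_smul, smul_eq_mul, mul_one]

open Classical in
theorem vt_mul_vt (c : ι) (τ : ℝ) : vt S c τ * vt S c τ = vt S c (2 * τ) := by
  rw [vt, mk_mul_mk, ← Pi.single_add, vt, two_mul]

/-- Translation operators on `L²`. -/
noncomputable def TL2 (v : Gr S) : Module.End ℝ (Lp ℝ 2 (volume : Measure (Gr S))) :=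
  (Lp.compMeasurePreservingₗᵢ ℝ (fun g => v * g) (measurePreserving_mul_left volume v)).toLinearMap

theorem TL2_norm (v : Gr S) (f) : ‖TL2 v f‖ = ‖f‖ :=
  (Lp.compMeasurePreservingₗᵢ ℝ (fun g => v * g) (measurePreserving_mul_left volume v)).norm_map f

theorem TL2_sub_one (v : Gr S) {f : Gr S → ℝ} (hf : TF f) :
    (TL2 v - 1) ((hf.memLp (p := 2) (μ := volume)).toLp f)
      = ((Dl_TF v hf).memLp (p := 2) (μ := volume)).toLp (Dl v f) := by
  have h1 : TL2 v ((hf.memLp (p := 2) (μ := volume)).toLp f)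
    = ((TF_mul_left v hf).memLp (p := 2) (μ := volume)).toLp (fun g => f (v * g)) :=
    Lp.toLp_compMeasurePreserving _ _
  rw [LinearMap.sub_apply, Module.End.one_apply, h1]
  exact (MemLp.toLp_sub ((TF_mul_left v hf).memLp 2) (hf.memLp 2)).symm

theorem TL2_sub_one_pow (v : Gr S) (k : ℕ) {f : Gr S → ℝ} (hf : TF f) :
    ((TL2 v - 1) ^ k) ((hf.memLp (p := 2) (μ := volume)).toLp f)
      = ((Dlpow_TF v k hf).memLp (p := 2) (μ := volume)).toLp ((Dl v ^ k) f) := by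
  induction k with
  | zero => rfl
  | succ k ih =>
    rw [pow_succ', Module.End.mul_apply, ih, TL2_sub_one v (Dlpow_TF v k hf)]
    congr 1
    rw [Dlpow_succ]

theorem TL2_sq (v : Gr S) : TL2 (v * v) = TL2 v ^ 2 := by
  refine LinearMap.ext fun f => ?_
  rw [sq, Module.End.mul_apply]
  refine Lp.ext ?_
  have h1 := Lp.coeFn_compMeasurePreserving f (measurePreserving_mul_left volume (v * v))
  have h2 := Lp.coeFn_compMeasurePreserving (TL2 v f) (measurePreserving_mul_left volume v)
  have h3 := (measurePreserving_mul_left volume v).quasiMeasurePreserving.ae_eq_comp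
    (Lp.coeFn_compMeasurePreserving f (measurePreserving_mul_left volume v))
  refine h1.trans ((Filter.EventuallyEq.trans ?_ h3.symm).trans h2.symm)
  refine .of_forall fun g => ?_
  simp [Function.comp, mul_assoc]

theorem norm_toLp_sq {f : Gr S → ℝ} (hf : TF f) :
    ‖(hf.memLp (p := 2) (μ := volume)).toLp f‖ ^ 2 = ∫ g, f g ^ 2 := by
  rw [Lp.norm_toLp, eLpNorm_two_sq (hf.memLp 2), ENNReal.toReal_ofReal (Real.sqrt_nonneg _),
    Real.sq_sqrt (integral_nonneg fun _ => sq_nonneg _)]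

/-- Vertical derivatives are controlled by powers of `L`. -/
theorem vertical_le (c : ι) {χ : Gr S → ℝ} (hχ : TF χ) {Ω : Set (Gr S)} (hΩ : MeasurableSet Ω)
    (hs : tsupport χ ⊆ Ω) : ∃ C k, 0 ≤ C ∧ ∀ u : Gr S → ℝ, TF u →
      ∫ g, (VF (fun _ => vt S c 1) (fun g => χ g * u g) g) ^ 2 ≤ C * Qs Ω k u := by
  obtain ⟨K, hK⟩ : ∃ K, ∀ i, S.w i ≤ K + 1 :=
    ⟨∑ i, S.w i, fun i => (Finset.single_le_sum (fun _ _ => Nat.zero_le _) (Finset.mem_univ i)).trans (Nat.le_succ _)⟩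
  obtain ⟨C0, hC0, h0⟩ := diff_le c hK 0 χ hχ Ω hΩ hs
  obtain ⟨C1, hC1, h1⟩ := diff_le c hK (2 * K + 2) χ hχ Ω hΩ hs
  obtain ⟨C, hC, hM⟩ := marchaud (E := Lp ℝ 2 (volume : Measure (Gr S))) (2 * K)
  refine ⟨2 * C ^ 2 * (C0 + C1), 2 * K + 2, by positivity, fun u hu => ?_⟩
  set f := fun g => χ g * u g
  have hf : TF f := hχ.mul_right hu.sm
  set Q := Qs Ω (2 * K + 2) u
  have hQ : 0 ≤ Q := Qs_nonneg _ _ _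
  set x := (hf.memLp (p := 2) (μ := volume)).toLp f
  have hx : ‖x‖ ^ 2 ≤ C0 * Q := by
    rw [norm_toLp_sq hf]
    refine (h0 u hu 1 one_pos le_rfl).trans ?_
    rw [one_pow, mul_one]
    exact mul_le_mul_of_nonneg_left (Qs_mono subset_rfl (Nat.zero_le _) hu) hC0
  have hB : ∀ i : ℕ, ‖((TL2 (vt S c ((1 / 2) ^ i)) - 1) ^ (2 * K + 2)) x‖ ≤ Real.sqrt (C1 * Q) * (3 / 8) ^ i := by
    intro i
    rw [TL2_sub_one_pow _ _ hf]
    set r : ℝ := (1 / 2) ^ ((i : ℝ) / (K + 1))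
    have hr : r ^ (K + 1) = (1 / 2) ^ i := by
      rw [← Real.rpow_natCast, ← Real.rpow_mul (by norm_num), ← Real.rpow_natCast]
      congr 1; push_cast; field_simp
    have hr0 : 0 < r := Real.rpow_pos_of_pos (by norm_num) _
    have hr1 : r ≤ 1 := Real.rpow_le_one (by norm_num) (by norm_num) (by positivity)
    have h3 := h1 u hu r hr0 hr1
    rw [hr, ← norm_toLp_sq (Dlpow_TF _ _ hf)] at h3
    refine le_of_sq_le_sq ?_ (by positivity)
    refine h3.trans ?_
    rw [mul_pow, Real.sq_sqrt (by positivity)]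
    have e : r ^ (2 * (2 * K + 2)) = (r ^ (K + 1)) ^ 4 := by ring
    rw [e, hr]
    have : ((1 / 2 : ℝ) ^ i) ^ 4 ≤ ((3 / 8) ^ i) ^ 2 := by
      rw [← pow_mul, ← pow_mul, mul_comm, mul_comm i, pow_mul, pow_mul]
      exact pow_le_pow_left₀ (by norm_num) (by norm_num) _
    have := mul_le_mul_of_nonneg_left this (by positivity : 0 ≤ C1 * Q)
    linarith
  have h2 := hM (fun i => TL2 (vt S c ((1 / 2) ^ i))) (fun i x => (TL2_norm _ x).le)
    (fun i => by rw [← TL2_sq, vt_mul_vt]; congr 2; ring) x _ (Real.sqrt_nonneg _) hB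
  set M := C * (Real.sqrt (C1 * Q) + ‖x‖)
  have hM0 : 0 ≤ M := by positivity
  have hMQ : M ^ 2 ≤ 2 * C ^ 2 * (C0 + C1) * Q := by
    have e1 : (Real.sqrt (C1 * Q) + ‖x‖) ^ 2 ≤ 2 * (C1 * Q + C0 * Q) := by
      have := sq_nonneg (Real.sqrt (C1 * Q) - ‖x‖)
      have e2 : Real.sqrt (C1 * Q) ^ 2 = C1 * Q := Real.sq_sqrt (by positivity)
      linarith
    have := mul_le_mul_of_nonneg_left e1 (sq_nonneg C)
    rw [show M ^ 2 = C ^ 2 * (Real.sqrt (C1 * Q) + ‖x‖) ^ 2 from mul_pow _ _ _]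
    linarith
  refine le_trans ?_ hMQ
  have hfat : q2 (VF (fun _ => vt S c 1) f) ≤ ENNReal.ofReal (M ^ 2) := by
    have hlim : ∀ g, Filter.Tendsto (fun i : ℕ => ‖(2 : ℝ) ^ i * Dl (vt S c ((1 / 2) ^ i)) f g‖ₑ ^ 2) Filter.atTop
        (nhds (‖VF (fun _ => vt S c 1) f g‖ₑ ^ 2)) := by
      intro g
      have hd := (sm_diff hf.sm g).hasFDerivAt.hasLineDerivAt (vt S c 1)
      have h5 := (hasLineDerivAt_iff_tendsto_slope_zero.1 hd)
      have h6 : Filter.Tendsto (fun i : ℕ => (1 / 2 : ℝ) ^ i) Filter.atTop (nhdsWithin 0 {0}ᶜ) :=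
        tendsto_nhdsWithin_of_tendsto_nhds_of_eventually_within _
          (tendsto_pow_atTop_nhds_zero_of_lt_one (by norm_num) (by norm_num))
          (.of_forall fun i => by simp)
      have h7 := h5.comp h6
      refine ((ENNReal.continuous_pow 2).tendsto _).comp ((continuous_enorm.tendsto _).comp (h7.congr fun i => ?_))
      simp only [Function.comp, Dl_apply, vt_mul c ((1 / 2) ^ i), smul_eq_mul]
      rw [← inv_pow]; norm_num
    have : q2 (VF (fun _ => vt S c 1) f)
      = ∫⁻ g, Filter.liminf (fun i : ℕ => ‖(2 : ℝ) ^ i * Dl (vt S c ((1 / 2) ^ i)) f g‖ₑ ^ 2) Filter.atTop :=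
      lintegral_congr fun g => (hlim g).liminf_eq.symm
    rw [this]
    refine (lintegral_liminf_le fun i => ?_).trans ?_
    · exact (((Dl_TF _ hf).continuous.measurable.const_mul _).enorm).pow_const 2
    · refine Filter.liminf_le_of_le (by isBoundedDefault) fun b hb => ?_
      obtain ⟨i, hi⟩ := hb.exists
      refine hi.trans ?_
      have h8 := h2 i
      rw [TL2_sub_one _ hf] at h8
      have hT : TF (fun g => (2 : ℝ) ^ i * Dl (vt S c ((1 / 2) ^ i)) f g) := (Dl_TF _ hf).const_mul _
      have h9 : (∫⁻ g, ‖(2 : ℝ) ^ i * Dl (vt S c ((1 / 2) ^ i)) f g‖ₑ ^ 2) = _ := q2_eq_ofReal hT.int_sq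
      rw [h9]
      refine ENNReal.ofReal_le_ofReal ?_
      simp only [mul_pow]
      rw [integral_const_mul, ← norm_toLp_sq (Dl_TF _ hf), ← mul_pow]
      refine pow_le_pow_left₀ (by positivity) ?_ 2
      refine (mul_le_mul_of_nonneg_left h8 (by positivity)).trans (le_of_eq ?_)
      have : (2 : ℝ) ^ i * (1 / 2) ^ i = 1 := by rw [← mul_pow]; norm_num
      calc _ = ((2 : ℝ) ^ i * (1 / 2) ^ i) * (C * (Real.sqrt (C1 * Q) + ‖x‖)) := by ring
        _ = _ := by rw [this, one_mul]
  rw [q2_eq_ofReal (VF_TF contDiff_const hf).int_sq] at hfat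
  exact (ENNReal.ofReal_le_ofReal_iff (sq_nonneg _)).1 hfat

end Gr

section Words

variable {E : Type*} [NormedAddCommGroup E] [NormedSpace ℝ E]

/-- Composition of a word of vector fields. -/
noncomputable def VW (l : List (E → E)) (f : E → ℝ) : E → ℝ := l.foldr (fun η f => VF η f) f

theorem VW_nil (f : E → ℝ) : VW [] f = f := rfl
theorem VW_cons (η : E → E) (l : List (E → E)) (f : E → ℝ) : VW (η :: l) f = VF η (VW l f) := rfl

theorem VW_append (l l' : List (E → E)) (f : E → ℝ) : VW (l ++ l') f = VW l (VW l' f) := by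
  simp [VW, List.foldr_append]

theorem VW_sm {l : List (E → E)} (hl : ∀ η ∈ l, ContDiff ℝ (⊤ : ℕ∞) η) {f : E → ℝ}
    (hf : ContDiff ℝ (⊤ : ℕ∞) f) : ContDiff ℝ (⊤ : ℕ∞) (VW l f) := by
  induction l with
  | nil => exact hf
  | cons η l ih =>
    exact VF_sm (hl η (by simp)) (ih fun ξ h => hl ξ (List.mem_cons_of_mem _ h))

theorem VW_tsupport (l : List (E → E)) (f : E → ℝ) : tsupport (VW l f) ⊆ tsupport f := by
  induction l with
  | nil => exact subset_rfl
  | cons η l ih => exact VF_tsupport.trans ih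

theorem VW_TF {l : List (E → E)} (hl : ∀ η ∈ l, ContDiff ℝ (⊤ : ℕ∞) η) {f : E → ℝ} (hf : TF f) :
    TF (VW l f) :=
  ⟨VW_sm hl hf.sm, hf.cs.mono' (subset_tsupport _ |>.trans (VW_tsupport l f))⟩

theorem VW_add {l : List (E → E)} (hl : ∀ η ∈ l, ContDiff ℝ (⊤ : ℕ∞) η) {f g : E → ℝ}
    (hf : ContDiff ℝ (⊤ : ℕ∞) f) (hg : ContDiff ℝ (⊤ : ℕ∞) g) :
    VW l (fun x => f x + g x) = fun x => VW l f x + VW l g x := by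
  induction l with
  | nil => rfl
  | cons η l ih =>
    have hl' := fun ξ h => hl ξ (List.mem_cons_of_mem _ h)
    rw [VW_cons, ih hl', VF_add (VW_sm hl' hf) (VW_sm hl' hg)]
    rfl

theorem VW_const_mul {l : List (E → E)} (hl : ∀ η ∈ l, ContDiff ℝ (⊤ : ℕ∞) η) (c : ℝ) {f : E → ℝ}
    (hf : ContDiff ℝ (⊤ : ℕ∞) f) : VW l (fun x => c * f x) = fun x => c * VW l f x := by
  induction l with
  | nil => rfl
  | cons η l ih =>
    have hl' := fun ξ h => hl ξ (List.mem_cons_of_mem _ h)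
    rw [VW_cons, ih hl', VF_const_mul c (VW_sm hl' hf)]
    rfl

theorem exists_cutoff [FiniteDimensional ℝ E] {K Ω : Set E} (hK : IsCompact K) (hΩ : IsOpen Ω)
    (h : K ⊆ Ω) : ∃ χ : E → ℝ, TF χ ∧ (∀ᶠ x in nhdsSet K, χ x = 1) ∧ tsupport χ ⊆ Ω
      ∧ ∀ x, χ x ∈ Set.Icc (0 : ℝ) 1 := by
  obtain ⟨K', hK', h1, h2⟩ := exists_compact_between hK hΩ h
  obtain ⟨f, f1, f0, f2⟩ := exists_contMDiffMap_one_nhds_of_subset_interior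
    (n := (⊤ : ℕ∞)) (modelWithCornersSelf ℝ E) hK.isClosed h1
  have hs : tsupport (f : E → ℝ) ⊆ K' := closure_minimal (fun x hx => by
    by_contra hx'; exact hx (f0 x hx')) hK'.isClosed
  exact ⟨f, ⟨f.contMDiff.contDiff, HasCompactSupport.of_support_subset_isCompact hK'
    ((subset_tsupport _).trans hs)⟩, f1, hs.trans h2, f2⟩

end Words

section Sup

variable {κ : Type*} [Fintype κ] [DecidableEq κ]

theorem TF.enorm_le_line {F : (κ → ℝ) → ℝ} (hF : TF F) (i : κ) (x : κ → ℝ) :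
    ‖F x‖ₑ ≤ ∫⁻ t, ‖VF (fun _ => Pi.single i (1 : ℝ)) F (Function.update x i t)‖ₑ := by
  calc ‖F x‖ₑ ≤ ∫⁻ t in Set.Iic (x i), ‖deriv (F ∘ Function.update x i) t‖ₑ := by
        apply le_trans (by simp) (HasCompactSupport.enorm_le_lintegral_Ici_deriv _ _ _)
        · exact (hF.sm.of_le (by simp)).comp (by convert! contDiff_update 1 x i)
        · exact hF.cs.comp_isClosedEmbedding (isClosedEmbedding_update x i)
    _ ≤ ∫⁻ t, ‖deriv (F ∘ Function.update x i) t‖ₑ := lintegral_mono' Measure.restrict_le_self le_rfl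
    _ = _ := by
      refine lintegral_congr fun t => ?_
      rw [fderiv_comp_deriv _ (sm_diff hF.sm _) (hasDerivAt_update x i t).differentiableAt,
        deriv_update]
      rfl

theorem TF.enorm_le_lmarginal (l : List κ) (hl : l.Nodup) {F : (κ → ℝ) → ℝ} (hF : TF F) (x : κ → ℝ) :
    ‖F x‖ₑ ≤ (∫⋯∫⁻_l.toFinset,
      (fun y => ‖VW (l.map fun i _ => Pi.single i (1 : ℝ)) F y‖ₑ) ∂fun _ => volume) x := by
  induction l generalizing x with
  | nil => simp [VW_nil]
  | cons i l ih =>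
    rw [List.nodup_cons] at hl
    have hT : ∀ l : List κ, TF (VW (l.map fun i _ => Pi.single i (1 : ℝ)) F) := fun l =>
      VW_TF (fun η h => by obtain ⟨j, -, rfl⟩ := List.mem_map.1 h; exact contDiff_const) hF
    refine (ih hl.2 x).trans ?_
    rw [List.toFinset_cons, lmarginal_insert' _ (hT (i :: l)).continuous.enorm.measurable (by simpa using hl.1)]
    exact lmarginal_mono (fun y => (hT l).enorm_le_line i y) x

end Sup

namespace Gr

variable {n : ℕ} {ι β : Type} [Fintype ι] [Fintype β] {S : Shear n ι β}

open Classical in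
/-- The coordinate frame. -/
noncomputable def fr (S : Shear n ι β) : Fin n ⊕ ι → Gr S
  | Sum.inl j => mk (Pi.single j 1) 0
  | Sum.inr c => mk 0 (Pi.single c 1)

/-- Coordinates with respect to the frame. -/
noncomputable def co (g : Gr S) : Fin n ⊕ ι → ℝ := Sum.elim g.1 g.2

theorem sum_fst {α : Type*} (s : Finset α) (h : α → Gr S) : (∑ i ∈ s, h i).1 = ∑ i ∈ s, (h i).1 :=
  Prod.fst_sum (s := s) (f := fun i => (h i : (Fin n → ℝ) × (ι → ℝ)))
theorem sum_snd {α : Type*} (s : Finset α) (h : α → Gr S) : (∑ i ∈ s, h i).2 = ∑ i ∈ s, (h i).2 :=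
  Prod.snd_sum (s := s) (f := fun i => (h i : (Fin n → ℝ) × (ι → ℝ)))

open Classical in
theorem sum_co (g : Gr S) : ∑ i, co g i • fr S i = g := by
  rw [Fintype.sum_sum_type]
  refine ext' ?_ ?_
  · rw [add_fst, sum_fst, sum_fst]
    funext j
    simp [smul_fst, fr, mk_fst, co, Finset.sum_apply, Pi.single_apply]
  · rw [add_snd, sum_snd, sum_snd]
    funext j
    simp only [smul_snd, fr, mk_snd, co, Finset.sum_apply, Pi.single_apply, Pi.add_apply, Pi.smul_apply,
      smul_eq_mul, mul_ite, mul_one, mul_zero, Pi.zero_apply, Finset.sum_const_zero, zero_add, Sum.elim_inr]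
    exact (Finset.sum_ite_eq _ j _).trans (if_pos (Finset.mem_univ _))

/-- The linear coordinate system as a continuous linear map. -/
noncomputable def coL (S : Shear n ι β) : (Fin n ⊕ ι → ℝ) →L[ℝ] Gr S :=
  ∑ i, (ContinuousLinearMap.proj i : (Fin n ⊕ ι → ℝ) →L[ℝ] ℝ).smulRight (fr S i)

theorem coL_apply (y : Fin n ⊕ ι → ℝ) : coL S y = mk (fun j => y (Sum.inl j)) (fun c => y (Sum.inr c)) := by
  have := sum_co (S := S) (mk (fun j => y (Sum.inl j)) (fun c => y (Sum.inr c)))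
  rw [← this]
  simp [coL, co, mk_fst, mk_snd]

theorem coL_single [DecidableEq (Fin n ⊕ ι)] (i) : coL S (Pi.single i 1) = fr S i := by
  simp only [coL, sum_apply, ContinuousLinearMap.smulRight_apply, ContinuousLinearMap.proj_apply]
  rw [Finset.sum_eq_single i]
  · simp
  · intro b _ hb; simp [hb]
  · simp

theorem coL_injective : Function.Injective (coL S) := by
  intro y z h
  rw [coL_apply, coL_apply] at h
  have h1 : (fun j => y (Sum.inl j)) = fun j => z (Sum.inl j) := congrArg (fun g : Gr S => g.1) h
  have h2 : (fun j => y (Sum.inr j)) = fun j => z (Sum.inr j) := congrArg (fun g : Gr S => g.2) h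
  funext i
  rcases i with j | c
  · exact congrFun h1 j
  · exact congrFun h2 c

theorem mp_coL : MeasurePreserving (coL S) volume volume := by
  have h := volume_measurePreserving_sumPiEquivProdPi (fun _ : Fin n ⊕ ι => ℝ)
  have e : (coL S : (Fin n ⊕ ι → ℝ) → Gr S) = MeasurableEquiv.sumPiEquivProdPi (fun _ : Fin n ⊕ ι => ℝ) := by
    funext y; rw [coL_apply]; rfl
  rw [e]; exact h

/-- Pointwise bound by the integral of the full mixed derivative. -/
theorem sup_le_full : ∃ l : List (Gr S → Gr S), (∀ η ∈ l, ContDiff ℝ (⊤ : ℕ∞) η) ∧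
    ∀ f : Gr S → ℝ, TF f → ∀ g, |f g| ≤ ∫ x, |VW l f x| := by
  classical
  refine ⟨(Finset.univ : Finset (Fin n ⊕ ι)).toList.map fun i _ => fr S i, fun η h => by
    obtain ⟨j, -, rfl⟩ := List.mem_map.1 h; exact contDiff_const, fun f hf g => ?_⟩
  set l := (Finset.univ : Finset (Fin n ⊕ ι)).toList
  have hF : TF (f ∘ coL S) := by
    exact ⟨hf.sm.comp (coL S).contDiff, hf.cs.comp_isClosedEmbedding
      (LinearMap.isClosedEmbedding_of_injective (f := (coL S).toLinearMap) (LinearMap.ker_eq_bot.2 coL_injective))⟩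
  have hw : ∀ l : List (Fin n ⊕ ι), VW (l.map fun i _ => Pi.single i (1 : ℝ)) (f ∘ coL S)
      = VW (l.map fun i _ => fr S i) f ∘ coL S := by
    intro l
    induction l with
    | nil => rfl
    | cons i l ih =>
      rw [List.map_cons, List.map_cons, VW_cons, VW_cons, ih]
      funext y
      have hs : ContDiff ℝ (⊤ : ℕ∞) (VW (l.map fun i _ => fr S i) f) := VW_sm (fun η h => by
        obtain ⟨j, -, rfl⟩ := List.mem_map.1 h; exact contDiff_const) hf.sm
      simp only [VF, Function.comp]
      have := fderiv_comp (𝕜 := ℝ) y (sm_diff hs (coL S y)) (coL S).differentiableAt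
      rw [this, ContinuousLinearMap.fderiv, ContinuousLinearMap.comp_apply, coL_single]
  have hT : TF (VW (l.map fun i _ => fr S i) f) := VW_TF (fun η h => by
    obtain ⟨j, -, rfl⟩ := List.mem_map.1 h; exact contDiff_const) hf
  have h := hF.enorm_le_lmarginal l (Finset.nodup_toList _) (co g)
  rw [Finset.toList_toFinset, lmarginal_univ, hw] at h
  have h2 : (f ∘ coL S) (co g) = f g := congrArg f ((coL_apply _).trans rfl)
  rw [h2, ← volume_pi] at h
  have h3 := mp_coL.lintegral_comp (f := fun x => ‖VW (l.map fun i _ => fr S i) f x‖ₑ)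
    hT.continuous.enorm.measurable
  have h4 := h.trans_eq h3
  rw [← ofReal_integral_norm_eq_lintegral_enorm hT.integrable, ← ofReal_norm,
    ENNReal.ofReal_le_ofReal_iff (integral_nonneg fun _ => norm_nonneg _)] at h4
  exact h4

end Gr

namespace Gr

variable {n : ℕ} {ι β : Type} [Fintype ι] [Fintype β] {S : Shear n ι β}

/-- The right-invariant vector field with value `v` at the identity. -/
noncomputable def rf (v g : Gr S) : Gr S := mk v.1 (v.2 + (fderiv ℝ S.ρ 0 v.1) g.2)

theorem rf_sm (v : Gr S) : ContDiff ℝ (⊤ : ℕ∞) (rf v) :=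
  contDiff_mk contDiff_const (contDiff_const.add ((contDiff_const).clm_apply contDiff_snd))

theorem hasFDerivAt_fst (g : Gr S) : HasFDerivAt (fun g : Gr S => g.1)
    (ContinuousLinearMap.fst ℝ (Fin n → ℝ) (ι → ℝ) : Gr S →L[ℝ] (Fin n → ℝ)) g :=
  (ContinuousLinearMap.fst ℝ (Fin n → ℝ) (ι → ℝ)).hasFDerivAt
theorem hasFDerivAt_snd (g : Gr S) : HasFDerivAt (fun g : Gr S => g.2)
    (ContinuousLinearMap.snd ℝ (Fin n → ℝ) (ι → ℝ) : Gr S →L[ℝ] (ι → ℝ)) g :=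
  (ContinuousLinearMap.snd ℝ (Fin n → ℝ) (ι → ℝ)).hasFDerivAt

theorem rho_diff : Differentiable ℝ S.ρ := S.smooth.differentiable (by simp)

theorem fld_fderiv (w g h : Gr S) : fderiv ℝ (fld w) g h = mk 0 ((fderiv ℝ S.ρ g.1 h.1) w.2) := by
  have h1 := (((rho_diff (S := S) g.1).hasFDerivAt.comp g (hasFDerivAt_fst g)).clm_apply
    (hasFDerivAt_const w.2 g))
  have h2 := (hasFDerivAt_const w.1 g).prodMk h1
  refine (congrArg (fun D : Gr S →L[ℝ] Gr S => D h) (HasFDerivAt.fderiv (E := Gr S) (F := Gr S) (f := fld w) h2)).trans ?_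
  refine ext' rfl ?_
  simp only [mk_snd]
  change S.ρ g.1 0 + (fderiv ℝ S.ρ g.1 h.1) w.2 = _
  rw [map_zero, zero_add]

theorem rf_fderiv (v g h : Gr S) : fderiv ℝ (rf v) g h = mk 0 ((fderiv ℝ S.ρ 0 v.1) h.2) := by
  have h1 := ((fderiv ℝ S.ρ 0 v.1).hasFDerivAt.comp g (hasFDerivAt_snd g)).const_add v.2
  have h2 := (hasFDerivAt_const v.1 g).prodMk h1
  exact congrArg (fun D : Gr S →L[ℝ] Gr S => D h) (HasFDerivAt.fderiv (E := Gr S) (F := Gr S) (f := rf v) h2)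

theorem fderiv_rho (x a : Fin n → ℝ) (q : ι → ℝ) : fderiv ℝ S.ρ x a q = fderiv ℝ S.ρ 0 a (S.ρ x q) := by
  have e : (fun t => S.ρ (t + x) q) = fun t => S.ρ t (S.ρ x q) := funext fun t => S.add t x q
  have h0 : HasFDerivAt S.ρ (fderiv ℝ S.ρ x) (0 + x) := by
    rw [zero_add]; exact (rho_diff x).hasFDerivAt
  have h1 := (h0.comp 0 ((hasFDerivAt_id (𝕜 := ℝ) (0 : Fin n → ℝ)).add_const x)).clm_apply (hasFDerivAt_const q 0)
  have h2 := ((rho_diff (S := S) 0).hasFDerivAt).clm_apply (hasFDerivAt_const (S.ρ x q) 0)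
  have h3 : HasFDerivAt (fun t => S.ρ (t + x) q) _ 0 := h1
  rw [e] at h3
  have := congrArg (fun D => D a) (h3.unique h2)
  simpa using this

theorem rf_comm (v w : Gr S) {f : Gr S → ℝ} (hf : ContDiff ℝ (⊤ : ℕ∞) f) :
    VF (rf v) (VF (fld w) f) = VF (fld w) (VF (rf v) f) := by
  refine VF_comm (rf_sm v) (fld_sm w) (fun g => ?_) hf
  rw [fld_fderiv, rf_fderiv, fderiv_rho]
  rfl

theorem L_rf (v : Gr S) {f : Gr S → ℝ} (hf : ContDiff ℝ (⊤ : ℕ∞) f) :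
    L (VF (rf v) f) = VF (rf v) (L f) := by
  have : ∀ i, Xb S i (Xb S i (VF (rf v) f)) = VF (rf v) (Xb S i (Xb S i f)) := fun i => by
    have h1 := rf_comm v (bv S i) hf
    have h2 := rf_comm v (bv S i) (Xb_sm i hf)
    change VF (fld _) (VF (fld _) (VF (rf v) f)) = _
    rw [← h1]
    exact h2.symm
  unfold L
  simp only [this]
  rw [VF_neg, VF_sum _ fun i _ => Xb_sm i (Xb_sm i hf)]

/-- Words in the right-invariant frame. -/
noncomputable def RW (S : Shear n ι β) (l : List (Fin n ⊕ ι)) : (Gr S → ℝ) → Gr S → ℝ :=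
  VW (l.map fun j => rf (fr S j))

theorem RW_mem (l : List (Fin n ⊕ ι)) : ∀ η ∈ l.map fun j => rf (fr S j), ContDiff ℝ (⊤ : ℕ∞) η :=
  fun η h => by obtain ⟨j, -, rfl⟩ := List.mem_map.1 h; exact rf_sm _

theorem RW_TF (l : List (Fin n ⊕ ι)) {u : Gr S → ℝ} (hu : TF u) : TF (RW S l u) := VW_TF (RW_mem l) hu

theorem L_RW (l : List (Fin n ⊕ ι)) {u : Gr S → ℝ} (hu : TF u) : L (RW S l u) = RW S l (L u) := by
  induction l with
  | nil => rfl
  | cons j l ih =>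
    change L (VF (rf (fr S j)) (RW S l u)) = VF (rf (fr S j)) (RW S l (L u))
    rw [L_rf _ (RW_TF l hu).sm, ih]

theorem Lpow_RW (l : List (Fin n ⊕ ι)) (k : ℕ) {u : Gr S → ℝ} (hu : TF u) :
    L^[k] (RW S l u) = RW S l (L^[k] u) := by
  induction k with
  | zero => rfl
  | succ k ih => rw [Function.iterate_succ_apply', Function.iterate_succ_apply', ih, L_RW l (Lpow_TF k hu)]

/-- `T` is locally bounded on `L²` by powers of `L`. -/
def Est (Ω : Set (Gr S)) (T : (Gr S → ℝ) → Gr S → ℝ) : Prop :=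
  ∀ χ, TF χ → tsupport χ ⊆ Ω → ∃ (C : ℝ) (k : ℕ), 0 ≤ C ∧ ∀ u, TF u →
    ∫ g, (χ g * T u g) ^ 2 ≤ C * Qs Ω k u

variable {Ω : Set (Gr S)} {T T' : (Gr S → ℝ) → Gr S → ℝ}

theorem Est.congr (h : Est Ω T) (e : ∀ u, TF u → T u = T' u) : Est Ω T' := fun χ hχ hs => by
  obtain ⟨C, k, hC, H⟩ := h χ hχ hs
  exact ⟨C, k, hC, fun u hu => by rw [← e u hu]; exact H u hu⟩

theorem Est.add (h : Est Ω T) (h' : Est Ω T') (hT : ∀ u, TF u → TF (T u)) (hT' : ∀ u, TF u → TF (T' u)) :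
    Est Ω (fun u g => T u g + T' u g) := fun χ hχ hs => by
  obtain ⟨C, k, hC, H⟩ := h χ hχ hs
  obtain ⟨C', k', hC', H'⟩ := h' χ hχ hs
  refine ⟨2 * C + 2 * C', max k k', by positivity, fun u hu => ?_⟩
  have a1 : TF (fun g => χ g * T u g) := hχ.mul_right (hT u hu).sm
  have a2 : TF (fun g => χ g * T' u g) := hχ.mul_right (hT' u hu).sm
  have b1 := (H u hu).trans (mul_le_mul_of_nonneg_left (Qs_mono subset_rfl (le_max_left k k') hu) hC)
  have b2 := (H' u hu).trans (mul_le_mul_of_nonneg_left (Qs_mono subset_rfl (le_max_right k k') hu) hC')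
  have : ∫ g, (χ g * (T u g + T' u g)) ^ 2 ≤ ∫ g, (2 * (χ g * T u g) ^ 2 + 2 * (χ g * T' u g) ^ 2) := by
    refine integral_mono (TF.int_sq (hχ.mul_right ((hT u hu).add (hT' u hu)).sm))
      ((a1.int_sq.const_mul 2).add (a2.int_sq.const_mul 2)) fun g => ?_
    have := sq_nonneg (χ g * T u g - χ g * T' u g)
    change (χ g * (T u g + T' u g)) ^ 2 ≤ 2 * (χ g * T u g) ^ 2 + 2 * (χ g * T' u g) ^ 2
    linarith
  rw [integral_add (a1.int_sq.const_mul 2) (a2.int_sq.const_mul 2), integral_const_mul, integral_const_mul] at this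
  linarith

theorem Est.mul (h : Est Ω T) {a : Gr S → ℝ} (ha : ContDiff ℝ (⊤ : ℕ∞) a) :
    Est Ω (fun u g => a g * T u g) := fun χ hχ hs => by
  have hχa : TF (fun g => χ g * a g) := hχ.mul_right ha
  obtain ⟨C, k, hC, H⟩ := h _ hχa ((tsupport_mul_subset_left (f := χ) (g := a)).trans hs)
  refine ⟨C, k, hC, fun u hu => ?_⟩
  simpa only [mul_assoc] using H u hu

theorem Est.zero : Est Ω (fun _ _ => 0) := fun χ _ _ => ⟨0, 0, le_rfl, fun u _ => by simp⟩

theorem Est.sum {α : Type*} (s : Finset α) {F : α → (Gr S → ℝ) → Gr S → ℝ} (h : ∀ i ∈ s, Est Ω (F i))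
    (hF : ∀ i ∈ s, ∀ u, TF u → TF (F i u)) : Est Ω (fun u g => ∑ i ∈ s, F i u g) := by
  classical
  induction s using Finset.induction_on with
  | empty => simpa using Est.zero
  | insert i s hi ih =>
    simp only [Finset.sum_insert hi]
    exact (h i (by simp)).add (ih (fun j hj => h j (by simp [hj])) fun j hj => hF j (by simp [hj]))
      (hF i (by simp)) fun u hu => TF.sum s fun j hj => hF j (by simp [hj]) u hu

theorem Est.frame [Nonempty ι] (hΩ : IsOpen Ω) (i : Fin n ⊕ ι) : Est Ω (VF fun _ => fr S i) := fun χ hχ hs => by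
  have key : ∃ C k, 0 ≤ C ∧ ∀ u : Gr S → ℝ, TF u →
      ∫ g, (VF (fun _ => fr S i) (fun g => χ g * u g) g) ^ 2 ≤ C * Qs Ω k u := by
    rcases i with j | c
    · obtain ⟨K, hK⟩ : ∃ K, ∀ i, S.w i ≤ K :=
        ⟨∑ i, S.w i, fun i => Finset.single_le_sum (fun _ _ => Nat.zero_le _) (Finset.mem_univ i)⟩
      obtain ⟨c⟩ := ‹Nonempty ι›
      obtain ⟨C, hC, h⟩ := energy_step c 0 (diff_le c hK 0) hχ hΩ.measurableSet hs
      refine ⟨C, 1, hC, fun u hu => ?_⟩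
      have h1 := h u hu 1 one_pos le_rfl
      have hT : TF (fun g => χ g * u g) := hχ.mul_right hu.sm
      have h2 := energy hT
      have h3 := Finset.single_le_sum (f := fun i => ∫ x, Xb S i (fun g => χ g * u g) x ^ 2)
        (fun _ _ => integral_nonneg fun _ => sq_nonneg _) (Finset.mem_univ (Sum.inl j))
      have e : VF (fun _ => fr S (Sum.inl j)) = Xb S (Sum.inl j) := by
        unfold Xb; congr 1; funext g
        exact ext' rfl (map_zero _).symm
      rw [e]
      simp only [mul_zero, pow_zero, mul_one, zero_add, Module.End.one_apply] at h1
      linarith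
    · exact vertical_le c hχ hΩ.measurableSet hs
  obtain ⟨C, k, hC, h⟩ := key
  have hχ' : TF (VF (fun _ => fr S i) χ) := VF_TF contDiff_const hχ
  obtain ⟨M, hM⟩ := hχ'.bdd
  refine ⟨2 * C + 2 * M ^ 2, k, by positivity, fun u hu => ?_⟩
  have hT : TF (fun g => χ g * u g) := hχ.mul_right hu.sm
  have hV : TF (VF (fun _ => fr S i) (fun g => χ g * u g)) := VF_TF contDiff_const hT
  have hP : TF (fun g => VF (fun _ => fr S i) χ g * u g) := hχ'.mul_right hu.sm
  have e : ∀ g, χ g * VF (fun _ => fr S i) u g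
      = VF (fun _ => fr S i) (fun g => χ g * u g) g - VF (fun _ => fr S i) χ g * u g := fun g => by
    rw [VF_mul hχ.sm hu.sm]; ring
  have q0 : ∫ g in Ω, u g ^ 2 ≤ Qs Ω k u := by
    have := Qs_mono (Ω := Ω) subset_rfl (Nat.zero_le k) hu
    simpa [Qs] using this
  have q1 : ∫ g, (VF (fun _ => fr S i) χ g * u g) ^ 2 ≤ M ^ 2 * ∫ g in Ω, u g ^ 2 := by
    rw [← integral_indicator hΩ.measurableSet, ← integral_const_mul]
    refine integral_mono hP.int_sq ((hu.int_sq.indicator hΩ.measurableSet).const_mul _) fun g => ?_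
    by_cases hg : g ∈ Ω
    · simp only [Set.indicator_of_mem hg, mul_pow]
      exact mul_le_mul_of_nonneg_right (sq_le_sq' (abs_le.1 (hM g)).1 (abs_le.1 (hM g)).2) (sq_nonneg _)
    · have : VF (fun _ => fr S i) χ g = 0 := VF_eq_zero fun h => hg (hs h)
      simp [this, hg]
  have : ∫ g, (χ g * VF (fun _ => fr S i) u g) ^ 2 ≤ ∫ g, (2 * (VF (fun _ => fr S i) (fun g => χ g * u g) g) ^ 2
      + 2 * (VF (fun _ => fr S i) χ g * u g) ^ 2) := by
    refine integral_mono (TF.int_sq (hχ.mul_right (VF_TF contDiff_const hu).sm))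
      ((hV.int_sq.const_mul 2).add (hP.int_sq.const_mul 2)) fun g => ?_
    have := sq_nonneg (VF (fun _ => fr S i) (fun g => χ g * u g) g + VF (fun _ => fr S i) χ g * u g)
    simp only [e]
    linarith
  rw [integral_add (hV.int_sq.const_mul 2) (hP.int_sq.const_mul 2), integral_const_mul, integral_const_mul] at this
  have := h u hu
  have := mul_le_mul_of_nonneg_left q0 (sq_nonneg M)
  linarith

end Gr

namespace Gr

variable {n : ℕ} {ι β : Type} [Fintype ι] [Fintype β] {S : Shear n ι β}
variable {Ω : Set (Gr S)} {T T' : (Gr S → ℝ) → Gr S → ℝ}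

theorem co_sm {η : Gr S → Gr S} (hη : ContDiff ℝ (⊤ : ℕ∞) η) (i : Fin n ⊕ ι) :
    ContDiff ℝ (⊤ : ℕ∞) (fun g => co (η g) i) := by
  rcases i with j | c
  · exact (contDiff_pi.1 (contDiff_fst.comp hη)) j
  · exact (contDiff_pi.1 (contDiff_snd.comp hη)) c

theorem VF_frame (η : Gr S → Gr S) (u : Gr S → ℝ) :
    VF η u = fun g => ∑ i, co (η g) i * VF (fun _ => fr S i) u g := by
  funext g
  unfold VF
  conv_lhs => rw [← sum_co (η g)]
  rw [map_sum]
  exact Finset.sum_congr rfl fun i _ => by rw [map_smul, smul_eq_mul]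

theorem VF_fr_TF (i : Fin n ⊕ ι) {u : Gr S → ℝ} (hu : TF u) : TF (VF (fun _ => fr S i) u) :=
  VF_TF contDiff_const hu

theorem Est.field [Nonempty ι] (hΩ : IsOpen Ω) {η : Gr S → Gr S} (hη : ContDiff ℝ (⊤ : ℕ∞) η) :
    Est Ω (VF η) := by
  refine Est.congr (T := fun u g => ∑ i, co (η g) i * VF (fun _ => fr S i) u g)
    (Est.sum _ (fun i _ => (Est.frame hΩ i).mul (co_sm hη i))
      fun i _ u hu => (VF_fr_TF i hu).mul_left (co_sm hη i)) fun u _ => (VF_frame η u).symm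

theorem Qs_Lpow_le (Ω : Set (Gr S)) (k i : ℕ) (u : Gr S → ℝ) : Qs Ω k (L^[i] u) ≤ Qs Ω (k + i) u := by
  induction i generalizing k with
  | zero => exact le_rfl
  | succ i ih =>
    rw [Function.iterate_succ_apply']
    refine (Qs_L_le Ω k _).trans ((ih (k + 1)).trans (le_of_eq ?_))
    rw [show k + 1 + i = k + (i + 1) by omega]

theorem Est.id (hΩ : IsOpen Ω) : Est Ω (fun u => u) := fun χ hχ hs => by
  obtain ⟨M, hM⟩ := hχ.bdd
  refine ⟨M ^ 2, 0, sq_nonneg M, fun u hu => ?_⟩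
  have : Qs Ω 0 u = ∫ g in Ω, u g ^ 2 := by simp [Qs]
  rw [this, ← integral_indicator hΩ.measurableSet, ← integral_const_mul]
  refine integral_mono (hχ.mul_right hu.sm).int_sq ((hu.int_sq.indicator hΩ.measurableSet).const_mul _)
    fun g => ?_
  by_cases hg : g ∈ Ω
  · simp only [Set.indicator_of_mem hg, mul_pow]
    exact mul_le_mul_of_nonneg_right (sq_le_sq' (abs_le.1 (hM g)).1 (abs_le.1 (hM g)).2) (sq_nonneg _)
  · have : χ g = 0 := image_eq_zero_of_notMem_tsupport fun h => hg (hs h)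
    simp [this, hg]

theorem Est.word [Nonempty ι] (l : List (Fin n ⊕ ι)) : ∀ {Ω : Set (Gr S)}, IsOpen Ω → Est Ω (RW S l) := by
  induction l with
  | nil => exact fun hΩ => Est.id hΩ
  | cons j l ih =>
    intro Ω hΩ χ hχ hs
    obtain ⟨χ', hχ', h1, hs', -⟩ := exists_cutoff hχ.cs hΩ hs
    set Ω' := interior {g | χ' g = 1}
    have hsub : tsupport χ ⊆ Ω' := fun g hg => mem_interior_iff_mem_nhds.2
      ((Filter.eventually_iff.1 h1) |> fun h => mem_nhdsSet_iff_forall.1 h g hg)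
    obtain ⟨C, k, hC, H⟩ := Est.field (Ω := Ω') isOpen_interior (rf_sm (fr S j)) χ hχ hsub
    obtain ⟨C', k', hC', H'⟩ := ih hΩ χ' hχ' hs'
    refine ⟨C * ((k + 1) * C'), k' + k, by positivity, fun u hu => ?_⟩
    refine (H (RW S l u) (RW_TF l hu)).trans ?_
    rw [mul_assoc]
    refine mul_le_mul_of_nonneg_left ?_ hC
    unfold Qs
    have : ∀ i ∈ Finset.range (k + 1), ∫ x in Ω', (L^[i] (RW S l u) x) ^ 2 ≤ C' * Qs Ω (k' + k) u := fun i hi => by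
      rw [Lpow_RW l i hu]
      have hi' : i ≤ k := by have := Finset.mem_range.1 hi; omega
      refine le_trans ?_ ((H' _ (Lpow_TF i hu)).trans (mul_le_mul_of_nonneg_left
        ((Qs_Lpow_le Ω k' i u).trans (Qs_mono subset_rfl (by omega) hu)) hC'))
      have hw := RW_TF l (Lpow_TF i hu)
      rw [← integral_indicator isOpen_interior.measurableSet]
      refine integral_mono (hw.int_sq.indicator isOpen_interior.measurableSet)
        (hχ'.mul_right hw.sm).int_sq fun g => ?_
      by_cases hg : g ∈ Ω'
      · have : χ' g = 1 := interior_subset (s := {g | χ' g = 1}) hg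
        rw [Set.indicator_of_mem hg, this, one_mul]
      · rw [Set.indicator_of_notMem hg]; exact sq_nonneg _
    refine (Finset.sum_le_sum this).trans (le_of_eq ?_)
    rw [Finset.sum_const, Finset.card_range, nsmul_eq_mul]
    push_cast; unfold Qs; ring

/-- Operators all of whose right-invariant derivatives are controlled. -/
def Reg (Ω : Set (Gr S)) (T : (Gr S → ℝ) → Gr S → ℝ) : Prop :=
  (∀ u, TF u → TF (T u)) ∧ ∀ l, Est Ω (fun u => RW S l (T u))

theorem Reg.congr (h : Reg Ω T) (e : ∀ u, TF u → T u = T' u) : Reg Ω T' :=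
  ⟨fun u hu => e u hu ▸ h.1 u hu, fun l => (h.2 l).congr fun u hu => by rw [e u hu]⟩

theorem Reg.id [Nonempty ι] (hΩ : IsOpen Ω) : Reg Ω (fun u => u) := ⟨fun _ hu => hu, fun l => Est.word l hΩ⟩

theorem Reg.add (h : Reg Ω T) (h' : Reg Ω T') : Reg Ω (fun u g => T u g + T' u g) :=
  ⟨fun u hu => (h.1 u hu).add (h'.1 u hu), fun l =>
    ((h.2 l).add (h'.2 l) (fun u hu => RW_TF l (h.1 u hu)) fun u hu => RW_TF l (h'.1 u hu)).congr fun u hu =>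
      (VW_add (RW_mem l) (h.1 u hu).sm (h'.1 u hu).sm).symm⟩

theorem RW_append_singleton (l : List (Fin n ⊕ ι)) (j) (u : Gr S → ℝ) :
    RW S (l ++ [j]) u = RW S l (VF (rf (fr S j)) u) := by
  unfold RW
  rw [List.map_append, VW_append]; rfl

theorem Reg.rfield (h : Reg Ω T) (j : Fin n ⊕ ι) : Reg Ω (fun u => VF (rf (fr S j)) (T u)) :=
  ⟨fun u hu => VF_TF (rf_sm _) (h.1 u hu), fun l => (h.2 (l ++ [j])).congr fun u _ => RW_append_singleton l j _⟩

theorem Reg.mul (h : Reg Ω T) {a : Gr S → ℝ} (ha : ContDiff ℝ (⊤ : ℕ∞) a) :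
    Reg Ω (fun u g => a g * T u g) := by
  refine ⟨fun u hu => (h.1 u hu).mul_left ha, fun l => ?_⟩
  induction l using List.reverseRecOn generalizing T a with
  | nil => exact (h.2 []).mul ha
  | append_singleton l j ih =>
    have h1 := ih h (VF_sm (rf_sm (fr S j)) ha)
    have h2 := ih (h.rfield j) ha
    have a1 : ∀ u, TF u → TF (fun g => VF (rf (fr S j)) a g * T u g) := fun u hu =>
      (h.1 u hu).mul_left (VF_sm (rf_sm (fr S j)) ha)
    have a2 : ∀ u, TF u → TF (fun g => a g * VF (rf (fr S j)) (T u) g) := fun u hu =>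
      ((h.rfield j).1 u hu).mul_left ha
    refine (h1.add h2 (fun u hu => RW_TF l (a1 u hu)) fun u hu => RW_TF l (a2 u hu)).congr fun u hu => ?_
    rw [RW_append_singleton, VF_mul ha (h.1 u hu).sm]
    exact (VW_add (RW_mem l) (a1 u hu).sm (a2 u hu).sm).symm

theorem Reg.zero : Reg Ω (fun _ _ => 0) := by
  refine ⟨fun _ _ => TF.zero, fun l => Est.zero.congr fun u _ => ?_⟩
  have := VW_const_mul (RW_mem (S := S) l) 0 (f := fun _ => 0) contDiff_const
  simp only [zero_mul] at this
  exact this.symm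

theorem Reg.sum {α : Type*} (s : Finset α) {F : α → (Gr S → ℝ) → Gr S → ℝ} (h : ∀ i ∈ s, Reg Ω (F i)) :
    Reg Ω (fun u g => ∑ i ∈ s, F i u g) := by
  classical
  induction s using Finset.induction_on with
  | empty => simpa using Reg.zero
  | insert i s hi ih =>
    simp only [Finset.sum_insert hi]
    exact (h i (by simp)).add (ih fun j hj => h j (by simp [hj]))

theorem Reg.vert (h : Reg Ω T) (c : ι) : Reg Ω (fun u => VF (fun _ => fr S (Sum.inr c)) (T u)) := by
  refine (h.rfield (Sum.inr c)).congr fun u _ => ?_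
  congr 1; funext g
  refine ext' rfl ?_
  change (fr S (Sum.inr c)).2 + (fderiv ℝ S.ρ 0 0) g.2 = _
  rw [map_zero]; exact add_zero _

theorem Reg.frame (h : Reg Ω T) (i : Fin n ⊕ ι) : Reg Ω (fun u => VF (fun _ => fr S i) (T u)) := by
  rcases i with j | c
  swap
  · exact h.vert c
  have ha : ∀ c, ContDiff ℝ (⊤ : ℕ∞) (fun g : Gr S => (-1) * co (rf (fr S (Sum.inl j)) g) (Sum.inr c)) :=
    fun c => contDiff_const.mul (co_sm (rf_sm _) _)
  refine ((h.rfield (Sum.inl j)).add (Reg.sum Finset.univ fun c _ => (h.vert c).mul (ha c))).congr fun u _ => ?_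
  classical
  funext g
  rw [VF_frame (rf _)]
  beta_reduce
  rw [Fintype.sum_sum_type, Finset.sum_eq_single j]
  · have : co (rf (fr S (Sum.inl j)) g) (Sum.inl j) = 1 := by
      change (Pi.single j 1 : Fin n → ℝ) j = 1
      simp
    rw [this, add_assoc, ← Finset.sum_add_distrib]
    simp
  · intro b _ hb
    have : co (rf (fr S (Sum.inl j)) g) (Sum.inl b) = 0 := by
      change (Pi.single j 1 : Fin n → ℝ) b = 0
      simp [hb]
    rw [this, zero_mul]
  · simp

theorem Reg.field (h : Reg Ω T) {η : Gr S → Gr S} (hη : ContDiff ℝ (⊤ : ℕ∞) η) : Reg Ω (fun u => VF η (T u)) :=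
  (Reg.sum Finset.univ fun i _ => (h.frame i).mul (co_sm hη i)).congr fun u _ => (VF_frame η (T u)).symm

theorem integral_abs_sq_le {f : Gr S → ℝ} (hf : TF f) {K : Set (Gr S)} (hK : IsCompact K) (hs : tsupport f ⊆ K) :
    (∫ g, |f g|) ^ 2 ≤ ((volume K).toReal + 1) * ∫ g, f g ^ 2 := by
  set V := (volume K).toReal
  set X := ∫ g, |f g|
  set I := ∫ g, f g ^ 2
  have hV : 0 ≤ V := ENNReal.toReal_nonneg
  have hX : 0 ≤ X := integral_nonneg fun _ => abs_nonneg _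
  have hI : 0 ≤ I := integral_nonneg fun _ => sq_nonneg _
  have key : 2 * X * X ≤ X ^ 2 + (V + 1) * I := by
    have i1 : Integrable (K.indicator fun _ => X ^ 2 / (V + 1)) (volume : Measure (Gr S)) :=
      (integrable_indicator_iff hK.measurableSet).2 (integrableOn_const hK.measure_lt_top.ne)
    have : ∫ g, 2 * X * |f g| ≤ ∫ g, (K.indicator (fun _ => X ^ 2 / (V + 1)) g + (V + 1) * f g ^ 2) := by
      refine integral_mono (hf.integrable.abs.const_mul _) (i1.add (hf.int_sq.const_mul _)) fun g => ?_
      by_cases hg : g ∈ K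
      · simp only [Set.indicator_of_mem hg]
        have h1 : 0 < V + 1 := by positivity
        rw [← sq_abs (f g), div_add' _ _ _ h1.ne', le_div_iff₀ h1]
        nlinarith [sq_nonneg (X - (V + 1) * |f g|)]
      · have : f g = 0 := image_eq_zero_of_notMem_tsupport fun h => hg (hs h)
        simp [this, hg]
    rw [integral_const_mul, integral_add i1 (hf.int_sq.const_mul _), integral_const_mul,
      integral_indicator hK.measurableSet, setIntegral_const, smul_eq_mul] at this
    refine this.trans (add_le_add_left ?_ _)
    change V * _ ≤ _
    rw [mul_div_assoc', div_le_iff₀ (by positivity)]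
    nlinarith [sq_nonneg X]
  nlinarith

/-- Interior estimates for arbitrary derivatives by powers of `L`. -/
theorem sup_word [Nonempty ι] (hΩ : IsOpen Ω) {χ : Gr S → ℝ} (hχ : TF χ) (hs : tsupport χ ⊆ Ω)
    {l : List (Gr S → Gr S)} (hl : ∀ η ∈ l, ContDiff ℝ (⊤ : ℕ∞) η) :
    ∃ (C : ℝ) (k : ℕ), 0 ≤ C ∧ ∀ u, TF u → ∀ g, (VW l (fun g => χ g * u g) g) ^ 2 ≤ C * Qs Ω k u := by
  obtain ⟨χ', hχ', h1', hs', -⟩ := exists_cutoff hχ.cs hΩ hs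
  obtain ⟨l', hl', H⟩ := sup_le_full (S := S)
  have hP : ∀ l' : List (Gr S → Gr S), (∀ η ∈ l', ContDiff ℝ (⊤ : ℕ∞) η) →
      Reg Ω (fun u => VW l' (fun g => χ g * u g)) := by
    intro l' hl'
    induction l' with
    | nil => exact (Reg.id hΩ).mul hχ.sm
    | cons η l' ih => exact (ih fun η h => hl' η (by simp [h])).field (hl' η (by simp))
  have hll : ∀ η ∈ l' ++ l, ContDiff ℝ (⊤ : ℕ∞) η := fun η h => (List.mem_append.1 h).elim (hl' η) (hl η)
  obtain ⟨C, k, hC, H2⟩ := (hP _ hll).2 [] χ' hχ' hs'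
  set V := (volume (tsupport χ)).toReal
  refine ⟨(V + 1) * C, k, mul_nonneg (add_nonneg ENNReal.toReal_nonneg zero_le_one) hC, fun u hu g => ?_⟩
  have hw : TF (fun g => χ g * u g) := hχ.mul_right hu.sm
  have hw' := VW_TF hll hw
  have hsub : tsupport (VW (l' ++ l) fun g => χ g * u g) ⊆ tsupport χ :=
    (VW_tsupport _ _).trans tsupport_mul_subset_left
  have h2 := H _ (VW_TF hl hw) g
  simp only [← VW_append] at h2
  have h3 := integral_abs_sq_le hw' hχ.cs hsub
  have h4 := H2 u hu
  have e2 : ∀ g, χ' g * RW S [] (VW (l' ++ l) fun g => χ g * u g) g = VW (l' ++ l) (fun g => χ g * u g) g := fun g => by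
    change χ' g * VW (l' ++ l) (fun g => χ g * u g) g = _
    by_cases hg : g ∈ tsupport χ
    · rw [h1'.self_of_nhdsSet g hg, one_mul]
    · have : VW (l' ++ l) (fun g => χ g * u g) g = 0 := image_eq_zero_of_notMem_tsupport fun h => hg (hsub h)
      rw [this, mul_zero]
  simp only [e2] at h4
  rw [← sq_abs]
  calc |VW l (fun g => χ g * u g) g| ^ 2 ≤ (∫ x, |VW (l' ++ l) (fun g => χ g * u g) x|) ^ 2 := by gcongr
    _ ≤ _ := h3
    _ ≤ (V + 1) * (C * Qs Ω k u) := mul_le_mul_of_nonneg_left h4 (add_nonneg ENNReal.toReal_nonneg zero_le_one)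
    _ = _ := by ring

end Gr

namespace Gr

variable {n : ℕ} {ι β : Type} [Fintype ι] [Fintype β] {S : Shear n ι β}

theorem Xb_pow (i) (k : ℕ) {η : Gr S → ℝ} (hη : ContDiff ℝ (⊤ : ℕ∞) η) :
    Xb S i (fun g => η g ^ (k + 1)) = fun g => (k + 1) * η g ^ k * Xb S i η g := by
  induction k with
  | zero => simp
  | succ k ih =>
    have : (fun g => η g ^ (k + 1 + 1)) = fun g => η g ^ (k + 1) * η g := by funext g; ring
    rw [this, Xb_mul i (hη.pow _) hη, ih]
    funext g; push_cast; ring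

theorem Xb_Xb_pow (i) (k : ℕ) {η : Gr S → ℝ} (hη : ContDiff ℝ (⊤ : ℕ∞) η) :
    Xb S i (Xb S i (fun g => η g ^ (k + 2))) =
      fun g => η g ^ k * ((k + 2) * ((k + 1) * Xb S i η g ^ 2 + η g * Xb S i (Xb S i η) g)) := by
  rw [Xb_pow i (k + 1) hη]
  have e : (fun g => ((k + 1 : ℕ) + 1 : ℝ) * η g ^ (k + 1) * Xb S i η g)
      = fun g => (k + 2 : ℝ) * (η g ^ (k + 1) * Xb S i η g) := by funext g; push_cast; ring
  rw [e, Xb_const_mul i _ ((hη.pow _).mul (Xb_sm i hη)), Xb_mul i (hη.pow _) (Xb_sm i hη), Xb_pow i k hη]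
  funext g; ring

theorem integral_mul_mul_le {c f g : Gr S → ℝ} {M δ : ℝ} (hδ : 0 < δ) (hc : ContDiff ℝ (⊤ : ℕ∞) c)
    (hM : ∀ x, |c x| ≤ M) (hf : TF f) (hg : TF g) :
    ∫ x, c x * f x * g x ≤ δ * (∫ x, g x ^ 2) + (4 * δ)⁻¹ * M ^ 2 * ∫ x, f x ^ 2 := by
  have h := integral_mul_le_sq hg (hf.mul_left hc) hδ
  have h2 : ∫ x, (c x * f x) ^ 2 ≤ M ^ 2 * ∫ x, f x ^ 2 := by
    rw [← integral_const_mul]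
    refine integral_mono (hf.mul_left hc).int_sq (hf.int_sq.const_mul _) fun x => ?_
    simp only [mul_pow]
    exact mul_le_mul_of_nonneg_right (sq_le_sq' (abs_le.1 (hM x)).1 (abs_le.1 (hM x)).2) (sq_nonneg _)
  have h3 := mul_le_mul_of_nonneg_left h2 (by positivity : 0 ≤ (4 * δ)⁻¹)
  have e : ∫ x, c x * f x * g x = ∫ x, g x * (c x * f x) := by congr 1; funext x; ring
  rw [e, mul_assoc]
  linarith

/-- Cutoff energy identity. -/
theorem cutoff_energy (p : ℕ) {η v : Gr S → ℝ} (hη : TF η) (hv : TF v) :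
    ∑ i, ∫ x, (η x ^ (p + 1) * Xb S i v x) ^ 2 = (∫ x, (η x ^ p * v x) * (η x ^ (p + 2) * L v x))
      + ∑ i, ∫ x, (-(2 * p + 2) * Xb S i η x) * (η x ^ p * v x) * (η x ^ (p + 1) * Xb S i v x) := by
  have hb : ContDiff ℝ (⊤ : ℕ∞) (fun x => η x ^ (2 * p + 1 + 1)) := hη.sm.pow _
  have h := integral_L_mul' hv (hb.mul hv.sm)
  have e : (∫ x, (η x ^ p * v x) * (η x ^ (p + 2) * L v x)) = ∫ x, L v x * (η x ^ (2 * p + 1 + 1) * v x) := by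
    congr 1; funext x; ring
  rw [e, h, ← Finset.sum_add_distrib]
  refine Finset.sum_congr rfl fun i _ => ?_
  have hX := Xb_TF i hv
  have hXη := (Xb_TF i hη).sm
  rw [← integral_add]
  · congr 1; funext x
    have := congrFun (Xb_mul i hb hv.sm) x
    rw [this, Xb_pow i _ hη.sm]; push_cast; ring
  · exact TF.integrable (hX.mul_right (Xb_TF i (hv.mul_left hb)).sm)
  · exact TF.integrable (((hv.mul_left (hη.sm.pow p)).mul_left (contDiff_const.mul hXη)).mul_right
      ((hη.sm.pow (p + 1)).mul hX.sm))

theorem cutoff_second (p : ℕ) {η v : Gr S → ℝ} (hη : TF η) (hv : TF v) :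
    ∫ x, (η x ^ (p + 2) * L v x) ^ 2 = (∫ x, (η x ^ p * v x) * (η x ^ (p + 4) * L (L v) x))
      + ∑ i, ((∫ x, (2 * (2 * p + 4) * Xb S i η x) * (η x ^ (p + 1) * Xb S i v x) * (η x ^ (p + 2) * L v x))
        + ∫ x, ((2 * p + 2 + 2) * ((2 * p + 2 + 1) * Xb S i η x ^ 2 + η x * Xb S i (Xb S i η) x)) *
          (η x ^ p * v x) * (η x ^ (p + 2) * L v x)) := by
  set w := L v with hw
  have hwT : TF w := L_TF hv
  have ha : ContDiff ℝ (⊤ : ℕ∞) (fun x => η x ^ (2 * p + 2 + 2)) := hη.sm.pow _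
  have haw := hwT.mul_left ha
  have e0 : ∫ x, (η x ^ (p + 2) * w x) ^ 2 = ∫ x, L v x * (η x ^ (2 * p + 2 + 2) * w x) := by
    congr 1; funext x; rw [← hw]; ring
  rw [e0, integral_L_symm hv.sm haw, L_mul ha hwT.sm]
  have hX := fun i => Xb_TF i hv
  have hXη := fun i => (Xb_TF i hη).sm
  have hXa := fun i => Xb_sm i ha
  have t1 : TF (fun x => (η x ^ p * v x) * (η x ^ (p + 4) * L w x)) :=
    (hv.mul_left (hη.sm.pow p)).mul_right ((hη.sm.pow _).mul (L_sm hwT.sm))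
  have e1 : ∀ x, v x * (η x ^ (2 * p + 2 + 2) * L w x - 2 * ∑ i, Xb S i (fun x => η x ^ (2 * p + 2 + 2)) x * Xb S i w x
      + L (fun x => η x ^ (2 * p + 2 + 2)) x * w x) = (η x ^ p * v x) * (η x ^ (p + 4) * L w x)
      + ∑ i, (-2 * ((v x * Xb S i (fun x => η x ^ (2 * p + 2 + 2)) x) * Xb S i w x)
        - v x * Xb S i (Xb S i (fun x => η x ^ (2 * p + 2 + 2))) x * w x) := fun x => by
    simp only [L, Finset.sum_sub_distrib, ← Finset.mul_sum, ← Finset.sum_mul, mul_assoc]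
    ring
  simp only [e1]
  have t2 : ∀ i, TF (fun x => v x * Xb S i (fun x => η x ^ (2 * p + 2 + 2)) x) := fun i => hv.mul_right (hXa i)
  have t3 : ∀ i, TF (fun x => -2 * ((v x * Xb S i (fun x => η x ^ (2 * p + 2 + 2)) x) * Xb S i w x)) := fun i =>
    ((t2 i).mul_right (Xb_sm i hwT.sm)).const_mul _
  have t4 : ∀ i, TF (fun x => v x * Xb S i (Xb S i (fun x => η x ^ (2 * p + 2 + 2))) x * w x) := fun i =>
    (hv.mul_right (Xb_sm i (hXa i))).mul_right hwT.sm
  have t5 := fun i => (t3 i).sub (t4 i)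
  rw [integral_add t1.integrable (TF.sum _ fun i _ => t5 i).integrable, integral_finsetSum _ fun i _ => (t5 i).integrable]
  congr 1
  refine Finset.sum_congr rfl fun i _ => ?_
  rw [integral_sub (t3 i).integrable (t4 i).integrable, integral_const_mul]
  have h := integral_Xb_mul i (t2 i).sm hwT
  have h' : ∫ x, (v x * Xb S i (fun x => η x ^ (2 * p + 2 + 2)) x) * Xb S i w x
      = - ∫ x, Xb S i (fun x => v x * Xb S i (fun x => η x ^ (2 * p + 2 + 2)) x) x * w x := by rw [h, neg_neg]
  rw [h', Xb_mul i hv.sm (hXa i)]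
  have s1 : TF (fun x => (2 * (2 * p + 4) * Xb S i η x) * (η x ^ (p + 1) * Xb S i v x) * (η x ^ (p + 2) * w x)) :=
    (((hX i).mul_left (hη.sm.pow _)).mul_left (contDiff_const.mul (hXη i))).mul_right ((hη.sm.pow _).mul hwT.sm)
  have s2 : TF (fun x => ((2 * p + 2 + 2) * ((2 * p + 2 + 1) * Xb S i η x ^ 2 + η x * Xb S i (Xb S i η) x)) *
          (η x ^ p * v x) * (η x ^ (p + 2) * w x)) :=
    ((hv.mul_left (hη.sm.pow _)).mul_left (contDiff_const.mul ((contDiff_const.mul ((hXη i).pow 2)).add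
      (hη.sm.mul (Xb_sm i (hXη i)))))).mul_right ((hη.sm.pow _).mul hwT.sm)
  have s3 : TF (fun x => (Xb S i v x * Xb S i (fun x => η x ^ (2 * p + 2 + 2)) x
      + v x * Xb S i (Xb S i (fun x => η x ^ (2 * p + 2 + 2))) x) * w x) :=
    (((hX i).mul_right (hXa i)).add (hv.mul_right (Xb_sm i (hXa i)))).mul_right hwT.sm
  rw [← integral_add s1.integrable s2.integrable, mul_neg, neg_mul, neg_neg, ← integral_const_mul,
    ← integral_sub (s3.const_mul 2).integrable (t4 i).integrable]
  congr 1; funext x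
  rw [Xb_Xb_pow i _ hη.sm, Xb_pow i (2 * p + 2 + 1) hη.sm]
  push_cast; ring

theorem TF_bdd_fin {κ : Type*} [Fintype κ] {f : κ → Gr S → ℝ} (hf : ∀ i, TF (f i)) :
    ∃ M, 0 ≤ M ∧ ∀ i x, |f i x| ≤ M := by
  choose M hM using fun i => (hf i).bdd
  refine ⟨∑ i, |M i|, Finset.sum_nonneg fun _ _ => abs_nonneg _, fun i x => (hM i x).trans ?_⟩
  exact (le_abs_self _).trans (Finset.single_le_sum (f := fun i => |M i|) (fun _ _ => abs_nonneg _) (Finset.mem_univ i))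

/-- Interpolation of weighted `L²` norms of powers of `L`. -/
theorem interpolation (p : ℕ) {η : Gr S → ℝ} (hη : TF η) {ε : ℝ} (hε : 0 < ε) :
    ∃ C, 0 ≤ C ∧ ∀ v, TF v → ∫ x, (η x ^ (p + 2) * L v x) ^ 2 ≤
      ε * (∫ x, (η x ^ (p + 4) * L (L v) x) ^ 2) + C * ∫ x, (η x ^ p * v x) ^ 2 := by
  have hXη := fun i => Xb_TF (S := S) i hη
  obtain ⟨M₁, hM₁, b1⟩ := TF_bdd_fin fun i => (hXη i).mul_left (g := fun _ => -(2 * p + 2 : ℝ)) contDiff_const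
  obtain ⟨M₂, hM₂, b2⟩ := TF_bdd_fin fun i => (hXη i).mul_left (g := fun _ => 2 * (2 * p + 4 : ℝ)) contDiff_const
  have hc : ∀ i, TF (fun x => (2 * p + 2 + 2) * ((2 * p + 2 + 1) * Xb S i η x ^ 2 + η x * Xb S i (Xb S i η) x)) := by
    intro i
    have e : (fun x => (2 * p + 2 + 2) * ((2 * p + 2 + 1) * Xb S i η x ^ 2 + η x * Xb S i (Xb S i η) x)) =
      fun x => (2 * p + 2 + 2) * ((2 * p + 2 + 1) * (Xb S i η x * Xb S i η x) + η x * Xb S i (Xb S i η) x) := by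
      funext x; ring
    rw [e]
    exact ((((hXη i).mul_left (hXη i).sm).const_mul _).add (hη.mul_right (Xb_sm i (hXη i).sm))).const_mul _
  obtain ⟨M₃, hM₃, b3⟩ := TF_bdd_fin hc
  set d : ℝ := (Fintype.card (Fin n ⊕ β) : ℝ)
  have hd : 0 ≤ d := Nat.cast_nonneg _
  obtain ⟨δ₁, hδ₁, hδ₁'⟩ : ∃ δ : ℝ, 0 < δ ∧ d * (2 * δ) ≤ 1 / 4 :=
    ⟨1 / (8 * (d + 1)), by positivity, by rw [mul_one_div, mul_div_assoc', div_le_iff₀ (by positivity)]; linarith⟩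
  set C₁ := (4 * δ₁)⁻¹ * M₂ ^ 2
  have hC₁ : 0 ≤ C₁ := by positivity
  obtain ⟨δ₂, hδ₂, hδ₂'⟩ : ∃ δ : ℝ, 0 < δ ∧ C₁ * (2 * δ) ≤ 1 / 4 :=
    ⟨1 / (8 * (C₁ + 1)), by positivity, by rw [mul_one_div, mul_div_assoc', div_le_iff₀ (by positivity)]; linarith⟩
  set C₂ := (4 * (1 / 2 : ℝ))⁻¹ * M₁ ^ 2
  set C₃ := (4 * δ₁)⁻¹ * M₃ ^ 2
  refine ⟨2 * ((4 * (ε / 2))⁻¹ + d * C₃ + C₁ * (2 * ((4 * δ₂)⁻¹ + d * C₂))), by positivity, fun v hv => ?_⟩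
  have f0 : TF (fun x => η x ^ p * v x) := hv.mul_left (hη.sm.pow _)
  have f1 : TF (fun x => η x ^ (p + 2) * L v x) := (L_TF hv).mul_left (hη.sm.pow _)
  have f2 : TF (fun x => η x ^ (p + 4) * L (L v) x) := (L_TF (L_TF hv)).mul_left (hη.sm.pow _)
  have fe : ∀ i, TF (fun x => η x ^ (p + 1) * Xb S i v x) := fun i => (Xb_TF i hv).mul_left (hη.sm.pow _)
  have g1 := cutoff_energy p hη hv
  have g2 := cutoff_second p hη hv
  have i1 := fun i => integral_mul_mul_le (one_half_pos (α := ℝ))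
    (contDiff_const.mul (hXη i).sm : ContDiff ℝ (⊤ : ℕ∞) fun x => -(2 * p + 2 : ℝ) * Xb S i η x) (b1 i) f0 (fe i)
  have i2 := fun i => integral_mul_mul_le hδ₁
    (contDiff_const.mul (hXη i).sm : ContDiff ℝ (⊤ : ℕ∞) fun x => 2 * (2 * p + 4 : ℝ) * Xb S i η x) (b2 i) (fe i) f1
  have i3 := fun i => integral_mul_mul_le hδ₁ (hc i).sm (b3 i) f0 f1
  have i4 := integral_mul_le_sq f2 f0 (half_pos hε)
  have i5 := integral_mul_le_sq f1 f0 hδ₂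
  have e4 : ∀ f g : Gr S → ℝ, ∫ x, f x * g x = ∫ x, g x * f x := fun f g => by congr 1; funext x; ring
  rw [e4] at i4 i5
  have j1 := Finset.sum_le_sum fun i (_ : i ∈ Finset.univ) => i1 i
  have j2 := Finset.sum_le_sum fun i (_ : i ∈ Finset.univ) => add_le_add (i2 i) (i3 i)
  rw [Finset.sum_add_distrib, ← Finset.mul_sum, Finset.sum_const, nsmul_eq_mul, Finset.card_univ] at j1
  simp only [Finset.sum_add_distrib, Finset.sum_const, nsmul_eq_mul, Finset.card_univ, ← Finset.mul_sum] at j2 g2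
  clear i1 i2 i3 e4
  have hA : 0 ≤ ∫ x, (η x ^ p * v x) ^ 2 := integral_nonneg fun _ => sq_nonneg _
  have hB : 0 ≤ ∫ x, (η x ^ (p + 2) * L v x) ^ 2 := integral_nonneg fun _ => sq_nonneg _
  generalize (∫ x, (η x ^ p * v x) ^ 2) = A at *
  generalize (∫ x, (η x ^ (p + 2) * L v x) ^ 2) = B at *
  generalize (∫ x, (η x ^ (p + 4) * L (L v) x) ^ 2) = D at *
  generalize (∑ i, ∫ x, (η x ^ (p + 1) * Xb S i v x) ^ 2) = E at *
  change _ ≤ _ + d * (C₂ * A) at j1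
  change _ ≤ d * (δ₁ * B) + C₁ * E + (d * (δ₁ * B) + d * (C₃ * A)) at j2
  have k1 : E ≤ 2 * δ₂ * B + 2 * ((4 * δ₂)⁻¹ + d * C₂) * A := by linarith
  have k2 := mul_le_mul_of_nonneg_left k1 hC₁
  have k3 := mul_le_mul_of_nonneg_right hδ₁' hB
  have k4 := mul_le_mul_of_nonneg_right hδ₂' hB
  linarith

theorem chain_le (η : Gr S → ℝ) (hη : TF η) (j : ℕ) : ∀ ε : ℝ, 0 < ε → ∃ C, 0 ≤ C ∧ ∀ u, TF u →
    ∫ x, (η x ^ (2 * (j + 1)) * L^[j + 1] u x) ^ 2 ≤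
      ε * (∫ x, (η x ^ (2 * (j + 2)) * L^[j + 2] u x) ^ 2) + C * ∫ x, u x ^ 2 := by
  induction j with
  | zero =>
    intro ε hε
    obtain ⟨C, hC, h⟩ := interpolation 0 hη hε
    exact ⟨C, hC, fun u hu => by simpa using h u hu⟩
  | succ j ih =>
    intro ε hε
    obtain ⟨C, hC, h⟩ := interpolation (2 * (j + 1)) hη (half_pos hε)
    obtain ⟨C', hC', h'⟩ := ih (1 / (2 * (C + 1))) (by positivity)
    refine ⟨2 * (C * C'), by positivity, fun u hu => ?_⟩
    have a := h _ (Lpow_TF (j + 1) hu)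
    have b := mul_le_mul_of_nonneg_left (h' u hu) hC
    have hB : 0 ≤ ∫ x, (η x ^ (2 * (j + 2)) * L^[j + 2] u x) ^ 2 := integral_nonneg fun _ => sq_nonneg _
    have hc : C * (1 / (2 * (C + 1))) ≤ 1 / 2 := by
      rw [mul_one_div, div_le_iff₀ (by positivity)]; linarith
    have k := mul_le_mul_of_nonneg_right hc hB
    simp only [← Function.iterate_succ_apply' (f := L)] at a
    change ∫ x, (η x ^ (2 * (j + 2)) * L^[j + 2] u x) ^ 2 ≤
      ε / 2 * (∫ x, (η x ^ (2 * (j + 3)) * L^[j + 3] u x) ^ 2) + C * _ at a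
    change ∫ x, (η x ^ (2 * (j + 2)) * L^[j + 2] u x) ^ 2 ≤
      ε * (∫ x, (η x ^ (2 * (j + 3)) * L^[j + 3] u x) ^ 2) + _
    linarith

/-- Interior control of all powers of `L` for functions with `L^M u = 0`. -/
theorem caccioppoli {Ω K : Set (Gr S)} (hΩ : IsOpen Ω) (hK : IsCompact K) (hKΩ : K ⊆ Ω) (M : ℕ) :
    ∃ C, 0 ≤ C ∧ ∀ u, TF u → (∀ x ∈ Ω, L^[M] u x = 0) → ∀ k, Qs K k u ≤ C * ∫ x, u x ^ 2 := by
  obtain ⟨η, hη, h1, hs, -⟩ := exists_cutoff hK hΩ hKΩ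
  have key : ∀ j, ∃ C, 0 ≤ C ∧ ∀ u, TF u → (∀ x ∈ Ω, L^[M] u x = 0) →
      ∫ x, (η x ^ (2 * (M - j)) * L^[M - j] u x) ^ 2 ≤ C * ∫ x, u x ^ 2 := by
    intro j
    induction j with
    | zero =>
      obtain ⟨B, hB⟩ := (hη.mul_left (g := fun _ => (1 : ℝ)) contDiff_const).bdd
      rcases Nat.eq_zero_or_pos M with rfl | hM
      · exact ⟨1, zero_le_one, fun u hu _ => by simp⟩
      refine ⟨0, le_rfl, fun u hu h => ?_⟩
      rw [zero_mul]
      refine le_of_eq ((integral_congr_ae (.of_forall fun x => ?_)).trans (integral_zero _ _))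
      by_cases hx : x ∈ Ω
      · simp [h x hx]
      · have : η x = 0 := image_eq_zero_of_notMem_tsupport fun h => hx (hs h)
        have h2 : 2 * (M - 0) ≠ 0 := by omega
        simp only [this, zero_pow h2]; simp
    | succ j ih =>
      by_cases hj : M ≤ j + 1
      · refine ⟨1, zero_le_one, fun u hu _ => ?_⟩
        rw [show M - (j + 1) = 0 by omega]; simp
      · obtain ⟨C, hC, h⟩ := ih
        obtain ⟨C', hC', h'⟩ := chain_le η hη (M - (j + 2)) 1 one_pos
        rw [show M - (j + 2) + 1 = M - (j + 1) by omega, show M - (j + 2) + 2 = M - j by omega] at h'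
        refine ⟨C + C', by positivity, fun u hu hz => ?_⟩
        have := h u hu hz
        have := h' u hu
        linarith
  choose C hC H using key
  refine ⟨∑ j ∈ Finset.range (M + 1), C j, Finset.sum_nonneg fun j _ => hC j, fun u hu hz k => ?_⟩
  have hI : 0 ≤ ∫ x, u x ^ 2 := integral_nonneg fun _ => sq_nonneg _
  have hone : ∀ x ∈ K, η x = 1 := fun x hx => h1.self_of_nhdsSet x hx
  have hmeas := hK.measurableSet
  have b : ∀ i ≤ M, ∫ x in K, (L^[i] u x) ^ 2 ≤ C (M - i) * ∫ x, u x ^ 2 := fun i hi => by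
    refine le_trans ?_ (H (M - i) u hu hz)
    rw [show M - (M - i) = i by omega, ← integral_indicator hmeas]
    have hT := Lpow_TF i hu
    refine integral_mono (hT.int_sq.indicator hmeas) (hT.mul_left (hη.sm.pow _)).int_sq fun x => ?_
    by_cases hx : x ∈ K
    · rw [Set.indicator_of_mem hx, hone x hx, one_pow, one_mul]
    · rw [Set.indicator_of_notMem hx]; exact sq_nonneg _
  have z : ∀ i, M ≤ i → ∫ x in K, (L^[i] u x) ^ 2 = 0 := fun i hi => by
    rw [← integral_indicator hmeas]
    refine (integral_congr_ae (.of_forall fun x => ?_)).trans (integral_zero _ _)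
    by_cases hx : x ∈ K
    · have : L^[i] u x = 0 := by
        obtain ⟨k, rfl⟩ := Nat.exists_eq_add_of_le' hi
        rw [Function.iterate_add_apply, Lpow_congr k hΩ (g := fun _ => 0) hz x (hKΩ hx)]
        have := congrFun (Lpow_const_mul (S := S) k 0 (f := fun _ => 0) contDiff_const) x
        simpa using this
      simp [this, hx]
    · simp [hx]
  have e : Qs K k u ≤ ∑ i ∈ Finset.range (M + 1), ∫ x in K, (L^[i] u x) ^ 2 := by
    rcases le_total k M with h | h
    · exact Qs_mono subset_rfl h hu
    · refine le_of_eq ((Finset.sum_subset (Finset.range_mono (by omega)) fun i _ hi => z i ?_).symm)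
      have := Finset.mem_range.not.1 hi; omega
  refine e.trans ?_
  rw [Finset.sum_mul, ← Finset.sum_range_reflect]
  refine Finset.sum_le_sum fun i hi => ?_
  have hi' := Finset.mem_range.1 hi
  have := b (M + 1 - 1 - i) (by omega)
  rwa [show M - (M + 1 - 1 - i) = i by omega] at this

/-- Sup bounds for derivatives of `L`-harmonic functions of order `M`. -/
theorem sup_harmonic [Nonempty ι] {Ω : Set (Gr S)} (hΩ : IsOpen Ω) {χ : Gr S → ℝ} (hχ : TF χ)
    (hs : tsupport χ ⊆ Ω) (M : ℕ) {l : List (Gr S → Gr S)} (hl : ∀ η ∈ l, ContDiff ℝ (⊤ : ℕ∞) η) :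
    ∃ C, 0 ≤ C ∧ ∀ u, TF u → (∀ x ∈ Ω, L^[M] u x = 0) →
      ∀ g, (VW l (fun g => χ g * u g) g) ^ 2 ≤ C * ∫ x, u x ^ 2 := by
  obtain ⟨K', hK', h1, h2⟩ := exists_compact_between hχ.cs hΩ hs
  obtain ⟨C, k, hC, H⟩ := sup_word isOpen_interior hχ h1 hl
  obtain ⟨C', hC', H'⟩ := caccioppoli hΩ hK' h2 M
  refine ⟨C * C', by positivity, fun u hu hz g => (H u hu g).trans ?_⟩
  rw [mul_assoc]
  exact mul_le_mul_of_nonneg_left ((Qs_mono interior_subset le_rfl hu).trans (H' u hu hz k)) hC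

end Gr

theorem exists_inner_eq {H W : Type*} [NormedAddCommGroup H] [InnerProductSpace ℝ H] [CompleteSpace H]
    [AddCommGroup W] [Module ℝ W] (A : W →ₗ[ℝ] H) (e : W →ₗ[ℝ] ℝ) (C : ℝ) (h : ∀ w, |e w| ≤ C * ‖A w‖) :
    ∃ F : H, ∀ w, inner ℝ F (A w) = e w := by
  have hker : e ∈ (LinearMap.ker A).dualAnnihilator := by
    rw [Submodule.mem_dualAnnihilator]
    intro w hw
    have := h w
    rw [LinearMap.mem_ker.1 hw, norm_zero, mul_zero] at this
    exact abs_eq_zero.1 (le_antisymm this (abs_nonneg _))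
  rw [← LinearMap.range_dualMap_eq_dualAnnihilator_ker] at hker
  obtain ⟨g, hg⟩ := hker
  have hg' : ∀ w, g (A w) = e w := fun w => by rw [← hg]; rfl
  let f : StrongDual ℝ (LinearMap.range A) := (g.domRestrict (LinearMap.range A)).mkContinuous C (by
    rintro ⟨_, w, rfl⟩
    change ‖g (A w)‖ ≤ C * ‖A w‖
    rw [hg']; exact h w)
  obtain ⟨G, hG, -⟩ := exists_extension_norm_eq _ f
  refine ⟨(InnerProductSpace.toDual ℝ H).symm G, fun w => ?_⟩
  rw [InnerProductSpace.toDual_symm_apply]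
  exact (hG ⟨A w, w, rfl⟩).trans (hg' w)

namespace Gr

variable {n : ℕ} {ι β : Type} [Fintype ι] [Fintype β] {S : Shear n ι β}

theorem poincare [NeZero n] {R : ℝ} (hR : 0 < R) {u : Gr S → ℝ} (hu : TF u)
    (hs : tsupport u ⊆ {g | ‖g‖ ≤ R}) : ∫ x, u x ^ 2 ≤ (3 * R) ^ 4 * ∫ x, L u x ^ 2 := by
  set i : Fin n ⊕ β := Sum.inl 0
  have hL := L_TF hu
  have hz : ∀ g, u (g * ((3 * R) • bv S i)) * u g = 0 := fun g => by
    by_cases h1 : g ∈ tsupport u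
    · by_cases h2 : g * ((3 * R) • bv S i) ∈ tsupport u
      · exfalso
        have a := hs h1
        have b := hs h2
        have a1 : ‖g.1 0‖ ≤ R := ((norm_le_pi_norm g.1 0).trans (norm_fst_le (E := Fin n → ℝ) (F := ι → ℝ) g)).trans a
        have b1 : ‖(g * ((3 * R) • bv S i)).1 0‖ ≤ R :=
          ((norm_le_pi_norm (g * ((3 * R) • bv S i)).1 0).trans (norm_fst_le (E := Fin n → ℝ) (F := ι → ℝ) _)).trans b
        rw [mul_fst, smul_fst, bv_inl_fst] at b1
        simp only [Pi.add_apply, Pi.smul_apply, Pi.single_eq_same, smul_eq_mul, mul_one, Real.norm_eq_abs] at a1 b1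
        have := abs_le.1 a1
        have := abs_le.1 b1
        linarith
      · rw [image_eq_zero_of_notMem_tsupport h2, zero_mul]
    · rw [image_eq_zero_of_notMem_tsupport h1, mul_zero]
  have hT := TF_mul_right ((3 * R) • bv S i) hu
  have h1 := q2_flow_le i (3 * R) hu
  have hX := Xb_TF i hu
  rw [q2_eq_ofReal (hT.sub hu).int_sq, q2_eq_ofReal hX.int_sq, ← ENNReal.ofReal_mul (sq_nonneg _),
    ENNReal.ofReal_le_ofReal_iff (mul_nonneg (sq_nonneg _) (integral_nonneg fun _ => sq_nonneg _))] at h1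
  have h2 : ∫ x, u x ^ 2 ≤ ∫ x, (u (x * ((3 * R) • bv S i)) - u x) ^ 2 :=
    integral_mono hu.int_sq (hT.sub hu).int_sq fun g => by
      have := hz g
      have := sq_nonneg (u (g * ((3 * R) • bv S i)))
      change u g ^ 2 ≤ (u (g * ((3 * R) • bv S i)) - u g) ^ 2
      nlinarith
  have h3 := Finset.single_le_sum (f := fun i => ∫ x, Xb S i u x ^ 2)
    (fun _ _ => integral_nonneg fun _ => sq_nonneg _) (Finset.mem_univ i)
  have h4 := energy hu
  have h5 := integral_mul_le_sq hu hL (a := 1 / (2 * (3 * R) ^ 2)) (by positivity)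
  have h6 := mul_le_mul_of_nonneg_left (h3.trans (h4.le.trans h5)) (sq_nonneg (3 * R))
  have e : (3 * R) ^ 2 * (1 / (2 * (3 * R) ^ 2) * (∫ x, u x ^ 2) + (4 * (1 / (2 * (3 * R) ^ 2)))⁻¹ * ∫ x, L u x ^ 2)
    = 1 / 2 * (∫ x, u x ^ 2) + (3 * R) ^ 4 / 2 * ∫ x, L u x ^ 2 := by field_simp; ring
  rw [e] at h6
  linarith

theorem poincare_pow [NeZero n] {R : ℝ} (hR : 0 < R) {u : Gr S → ℝ} (hu : TF u)
    (hs : tsupport u ⊆ {g | ‖g‖ ≤ R}) (j k : ℕ) :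
    ∫ x, (L^[j] u x) ^ 2 ≤ ((3 * R) ^ 4) ^ k * ∫ x, (L^[j + k] u x) ^ 2 := by
  induction k with
  | zero => simp
  | succ k ih =>
    have := poincare hR (Lpow_TF (j + k) hu) ((Lpow_tsupport _ _).trans hs)
    rw [← Function.iterate_succ_apply' L] at this
    refine ih.trans ((mul_le_mul_of_nonneg_left this (by positivity)).trans (le_of_eq ?_))
    rw [pow_succ ((3 * R) ^ 4) k, mul_assoc]; rfl

/-- Evaluation at the identity is controlled by high powers of `L`. -/
theorem eval_le [NeZero n] [Nonempty ι] {R : ℝ} (hR : 0 < R) : ∃ M₀ : ℕ, ∀ M, M₀ ≤ M → ∃ C, 0 ≤ C ∧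
    ∀ u : Gr S → ℝ, TF u → tsupport u ⊆ {g | ‖g‖ ≤ R} → (u 0) ^ 2 ≤ C * ∫ x, (L^[M] u x) ^ 2 := by
  obtain ⟨χ, hχ, h1, -, -⟩ := exists_cutoff (isCompact_singleton (x := (0 : Gr S))) isOpen_univ (Set.subset_univ _)
  obtain ⟨C, k, hC, H⟩ := sup_word (S := S) (Ω := Set.univ) isOpen_univ hχ (Set.subset_univ _) (l := []) (by simp)
  refine ⟨k, fun M hM => ⟨C * ∑ j ∈ Finset.range (k + 1), ((3 * R) ^ 4) ^ (M - j), by positivity, fun u hu hs => ?_⟩⟩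
  have h := H u hu 0
  have e : VW [] (fun g => χ g * u g) 0 = u 0 := by
    rw [VW_nil, h1.self_of_nhdsSet 0 rfl, one_mul]
  rw [e] at h
  refine h.trans ?_
  rw [mul_assoc, Finset.sum_mul]
  refine mul_le_mul_of_nonneg_left (Finset.sum_le_sum fun j hj => ?_) hC
  have := poincare_pow hR hu hs j (M - j)
  rw [Nat.add_sub_cancel' (by have := Finset.mem_range.1 hj; omega)] at this
  simpa using this

/-- A local square-integrable fundamental solution for a high power of `L`. -/
theorem exists_fundamental [NeZero n] [Nonempty ι] (S : Shear n ι β) (R : ℝ) : ∃ M₀ : ℕ, ∀ M, M₀ ≤ M →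
    ∃ F : Gr S → ℝ, MemLp F 2 volume ∧ Measurable F ∧ (∀ g, R < NN g → F g = 0) ∧
      ∀ u, TF u → tsupport u ⊆ {g | NN g ≤ R} → ∫ x, F x * L^[M] u x = u 0 := by
  obtain ⟨R', hR'⟩ := (isBounded_NN (S := S) R).exists_norm_le
  obtain ⟨M₀, H⟩ := eval_le (S := S) (R := |R'| + 1) (by positivity)
  refine ⟨M₀, fun M hM => ?_⟩
  obtain ⟨C, hC, h⟩ := H M hM
  let W : Submodule ℝ (Gr S → ℝ) :=
    { carrier := {u | TF u ∧ tsupport u ⊆ {g | NN g ≤ R}}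
      add_mem' := fun {u v} hu hv => ⟨hu.1.add hv.1, (tsupport_add u v).trans (Set.union_subset hu.2 hv.2)⟩
      zero_mem' := ⟨TF.zero, by simp [tsupport]⟩
      smul_mem' := fun c u hu => ⟨hu.1.const_mul c, (closure_mono (Function.support_const_smul_subset c u)).trans hu.2⟩ }
  have hadd : ∀ u v : Gr S → ℝ, TF u → TF v → L^[M] (u + v) = L^[M] u + L^[M] v := fun u v hu hv => by
    have := Lpow_sub M (hu.add hv).sm hv.sm
    simp only [add_sub_cancel_right] at this
    funext x
    have := congrFun this x
    have e : L^[M] u x = L^[M] (fun x => u x + v x) x - L^[M] v x := this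
    change L^[M] (fun x => u x + v x) x = L^[M] u x + L^[M] v x
    rw [e]; ring
  let A : W →ₗ[ℝ] Lp ℝ 2 (volume : Measure (Gr S)) :=
    { toFun := fun u => ((Lpow_TF M u.2.1).memLp (p := 2) (μ := volume)).toLp _
      map_add' := fun u v => by
        rw [← MemLp.toLp_add]
        exact MemLp.toLp_congr _ _ (.of_forall fun x => congrFun (hadd u v u.2.1 v.2.1) x)
      map_smul' := fun c u => by
        rw [RingHom.id_apply, ← MemLp.toLp_const_smul]
        exact MemLp.toLp_congr _ _ (.of_forall fun x => congrFun (Lpow_const_mul M c u.2.1.sm) x) }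
  let e : W →ₗ[ℝ] ℝ := { toFun := fun u => u.1 0, map_add' := fun u v => rfl, map_smul' := fun c u => rfl }
  obtain ⟨F, hF⟩ := exists_inner_eq A e (Real.sqrt C) (fun u => by
    refine abs_le_of_sq_le_sq ?_ (by positivity)
    rw [mul_pow, Real.sq_sqrt hC]
    change _ ≤ C * ‖((Lpow_TF M u.2.1).memLp (p := 2) (μ := volume)).toLp _‖ ^ 2
    rw [norm_toLp_sq (Lpow_TF M u.2.1)]
    exact h u u.2.1 fun g hg => (hR' g (u.2.2 hg)).trans ((le_abs_self _).trans (by linarith)))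
  have hm : MeasurableSet {g : Gr S | NN g ≤ R} := measurableSet_le continuous_NN.measurable measurable_const
  have hFm : AEStronglyMeasurable F volume := (Lp.memLp F).1
  have hae := hFm.ae_eq_mk
  refine ⟨{g | NN g ≤ R}.indicator (hFm.mk F), ((Lp.memLp F).ae_eq hae).indicator hm,
    hFm.stronglyMeasurable_mk.measurable.indicator hm,
    fun g hg => Set.indicator_of_notMem (s := {g | NN g ≤ R}) (not_le.2 hg) _, fun u hu hs => ?_⟩
  have h1 := hF ⟨u, hu, hs⟩
  rw [L2.inner_def] at h1
  refine Eq.trans ?_ h1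
  refine integral_congr_ae ?_
  filter_upwards [hae, ((Lpow_TF M hu).memLp (p := 2) (μ := volume)).coeFn_toLp] with x hx hx2
  have hx3 : (A ⟨u, hu, hs⟩) x = L^[M] u x := hx2
  rw [hx3]
  by_cases hxB : x ∈ {g : Gr S | NN g ≤ R}
  · rw [Set.indicator_of_mem hxB, ← hx]
    exact mul_comm _ _
  · have : L^[M] u x = 0 := image_eq_zero_of_notMem_tsupport fun h => hxB (hs (Lpow_tsupport _ _ h))
    rw [this]; simp

end Gr

namespace Gr

variable {n : ℕ} {ι β : Type} [Fintype ι] [Fintype β] {S : Shear n ι β} {I : Type*}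

/-- Families of test functions with a common support and uniformly bounded derivatives. -/
structure UB (f : I → Gr S → ℝ) : Prop where
  tf : ∀ i, TF (f i)
  supp : ∃ R, ∀ i g, R < NN g → f i g = 0
  bdd : ∀ l : List (Gr S → Gr S), (∀ η ∈ l, ContDiff ℝ (⊤ : ℕ∞) η) → ∃ B, ∀ i g, |VW l (f i) g| ≤ B

variable {f f' : I → Gr S → ℝ}

theorem UB.add (h : UB f) (h' : UB f') : UB (fun i g => f i g + f' i g) where
  tf i := (h.tf i).add (h'.tf i)
  supp := by
    obtain ⟨R, hR⟩ := h.supp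
    obtain ⟨R', hR'⟩ := h'.supp
    refine ⟨max R R', fun i g hg => ?_⟩
    rw [hR i g ((le_max_left _ _).trans_lt hg), hR' i g ((le_max_right _ _).trans_lt hg), add_zero]
  bdd l hl := by
    obtain ⟨B, hB⟩ := h.bdd l hl
    obtain ⟨B', hB'⟩ := h'.bdd l hl
    refine ⟨B + B', fun i g => ?_⟩
    rw [VW_add hl (h.tf i).sm (h'.tf i).sm]
    exact (abs_add_le _ _).trans (add_le_add (hB i g) (hB' i g))

theorem UB.const_mul (h : UB f) (c : ℝ) : UB (fun i g => c * f i g) where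
  tf i := (h.tf i).const_mul c
  supp := by
    obtain ⟨R, hR⟩ := h.supp
    exact ⟨R, fun i g hg => by rw [hR i g hg, mul_zero]⟩
  bdd l hl := by
    obtain ⟨B, hB⟩ := h.bdd l hl
    refine ⟨|c| * B, fun i g => ?_⟩
    rw [VW_const_mul hl c (h.tf i).sm, abs_mul]
    exact mul_le_mul_of_nonneg_left (hB i g) (abs_nonneg _)

theorem UB.zero : UB (fun (_ : I) (_ : Gr S) => (0 : ℝ)) where
  tf _ := TF.zero
  supp := ⟨0, fun _ _ _ => rfl⟩
  bdd l hl := ⟨0, fun _ g => by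
    have := congrFun (VW_const_mul hl 0 (f := fun _ : Gr S => (0 : ℝ)) contDiff_const) g
    simp only [zero_mul] at this
    rw [this, abs_zero]⟩

theorem UB.sum {α : Type*} (s : Finset α) {F : α → I → Gr S → ℝ} (h : ∀ a ∈ s, UB (F a)) :
    UB (fun i g => ∑ a ∈ s, F a i g) := by
  classical
  induction s using Finset.induction_on with
  | empty => simpa using UB.zero
  | insert a s ha ih =>
    simp only [Finset.sum_insert ha]
    exact (h a (Finset.mem_insert_self _ _)).add (ih fun b hb => h b (Finset.mem_insert_of_mem hb))

theorem isOpen_NN_gt (R : ℝ) : IsOpen {g : Gr S | R < NN g} := isOpen_lt continuous_const continuous_NN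

theorem isOpen_NN_lt (R : ℝ) : IsOpen {g : Gr S | NN g < R} := isOpen_lt continuous_NN continuous_const

theorem VF_eq_zero_of_NN {η : Gr S → Gr S} {u : Gr S → ℝ} {R : ℝ} (h : ∀ g, R < NN g → u g = 0)
    {g : Gr S} (hg : R < NN g) : VF η u g = 0 := by
  rw [VF_congr (g := fun _ => (0 : ℝ)) (Filter.eventually_of_mem ((isOpen_NN_gt R).mem_nhds hg) h)]
  simp [VF]

theorem UB.field (h : UB f) {η : Gr S → Gr S} (hη : ContDiff ℝ (⊤ : ℕ∞) η) :
    UB (fun i => VF η (f i)) where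
  tf i := VF_TF hη (h.tf i)
  supp := by
    obtain ⟨R, hR⟩ := h.supp
    exact ⟨R, fun i g hg => VF_eq_zero_of_NN (hR i) hg⟩
  bdd l hl := by
    obtain ⟨B, hB⟩ := h.bdd (l ++ [η]) (by simpa [or_imp, forall_and] using ⟨hl, hη⟩)
    refine ⟨B, fun i g => ?_⟩
    have := hB i g
    rwa [VW_append, VW_cons, VW_nil] at this

theorem UB.xb (h : UB f) (b) : UB (fun i => Xb S b (f i)) := h.field (fld_sm _)

theorem UB.L (h : UB f) : UB (fun i => L (f i)) := by
  have := (UB.sum Finset.univ fun b _ => (h.xb b).xb b).const_mul (-1)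
  simp only [neg_one_mul] at this
  exact this

theorem UB.Lpow (h : UB f) (k : ℕ) : UB (fun i => Gr.L^[k] (f i)) := by
  induction k with
  | zero => exact h
  | succ k ih => simpa only [Function.iterate_succ_apply'] using ih.L

theorem UB.word (h : UB f) (l : List (Fin n ⊕ β)) : UB (fun i => (l.map (Xb S)).foldr (· ∘ ·) id (f i)) := by
  induction l with
  | nil => exact h
  | cons b l ih => exact ih.xb b

/-- Pullback of a vector field under inversion. -/
noncomputable def ivf (η : Gr S → Gr S) (y : Gr S) : Gr S :=
  (fderiv ℝ (fun g : Gr S => g⁻¹) y⁻¹ : Gr S →L[ℝ] Gr S) (η y⁻¹)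

theorem inv_sm : ContDiff ℝ (⊤ : ℕ∞) (fun g : Gr S => g⁻¹) := contDiff_inv contDiff_id

theorem ivf_sm {η : Gr S → Gr S} (hη : ContDiff ℝ (⊤ : ℕ∞) η) : ContDiff ℝ (⊤ : ℕ∞) (ivf η) :=
  ((sm_fderiv (inv_sm (S := S))).comp inv_sm).clm_apply (hη.comp inv_sm)

theorem VF_inv (η : Gr S → Gr S) {u : Gr S → ℝ} (hu : ContDiff ℝ (⊤ : ℕ∞) u) :
    VF η (fun g => u g⁻¹) = fun g => VF (ivf η) u g⁻¹ := by
  funext g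
  have hc : HasFDerivAt (fun g : Gr S => u g⁻¹) _ g :=
    HasFDerivAt.comp (f := fun g : Gr S => g⁻¹) g (sm_diff hu g⁻¹).hasFDerivAt
      ((inv_sm (S := S)).differentiable sm_ne_zero g).hasFDerivAt
  simp only [VF, ivf, inv_inv]
  rw [hc.fderiv]
  rfl

theorem VW_inv (l : List (Gr S → Gr S)) (hl : ∀ η ∈ l, ContDiff ℝ (⊤ : ℕ∞) η) {u : Gr S → ℝ}
    (hu : ContDiff ℝ (⊤ : ℕ∞) u) :
    VW l (fun g => u g⁻¹) = fun g => VW (l.map ivf) u g⁻¹ := by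
  induction l with
  | nil => rfl
  | cons η l ih =>
    have hl' : ∀ ξ ∈ l, ContDiff ℝ (⊤ : ℕ∞) ξ := fun ξ h => hl ξ (List.mem_cons_of_mem _ h)
    rw [VW_cons, ih hl', List.map_cons, VW_cons, VF_inv]
    refine VW_sm (fun ξ h => ?_) hu
    obtain ⟨ζ, hζ, rfl⟩ := List.mem_map.1 h
    exact ivf_sm (hl' ζ hζ)

theorem UB.inv (h : UB f) : UB (fun i g => f i g⁻¹) where
  tf i := TF_inv (h.tf i)
  supp := by
    obtain ⟨R, hR⟩ := h.supp
    exact ⟨R, fun i g hg => hR i _ (by rwa [NN_inv])⟩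
  bdd l hl := by
    obtain ⟨B, hB⟩ := h.bdd (l.map ivf) (fun ξ h => by
      obtain ⟨ζ, hζ, rfl⟩ := List.mem_map.1 h
      exact ivf_sm (hl ζ hζ))
    refine ⟨B, fun i g => ?_⟩
    rw [VW_inv l hl (h.tf i).sm]
    exact hB i _

theorem abs_co_le (v : Gr S) (i) : |co v i| ≤ ‖v‖ := by
  rcases i with j | c
  · exact (norm_le_pi_norm v.1 j).trans (norm_fst_le v)
  · exact (norm_le_pi_norm v.2 c).trans (norm_snd_le v)

theorem exists_fld_bound (R : ℝ) : ∃ C, 0 ≤ C ∧ ∀ g h : Gr S, NN g ≤ R → ‖h‖ ≤ 1 → ‖fld h g‖ ≤ C * ‖h‖ := by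
  have hc : Continuous fun p : Gr S × Gr S => fld p.1 p.2 :=
    (continuous_fst.fst).prodMk (cont_rho_app S (continuous_snd.fst) (continuous_fst.snd))
  obtain ⟨C, hC⟩ := ((isCompact_closedBall (0 : Gr S) 1).prod (isCompact_NN R)).exists_bound_of_continuousOn
    hc.continuousOn
  refine ⟨max C 0, le_max_right _ _, fun g h hg _ => ?_⟩
  rcases eq_or_ne h 0 with rfl | h0
  · have : fld (0 : Gr S) g = 0 := Gr.ext' rfl (map_zero (S.ρ g.1))
    simp [this]
  · have hn : 0 < ‖h‖ := norm_pos_iff.2 h0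
    have e : fld h g = ‖h‖ • fld (‖h‖⁻¹ • h) g := by
      refine Gr.ext' ?_ ?_
      · change h.1 = ‖h‖ • (‖h‖⁻¹ • h.1)
        rw [smul_smul, mul_inv_cancel₀ hn.ne', one_smul]
      · change S.ρ g.1 h.2 = ‖h‖ • S.ρ g.1 (‖h‖⁻¹ • h.2)
        rw [map_smul, smul_smul, mul_inv_cancel₀ hn.ne', one_smul]
    rw [e, norm_smul, norm_norm, mul_comm]
    refine mul_le_mul_of_nonneg_right ((hC (‖h‖⁻¹ • h, g) ⟨?_, hg⟩).trans (le_max_left _ _)) hn.le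
    rw [mem_closedBall_zero_iff, norm_smul, norm_inv, norm_norm, inv_mul_cancel₀ hn.ne']

theorem UB.abs_le (h : UB f) : ∃ B, 0 ≤ B ∧ ∀ i g, |f i g| ≤ B := by
  obtain ⟨B, hB⟩ := h.bdd [] (by simp)
  exact ⟨max B 0, le_max_right _ _, fun i g => (hB i g).trans (le_max_left _ _)⟩

theorem UB.lipR (h : UB f) : ∃ B, 0 ≤ B ∧ ∀ i g k, |f i (g * k) - f i g| ≤ B * NN k := by
  obtain ⟨κ, hκ, hm⟩ := NN_mul_le S
  obtain ⟨R, hR⟩ := h.supp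
  obtain ⟨B₀, hB₀, h0⟩ := h.abs_le
  have hd : ∀ j, ∃ B, 0 ≤ B ∧ ∀ i g, |VF (fun _ => fr S j) (f i) g| ≤ B :=
    fun j => (h.field contDiff_const).abs_le
  choose B hB H using hd
  obtain ⟨C, hC, hfld⟩ := exists_fld_bound (S := S) (κ * (R + 1))
  have hD : ∀ i x, ‖fderiv ℝ (f i) x‖ ≤ ∑ j, B j := fun i x =>
    ContinuousLinearMap.opNorm_le_bound _ (Finset.sum_nonneg fun j _ => hB j) fun v => by
      have e : fderiv ℝ (f i) x v = _ := congrFun (VF_frame (fun _ => v) (f i)) x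
      rw [e, Finset.sum_mul]
      refine (Finset.abs_sum_le_sum_abs _ _).trans (Finset.sum_le_sum fun j _ => ?_)
      rw [abs_mul, mul_comm]
      exact mul_le_mul (H j i x) (abs_co_le v j) (abs_nonneg _) (hB j)
  refine ⟨2 * B₀ + (∑ j, B j) * C, add_nonneg (by positivity)
    (mul_nonneg (Finset.sum_nonneg fun j _ => hB j) hC), fun i g k => ?_⟩
  have hk := NN_nonneg k
  have hS : 0 ≤ (∑ j, B j) * C := mul_nonneg (Finset.sum_nonneg fun j _ => hB j) hC
  have hb : |f i (g * k) - f i g| ≤ 2 * B₀ := by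
    refine (abs_sub _ _).trans ?_
    have := h0 i (g * k); have := h0 i g; linarith
  rcases le_total (NN k) 1 with hk1 | hk1
  · by_cases hg : NN g ≤ κ * (R + 1)
    · have h1 := Convex.norm_image_sub_le_of_norm_fderiv_le (𝕜 := ℝ) (s := Set.univ) (x := g) (y := g * k)
        (fun x _ => sm_diff (h.tf i).sm x) (fun x _ => hD i x) convex_univ trivial trivial
      have e : g * k - g = fld k g := by
        have := mul_smul_eq g k 1
        rw [one_smul, one_smul] at this
        rw [this, add_sub_cancel_left]
      rw [e] at h1
      have h2 := hfld g k hg ((norm_le_NN hk1).trans hk1)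
      have h3 := mul_le_mul_of_nonneg_left (h2.trans (mul_le_mul_of_nonneg_left (norm_le_NN hk1) hC))
        (Finset.sum_nonneg fun j (_ : j ∈ Finset.univ) => hB j)
      have h4 : 0 ≤ 2 * B₀ * NN k := by positivity
      have h5 : |f i (g * k) - f i g| ≤ _ := h1.trans h3
      linarith
    · have hg' := not_le.1 hg
      have a1 : R < NN g := by
        by_contra hc
        have hN : 0 ≤ R := (NN_nonneg g).trans (not_lt.1 hc)
        nlinarith [not_lt.1 hc]
      have a2 : R < NN (g * k) := by
        have := hm (g * k) k⁻¹
        rw [mul_inv_cancel_right, NN_inv] at this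
        have h6 := lt_of_mul_lt_mul_left (hg'.trans_le this) (by linarith)
        linarith
      rw [hR i _ a1, hR i _ a2, sub_zero, abs_zero]
      positivity
  · have h4 : 2 * B₀ * 1 ≤ 2 * B₀ * NN k := mul_le_mul_of_nonneg_left hk1 (by positivity)
    have h5 := mul_nonneg hS hk
    linarith

theorem UB.lipL (h : UB f) : ∃ B, 0 ≤ B ∧ ∀ i g k, |f i (k * g) - f i g| ≤ B * NN k := by
  obtain ⟨B, hB, H⟩ := h.inv.lipR
  refine ⟨B, hB, fun i g k => ?_⟩
  have := H i g⁻¹ k⁻¹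
  rwa [NN_inv, inv_inv, mul_inv_rev, inv_inv, inv_inv] at this

/-- Dilates of a mean-zero uniformly bounded family are bumps, uniformly in the scale. -/
theorem UB.bump (h : UB f) (hm : ∀ i, ∫ g, f i g = 0) : ∃ (A : ℝ) (c : ℕ), 0 ≤ A ∧ ∀ i (r : ℝ), 0 < r →
    IsBump (hn S) A (2 ^ c * r) (fun g => (r⁻¹) ^ hdim S * f i (dil S r⁻¹ g)) := by
  obtain ⟨R, hR⟩ := h.supp
  obtain ⟨B₀, hB₀, h0⟩ := h.abs_le
  obtain ⟨B₁, hB₁, h1⟩ := h.lipR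
  obtain ⟨B₂, hB₂, h2⟩ := h.lipL
  obtain ⟨c, hc⟩ := pow_unbounded_of_one_lt R (one_lt_two)
  set P : ℝ := 2 ^ c with hP
  have hP1 : 1 ≤ P := one_le_pow₀ one_le_two
  have hP0 : 0 < P := by linarith
  set A := (B₀ + B₁ + B₂) * P ^ (hdim S + 1) with hA
  have hPP : P ^ hdim S ≤ P ^ (hdim S + 1) := pow_le_pow_right₀ hP1 (Nat.le_succ _)
  refine ⟨A, c, by positivity, fun i r hr => ?_⟩
  have hQ : 0 < r⁻¹ ^ hdim S := by positivity
  have key : ∀ B, 0 ≤ B → B ≤ B₀ + B₁ + B₂ → ∀ g : Gr S,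
      r⁻¹ ^ hdim S * (B * (r⁻¹ * NN g)) ≤ A / (P * r) ^ (hdim S + 1) * NN g := fun B hB hB' g => by
    have : A / (P * r) ^ (hdim S + 1) = (B₀ + B₁ + B₂) * (r⁻¹ ^ hdim S * r⁻¹) := by
      rw [hA, mul_pow, ← pow_succ, inv_pow]; field_simp
    rw [this]
    have h3 := mul_le_mul_of_nonneg_right hB'
      (mul_nonneg (by positivity : 0 ≤ r⁻¹ ^ hdim S * r⁻¹) (NN_nonneg g))
    linarith
  exact
    { meas := (continuous_const.mul (TF_dil (S := S) (inv_ne_zero hr.ne') (h.tf i)).continuous).measurable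
      supp := fun g hg => by
        change P * r ≤ NN g at hg
        rw [hR i, mul_zero]
        rw [NN_dil (by positivity), lt_inv_mul_iff₀ hr]
        nlinarith
      bdd := fun g => by
        change _ ≤ A / (P * r) ^ hdim S
        rw [abs_mul, abs_of_pos hQ, hA, mul_pow, inv_pow, le_div_iff₀ (by positivity)]
        have h3 := h0 i (dil S r⁻¹ g)
        have h4 : B₀ * P ^ hdim S ≤ (B₀ + B₁ + B₂) * P ^ (hdim S + 1) :=
          mul_le_mul (by linarith) hPP (by positivity) (by positivity)
        have h5 := mul_le_mul_of_nonneg_right h3 (by positivity : 0 ≤ P ^ hdim S)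
        have e : (r ^ hdim S)⁻¹ * |f i (dil S r⁻¹ g)| * (P ^ hdim S * r ^ hdim S)
          = |f i (dil S r⁻¹ g)| * P ^ hdim S := by field_simp
        rw [e]; exact h5.trans h4
      lipR := fun g k => by
        change _ ≤ A / (P * r) ^ (hdim S + 1) * NN k
        rw [← mul_sub, abs_mul, abs_of_pos hQ, dil_mul]
        refine le_trans (mul_le_mul_of_nonneg_left (h1 i _ _) hQ.le) ?_
        rw [NN_dil (by positivity)]
        exact key B₁ hB₁ (by linarith) k
      lipL := fun g k => by
        change _ ≤ A / (P * r) ^ (hdim S + 1) * NN k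
        rw [← mul_sub, abs_mul, abs_of_pos hQ, dil_mul]
        refine le_trans (mul_le_mul_of_nonneg_left (h2 i _ _) hQ.le) ?_
        rw [NN_dil (by positivity)]
        exact key B₂ hB₂ (by linarith) k
      mean := by
        rw [integral_const_mul, integral_dil (by positivity) (f i), hm i, mul_zero, mul_zero] }

end Gr

namespace Gr

variable {n : ℕ} {ι β : Type} [Fintype ι] [Fintype β] {S : Shear n ι β}

theorem contDiff_param_integral {K : Gr S → Gr S → ℝ}
    (hK : ContDiff ℝ (⊤ : ℕ∞) fun p : Gr S × Gr S => K p.1 p.2) {F : Gr S → ℝ} (hF : Integrable F)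
    {R : ℝ} (hs : ∀ g, R < NN g → F g = 0) : ContDiff ℝ (⊤ : ℕ∞) fun g => ∫ k, K g k * F k := by
  obtain ⟨χ, hχ, h1, -, -⟩ := exists_cutoff (isCompact_NN (S := S) R) isOpen_univ (Set.subset_univ _)
  have hG : ContDiff ℝ (⊤ : ℕ∞) fun p : Gr S × Gr S => K p.1 (-p.2) * χ (-p.2) :=
    (ContDiff.comp (g := fun p : Gr S × Gr S => K p.1 p.2) (f := fun p : Gr S × Gr S => (p.1, -p.2)) hK
      (_root_.contDiff_fst.prodMk _root_.contDiff_snd.neg)).mul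
      (ContDiff.comp (f := fun p : Gr S × Gr S => -p.2) hχ.sm _root_.contDiff_snd.neg)
  have h := contDiffOn_convolution_right_with_param (𝕜 := ℝ) (n := ⊤) (μ := (volume : Measure (Gr S)))
    (ContinuousLinearMap.mul ℝ ℝ) (f := F) (g := fun p x : Gr S => K p (-x) * χ (-x))
    (s := Set.univ) (k := (fun x : Gr S => -x) ⁻¹' tsupport χ) isOpen_univ
    ((Homeomorph.neg (Gr S)).isCompact_preimage.2 hχ.cs)
    (fun p x _ hx => by rw [image_eq_zero_of_notMem_tsupport hx, mul_zero])
    hF.locallyIntegrable hG.contDiffOn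
  rw [Set.univ_prod_univ, contDiffOn_univ] at h
  have h2 := h.comp (contDiff_id.prodMk (contDiff_const (c := (0 : Gr S))))
  convert h2 using 1
  funext g
  simp only [Function.comp_apply, id, convolution, zero_sub, neg_neg, ContinuousLinearMap.mul_apply']
  refine integral_congr_ae (.of_forall fun k => ?_)
  by_cases hk : NN k ≤ R
  · have : χ k = 1 := h1.self_of_nhdsSet k hk
    simp only [this]; ring
  · simp only [hs k (not_le.1 hk)]; ring

theorem _root_.TF.isKer {ρ : Gr S → ℝ} (h : TF ρ) : IsKer (hn S) ρ where
  meas := h.continuous.measurable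
  bdd := h.bdd
  supp := by
    obtain ⟨C, hC⟩ := h.cs.exists_bound_of_continuousOn continuous_NN.continuousOn
    refine ⟨C + 1, fun g hg => image_eq_zero_of_notMem_tsupport fun hm => ?_⟩
    have h1 := (le_abs_self _).trans (hC g hm)
    have h2 : C + 1 ≤ NN g := hg
    linarith

/-- A normalized test function supported near the identity. -/
theorem exists_mollifier (S : Shear n ι β) {r : ℝ} (hr : 0 < r) : ∃ ρ : Gr S → ℝ, TF ρ ∧ (∀ g, 0 ≤ ρ g) ∧
    ∫ g, ρ g = 1 ∧ ∀ g, r ≤ NN g → ρ g = 0 := by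
  obtain ⟨χ, hχ, h1, h2, h3⟩ := exists_cutoff (isCompact_singleton (x := (0 : Gr S))) (isOpen_NN_lt r)
    (by rintro _ rfl; change NN 0 < r; rwa [NN_zero])
  have hpos : 0 < ∫ g, χ g := hχ.continuous.integral_pos_of_hasCompactSupport_nonneg_nonzero hχ.cs
    (fun g => (h3 g).1) (x := 0) (by rw [h1.self_of_nhdsSet 0 rfl]; exact one_ne_zero)
  refine ⟨fun g => (∫ g, χ g)⁻¹ * χ g, hχ.const_mul _, fun g => mul_nonneg (inv_nonneg.2 hpos.le) (h3 g).1,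
    by rw [integral_const_mul, inv_mul_cancel₀ hpos.ne'], fun g hg => ?_⟩
  change _ * χ g = 0
  rw [image_eq_zero_of_notMem_tsupport fun hm => absurd (h2 hm) (not_lt.2 hg), mul_zero]

variable {ρ F : Gr S → ℝ} {R a b : ℝ}

theorem integrable_of_memLp_two (hF : MemLp F 2 volume) (hs : ∀ g, R < NN g → F g = 0) : Integrable F := by
  have hK := isCompact_NN (S := S) R
  have : MemLp F 1 (volume.restrict {g | NN g ≤ R}) := by
    haveI : IsFiniteMeasure ((volume : Measure (Gr S)).restrict {g | NN g ≤ R}) :=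
      ⟨by rw [Measure.restrict_apply_univ]; exact hK.measure_lt_top⟩
    exact (hF.restrict _).mono_exponent one_le_two
  refine ((integrableOn_iff_integrable_of_support_subset fun g hg => ?_).1 (memLp_one_iff_integrable.1 this))
  exact not_lt.1 fun h => hg (hs g h)

theorem gconv_support {κ : ℝ} (hm : ∀ g h : Gr S, NN (g * h) ≤ κ * (NN g + NN h)) (hκ : 1 ≤ κ)
    (hρ : ∀ g, a ≤ NN g → ρ g = 0) (hs : ∀ g, R < NN g → F g = 0) {g : Gr S} (hg : κ * (a + R) < NN g) :
    gconv volume ρ F g = 0 := by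
  refine (integral_congr_ae (.of_forall fun k => ?_)).trans (integral_zero _ _)
  by_cases hk : R < NN k
  · simp only [hs k hk, mul_zero]
  · have h1 := hm (g * k⁻¹) k
    rw [inv_mul_cancel_right] at h1
    have h2 : a + R < NN (g * k⁻¹) + NN k := lt_of_mul_lt_mul_left (hg.trans_le h1) (by linarith)
    simp only [hρ (g * k⁻¹) (by linarith [not_lt.1 hk]), zero_mul]

theorem gconv_TF (hρ : TF ρ) (hF : Integrable F) (hs : ∀ g, R < NN g → F g = 0) : TF (gconv volume ρ F) := by
  obtain ⟨κ, hκ, hm⟩ := NN_mul_le S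
  obtain ⟨a, ha⟩ := hρ.isKer.supp
  refine ⟨contDiff_param_integral (K := fun g k => ρ (g * k⁻¹))
    (hρ.sm.comp (contDiff_mul _root_.contDiff_fst (contDiff_inv _root_.contDiff_snd))) hF hs,
    HasCompactSupport.intro (isCompact_NN (κ * (a + R))) fun g hg => gconv_support hm hκ ha hs (not_le.1 hg)⟩

theorem integral_gconv_sq_le (hρ : TF ρ) (h0 : ∀ g, 0 ≤ ρ g) (h1 : ∫ g, ρ g = 1) (hF : MemLp F 2 volume)
    (hs : ∀ g, R < NN g → F g = 0) : ∫ g, gconv volume ρ F g ^ 2 ≤ ∫ g, F g ^ 2 := by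
  have hi : MemLp (fun g => F g⁻¹) 2 volume :=
    hF.comp_measurePreserving (Measure.measurePreserving_inv (volume : Measure (Gr S)))
  have hm := memLp_gconv hi (TF_inv hρ).isKer
  have e1 : ∫ h, |ρ h⁻¹| = 1 := by
    rw [← h1, ← integral_inv_eq_self ρ]
    exact integral_congr_ae (.of_forall fun g => abs_of_nonneg (h0 _))
  have e2 : ∀ u : Gr S → ℝ, ∫ g, u g⁻¹ ^ 2 = ∫ g, u g ^ 2 := fun u =>
    integral_inv_eq_self (fun g => u g ^ 2) (volume : Measure (Gr S))
  have h2 := hm.2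
  rw [e1, ENNReal.ofReal_one, one_mul, eLpNorm_two_sq hm.1, eLpNorm_two_sq hi,
    ENNReal.ofReal_le_ofReal_iff (Real.sqrt_nonneg _),
    Real.sqrt_le_sqrt_iff (integral_nonneg fun _ => sq_nonneg _), e2] at h2
  refine le_trans (le_of_eq ?_) h2
  rw [← e2]
  exact integral_congr_ae (.of_forall fun g => by simp only [gconv_inv])

theorem weak_pairing (hρ : TF ρ) (hF : Integrable F) {u : Gr S → ℝ} (hu : TF u) (M : ℕ)
    (H : ∀ h, ρ h ≠ 0 → ∫ k, F k * L^[M] (fun k => u (h * k)) k = u h) :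
    ∫ g, gconv volume ρ F g * L^[M] u g = ∫ g, ρ g * u g := by
  have hL := Lpow_TF M hu
  obtain ⟨A, hA⟩ := hρ.bdd
  obtain ⟨B, hB⟩ := hL.bdd
  have c1 : Continuous fun p : Gr S × Gr S => ρ (p.1 * p.2⁻¹) :=
    hρ.continuous.comp (continuous_fst.mul continuous_snd.inv)
  have c2 : Continuous fun p : Gr S × Gr S => L^[M] u (p.1 * p.2) :=
    hL.continuous.comp (continuous_fst.mul continuous_snd)
  have i1 : Integrable (fun p : Gr S × Gr S => ρ (p.1 * p.2⁻¹) * (L^[M] u p.1 * F p.2)) (volume.prod volume) :=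
    (hL.integrable.mul_prod hF).bdd_mul c1.aestronglyMeasurable (.of_forall fun p => hA _)
  have i2 : Integrable (fun p : Gr S × Gr S => L^[M] u (p.1 * p.2) * (ρ p.1 * F p.2)) (volume.prod volume) :=
    (hρ.integrable.mul_prod hF).bdd_mul c2.aestronglyMeasurable (.of_forall fun p => hB _)
  calc ∫ g, gconv volume ρ F g * L^[M] u g
      = ∫ g, ∫ k, ρ (g * k⁻¹) * (L^[M] u g * F k) := by
        refine integral_congr_ae (.of_forall fun g => ?_)
        simp only [gconv]
        rw [← integral_mul_const]
        exact integral_congr_ae (.of_forall fun k => by ring)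
    _ = ∫ k, ∫ g, ρ (g * k⁻¹) * (L^[M] u g * F k) := integral_integral_swap i1
    _ = ∫ k, ∫ h, L^[M] u (h * k) * (ρ h * F k) := by
        refine integral_congr_ae (.of_forall fun k => ?_)
        simp only
        rw [← integral_mul_right_eq_self (fun g => ρ (g * k⁻¹) * (L^[M] u g * F k)) k]
        refine integral_congr_ae (.of_forall fun h => ?_)
        simp only [mul_inv_cancel_right]; ring
    _ = ∫ h, ∫ k, L^[M] u (h * k) * (ρ h * F k) := (integral_integral_swap i2).symm
    _ = ∫ g, ρ g * u g := by
        refine integral_congr_ae (.of_forall fun h => ?_)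
        simp only
        by_cases hz : ρ h = 0
        · simp [hz]
        · rw [← H h hz, ← integral_const_mul]
          refine integral_congr_ae (.of_forall fun k => ?_)
          simp only [Lpow_mul_left M h hu.sm]; ring

/-- `F` inverts `L ^ M` on test functions supported in the ball of radius `R`. -/
def Fund (F : Gr S → ℝ) (M : ℕ) (R : ℝ) : Prop :=
  ∀ u, TF u → tsupport u ⊆ {g | NN g ≤ R} → ∫ x, F x * L^[M] u x = u 0

theorem Lpow_gconv {κ : ℝ} (hm : ∀ g h : Gr S, NN (g * h) ≤ κ * (NN g + NN h)) (hκ : 1 ≤ κ)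
    (hρ : TF ρ) (ha : ∀ g, a ≤ NN g → ρ g = 0) (hF : Integrable F) (hs : ∀ g, R < NN g → F g = 0)
    {M : ℕ} {r : ℝ} (hfun : Fund F M r) (hr : κ * (a + b) ≤ r) :
    ∀ g, NN g < b → L^[M] (gconv volume ρ F) g = ρ g := by
  have hw := gconv_TF hρ hF hs
  have hD := (Lpow_TF M hw).sub hρ
  have hU := isOpen_NN_lt (S := S) b
  have hae := hU.ae_eq_zero_of_integral_contDiff_smul_eq_zero (μ := volume)
    (hD.integrable.locallyIntegrable.locallyIntegrableOn _) (fun u hu hc hsu => by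
      have hT : TF u := ⟨hu, hc⟩
      have e := weak_pairing hρ hF hT M fun h hh => by
        have h1 := hfun (fun k => u (h * k)) (TF_mul_left h hT) ?_
        · rw [h1, ← one_eq_zero, mul_one]
        · refine closure_minimal (fun k hk => ?_) (isCompact_NN r).isClosed
          have h2 : NN (h * k) < b := hsu (subset_tsupport _ hk)
          have h3 : NN h < a := not_le.1 fun h' => hh (ha h h')
          have h4 := hm h⁻¹ (h * k)
          rw [inv_mul_cancel_left, NN_inv] at h4
          exact h4.trans ((mul_le_mul_of_nonneg_left (by linarith) (by linarith)).trans hr)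
      rw [← integral_Lpow_symm M hw.sm hT, ← sub_eq_zero, ← integral_sub
        ((Lpow_TF M hw).mul_right hu).integrable (hρ.mul_right hu).integrable] at e
      rw [← e]
      exact integral_congr_ae (.of_forall fun x => by ring))
  have := Measure.eqOn_open_of_ae_eq (μ := (volume : Measure (Gr S)))
    (f := fun x => L^[M] (gconv volume ρ F) x - ρ x) (g := fun _ => 0)
    ((ae_restrict_iff' hU.measurableSet).2 hae) hU hD.continuous.continuousOn continuousOn_const
  exact fun g hg => sub_eq_zero.1 (this hg)

end Gr

namespace Gr

variable {n : ℕ} {ι β : Type} [Fintype ι] [Fintype β] {S : Shear n ι β}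

theorem Lpow_add (k : ℕ) {f g : Gr S → ℝ} (hf : ContDiff ℝ (⊤ : ℕ∞) f) (hg : ContDiff ℝ (⊤ : ℕ∞) g) :
    L^[k] (fun x => f x + g x) = fun x => L^[k] f x + L^[k] g x := by
  induction k with
  | zero => rfl
  | succ k ih => simp only [Function.iterate_succ_apply', ih, L_add (Lpow_sm k hf) (Lpow_sm k hg)]

theorem Lpow_sum {α : Type*} (k : ℕ) (s : Finset α) {F : α → Gr S → ℝ} (h : ∀ a, ContDiff ℝ (⊤ : ℕ∞) (F a)) :
    L^[k] (fun g => ∑ a ∈ s, F a g) = fun g => ∑ a ∈ s, L^[k] (F a) g := by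
  classical
  induction s using Finset.induction_on with
  | empty =>
    simp only [Finset.sum_empty]
    simpa using Lpow_const_mul (S := S) k 0 (f := fun _ => 0) contDiff_const
  | insert a s ha ih =>
    simp only [Finset.sum_insert ha]
    rw [Lpow_add k (h a) (ContDiff.sum fun b _ => h b), ih]

theorem UB.cons {f : ℕ → Gr S → ℝ} (h : UB f) {u : Gr S → ℝ} (hu : TF u) :
    UB (fun j => if j = 0 then u else f j) where
  tf j := by split_ifs; exacts [hu, h.tf j]
  supp := by
    obtain ⟨R, hR⟩ := h.supp
    obtain ⟨R', hR'⟩ := hu.isKer.supp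
    refine ⟨max R R', fun j g hg => ?_⟩
    split_ifs
    · exact hR' g ((le_max_right _ _).trans hg.le)
    · exact hR j g ((le_max_left _ _).trans_lt hg)
  bdd l hl := by
    obtain ⟨B, hB⟩ := h.bdd l hl
    obtain ⟨B', hB'⟩ := (VW_TF hl hu).bdd
    refine ⟨max B B', fun j g => ?_⟩
    split_ifs
    · exact (hB' g).trans (le_max_right _ _)
    · exact (hB j g).trans (le_max_left _ _)

theorem integral_sub_sq_le {u v : Gr S → ℝ} (hu : TF u) (hv : TF v) :
    ∫ g, (u g - v g) ^ 2 ≤ 2 * (∫ g, u g ^ 2) + 2 * ∫ g, v g ^ 2 := by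
  rw [← integral_const_mul, ← integral_const_mul,
    ← integral_add (hu.int_sq.const_mul _) (hv.int_sq.const_mul _)]
  refine integral_mono (hu.sub hv).int_sq ((hu.int_sq.const_mul _).add (hv.int_sq.const_mul _)) fun g => ?_
  simp only
  nlinarith [sq_nonneg (u g + v g)]

/-- Cutoffs of harmonic functions of bounded energy are uniformly bounded. -/
theorem UB.of_harmonic [Nonempty ι] {I : Type*} {u : I → Gr S → ℝ} (hu : ∀ i, TF (u i)) {D : ℝ}
    (hD : ∀ i, ∫ g, u i g ^ 2 ≤ D) {Ω : Set (Gr S)} (hΩ : IsOpen Ω) {M : ℕ}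
    (hL : ∀ i, ∀ x ∈ Ω, Gr.L^[M] (u i) x = 0) {χ : Gr S → ℝ} (hχ : TF χ) (hs : tsupport χ ⊆ Ω) :
    UB (fun i g => χ g * u i g) where
  tf i := (hu i).mul_left hχ.sm
  supp := by
    obtain ⟨R, hR⟩ := hχ.isKer.supp
    exact ⟨R, fun i g hg => by rw [hR g hg.le, zero_mul]⟩
  bdd l hl := by
    obtain ⟨C, hC, H⟩ := sup_harmonic hΩ hχ hs M hl
    exact ⟨Real.sqrt (C * D), fun i g => Real.abs_le_sqrt
      ((H (u i) (hu i) (hL i) g).trans (mul_le_mul_of_nonneg_left (hD i) hC))⟩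

theorem Fund.dil {F : Gr S → ℝ} {M : ℕ} {R r : ℝ} (h : Fund F M R) (hr : 0 < r) :
    Fund (fun g => r ^ hdim S / r ^ (2 * M) * F (dil S r g)) M (R / r) := by
  intro u hu hs
  have hv := TF_dil (S := S) (inv_ne_zero hr.ne') hu
  have e : u = fun g => (fun g => u (Gr.dil S r⁻¹ g)) (Gr.dil S r g) := by
    funext g; simp only [dil_inv_dil hr.ne']
  have h1 := h _ hv (closure_minimal (fun g hg => by
    have h2 : NN (Gr.dil S r⁻¹ g) ≤ R / r := hs (subset_tsupport _ hg)
    rw [NN_dil (by positivity), ← div_eq_inv_mul] at h2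
    exact (div_le_div_iff_of_pos_right hr).1 h2) (isCompact_NN R).isClosed)
  rw [map_zero] at h1
  have e2 : ∀ x, L^[M] u x = r ^ (2 * M) * L^[M] (fun g => u (Gr.dil S r⁻¹ g)) (Gr.dil S r x) := fun x => by
    conv_lhs => rw [e]
    exact congrFun (Lpow_dil M r hv.sm) x
  have e3 : (∫ x, r ^ hdim S / r ^ (2 * M) * F (Gr.dil S r x) * L^[M] u x)
      = r ^ hdim S * ∫ x, (fun y => F y * L^[M] (fun g => u (Gr.dil S r⁻¹ g)) y) (Gr.dil S r x) := by
    rw [← integral_const_mul]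
    refine integral_congr_ae (.of_forall fun x => ?_)
    simp only [e2]; field_simp
  rw [e3, integral_dil hr (fun y => F y * L^[M] (fun g => u (Gr.dil S r⁻¹ g)) y), h1]
  field_simp

/-- The dyadic rescalings of a mollifier. -/
noncomputable def mol (ρ : Gr S → ℝ) (J : ℕ) (g : Gr S) : ℝ := ((2 : ℝ) ^ J) ^ hdim S * ρ (dil S (2 ^ J) g)

theorem mol_TF {ρ : Gr S → ℝ} (h : TF ρ) (J : ℕ) : TF (mol ρ J) := (TF_dil (S := S) (by positivity) h).const_mul _

theorem integral_mol {ρ : Gr S → ℝ} (h : ∫ g, ρ g = 1) (J : ℕ) : ∫ g, mol ρ J g = 1 := by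
  simp only [mol]
  rw [integral_const_mul, integral_dil (by positivity), h]
  field_simp

theorem mol_supp {ρ : Gr S → ℝ} {a : ℝ} (h : ∀ g, a ≤ NN g → ρ g = 0) (J : ℕ) {g : Gr S} (hg : a ≤ NN g) :
    mol ρ J g = 0 := by
  rw [mol, h, mul_zero]
  rw [NN_dil (by positivity)]
  have : NN g ≤ 2 ^ J * NN g := le_mul_of_one_le_left (NN_nonneg g) (one_le_pow₀ one_le_two)
  linarith

theorem gconv_mol_dil (ρ F : Gr S → ℝ) (M J : ℕ) (y : Gr S) :
    2 ^ hdim S / 2 ^ (2 * M) * gconv volume (mol ρ J) F (dil S 2 y)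
      = 2 ^ hdim S * gconv volume (mol ρ (J + 1)) (fun g => 2 ^ hdim S / 2 ^ (2 * M) * F (dil S 2 g)) y
        / 2 ^ hdim S := by
  have h := integral_dil (S := S) two_pos (fun k => mol ρ J (dil S 2 y * k⁻¹) * F k)
  have e : gconv volume (mol ρ J) F (dil S 2 y)
      = 2 ^ hdim S * ∫ k, mol ρ J (dil S 2 y * (dil S 2 k)⁻¹) * F (dil S 2 k) := by
    rw [h, gconv]; field_simp
  rw [e, gconv, ← integral_const_mul, ← integral_const_mul, mul_div_cancel_left₀ _ (by positivity)]
  refine integral_congr_ae (.of_forall fun k => ?_)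
  simp only [mol, ← dil_inv, ← dil_mul, dil_dil]
  rw [← pow_succ]
  ring

set_option maxHeartbeats 1000000 in
/-- A parametrix for powers of `L` as a sum of uniformly bounded dyadic pieces. -/
theorem exists_kernels [NeZero n] [Nonempty ι] (S : Shear n ι β) (s : ℕ) :
    ∃ (ρ : Gr S → ℝ) (k ϑ : ℕ → Gr S → ℝ) (C R : ℝ), TF ρ ∧ ∫ g, ρ g = 1 ∧ UB k ∧ (∀ J, TF (ϑ J)) ∧
      (∀ J g, |ϑ J g| ≤ C) ∧ (∀ J g, R < NN g → ϑ J g = 0) ∧ ∀ J g,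
        L^[s] (fun g => ∑ j ∈ Finset.range (J + 1),
          ((2 : ℝ) ^ j) ^ (2 * s) / (2 ^ j) ^ hdim S * k j (dil S (2 ^ j)⁻¹ g)) g
        = ρ g - (((2 : ℝ) ^ J) ^ hdim S)⁻¹ * ϑ J (dil S (2 ^ J)⁻¹ g) := by
  obtain ⟨κ, hκ, hm⟩ := NN_mul_le S
  obtain ⟨M₀, hM₀⟩ := exists_fundamental S (8 * κ)
  set M := max M₀ s with hM
  obtain ⟨F, hF2, -, hFs, hFf⟩ := hM₀ M (le_max_left _ _)
  have hFf : Fund F M (8 * κ) := hFf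
  obtain ⟨ρ, hρ, hρ0, hρ1, hρs⟩ := exists_mollifier S (r := 1 / 4) (by norm_num)
  obtain ⟨χ, hχ, hχ1, hχ2, -⟩ := exists_cutoff (isCompact_NN (S := S) 1) (isOpen_NN_lt 2)
    (fun g (hg : NN g ≤ 1) => lt_of_le_of_lt hg one_lt_two)
  have hFi := integrable_of_memLp_two hF2 hFs
  set F' : Gr S → ℝ := fun g => 2 ^ hdim S / 2 ^ (2 * M) * F (dil S 2 g) with hF'
  have hF'f : Fund F' M (8 * κ / 2) := hFf.dil two_pos
  have hF's : ∀ g, 8 * κ < NN g → F' g = 0 := fun g hg => by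
    rw [hF']; simp only
    rw [hFs, mul_zero]
    rw [NN_dil two_pos.le]; linarith
  have hF'2 : MemLp F' 2 volume := by
    refine MemLp.const_mul ?_ _
    have h1 : MemLp F 2 (Measure.map (dil S 2) volume) := by
      rw [map_dil two_pos]; exact hF2.smul_measure ENNReal.ofReal_ne_top
    exact h1.comp_of_map (continuous_dil (S := S) 2).aemeasurable
  have hF'i := integrable_of_memLp_two hF'2 hF's
  have hmT := mol_TF hρ
  have hm0 : ∀ J g, 0 ≤ mol ρ J g := fun J g => mul_nonneg (by positivity) (hρ0 _)
  have hms : ∀ J g, 1 / 4 ≤ NN g → mol ρ J g = 0 := fun J g => mol_supp hρs J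
  set w : ℕ → Gr S → ℝ := fun J => gconv volume (mol ρ J) F with hw
  set w' : ℕ → Gr S → ℝ := fun J => gconv volume (mol ρ J) F' with hw'
  have hwT : ∀ J, TF (w J) := fun J => gconv_TF (hmT J) hFi hFs
  have hwT' : ∀ J, TF (w' J) := fun J => gconv_TF (hmT J) hF'i hF's
  have hwL : ∀ J g, NN g < 3 → L^[M] (w J) g = mol ρ J g := fun J =>
    Lpow_gconv hm hκ (hmT J) (hms J) hFi hFs hFf (by linarith)
  have hwL' : ∀ J g, NN g < 3 → L^[M] (w' J) g = mol ρ J g := fun J =>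
    Lpow_gconv hm hκ (hmT J) (hms J) hF'i hF's hF'f (by linarith)
  have hw2 : ∀ J, ∫ g, w J g ^ 2 ≤ ∫ g, F g ^ 2 := fun J =>
    integral_gconv_sq_le (hmT J) (hm0 J) (integral_mol hρ1 J) hF2 hFs
  have hw2' : ∀ J, ∫ g, w' J g ^ 2 ≤ ∫ g, F' g ^ 2 := fun J =>
    integral_gconv_sq_le (hmT J) (hm0 J) (integral_mol hρ1 J) hF'2 hF's
  have hww : ∀ J y, 2 ^ hdim S / 2 ^ (2 * M) * w J (dil S 2 y) = w' (J + 1) y := fun J y => by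
    rw [hw, hw']; simp only
    rw [gconv_mol_dil, mul_div_cancel_left₀ _ (by positivity)]
  clear_value w w'
  set χ' : Gr S → ℝ := fun g => χ (dil S 2 g) with hχ'
  have hχT' : TF χ' := TF_dil two_ne_zero hχ
  have hχs : ∀ g, 2 ≤ NN g → χ g = 0 := fun g hg =>
    image_eq_zero_of_notMem_tsupport fun h => absurd (hχ2 h) (not_lt.2 hg)
  have hχs' : ∀ g, 1 ≤ NN g → χ' g = 0 := fun g hg => hχs _ (by rw [NN_dil two_pos.le]; linarith)
  have hA : UB (fun J g => χ' g * (w J g - w' J g)) := by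
    refine UB.of_harmonic (fun J => (hwT J).sub (hwT' J)) (D := 2 * (∫ g, F g ^ 2) + 2 * ∫ g, F' g ^ 2)
      (fun J => (integral_sub_sq_le (hwT J) (hwT' J)).trans (by linarith [hw2 J, hw2' J]))
      (isOpen_NN_lt 3) (M := M) (fun J g hg => ?_) hχT' ?_
    · rw [Lpow_sub M (hwT J).sm (hwT' J).sm]
      exact sub_eq_zero.2 ((hwL J g hg).trans (hwL' J g hg).symm)
    · refine (closure_minimal (t := {g | NN g ≤ 1}) (fun g hg => ?_) (isCompact_NN 1).isClosed).trans
        fun g (hg : NN g ≤ 1) => lt_of_le_of_lt hg (by norm_num)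
      exact le_of_not_ge fun h => hg (hχs' g h)
  have hB : UB (fun J g => (χ g - χ' g) * w J g) := by
    refine UB.of_harmonic hwT hw2 ((isOpen_NN_gt (1 / 4)).inter (isOpen_NN_lt 3)) (M := M)
      (fun J g hg => ?_) (hχ.sub hχT') ?_
    · rw [hwL J g hg.2]; exact hms J g (le_of_lt hg.1)
    · refine (closure_minimal (t := {g | 1 / 2 ≤ NN g} ∩ {g | NN g ≤ 2}) (fun g hg => ?_)
        ((isClosed_le continuous_const continuous_NN).inter (isCompact_NN 2).isClosed)).trans
        fun g hg => ⟨lt_of_lt_of_le (by norm_num) (show 1 / 2 ≤ NN g from hg.1),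
          lt_of_le_of_lt (show NN g ≤ 2 from hg.2) (by norm_num)⟩
      refine ⟨le_of_not_gt (a := (1/2:ℝ)) (b := NN g) fun h => hg ?_, le_of_not_ge (a := (2:ℝ)) (b := NN g) fun h => hg ?_⟩
      · have h1 : χ g = 1 := hχ1.self_of_nhdsSet g (show NN g ≤ 1 by linarith)
        have h2 : χ' g = 1 := hχ1.self_of_nhdsSet _ (show NN (dil S 2 g) ≤ 1 by
          rw [NN_dil two_pos.le]; linarith)
        simp only [h1, h2, sub_self]
      · simp only [hχs g h, hχs' g (by linarith), sub_self]
  set kk : ℕ → Gr S → ℝ := fun J => if J = 0 then fun g => χ g * w 0 g else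
    fun g => χ' g * (w J g - w' J g) + (χ g - χ' g) * w J g with hkk
  have hkU : UB kk := (hA.add hB).cons ((hwT 0).mul_left hχ.sm)
  have hkT := hkU.tf
  have hΦT : ∀ J, TF (fun g => χ g * w J g) := fun J => (hwT J).mul_left hχ.sm
  have htel : ∀ J, (fun g => ∑ j ∈ Finset.range (J + 1),
      ((2 : ℝ) ^ j) ^ (2 * M) / (2 ^ j) ^ hdim S * kk j (dil S (2 ^ j)⁻¹ g))
      = fun g => ((2 : ℝ) ^ J) ^ (2 * M) / (2 ^ J) ^ hdim S * ((fun g => χ g * w J g) (dil S (2 ^ J)⁻¹ g)) := by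
    intro J
    induction J with
    | zero => simp [hkk]
    | succ J ih =>
      funext g
      rw [Finset.sum_range_succ, congrFun ih g]
      have e : dil S ((2 : ℝ) ^ J)⁻¹ g = dil S 2 (dil S (2 ^ (J + 1))⁻¹ g) := by
        rw [dil_dil, pow_succ]; congr 2; field_simp
      simp only [e, hkk, Nat.succ_ne_zero, if_false]
      rw [← hww]
      simp only [hχ']
      generalize dil S ((2 : ℝ) ^ (J + 1))⁻¹ g = y
      rw [pow_succ (2 : ℝ) J, mul_pow, mul_pow]
      field_simp
      ring
  have hLk : UB (fun j => L^[M - s] (kk j)) := hkU.Lpow _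
  have hθT : ∀ J, TF (fun g => mol ρ J g - L^[M] (fun g => χ g * w J g) g) := fun J =>
    (hmT J).sub (Lpow_TF M (hΦT J))
  have hθ : ∀ J g, (mol ρ J g - L^[M] (fun g => χ g * w J g) g = 0) ∨
      (1 < NN g ∧ mol ρ J g - L^[M] (fun g => χ g * w J g) g = - L^[M] (fun g => (χ g - χ' g) * w J g) g) := by
    intro J g
    rcases le_or_gt (NN g) 1 with h | h
    · left
      obtain ⟨U, hU, hKU, hU1⟩ := eventually_nhdsSet_iff_exists.1 hχ1
      have := Lpow_congr M (hU.inter (isOpen_NN_lt 3)) (f := fun g => χ g * w J g) (g := w J)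
        (fun x hx => by rw [hU1 x hx.1, one_mul]) g ⟨hKU h, lt_of_le_of_lt h (by norm_num)⟩
      rw [this, hwL J g (by linarith), sub_self]
    · right
      refine ⟨h, ?_⟩
      rw [hms J g (by linarith), zero_sub, Lpow_congr M (isOpen_NN_gt 1) (fun x hx => ?_) g h]
      simp only [hχs' x (le_of_lt hx), sub_zero]
  obtain ⟨C, hC, hCb⟩ := (hB.Lpow M).abs_le
  obtain ⟨R, hR⟩ := (hB.Lpow M).supp
  refine ⟨ρ, fun j => L^[M - s] (kk j), fun J g => mol ρ J g - L^[M] (fun g => χ g * w J g) g, C, R,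
    hρ, hρ1, hLk, hθT, fun J g => ?_, fun J g hg => ?_, fun J g => ?_⟩
  · simp only []
    rcases hθ J g with h | ⟨-, h⟩
    · rw [h, abs_zero]; exact hC
    · rw [h, abs_neg]; exact hCb J g
  · simp only []
    rcases hθ J g with h | ⟨-, h⟩
    · exact h
    · rw [h, hR J g hg, neg_zero]
  · have hMs : M = s + (M - s) := (Nat.add_sub_cancel' (le_max_right _ _)).symm
    have e1 : (fun g => ∑ j ∈ Finset.range (J + 1),
        ((2 : ℝ) ^ j) ^ (2 * s) / (2 ^ j) ^ hdim S * L^[M - s] (kk j) (dil S (2 ^ j)⁻¹ g))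
        = L^[M - s] (fun g => ∑ j ∈ Finset.range (J + 1),
          ((2 : ℝ) ^ j) ^ (2 * M) / (2 ^ j) ^ hdim S * kk j (dil S (2 ^ j)⁻¹ g)) := by
      rw [Lpow_sum _ _ fun j => contDiff_const.mul (sm_dil _ (hkT j).sm)]
      funext g
      refine Finset.sum_congr rfl fun j _ => ?_
      rw [Lpow_const_mul _ _ (sm_dil _ (hkT j).sm), Lpow_dil _ _ (hkT j).sm]
      simp only
      have e : ((2 : ℝ) ^ j) ^ (2 * M) = (2 ^ j) ^ (2 * s) * (2 ^ j) ^ (2 * (M - s)) := by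
        rw [← pow_add]; congr 1; omega
      rw [e, inv_pow]
      field_simp
    rw [e1, ← Function.iterate_add_apply, ← hMs, htel J,
      Lpow_const_mul _ _ (sm_dil _ (hΦT J).sm), Lpow_dil _ _ (hΦT J).sm]
    simp only [mol, dil_dil_inv (S := S) (r := 2 ^ J) (by positivity)]
    rw [inv_pow]
    field_simp
    ring

end Gr

namespace Gr

variable {n : ℕ} {ι β : Type} [Fintype ι] [Fintype β] {S : Shear n ι β}

section Words

/-- Iterated basis fields. -/
noncomputable def word (l : List (Fin n ⊕ β)) (f : Gr S → ℝ) : Gr S → ℝ :=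
  (l.map (Xb S)).foldr (· ∘ ·) id f

theorem word_cons (b : Fin n ⊕ β) (l) (f : Gr S → ℝ) : word (b :: l) f = Xb S b (word l f) := rfl

theorem word_concat (b : Fin n ⊕ β) (l) (f : Gr S → ℝ) : word (l ++ [b]) f = word l (Xb S b f) := by
  induction l with
  | nil => rfl
  | cons c l ih => rw [List.cons_append, word_cons, ih, word_cons]

theorem word_sm (l : List (Fin n ⊕ β)) {f : Gr S → ℝ} (hf : ContDiff ℝ (⊤ : ℕ∞) f) :
    ContDiff ℝ (⊤ : ℕ∞) (word l f) := by
  induction l with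
  | nil => exact hf
  | cons b l ih => exact Xb_sm b ih

theorem word_TF (l : List (Fin n ⊕ β)) {f : Gr S → ℝ} (hf : TF f) : TF (word l f) := by
  induction l with
  | nil => exact hf
  | cons b l ih => exact Xb_TF b ih

theorem word_const_mul (l : List (Fin n ⊕ β)) (c : ℝ) {f : Gr S → ℝ} (hf : ContDiff ℝ (⊤ : ℕ∞) f) :
    word l (fun x => c * f x) = fun x => c * word l f x := by
  induction l with
  | nil => rfl
  | cons b l ih => rw [word_cons, ih, Xb_const_mul b c (word_sm l hf)]; rfl

theorem word_sum (l : List (Fin n ⊕ β)) {κ : Type*} (s : Finset κ) {f : κ → Gr S → ℝ}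
    (hf : ∀ i, ContDiff ℝ (⊤ : ℕ∞) (f i)) :
    word l (fun x => ∑ i ∈ s, f i x) = fun x => ∑ i ∈ s, word l (f i) x := by
  induction l with
  | nil => rfl
  | cons b l ih =>
    rw [word_cons, ih]
    exact VF_sum s fun i _ => word_sm l (hf i)

theorem word_dil (l : List (Fin n ⊕ β)) (r : ℝ) {f : Gr S → ℝ} (hf : ContDiff ℝ (⊤ : ℕ∞) f) :
    word l (fun g => f (dil S r g)) = fun g => r ^ l.length * word l f (dil S r g) := by
  induction l with
  | nil => funext g; simp [word]
  | cons b l ih =>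
    rw [word_cons, ih, Xb_const_mul b _ (sm_dil r (word_sm l hf)), Xb_dil b r (word_sm l hf)]
    funext g
    rw [word_cons, List.length_cons]
    ring

theorem integral_word_mul (l : List (Fin n ⊕ β)) {f g : Gr S → ℝ} (hf : ContDiff ℝ (⊤ : ℕ∞) f) (hg : TF g) :
    ∫ x, word l f x * g x = (-1) ^ l.length * ∫ x, f x * word l.reverse g x := by
  induction l generalizing g with
  | nil => simp [word]
  | cons b l ih =>
    rw [word_cons, integral_Xb_mul b (word_sm l hf) hg, ih (Xb_TF b hg), List.reverse_cons, word_concat,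
      List.length_cons]
    ring

theorem integral_word_eq_zero {l : List (Fin n ⊕ β)} (hl : l ≠ []) {f : Gr S → ℝ} (hf : TF f) :
    ∫ g, word l f g = 0 := by
  cases l with
  | nil => exact absurd rfl hl
  | cons b l => exact integral_fld_eq_zero _ (word_TF l hf)

end Words

/-- A measure preserving smooth right action of the group whose dilates leave compact sets. -/
structure Act (S : Shear n ι β) (E : Type*) [NormedAddCommGroup E] [NormedSpace ℝ E] [MeasureSpace E] where
  act : E → Gr S → E
  sm : ContDiff ℝ (⊤ : ℕ∞) fun q : E × Gr S => act q.1 q.2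
  one : ∀ z, act z 1 = z
  mul : ∀ z g h, act (act z g) h = act z (g * h)
  mp : ∀ g, MeasurePreserving (fun z => act z g)
  escape : ∀ K : Set E, IsCompact K → ∀ z, ∀ᵐ g, ∀ᶠ t in Filter.atTop, act z (dil S t g) ∉ K

variable {E : Type*} [NormedAddCommGroup E] [NormedSpace ℝ E] [MeasureSpace E] (a : Act S E)

namespace Act

/-- The field on `E` induced by a basis field of the group. -/
noncomputable def X (b : Fin n ⊕ β) (φ : E → ℝ) (z : E) : ℝ := Xb S b (fun g => φ (a.act z g)) 1

/-- The operator on `E` induced by `L`. -/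
noncomputable def L (φ : E → ℝ) (z : E) : ℝ := -∑ b, a.X b (a.X b φ) z

/-- Iterated induced fields. -/
noncomputable def word (l : List (Fin n ⊕ β)) (φ : E → ℝ) : E → ℝ := (l.map a.X).foldr (· ∘ ·) id φ

theorem word_cons (b : Fin n ⊕ β) (l) (φ : E → ℝ) : a.word (b :: l) φ = a.X b (a.word l φ) := rfl

theorem word_concat (b : Fin n ⊕ β) (l) (φ : E → ℝ) : a.word (l ++ [b]) φ = a.word l (a.X b φ) := by
  induction l with
  | nil => rfl
  | cons c l ih => rw [List.cons_append, word_cons, ih, word_cons]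

theorem sm_left (z : E) {φ : E → ℝ} (hφ : ContDiff ℝ (⊤ : ℕ∞) φ) :
    ContDiff ℝ (⊤ : ℕ∞) fun g => φ (a.act z g) :=
  hφ.comp (ContDiff.comp (f := fun g : Gr S => (z, g)) a.sm (contDiff_const.prodMk contDiff_id))

theorem continuous_act : Continuous fun q : E × Gr S => a.act q.1 q.2 :=
  ContDiff.continuous (n := (⊤ : ℕ∞)) (𝕜 := ℝ) a.sm

theorem X_sm (b) {φ : E → ℝ} (hφ : ContDiff ℝ (⊤ : ℕ∞) φ) : ContDiff ℝ (⊤ : ℕ∞) (a.X b φ) := by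
  have h : ContDiff ℝ (⊤ : ℕ∞) fun z => fderiv ℝ (fun g => φ (a.act z g)) (1 : Gr S) :=
    ContDiff.fderiv (n := (⊤ : ℕ∞)) (m := (⊤ : ℕ∞)) (f := fun z g => φ (a.act z g)) (g := fun _ => (1 : Gr S))
      (hφ.comp a.sm) contDiff_const (by simp)
  exact h.clm_apply contDiff_const

theorem X_TF (b) {φ : E → ℝ} (hφ : TF φ) : TF (a.X b φ) := by
  refine ⟨a.X_sm b hφ.sm, hφ.cs.mono' fun z hz => ?_⟩
  by_contra h
  refine hz ?_
  refine VF_eq_zero (f := fun g => φ (a.act z g)) fun h1 => ?_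
  have h2 : (fun g => φ (a.act z g)) =ᶠ[nhds 1] fun _ => 0 := by
    have h3 := notMem_tsupport_iff_eventuallyEq.1 h
    have h4 : Filter.Tendsto (fun g => a.act z g) (nhds 1) (nhds z) := by
      have := (a.continuous_act.comp (Continuous.prodMk_right z)).tendsto (1 : Gr S)
      simpa only [Function.comp_def, a.one] using this
    exact h4.eventually h3
  exact notMem_tsupport_iff_eventuallyEq.2 h2 h1

theorem Xb_act (b) {φ : E → ℝ} (hφ : ContDiff ℝ (⊤ : ℕ∞) φ) (z : E) :
    Xb S b (fun g => φ (a.act z g)) = fun g => a.X b φ (a.act z g) := by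
  funext h
  have h1 := congrFun (Xb_mul_left b h (a.sm_left z hφ)) 1
  simp only [mul_one, ← a.mul] at h1
  exact h1.symm

theorem word_sm (l : List (Fin n ⊕ β)) {φ : E → ℝ} (hφ : ContDiff ℝ (⊤ : ℕ∞) φ) :
    ContDiff ℝ (⊤ : ℕ∞) (a.word l φ) := by
  induction l with
  | nil => exact hφ
  | cons b l ih => exact a.X_sm b ih

theorem word_TF (l : List (Fin n ⊕ β)) {φ : E → ℝ} (hφ : TF φ) : TF (a.word l φ) := by
  induction l with
  | nil => exact hφ
  | cons b l ih => exact a.X_TF b ih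

theorem word_act (l : List (Fin n ⊕ β)) {φ : E → ℝ} (hφ : ContDiff ℝ (⊤ : ℕ∞) φ) (z : E) :
    Gr.word l (fun g => φ (a.act z g)) = fun g => a.word l φ (a.act z g) := by
  induction l with
  | nil => rfl
  | cons b l ih => rw [Gr.word_cons, ih, a.Xb_act b (a.word_sm l hφ)]; rfl

theorem L_TF {φ : E → ℝ} (hφ : TF φ) : TF (a.L φ) :=
  (TF.sum _ fun b _ => a.X_TF b (a.X_TF b hφ)).neg

theorem L_act {φ : E → ℝ} (hφ : ContDiff ℝ (⊤ : ℕ∞) φ) (z : E) :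
    Gr.L (fun g => φ (a.act z g)) = fun g => a.L φ (a.act z g) := by
  funext g
  simp only [Gr.L, L, a.Xb_act _ hφ, a.Xb_act _ (a.X_sm _ hφ)]

theorem Lpow_TF (s : ℕ) {φ : E → ℝ} (hφ : TF φ) : TF (a.L^[s] φ) := by
  induction s with
  | zero => exact hφ
  | succ s ih => rw [Function.iterate_succ_apply']; exact a.L_TF ih

theorem Lpow_act (s : ℕ) {φ : E → ℝ} (hφ : TF φ) (z : E) :
    Gr.L^[s] (fun g => φ (a.act z g)) = fun g => a.L^[s] φ (a.act z g) := by
  induction s with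
  | zero => rfl
  | succ s ih =>
    rw [Function.iterate_succ_apply', ih, a.L_act (a.Lpow_TF s hφ).sm, Function.iterate_succ_apply']

theorem integral_act (g : Gr S) (u : E → ℝ) (hu : AEStronglyMeasurable u) :
    ∫ z, u (a.act z g) = ∫ z, u z := by
  rw [← (a.mp g).map_eq] at hu
  rw [← integral_map (a.mp g).measurable.aemeasurable hu, (a.mp g).map_eq]

variable [BorelSpace E] [SecondCountableTopology E] [SigmaFinite (volume : Measure E)]
  [IsFiniteMeasureOnCompacts (volume : Measure E)]

theorem integrable_prod {u : E → ℝ} (hu : TF u) {k : Gr S → ℝ} (hk : Integrable k) :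
    Integrable (fun q : E × Gr S => u (a.act q.1 q.2) * k q.2) (volume.prod volume) := by
  have hm : AEStronglyMeasurable (fun q : E × Gr S => u (a.act q.1 q.2) * k q.2) (volume.prod volume) :=
    (hu.continuous.comp a.continuous_act).aestronglyMeasurable.mul hk.aestronglyMeasurable.comp_snd
  rw [integrable_prod_iff' hm]
  have hi : ∀ g, Integrable fun z => u (a.act z g) := fun g =>
    (a.mp g).integrable_comp_of_integrable hu.integrable
  refine ⟨.of_forall fun g => (hi g).mul_const (k g), ?_⟩
  simp only [norm_mul, integral_mul_const]
  have e : ∀ g, ∫ z, ‖u (a.act z g)‖ = ∫ z, ‖u z‖ := fun g =>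
    a.integral_act g (fun z => ‖u z‖) hu.continuous.norm.aestronglyMeasurable
  simp only [e]
  exact hk.norm.const_mul _

theorem integrable_prod_mul {u w : E → ℝ} (hu : TF u) (hw : TF w) {k : Gr S → ℝ} (hk : Integrable k) :
    Integrable (fun q : E × Gr S => w q.1 * (u (a.act q.1 q.2) * k q.2)) (volume.prod volume) := by
  obtain ⟨C, hC⟩ := hw.bdd
  exact (a.integrable_prod hu hk).bdd_mul (c := C) (hw.continuous.comp continuous_fst).aestronglyMeasurable
    (.of_forall fun q => hC q.1)

theorem integral_X (b) {u : E → ℝ} (hu : TF u) : ∫ z, a.X b u z = 0 := by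
  obtain ⟨ρ, hρ, -, hρ1, -⟩ := exists_mollifier S one_pos
  have h1 : ∫ z, ∫ g, a.X b u (a.act z g) * ρ g = ∫ z, a.X b u z := by
    rw [integral_integral_swap (a.integrable_prod (a.X_TF b hu) hρ.integrable)]
    simp only [integral_mul_const,
      a.integral_act _ _ (a.X_TF b hu).continuous.aestronglyMeasurable, integral_const_mul, hρ1, mul_one]
  have h2 : ∀ z, ∫ g, a.X b u (a.act z g) * ρ g = - ∫ g, u (a.act z g) * Xb S b ρ g := fun z => by
    have := integral_Xb_mul b (a.sm_left z hu.sm) hρ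
    rwa [a.Xb_act b hu.sm] at this
  rw [← h1]
  simp only [h2]
  rw [integral_neg, integral_integral_swap (a.integrable_prod hu (Xb_TF b hρ).integrable)]
  simp only [integral_mul_const, a.integral_act _ _ hu.continuous.aestronglyMeasurable, integral_const_mul]
  rw [show ∫ g, Xb S b ρ g = 0 from integral_fld_eq_zero _ hρ]
  simp

theorem integral_X_mul (b) {u w : E → ℝ} (hu : TF u) (hw : TF w) :
    ∫ z, a.X b u z * w z = - ∫ z, u z * a.X b w z := by
  have h := a.integral_X b (hu.mul_right hw.sm)
  have e : ∀ z, a.X b (fun z => u z * w z) z = a.X b u z * w z + u z * a.X b w z := fun z => by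
    have := congrFun (Xb_mul b (a.sm_left z hu.sm) (a.sm_left z hw.sm)) 1
    simpa only [X, a.one] using this
  simp only [e] at h
  rw [integral_add ((a.X_TF b hu).mul_right hw.sm).integrable (hu.mul_right (a.X_TF b hw).sm).integrable] at h
  linarith

theorem integral_word_mul (l : List (Fin n ⊕ β)) {u w : E → ℝ} (hu : TF u) (hw : TF w) :
    ∫ z, a.word l u z * w z = (-1) ^ l.length * ∫ z, u z * a.word l.reverse w z := by
  induction l generalizing w with
  | nil => simp [word]
  | cons b l ih =>
    rw [word_cons, a.integral_X_mul b (a.word_TF l hu) hw, ih (a.X_TF b hw), List.reverse_cons, word_concat,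
      List.length_cons]
    ring

theorem integral_move {u w : E → ℝ} (hu : TF u) (hw : TF w) {k : Gr S → ℝ} (hk : Integrable k) :
    ∫ z, w z * ∫ g, u (a.act z g) * k g = ∫ z, u z * ∫ g, w (a.act z g) * k g⁻¹ := by
  simp only [← integral_const_mul]
  rw [integral_integral_swap (a.integrable_prod_mul hu hw hk),
    integral_integral_swap (f := fun z g => u z * (w (a.act z g) * k g⁻¹))
      (a.integrable_prod_mul hw hu hk.comp_inv)]
  rw [← integral_inv_eq_self]
  refine integral_congr_ae (.of_forall fun g => ?_)
  simp only []
  rw [← a.integral_act g (fun x => w x * (u (a.act x g⁻¹) * k g⁻¹)) ((hw.continuous.mul ((hu.continuous.comp (a.continuous_act.comp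
    (Continuous.prodMk_left g⁻¹))).mul continuous_const)).aestronglyMeasurable)]
  refine integral_congr_ae (.of_forall fun z => ?_)
  simp only [a.mul, mul_inv_cancel, a.one]
  ring

end Act

end Gr

theorem eLpNorm_ofReal_rpow {α : Type*} [MeasurableSpace α] {μ : Measure α} {q : ℝ} (hq : 0 < q) (f : α → ℝ) :
    eLpNorm f (ENNReal.ofReal q) μ ^ q = ∫⁻ x, ‖f x‖ₑ ^ q ∂μ := by
  rw [eLpNorm_eq_lintegral_rpow_enorm_toReal (ENNReal.ofReal_pos.2 hq).ne' ENNReal.ofReal_ne_top,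
    ENNReal.toReal_ofReal hq.le, ← ENNReal.rpow_mul, one_div_mul_cancel hq.ne', ENNReal.rpow_one]

namespace Gr

variable {n : ℕ} {ι β : Type} [Fintype ι] [Fintype β] {S : Shear n ι β}
variable {E : Type*} [NormedAddCommGroup E] [NormedSpace ℝ E] [MeasureSpace E] (a : Act S E)

namespace Act

theorem isKer_indicator [BorelSpace E] {u : E → ℝ} (hu : TF u) (z : E) (R : ℝ) :
    IsKer (hn S) (Set.indicator {g : Gr S | NN g < R} fun g => u (a.act z g)) where
  meas := ((hu.continuous.comp (a.continuous_act.comp (Continuous.prodMk_right z))).measurable).indicator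
    (isOpen_NN_lt R).measurableSet
  bdd := by
    obtain ⟨C, hC⟩ := hu.bdd
    refine ⟨C, fun g => ?_⟩
    by_cases hg : g ∈ {g : Gr S | NN g < R}
    · rw [Set.indicator_of_mem hg]; exact hC _
    · rw [Set.indicator_of_notMem hg, abs_zero]; exact (abs_nonneg _).trans (hC z)
  supp := ⟨R, fun g hg => Set.indicator_of_notMem (s := {g : Gr S | NN g < R}) (fun h : NN g < R => absurd hg (not_le.2 h)) _⟩

variable [BorelSpace E] [SecondCountableTopology E] [SigmaFinite (volume : Measure E)]

theorem measurable_conv {u : E → ℝ} (hu : TF u) {k : Gr S → ℝ} (hk : IsKer (hn S) k) :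
    Measurable fun z => ∫ g, u (a.act z g) * k g := by
  refine (StronglyMeasurable.integral_prod_right (f := fun z g => u (a.act z g) * k g) ?_).measurable
  exact (((hu.continuous.comp a.continuous_act).measurable).mul (hk.meas.comp measurable_snd)).stronglyMeasurable

theorem lintegral_ball (F : E → ℝ≥0∞) (hF : Measurable F) {R : ℝ} (hR : 0 < R) :
    ∫⁻ z, ∫⁻ g in {g : Gr S | NN g < R}, F (a.act z g) = ENNReal.ofReal ((hn S).c * R ^ hdim S) * ∫⁻ z, F z := by
  rw [lintegral_lintegral_swap (f := fun z g => F (a.act z g)) (hF.comp a.continuous_act.measurable).aemeasurable]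
  have : ∀ g, ∫⁻ z, F (a.act z g) = ∫⁻ z, F z := fun g => (a.mp g).lintegral_comp hF
  simp only [this, lintegral_const, Measure.restrict_apply_univ]
  rw [mul_comm]
  congr 1
  exact (hn S).vol R hR

set_option maxHeartbeats 1000000 in
/-- Transference of singular sums from the group to the space. -/
theorem eLpNorm_conv_sum_bump_le (hD : 1 ≤ hdim S) {A : ℝ} (hA : 0 ≤ A) {q : ℝ} (hq : 2 ≤ q) :
    ∃ C : ℝ, 0 ≤ C ∧ ∀ (F : Finset ℤ) (ψ : ℤ → Gr S → ℝ), (∀ j, IsBump (hn S) A ((2 : ℝ) ^ j) (ψ j)) →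
      ∀ u : E → ℝ, TF u → eLpNorm (fun z => ∫ g, u (a.act z g) * ∑ j ∈ F, ψ j g) (ENNReal.ofReal q) volume ≤
        ENNReal.ofReal C * eLpNorm u (ENNReal.ofReal q) volume := by
  obtain ⟨C, hC, H⟩ := eLpNorm_sum_bump_le (hn S) hD hA hq
  have hq0 : 0 < q := by linarith
  set κ := (hn S).κ with hκ
  have hκ1 : 1 ≤ κ := (hn S).one_le
  have hc := (hn S).c_pos
  refine ⟨C * ((2 * κ) ^ hdim S) ^ (1 / q), by positivity, fun F ψ hψ u hu => ?_⟩
  set Ψ : Gr S → ℝ := fun g => ∑ j ∈ F, ψ j g with hΨ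
  have hΨK : IsKer (hn S) Ψ := IsKer.sum F fun j _ => (hψ j).isKer
  obtain ⟨R₁, hR₁⟩ := hΨK.supp
  set R := max R₁ 1 with hR
  have hR0 : 0 < R := lt_of_lt_of_le one_pos (le_max_right _ _)
  have hRs : ∀ g, R ≤ NN g → Ψ g = 0 := fun g hg => hR₁ g ((le_max_left _ _).trans hg)
  set R' := κ * (R + R) with hR'
  have hR'0 : 0 < R' := by positivity
  set T : E → ℝ := fun z => ∫ g, u (a.act z g) * Ψ g with hT
  have hTm : Measurable T := a.measurable_conv hu hΨK
  set U : E → Gr S → ℝ := fun z => Set.indicator {g : Gr S | NN g < R'} fun g => u (a.act z g) with hU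
  have hUK : ∀ z, IsKer (hn S) (U z) := fun z => a.isKer_indicator hu z R'
  have hconv : ∀ z x, NN x < R →
      ∑ j ∈ F, gconv volume (U z) (fun g => ψ j g⁻¹) x = T (a.act z x) := by
    intro z x hx
    simp only [gconv]
    obtain ⟨B, hB⟩ := (hUK z).bdd
    rw [← integral_finsetSum]
    · simp only [← Finset.mul_sum]
      rw [← integral_inv_eq_self]
      simp only [inv_inv, hT]
      refine integral_congr_ae (.of_forall fun g => ?_)
      simp only []
      by_cases hg : NN g < R
      · rw [a.mul, hU]
        simp only []
        rw [Set.indicator_of_mem]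
        change NN (x * g) < R'
        refine lt_of_le_of_lt ((hn S).mul_le x g) ?_
        exact mul_lt_mul_of_pos_left (add_lt_add hx hg) (by linarith)
      · rw [show ∑ x ∈ F, ψ x g = 0 from hRs g (not_lt.1 hg), hRs g (not_lt.1 hg), mul_zero, mul_zero]
    · intro j _
      exact (hψ j).inv.isKer.integrable.bdd_mul (c := B)
        ((hUK z).meas.comp (measurable_inv.const_mul x)).aestronglyMeasurable (.of_forall fun g => hB _)
  have h1 : ∀ z, ∫⁻ g in {g : Gr S | NN g < R}, ‖T (a.act z g)‖ₑ ^ q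
      ≤ ENNReal.ofReal C ^ q * ∫⁻ g in {g : Gr S | NN g < R'}, ‖u (a.act z g)‖ₑ ^ q := by
    intro z
    have h2 := ENNReal.rpow_le_rpow (H F (fun j g => ψ j g⁻¹) (fun j => (hψ j).inv) (U z) (hUK z)) hq0.le
    rw [ENNReal.mul_rpow_of_nonneg _ _ hq0.le, eLpNorm_ofReal_rpow hq0, eLpNorm_ofReal_rpow hq0] at h2
    calc _ = ∫⁻ g in {g : Gr S | NN g < R}, ‖∑ j ∈ F, gconv volume (U z) (fun g => ψ j g⁻¹) g‖ₑ ^ q := by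
          refine setLIntegral_congr_fun (isOpen_NN_lt R).measurableSet fun g hg => ?_
          simp only [hconv z g hg]
      _ ≤ _ := setLIntegral_le_lintegral _ _
      _ ≤ _ := h2
      _ = _ := by
          congr 1
          rw [← lintegral_indicator (isOpen_NN_lt R').measurableSet]
          refine lintegral_congr fun g => ?_
          by_cases hg : g ∈ {g : Gr S | NN g < R'}
          · rw [hU, Set.indicator_of_mem hg]; simp only []; rw [Set.indicator_of_mem hg]
          · rw [hU, Set.indicator_of_notMem hg]; simp only []; rw [Set.indicator_of_notMem hg]; simp [hq0]
  have h2 := lintegral_mono (μ := (volume : Measure E)) h1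
  have hum : Measurable fun z => ‖u z‖ₑ ^ q := hu.continuous.measurable.enorm.pow_const q
  have hTm' : Measurable fun z => ‖T z‖ₑ ^ q := hTm.enorm.pow_const q
  rw [a.lintegral_ball (fun z => ‖T z‖ₑ ^ q) hTm' hR0, lintegral_const_mul' _ _ (by finiteness),
    a.lintegral_ball (fun z => ‖u z‖ₑ ^ q) hum hR'0, ← eLpNorm_ofReal_rpow hq0, ← eLpNorm_ofReal_rpow hq0] at h2
  have hb0 : ENNReal.ofReal ((hn S).c * R ^ hdim S) ≠ 0 := (ENNReal.ofReal_pos.2 (by positivity)).ne'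
  have e : ENNReal.ofReal ((hn S).c * R' ^ hdim S)
      = ENNReal.ofReal ((hn S).c * R ^ hdim S) * ENNReal.ofReal ((2 * κ) ^ hdim S) := by
    rw [← ENNReal.ofReal_mul (by positivity), hR', mul_assoc, ← mul_pow]; ring_nf
  rw [e] at h2
  replace h2 := h2.trans_eq (show _ = ENNReal.ofReal ((hn S).c * R ^ hdim S) * (ENNReal.ofReal C ^ q *
    ENNReal.ofReal ((2 * κ) ^ hdim S) * eLpNorm u (ENNReal.ofReal q) volume ^ q) by ring)
  rw [ENNReal.mul_le_mul_iff_right hb0 ENNReal.ofReal_ne_top] at h2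
  rw [← ENNReal.rpow_le_rpow_iff hq0, ENNReal.mul_rpow_of_nonneg _ _ hq0.le, ENNReal.ofReal_mul hC,
    ENNReal.mul_rpow_of_nonneg _ _ hq0.le, ENNReal.ofReal_rpow_of_nonneg (by positivity) hq0.le,
    ENNReal.ofReal_rpow_of_nonneg (by positivity) hq0.le,
    ← Real.rpow_mul (by positivity), one_div_mul_cancel hq0.ne', Real.rpow_one]
  rwa [ENNReal.ofReal_rpow_of_nonneg hC hq0.le] at h2

end Act

end Gr

/-- Hölder's inequality for the integral of a product of real functions. -/
theorem enorm_integral_mul_le {α : Type*} [MeasurableSpace α] {μ : Measure α} {p q : ℝ}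
    (h : p.HolderConjugate q) {f g : α → ℝ} (hf : Measurable f) (hg : Measurable g) :
    ‖∫ x, f x * g x ∂μ‖ₑ ≤ eLpNorm f (ENNReal.ofReal p) μ * eLpNorm g (ENNReal.ofReal q) μ := by
  refine (enorm_integral_le_lintegral_enorm _).trans ?_
  simp only [enorm_mul]
  refine (ENNReal.lintegral_mul_le_Lp_mul_Lq μ h hf.enorm.aemeasurable hg.enorm.aemeasurable).trans_eq ?_
  rw [← eLpNorm_ofReal_rpow h.pos, ← eLpNorm_ofReal_rpow h.symm.pos, ← ENNReal.rpow_mul, ← ENNReal.rpow_mul,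
    mul_one_div_cancel h.ne_zero, mul_one_div_cancel h.symm.ne_zero, ENNReal.rpow_one, ENNReal.rpow_one]

namespace Gr

variable {n : ℕ} {ι β : Type} [Fintype ι] [Fintype β] {S : Shear n ι β}

set_option maxHeartbeats 1000000 in
/-- Rescaled parametrices whose iterated derivatives are singular sums. -/
theorem exists_kernel_seq [NeZero n] [Nonempty ι] (S : Shear n ι β) {s : ℕ} (hs : 1 ≤ s)
    {l : List (Fin n ⊕ β)} (hl : l.length = 2 * s) :
    ∃ (ρ : Gr S → ℝ) (K ϑ : ℕ → Gr S → ℝ) (A C R : ℝ), TF ρ ∧ ∫ g, ρ g = 1 ∧ (∀ i, TF (K i)) ∧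
      (∀ i, TF (ϑ i)) ∧ (∀ i g, |ϑ i g| ≤ C) ∧ (∀ i g, R < NN g → ϑ i g = 0) ∧
      (∀ i g, L^[s] (K i) g = ((2 : ℝ) ^ i) ^ hdim S * ρ (dil S (2 ^ i) g)
        - (((2 : ℝ) ^ i)⁻¹) ^ hdim S * ϑ i (dil S (2 ^ i)⁻¹ g)) ∧ 0 ≤ A ∧
      ∀ i, ∃ (F : Finset ℤ) (ψ : ℤ → Gr S → ℝ), (∀ j, IsBump (hn S) A ((2 : ℝ) ^ j) (ψ j)) ∧
        ∀ g, word l (fun g => K i g⁻¹) g = ∑ j ∈ F, ψ j g := by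
  obtain ⟨ρ, k, ϑ, C, R, hρ, hρ1, hk, hϑ, hϑC, hϑR, hL⟩ := exists_kernels S s
  have hl0 : l ≠ [] := fun h => by rw [h] at hl; simp at hl; omega
  have hkw := hk.inv.word l
  obtain ⟨A, c, hA, hb⟩ := hkw.bump fun i => integral_word_eq_zero hl0 (hk.inv.tf i)
  have hkT : ∀ (r : ℝ), 0 < r → ∀ j, TF fun g => k j (dil S r g) := fun r hr j => TF_dil hr.ne' (hk.tf j)
  have hGT : ∀ J, TF fun g => ∑ j ∈ Finset.range (J + 1),
      ((2 : ℝ) ^ j) ^ (2 * s) / (2 ^ j) ^ hdim S * k j (dil S (2 ^ j)⁻¹ g) := fun J =>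
    TF.sum _ fun j _ => (hkT _ (by positivity) j).const_mul _
  refine ⟨ρ, fun i g => ((2 : ℝ) ^ i) ^ hdim S / (2 ^ i) ^ (2 * s) * ((fun g => ∑ j ∈ Finset.range (2 * i + 1),
      ((2 : ℝ) ^ j) ^ (2 * s) / (2 ^ j) ^ hdim S * k j (dil S (2 ^ j)⁻¹ g)) (dil S (2 ^ i) g)),
    fun i => ϑ (2 * i), A, C, R, hρ, hρ1, fun i => ?_, fun i => hϑ _, fun i => hϑC _, fun i => hϑR _,
    fun i g => ?_, hA, fun i => ?_⟩
  · exact (TF_dil (S := S) (by positivity) (hGT (2 * i))).const_mul _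
  · rw [Lpow_const_mul _ _ (sm_dil _ (hGT _).sm), Lpow_dil _ _ (hGT _).sm]
    simp only []
    rw [hL, dil_dil]
    have e : ((2 : ℝ) ^ (2 * i))⁻¹ * 2 ^ i = (2 ^ i)⁻¹ := by
      rw [two_mul, pow_add]; field_simp
    rw [e]
    have e2 : (((2 : ℝ) ^ (2 * i)) ^ hdim S)⁻¹ = (((2 ^ i : ℝ))⁻¹) ^ hdim S * (((2 ^ i : ℝ))⁻¹) ^ hdim S := by
      rw [two_mul, pow_add, mul_pow, mul_inv, inv_pow]
    rw [e2, inv_pow]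
    field_simp
  · refine ⟨(Finset.range (2 * i + 1)).image fun j : ℕ => (c : ℤ) + j - i,
      fun J g => (((2 : ℝ) ^ (J - c))⁻¹) ^ hdim S *
        (l.map (Xb S)).foldr (· ∘ ·) id (fun g => k (J - c + i).toNat g⁻¹) (dil S ((2 : ℝ) ^ (J - c))⁻¹ g),
      fun J => ?_, fun g => ?_⟩
    · have := hb (J - c + i).toNat ((2 : ℝ) ^ (J - c)) (by positivity)
      rwa [← zpow_natCast, ← zpow_add₀ two_ne_zero, add_sub_cancel] at this
    · rw [Finset.sum_image fun a _ b _ h => by simpa using h]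
      have hkT' : ∀ (r : ℝ), 0 < r → ∀ j, TF fun g => k j (dil S r g)⁻¹ := fun r hr j =>
        TF_dil hr.ne' (TF_inv (hk.tf j))
      have e : (fun g : Gr S => ((2 : ℝ) ^ i) ^ hdim S / (2 ^ i) ^ (2 * s) *
          ((fun g => ∑ j ∈ Finset.range (2 * i + 1),
          ((2 : ℝ) ^ j) ^ (2 * s) / (2 ^ j) ^ hdim S * k j (dil S (2 ^ j)⁻¹ g)) (dil S (2 ^ i) g⁻¹)))
          = fun g => ∑ j ∈ Finset.range (2 * i + 1),
          (((2 : ℝ) ^ i) ^ hdim S / (2 ^ i) ^ (2 * s) * (((2 : ℝ) ^ j) ^ (2 * s) / (2 ^ j) ^ hdim S)) *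
            k j (dil S ((2 ^ j)⁻¹ * 2 ^ i) g)⁻¹ := by
        funext g
        simp only []
        rw [Finset.mul_sum]
        refine Finset.sum_congr rfl fun j _ => ?_
        rw [dil_dil, dil_inv, mul_assoc]
      change word l (fun g : Gr S => ((2 : ℝ) ^ i) ^ hdim S / (2 ^ i) ^ (2 * s) *
          ((fun g => ∑ j ∈ Finset.range (2 * i + 1),
          ((2 : ℝ) ^ j) ^ (2 * s) / (2 ^ j) ^ hdim S * k j (dil S (2 ^ j)⁻¹ g)) (dil S (2 ^ i) g⁻¹))) g = _
      rw [e, word_sum l _ fun j => contDiff_const.mul (hkT' _ (by positivity) j).sm]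
      refine Finset.sum_congr rfl fun j _ => ?_
      have h1 := word_const_mul l (((2 : ℝ) ^ i) ^ hdim S / (2 ^ i) ^ (2 * s) * (((2 : ℝ) ^ j) ^ (2 * s) / (2 ^ j) ^ hdim S))
        (hkT' ((2 ^ j)⁻¹ * 2 ^ i) (by positivity) j).sm
      have h2 := word_dil l ((2 ^ j)⁻¹ * 2 ^ i) (TF_inv (hk.tf j)).sm
      rw [h1, h2]
      simp only []
      have e3 : ((2 : ℝ) ^ ((c : ℤ) + j - i - c))⁻¹ = (2 ^ j)⁻¹ * 2 ^ i := by
        rw [show (c : ℤ) + j - i - c = j - i by ring, zpow_sub₀ two_ne_zero, zpow_natCast, zpow_natCast]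
        field_simp
      have e4 : ((c : ℤ) + j - i - c + i).toNat = j := by
        rw [show (c : ℤ) + j - i - c + i = j by ring]; rfl
      rw [e3, e4, hl, mul_pow, mul_pow, inv_pow, inv_pow, ← mul_assoc]
      congr 1
      field_simp

end Gr

namespace Gr

variable {n : ℕ} {ι β : Type} [Fintype ι] [Fintype β] {S : Shear n ι β}
variable {E : Type*} [NormedAddCommGroup E] [NormedSpace ℝ E] [MeasureSpace E] (a : Act S E)

namespace Act

theorem tendsto_contract [BorelSpace E] {φ : E → ℝ} (hφ : TF φ) {ρ : Gr S → ℝ} (hρ : TF ρ) (h1 : ∫ g, ρ g = 1) (z : E) :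
    Filter.Tendsto (fun i : ℕ => ∫ g, φ (a.act z (dil S ((2 : ℝ) ^ i)⁻¹ g)) * ρ g) Filter.atTop (nhds (φ z)) := by
  obtain ⟨C, hC⟩ := hφ.bdd
  have hz := (hφ.continuous.comp (a.continuous_act.comp (Continuous.prodMk_right z)))
  have : φ z = ∫ g, φ z * ρ g := by rw [integral_const_mul, h1, mul_one]
  rw [this]
  refine tendsto_integral_of_dominated_convergence (fun g => C * |ρ g|)
    (fun i => ((hz.comp (continuous_dil (S := S) _)).mul hρ.continuous).aestronglyMeasurable)
    (hρ.integrable.abs.const_mul C) (fun i => .of_forall fun g => ?_) (.of_forall fun g => ?_)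
  · rw [Real.norm_eq_abs, abs_mul]
    exact mul_le_mul_of_nonneg_right (hC _) (abs_nonneg _)
  · refine Filter.Tendsto.mul_const _ ?_
    have h2 : Filter.Tendsto (fun i : ℕ => dil S ((2 : ℝ) ^ i)⁻¹ g) Filter.atTop (nhds (1 : Gr S)) := by
      have h3 : Continuous fun r : ℝ => dil S r g := by
        refine Continuous.prodMk (f := fun r : ℝ => (r • g.1 : Fin n → ℝ)) (g := fun r : ℝ => (fun i => r ^ S.w i * g.2 i : ι → ℝ)) ?_ ?_
        · exact continuous_id.smul continuous_const
        · exact continuous_pi fun i => (continuous_id.pow _).mul continuous_const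
      have h4 : dil S (0 : ℝ) g = 1 := by
        refine Gr.ext' ?_ ?_
        · rw [dil_fst, zero_smul]; rfl
        · rw [dil_snd]; funext i
          rw [zero_pow (by have := S.w_pos i; omega), zero_mul]; rfl
      have h5 : Filter.Tendsto (fun i : ℕ => ((2 : ℝ) ^ i)⁻¹) Filter.atTop (nhds 0) :=
        (tendsto_pow_atTop_atTop_of_one_lt one_lt_two).inv_tendsto_atTop
      have := (h3.tendsto 0).comp h5
      rwa [h4] at this
    have := (hz.tendsto 1).comp h2
    simpa only [Function.comp_def, a.one] using this

theorem tendsto_expand [BorelSpace E] {φ : E → ℝ} (hφ : TF φ) {ϑ : ℕ → Gr S → ℝ} {C R : ℝ} (hϑ : ∀ i, TF (ϑ i))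
    (hC : ∀ i g, |ϑ i g| ≤ C) (hR : ∀ i g, R < NN g → ϑ i g = 0) (z : E) :
    Filter.Tendsto (fun i : ℕ => ∫ g, φ (a.act z (dil S ((2 : ℝ) ^ i) g)) * ϑ i g) Filter.atTop (nhds 0) := by
  obtain ⟨B, hB⟩ := hφ.bdd
  have hB0 : 0 ≤ B := (abs_nonneg _).trans (hB z)
  have hz := (hφ.continuous.comp (a.continuous_act.comp (Continuous.prodMk_right z)))
  have hmR : MeasurableSet {g : Gr S | NN g ≤ R} := (isCompact_NN R).measurableSet
  have : (0 : ℝ) = ∫ _ : Gr S, (0 : ℝ) := by simp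
  rw [this]
  refine tendsto_integral_of_dominated_convergence (Set.indicator {g : Gr S | NN g ≤ R} fun _ => B * C)
    (fun i => ((hz.comp (continuous_dil (S := S) _)).mul (hϑ i).continuous).aestronglyMeasurable)
    ((integrable_indicator_iff hmR).2 (integrableOn_const (isCompact_NN R).measure_lt_top.ne))
    (fun i => .of_forall fun g => ?_) ?_
  · rw [Real.norm_eq_abs, abs_mul]
    by_cases hg : NN g ≤ R
    · rw [Set.indicator_of_mem (s := {g : Gr S | NN g ≤ R}) hg]
      exact mul_le_mul (hB _) (hC i g) (abs_nonneg _) hB0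
    · rw [Set.indicator_of_notMem (s := {g : Gr S | NN g ≤ R}) hg, hR i g (not_le.1 hg), abs_zero, mul_zero]
  · filter_upwards [a.escape _ hφ.cs z] with g hg
    refine tendsto_const_nhds.congr' ?_
    filter_upwards [(tendsto_pow_atTop_atTop_of_one_lt (one_lt_two (α := ℝ))).eventually hg] with i hi
    rw [image_eq_zero_of_notMem_tsupport hi, zero_mul]

variable [BorelSpace E] [SecondCountableTopology E] [SigmaFinite (volume : Measure E)]
  [IsFiniteMeasureOnCompacts (volume : Measure E)]

/-- Pairing bound for singular sums acting on the space. -/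
theorem exists_pairing_bound (hD : 1 ≤ hdim S) {A : ℝ} (hA : 0 ≤ A) {p q : ℝ} (hpq : p.HolderConjugate q) :
    ∃ C : ℝ, 0 ≤ C ∧ ∀ (F : Finset ℤ) (ψ : ℤ → Gr S → ℝ), (∀ j, IsBump (hn S) A ((2 : ℝ) ^ j) (ψ j)) →
      ∀ u w : E → ℝ, TF u → TF w → ‖∫ z, u z * ∫ g, w (a.act z g) * ∑ j ∈ F, ψ j g‖ₑ ≤
        ENNReal.ofReal C * (eLpNorm u (ENNReal.ofReal p) volume * eLpNorm w (ENNReal.ofReal q) volume) := by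
  rcases le_or_gt 2 q with hq | hq
  · obtain ⟨C, hC, H⟩ := a.eLpNorm_conv_sum_bump_le hD hA hq
    refine ⟨C, hC, fun F ψ hψ u w hu hw => ?_⟩
    refine (enorm_integral_mul_le hpq hu.continuous.measurable
      (a.measurable_conv hw (IsKer.sum F fun j _ => (hψ j).isKer))).trans ?_
    rw [mul_left_comm]
    gcongr
    exact H F ψ hψ w hw
  · have hp : 2 ≤ p := by
      have h1 := hpq.inv_add_inv_eq_one
      by_contra h
      push Not at h
      have h2 : (1 / 2 : ℝ) < p⁻¹ := by rw [one_div]; exact inv_strictAnti₀ hpq.pos h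
      have h3 : (1 / 2 : ℝ) < q⁻¹ := by rw [one_div]; exact inv_strictAnti₀ hpq.symm.pos hq
      linarith
    obtain ⟨C, hC, H⟩ := a.eLpNorm_conv_sum_bump_le hD hA hp
    refine ⟨C, hC, fun F ψ hψ u w hu hw => ?_⟩
    have hk : IsKer (hn S) fun g => ∑ j ∈ F, ψ j g := IsKer.sum F fun j _ => (hψ j).isKer
    rw [a.integral_move hw hu hk.integrable]
    refine (enorm_integral_mul_le hpq.symm hw.continuous.measurable (a.measurable_conv hu hk.inv)).trans ?_
    rw [mul_comm, ← mul_assoc]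
    gcongr
    exact H F (fun j g => ψ j g⁻¹) (fun j => (hψ j).inv) u hu

set_option maxHeartbeats 1000000 in
/-- Weak form of the boundedness of the Riesz transforms. -/
theorem exists_weak_bound [NeZero n] [Nonempty ι] {s : ℕ} (hs : 1 ≤ s)
    {l : List (Fin n ⊕ β)} (hl : l.length = 2 * s) {p q : ℝ} (hpq : p.HolderConjugate q) :
    ∃ C : ℝ, 0 ≤ C ∧ ∀ φ w : E → ℝ, TF φ → TF w → ‖∫ z, a.word l φ z * w z‖ₑ ≤
      ENNReal.ofReal C * (eLpNorm (a.L^[s] φ) (ENNReal.ofReal p) volume * eLpNorm w (ENNReal.ofReal q) volume) := by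
  have hD : 1 ≤ hdim S := (Nat.one_le_iff_ne_zero.2 (NeZero.ne n)).trans (Nat.le_add_right _ _)
  obtain ⟨ρ, K, ϑ, A, C, R, hρ, hρ1, hK, hϑ, hϑC, hϑR, hL, hA, hψ⟩ := exists_kernel_seq S hs hl
  obtain ⟨C', hC', H⟩ := a.exists_pairing_bound hD hA hpq
  refine ⟨C', hC', fun φ w hφ hw => ?_⟩
  have hsgn : ((-1 : ℝ)) ^ (2 * s) = 1 := by rw [pow_mul]; norm_num
  rw [a.integral_word_mul l hφ hw, hl, hsgn, one_mul]
  set W := a.word l.reverse w with hW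
  have hWT : TF W := a.word_TF _ hw
  have hf := a.Lpow_TF s hφ
  set f := a.L^[s] φ with hfd
  have h1 : ∀ i, ∫ z, W z * ∫ g, φ (a.act z g) * Gr.L^[s] (K i) g = ∫ z, f z * ∫ g, w (a.act z g) *
      Gr.word l (fun g => K i g⁻¹) g := by
    intro i
    have e1 : ∀ z, ∫ g, φ (a.act z g) * Gr.L^[s] (K i) g = ∫ g, f (a.act z g) * K i g := fun z => by
      rw [← integral_Lpow_symm s (a.sm_left z hφ.sm) (hK i), a.Lpow_act s hφ]
    simp only [e1]
    rw [a.integral_move hf hWT (hK i).integrable]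
    refine integral_congr_ae (.of_forall fun z => ?_)
    have e2 := Gr.integral_word_mul l.reverse (a.sm_left z hw.sm) (TF_inv (hK i))
    rw [a.word_act _ hw.sm, List.reverse_reverse, List.length_reverse, hl, hsgn, one_mul] at e2
    simp only []
    rw [← e2]
  have h2 : ∀ i z, ∫ g, φ (a.act z g) * Gr.L^[s] (K i) g = (∫ g, φ (a.act z (dil S ((2 : ℝ) ^ i)⁻¹ g)) * ρ g)
      - ∫ g, φ (a.act z (dil S ((2 : ℝ) ^ i) g)) * ϑ i g := by
    intro i z
    have hz := (hφ.continuous.comp (a.continuous_act.comp (Continuous.prodMk_right z)))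
    have h0 : (0 : ℝ) < 2 ^ i := by positivity
    have hi1 : Integrable fun g => φ (a.act z g) * (((2 : ℝ) ^ i) ^ hdim S * ρ (dil S (2 ^ i) g)) :=
      ((((TF_dil (S := S) h0.ne' hρ).const_mul _).mul_left (a.sm_left z hφ.sm))).integrable
    have hi2 : Integrable fun g => φ (a.act z g) * ((((2 : ℝ) ^ i)⁻¹) ^ hdim S * ϑ i (dil S (2 ^ i)⁻¹ g)) :=
      ((((TF_dil (S := S) (inv_ne_zero h0.ne') (hϑ i)).const_mul _).mul_left (a.sm_left z hφ.sm))).integrable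
    simp only [hL, mul_sub]
    rw [integral_sub hi1 hi2]
    congr 1
    · have e := integral_dil h0 fun g => φ (a.act z (dil S ((2 : ℝ) ^ i)⁻¹ g)) * ρ g
      rw [eq_inv_mul_iff_mul_eq₀ (by positivity), ← integral_const_mul] at e
      rw [← e]
      refine integral_congr_ae (.of_forall fun g => ?_)
      simp only [dil_inv_dil h0.ne']; ring
    · have e := integral_dil (inv_pos.2 h0) fun g => φ (a.act z (dil S ((2 : ℝ) ^ i) g)) * ϑ i g
      rw [eq_inv_mul_iff_mul_eq₀ (by positivity), ← integral_const_mul] at e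
      rw [← e]
      refine integral_congr_ae (.of_forall fun g => ?_)
      simp only [dil_dil_inv h0.ne']; ring
  obtain ⟨B, hB⟩ := hφ.bdd
  have hB0 : 0 ≤ B := (abs_nonneg _).trans (hB 0)
  have hT : Filter.Tendsto (fun i => ∫ z, W z * ∫ g, φ (a.act z g) * Gr.L^[s] (K i) g) Filter.atTop
      (nhds (∫ z, W z * φ z)) := by
    refine tendsto_integral_of_dominated_convergence
      (fun z => |W z| * (B * (∫ g, |ρ g|) + B * (∫ g, Set.indicator {g : Gr S | NN g ≤ R} (fun _ => C) g)))
      (fun i => (hWT.continuous.measurable.mul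
        (a.measurable_conv hφ (Gr.Lpow_TF s (hK i)).isKer)).aestronglyMeasurable)
      (hWT.integrable.abs.mul_const _) (fun i => .of_forall fun z => ?_) (.of_forall fun z => ?_)
    · rw [norm_mul, Real.norm_eq_abs]
      refine mul_le_mul_of_nonneg_left ?_ (abs_nonneg _)
      rw [h2]
      refine (norm_sub_le _ _).trans (add_le_add ?_ ?_)
      · rw [← integral_const_mul]
        refine norm_integral_le_of_norm_le (hρ.integrable.abs.const_mul B) (.of_forall fun g => ?_)
        rw [norm_mul]
        exact mul_le_mul_of_nonneg_right (hB _) (norm_nonneg _)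
      · rw [← integral_const_mul]
        refine norm_integral_le_of_norm_le (((integrable_indicator_iff (isCompact_NN R).measurableSet).2
          (integrableOn_const (isCompact_NN R).measure_lt_top.ne)).const_mul B) (.of_forall fun g => ?_)
        rw [norm_mul]
        refine mul_le_mul (hB _) ?_ (norm_nonneg _) hB0
        by_cases hg : NN g ≤ R
        · rw [Set.indicator_of_mem (s := {g : Gr S | NN g ≤ R}) hg]; exact hϑC i g
        · rw [Set.indicator_of_notMem (s := {g : Gr S | NN g ≤ R}) hg, hϑR i g (not_le.1 hg), norm_zero]
    · simp only [h2]
      have := (a.tendsto_contract hφ hρ hρ1 z).sub (a.tendsto_expand hφ hϑ hϑC hϑR z)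
      rw [sub_zero] at this
      exact this.const_mul _
  have hbd : ∀ i, ‖∫ z, W z * ∫ g, φ (a.act z g) * Gr.L^[s] (K i) g‖ₑ ≤ ENNReal.ofReal C' *
      (eLpNorm f (ENNReal.ofReal p) volume * eLpNorm w (ENNReal.ofReal q) volume) := by
    intro i
    obtain ⟨F, ψ, hψ1, hψ2⟩ := hψ i
    rw [h1]
    simp only [hψ2]
    exact H F ψ hψ1 f w hf hw
  simp only [mul_comm (φ _)]
  exact le_of_tendsto hT.enorm (.of_forall hbd)

end Act

end Gr

section Duality

variable {E : Type*} [NormedAddCommGroup E] [NormedSpace ℝ E] [MeasurableSpace E] [BorelSpace E] {μ : Measure E}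
  [IsFiniteMeasureOnCompacts μ]

theorem integral_abs_rpow_eq {q : ℝ} (hq : 0 < q) {w : E → ℝ} (hw : TF w) :
    ENNReal.ofReal (∫ x, |w x| ^ q ∂μ) = eLpNorm w (ENNReal.ofReal q) μ ^ q := by
  have hi : Integrable (fun x => |w x| ^ q) μ := by
    refine Continuous.integrable_of_hasCompactSupport
      (hw.continuous.abs.rpow_const fun x => Or.inr hq.le) (hw.cs.mono fun x hx => ?_)
    intro h
    exact hx (by simp only [h, abs_zero]; exact Real.zero_rpow hq.ne')
  rw [eLpNorm_ofReal_rpow hq, ofReal_integral_eq_lintegral_ofReal hi (.of_forall fun x => by positivity)]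
  refine lintegral_congr fun x => ?_
  rw [← ENNReal.ofReal_rpow_of_nonneg (abs_nonneg _) hq.le, Real.enorm_eq_ofReal_abs]

set_option maxHeartbeats 1000000 in
/-- Duality: pairings with test functions control the norm. -/
theorem eLpNorm_le_of_pairing {p q : ℝ} (hpq : p.HolderConjugate q) {v : E → ℝ} (hv : TF v) {M : ℝ≥0∞}
    (hM : M ≠ ∞) (H : ∀ w : E → ℝ, TF w → ‖∫ z, v z * w z ∂μ‖ₑ ≤ M * eLpNorm w (ENNReal.ofReal q) μ) :
    eLpNorm v (ENNReal.ofReal p) μ ≤ M := by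
  have hp := hpq.pos
  have hq := hpq.symm.pos
  have hp1 := hpq.lt
  set ε : ℕ → ℝ := fun k => 1 / ((k : ℝ) + 1) with hε
  have hε0 : ∀ k, 0 < ε k := fun k => by positivity
  have hε1 : ∀ k, ε k ≤ 1 := fun k => by
    rw [hε]; simp only []
    exact (div_le_one (by positivity)).2 (by linarith [k.cast_nonneg (α := ℝ)])
  set w : ℕ → E → ℝ := fun k z => v z * (v z ^ 2 + ε k ^ 2) ^ ((p - 2) / 2) with hw
  have hwT : ∀ k, TF (w k) := fun k => hv.mul_right
    (((hv.sm.pow 2).add contDiff_const).rpow_const_of_ne fun z => by have := hε0 k; positivity)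
  set G : E → ℝ := fun z => |v z| ^ (p - 1) + |v z| * (v z ^ 2 + 1) ^ ((p - 2) / 2) with hG
  have hGc : Continuous G := (hv.continuous.abs.rpow_const fun x => Or.inr (by linarith)).add
    (hv.continuous.abs.mul (((hv.continuous.pow 2).add continuous_const).rpow_const
      fun x => Or.inl (show v x ^ 2 + 1 ≠ 0 by positivity)))
  have hG0 : ∀ z, 0 ≤ G z := fun z => by rw [hG]; positivity
  have hGz : ∀ z, v z = 0 → G z = 0 := fun z h => by
    simp only [hG, h, abs_zero, zero_mul, add_zero]
    exact Real.zero_rpow (by linarith)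
  have hsq : ∀ t : ℝ, t ≠ 0 → (t ^ 2) ^ ((p - 2) / 2) = |t| ^ (p - 2) := fun t _ => by
    rw [← sq_abs, ← Real.rpow_natCast, ← Real.rpow_mul (abs_nonneg _)]
    congr 1
    push_cast; ring
  have hmul : ∀ t : ℝ, t ≠ 0 → |t| * |t| ^ (p - 2) = |t| ^ (p - 1) := fun t ht => by
    rw [← Real.rpow_one_add' (abs_nonneg _) (by linarith)]; congr 1; ring
  have hwG : ∀ k z, |w k z| ≤ G z := by
    intro k z
    by_cases h : v z = 0
    · simp [hw, h, hG0 z]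
    rw [hw]; simp only []
    rw [abs_mul, abs_of_nonneg (a := (v z ^ 2 + ε k ^ 2) ^ ((p - 2) / 2)) (by positivity)]
    have hvp : 0 < v z ^ 2 := by positivity
    rcases le_total 2 p with h2 | h2
    · refine le_add_of_nonneg_of_le (by positivity) (mul_le_mul_of_nonneg_left ?_ (abs_nonneg _))
      refine Real.rpow_le_rpow (by positivity) ?_ (by linarith)
      have : ε k ^ 2 ≤ 1 := pow_le_one₀ (hε0 k).le (hε1 k)
      linarith
    · refine le_add_of_le_of_nonneg ?_ (by positivity)
      rw [← hmul _ h, ← hsq _ h]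
      refine mul_le_mul_of_nonneg_left ?_ (abs_nonneg _)
      exact Real.rpow_le_rpow_of_nonpos hvp (by linarith [sq_nonneg (ε k)]) (by linarith)
  have hεt : Filter.Tendsto ε Filter.atTop (nhds 0) := tendsto_one_div_add_atTop_nhds_zero_nat
  have hwt : ∀ z, Filter.Tendsto (fun k => w k z) Filter.atTop (nhds (v z * |v z| ^ (p - 2))) := by
    intro z
    by_cases h : v z = 0
    · simp [hw, h]
    · have hvp : v z ^ 2 + 0 ^ 2 ≠ 0 := by positivity
      have h1 : Filter.Tendsto (fun k => v z ^ 2 + ε k ^ 2) Filter.atTop (nhds (v z ^ 2 + 0 ^ 2)) :=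
        (hεt.pow 2).const_add _
      have h2 := (h1.rpow_const (p := (p - 2) / 2) (Or.inl hvp)).const_mul (v z)
      rwa [zero_pow two_ne_zero, add_zero, hsq _ h] at h2
  have hlim : ∀ z, v z * (v z * |v z| ^ (p - 2)) = |v z| ^ p := by
    intro z
    by_cases h : v z = 0
    · rw [h, zero_mul, abs_zero, Real.zero_rpow hp.ne']
    · rw [← mul_assoc, ← abs_mul_abs_self, mul_assoc, hmul _ h, ← Real.rpow_one_add' (abs_nonneg _) (by linarith)]
      congr 1; ring
  have hlimq : ∀ z, |v z * |v z| ^ (p - 2)| ^ q = |v z| ^ p := by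
    intro z
    by_cases h : v z = 0
    · rw [h, zero_mul, abs_zero, Real.zero_rpow hp.ne', Real.zero_rpow hq.ne']
    · rw [abs_mul, abs_of_nonneg (a := |v z| ^ (p - 2)) (by positivity), hmul _ h, ← Real.rpow_mul (abs_nonneg _)]
      congr 1
      exact hpq.sub_one_mul_conj
  have hcs : ∀ {F : E → ℝ}, (∀ z, v z = 0 → F z = 0) → HasCompactSupport F := fun h =>
    hv.cs.mono fun z hz h' => hz (h z h')
  have hT1 : Filter.Tendsto (fun k => ∫ z, v z * w k z ∂μ) Filter.atTop (nhds (∫ z, |v z| ^ p ∂μ)) := by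
    simp only [← hlim]
    refine tendsto_integral_of_dominated_convergence (fun z => |v z| * G z)
      (fun k => (hv.continuous.mul (hwT k).continuous).aestronglyMeasurable)
      ((hv.continuous.abs.mul hGc).integrable_of_hasCompactSupport (hcs fun z h => by simp [h]))
      (fun k => .of_forall fun z => ?_) (.of_forall fun z => (hwt z).const_mul _)
    rw [Real.norm_eq_abs, abs_mul]
    exact mul_le_mul_of_nonneg_left (hwG k z) (abs_nonneg _)
  have hT2 : Filter.Tendsto (fun k => ∫ z, |w k z| ^ q ∂μ) Filter.atTop (nhds (∫ z, |v z| ^ p ∂μ)) := by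
    simp only [← hlimq]
    refine tendsto_integral_of_dominated_convergence (fun z => G z ^ q)
      (fun k => ((hwT k).continuous.abs.rpow_const fun _ => Or.inr hq.le).aestronglyMeasurable)
      ((hGc.rpow_const fun _ => Or.inr hq.le).integrable_of_hasCompactSupport
        (hcs fun z h => by simp only [hGz z h]; exact Real.zero_rpow hq.ne'))
      (fun k => .of_forall fun z => ?_) (.of_forall fun z => ((hwt z).abs).rpow_const (Or.inr hq.le))
    rw [Real.norm_eq_abs, abs_of_nonneg (by positivity)]
    exact Real.rpow_le_rpow (abs_nonneg _) (hwG k z) hq.le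
  set I := ∫ z, |v z| ^ p ∂μ with hI
  have hI0 : 0 ≤ I := integral_nonneg fun z => by positivity
  have hk : ∀ k, |∫ z, v z * w k z ∂μ| ≤ M.toReal * (∫ z, |w k z| ^ q ∂μ) ^ (1 / q) := by
    intro k
    have h1 := H (w k) (hwT k)
    have hn : 0 ≤ ∫ z, |w k z| ^ q ∂μ := integral_nonneg fun z => by positivity
    have h2 : eLpNorm (w k) (ENNReal.ofReal q) μ = ENNReal.ofReal ((∫ z, |w k z| ^ q ∂μ) ^ (1 / q)) := by
      rw [← ENNReal.ofReal_rpow_of_nonneg hn (by positivity), integral_abs_rpow_eq hq (hwT k),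
        ← ENNReal.rpow_mul, mul_one_div_cancel hq.ne', ENNReal.rpow_one]
    rw [h2, Real.enorm_eq_ofReal_abs, ← ENNReal.ofReal_toReal hM, ← ENNReal.ofReal_mul ENNReal.toReal_nonneg] at h1
    exact (ENNReal.ofReal_le_ofReal_iff (by positivity)).1 h1
  have hfin : I ≤ M.toReal * I ^ (1 / q) := by
    have := le_of_tendsto_of_tendsto' hT1.abs ((hT2.rpow_const (p := 1 / q) (Or.inr (by positivity))).const_mul M.toReal) hk
    rwa [abs_of_nonneg hI0] at this
  have hfin2 : I ^ (1 / p) ≤ M.toReal := by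
    rcases hI0.eq_or_lt with h | h
    · rw [← h, Real.zero_rpow (by positivity)]; exact ENNReal.toReal_nonneg
    · have hpos : 0 < I ^ (1 / q) := Real.rpow_pos_of_pos h _
      refine le_of_mul_le_mul_right ?_ hpos
      rw [← Real.rpow_add h, one_div, one_div, hpq.inv_add_inv_eq_one, Real.rpow_one, ← one_div]
      exact hfin
  calc eLpNorm v (ENNReal.ofReal p) μ = ENNReal.ofReal (I ^ (1 / p)) := by
        rw [← ENNReal.ofReal_rpow_of_nonneg hI0 (by positivity), integral_abs_rpow_eq hp hv,
          ← ENNReal.rpow_mul, mul_one_div_cancel hp.ne', ENNReal.rpow_one]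
    _ ≤ ENNReal.ofReal M.toReal := ENNReal.ofReal_le_ofReal hfin2
    _ = M := ENNReal.ofReal_toReal hM

end Duality

namespace Gr.Act

variable {n : ℕ} {ι β : Type} [Fintype ι] [Fintype β] {S : Shear n ι β}
variable {E : Type*} [NormedAddCommGroup E] [NormedSpace ℝ E] [MeasureSpace E] (a : Act S E)
variable [BorelSpace E] [SecondCountableTopology E] [SigmaFinite (volume : Measure E)]
  [IsFiniteMeasureOnCompacts (volume : Measure E)]

/-- Boundedness of the even-order Riesz transforms of an action. -/
theorem exists_riesz_bound [NeZero n] [Nonempty ι] {s : ℕ} (hs : 1 ≤ s)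
    {l : List (Fin n ⊕ β)} (hl : l.length = 2 * s) {p : ℝ} (hp : 1 < p) :
    ∃ C : ℝ, 0 ≤ C ∧ ∀ φ : E → ℝ, TF φ → eLpNorm (a.word l φ) (ENNReal.ofReal p) volume ≤
      ENNReal.ofReal C * eLpNorm (a.L^[s] φ) (ENNReal.ofReal p) volume := by
  have hpq := Real.HolderConjugate.conjExponent hp
  obtain ⟨C, hC, H⟩ := a.exists_weak_bound hs hl hpq
  refine ⟨C, hC, fun φ hφ => ?_⟩
  refine eLpNorm_le_of_pairing hpq (a.word_TF l hφ) ?_ fun w hw => ?_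
  · exact ENNReal.mul_ne_top ENNReal.ofReal_ne_top ((a.Lpow_TF s hφ).memLp _).eLpNorm_ne_top
  · rw [mul_assoc]; exact H φ w hφ hw

end Gr.Act

/-- Matrix entries of the translation action on divided powers. -/
noncomputable def dpow {n : ℕ} (x : Fin n → ℝ) (μ ν : Fin n → ℕ) : ℝ :=
  ∏ i, if μ i ≤ ν i then x i ^ (ν i - μ i) / (ν i - μ i).factorial else 0

namespace dpow

variable {n : ℕ}

theorem eq_zero {μ ν : Fin n → ℕ} (h : ¬ μ ≤ ν) (x : Fin n → ℝ) : dpow x μ ν = 0 := by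
  obtain ⟨i, hi⟩ := not_forall.1 h
  exact Finset.prod_eq_zero (Finset.mem_univ i) (if_neg hi)

theorem eq_prod {μ ν : Fin n → ℕ} (h : μ ≤ ν) (x : Fin n → ℝ) :
    dpow x μ ν = ∏ i, x i ^ (ν i - μ i) / (ν i - μ i).factorial :=
  Finset.prod_congr rfl fun i _ => if_pos (h i)

theorem zero_left (x : Fin n → ℝ) (ν : Fin n → ℕ) :
    dpow x 0 ν = (∏ i, x i ^ ν i) / ∏ i, ((ν i).factorial : ℝ) := by
  rw [eq_prod (μ := 0) (fun _ => Nat.zero_le _), ← Finset.prod_div_distrib]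
  rfl

theorem self (x : Fin n → ℝ) (μ : Fin n → ℕ) : dpow x μ μ = 1 := by simp [dpow]

theorem at_zero (μ ν : Fin n → ℕ) : dpow 0 μ ν = if μ = ν then 1 else 0 := by
  split_ifs with h
  · rw [h, self]
  · by_cases hle : μ ≤ ν
    · obtain ⟨i, hi⟩ := Function.ne_iff.1 h
      rw [eq_prod hle]
      refine Finset.prod_eq_zero (Finset.mem_univ i) ?_
      rw [Pi.zero_apply, zero_pow (Nat.sub_ne_zero_of_lt (lt_of_le_of_ne (hle i) hi)), zero_div]
    · exact eq_zero hle _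

theorem sm (μ ν : Fin n → ℕ) : ContDiff ℝ (⊤ : ℕ∞) fun x : Fin n → ℝ => dpow x μ ν := by
  unfold dpow
  refine contDiff_prod fun i _ => ?_
  split_ifs
  · exact ((contDiff_apply ℝ ℝ i).pow _).div_const _
  · exact contDiff_const

theorem smul {μ ν : Fin n → ℕ} (h : μ ≤ ν) (r : ℝ) (x : Fin n → ℝ) :
    dpow (r • x) μ ν = r ^ (∑ i, ν i - ∑ i, μ i) * dpow x μ ν := by
  rw [eq_prod h, eq_prod h, ← Finset.sum_tsub_distrib _ fun i _ => h i,
    ← Finset.prod_pow_eq_pow_sum, ← Finset.prod_mul_distrib]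
  exact Finset.prod_congr rfl fun i _ => by
    rw [Pi.smul_apply, smul_eq_mul, mul_pow, mul_div_assoc]

theorem sum_one {N a c : ℕ} (hc : c ≤ N) (s t : ℝ) :
    ∑ b ∈ Finset.range (N + 1), (if a ≤ b then s ^ (b - a) / (b - a).factorial else 0) *
      (if b ≤ c then t ^ (c - b) / (c - b).factorial else 0) =
    if a ≤ c then (s + t) ^ (c - a) / (c - a).factorial else 0 := by
  split_ifs with h
  · obtain ⟨d, rfl⟩ := Nat.exists_eq_add_of_le h
    have hsub : (Finset.range (d + 1)).map (addLeftEmbedding a) ⊆ Finset.range (N + 1) := by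
      intro b hb
      obtain ⟨j, hj, rfl⟩ := Finset.mem_map.1 hb
      have := Finset.mem_range.1 hj
      simp only [addLeftEmbedding_apply, Finset.mem_range]
      omega
    rw [← Finset.sum_subset hsub, Finset.sum_map, add_pow, Nat.add_sub_cancel_left,
      Finset.sum_div]
    · refine Finset.sum_congr rfl fun j hj => ?_
      have hj' : j ≤ d := by have := Finset.mem_range.1 hj; omega
      simp only [addLeftEmbedding_apply]
      rw [if_pos (by omega), if_pos (by omega), Nat.add_sub_cancel_left, Nat.add_sub_add_left,
        Nat.cast_choose ℝ hj']
      have := Nat.factorial_ne_zero d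
      have := Nat.factorial_ne_zero j
      have := Nat.factorial_ne_zero (d - j)
      field_simp
    · intro b _ hb
      by_cases h1 : a ≤ b
      · rw [if_neg (c := b ≤ a + d), mul_zero]
        intro h2
        refine hb (Finset.mem_map.2 ⟨b - a, Finset.mem_range.2 (by omega), ?_⟩)
        simp only [addLeftEmbedding_apply]
        omega
      · rw [if_neg h1, zero_mul]
  · refine Finset.sum_eq_zero fun b _ => ?_
    by_cases h1 : a ≤ b
    · rw [if_neg (c := b ≤ c) (by omega), mul_zero]
    · rw [if_neg h1, zero_mul]

end dpow

/-- Multi-indices of order at most `N`. -/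
abbrev MI (n N : ℕ) := {μ : Fin n → ℕ // ∑ i, μ i ≤ N}

theorem MI.le {n N : ℕ} (μ : MI n N) (i : Fin n) : μ.1 i ≤ N :=
  (Finset.single_le_sum (fun _ _ => Nat.zero_le _) (Finset.mem_univ i)).trans μ.2

noncomputable instance (n N : ℕ) : Fintype (MI n N) :=
  Fintype.ofInjective (fun μ : MI n N => fun i => (⟨μ.1 i, Nat.lt_succ_of_le (MI.le μ i)⟩ : Fin (N + 1)))
    fun μ ν h => Subtype.ext (funext fun i => by simpa using congrFun h i)

/-- Multi-indices of order exactly `N`. -/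
abbrev MT (n N : ℕ) := {ν : Fin n → ℕ // ∑ i, ν i = N}

noncomputable instance (n N : ℕ) : Fintype (MT n N) :=
  Fintype.subtype (Finset.piAntidiag Finset.univ N) fun ν => by simp

/-- A multi-index of order `N` regarded as one of order at most `N`. -/
def MT.toMI {n N : ℕ} (ν : MT n N) : MI n N := ⟨ν.1, ν.2.le⟩

theorem dpow.add {n N : ℕ} (x y : Fin n → ℝ) (μ ν : MI n N) :
    dpow (x + y) μ.1 ν.1 = ∑ κ : MI n N, dpow x μ.1 κ.1 * dpow y κ.1 ν.1 := by
  have h1 : dpow (x + y) μ.1 ν.1 =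
      ∑ κ ∈ Fintype.piFinset fun _ : Fin n => Finset.range (N + 1), dpow x μ.1 κ * dpow y κ ν.1 := by
    unfold dpow
    refine (Finset.prod_congr rfl fun i _ =>
      (dpow.sum_one (a := μ.1 i) (MI.le ν i) (x i) (y i)).symm).trans ?_
    rw [Finset.prod_univ_sum]
    exact Finset.sum_congr rfl fun κ _ => Finset.prod_mul_distrib
  rw [h1]
  refine (Finset.sum_subset_zero_on_sdiff (s₁ := Finset.univ.map (Function.Embedding.subtype _))
    (g := fun κ => dpow x μ.1 κ * dpow y κ ν.1) ?_ ?_ fun _ _ => rfl).symm.trans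
    (Finset.sum_map _ _ _)
  · intro κ hκ
    obtain ⟨κ, -, rfl⟩ := Finset.mem_map.1 hκ
    change MI n N at κ
    exact Fintype.mem_piFinset.2 fun i => Finset.mem_range.2 (Nat.lt_succ_of_le (MI.le κ i))
  · intro κ hκ
    by_cases h : κ ≤ ν.1
    · exact absurd (Finset.mem_map_of_mem (Function.Embedding.subtype _)
        (Finset.mem_univ (⟨κ, (Finset.sum_le_sum fun i _ => h i).trans ν.2⟩ : MI n N)))
        (Finset.mem_sdiff.1 hκ).2
    · rw [dpow.eq_zero h, mul_zero]

section

variable {n m N : ℕ}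

/-- The translation action of `ℝⁿ` on Taylor coefficients of order at most `N`. -/
noncomputable def taylorRho (n m N : ℕ) (x : Fin n → ℝ) :
    (MI n N × Fin m → ℝ) →L[ℝ] (MI n N × Fin m → ℝ) :=
  ContinuousLinearMap.pi fun p =>
    ∑ κ : MI n N, dpow x p.1.1 κ.1 • ContinuousLinearMap.proj (R := ℝ) (κ, p.2)

theorem taylorRho_apply (x : Fin n → ℝ) (q : MI n N × Fin m → ℝ) (p : MI n N × Fin m) :
    taylorRho n m N x q p = ∑ κ : MI n N, dpow x p.1.1 κ.1 * q (κ, p.2) := by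
  simp [taylorRho]

open Classical in
/-- The generating vectors of weight one. -/
noncomputable def taylorVec (n m N : ℕ) (b : MT n N × Fin m) (p : MI n N × Fin m) : ℝ :=
  if p = (b.1.toMI, b.2) then Real.sqrt (N.factorial * ∏ i, ((b.1.1 i).factorial : ℝ)) else 0

theorem taylorRho_vec (x : Fin n → ℝ) (b : MT n N × Fin m) (p : MI n N × Fin m) :
    taylorRho n m N x (taylorVec n m N b) p =
      if p.2 = b.2 then
        Real.sqrt (N.factorial * ∏ i, ((b.1.1 i).factorial : ℝ)) * dpow x p.1.1 b.1.1
      else 0 := by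
  rw [taylorRho_apply, Finset.sum_eq_single b.1.toMI]
  · by_cases h : p.2 = b.2 <;> simp [taylorVec, h, MT.toMI, mul_comm]
  · intro κ _ hκ
    simp [taylorVec, hκ]
  · simp

theorem MI.exists_le (hn : 1 ≤ n) (μ : MI n N) : ∃ ν : MT n N, μ.1 ≤ ν.1 := by
  refine ⟨⟨μ.1 + Pi.single (⟨0, hn⟩ : Fin n) (N - ∑ i, μ.1 i), ?_⟩, le_self_add⟩
  simp only [Pi.add_apply, Finset.sum_add_distrib]
  rw [Finset.sum_pi_single', if_pos (Finset.mem_univ _)]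
  have := μ.2
  omega

theorem eq_zero_of_sum_dpow_eq_zero (ν : Fin n → ℕ) (c : MI n N → ℝ)
    (h : ∀ x : Fin n → ℝ, ∑ μ : MI n N, dpow x μ.1 ν * c μ = 0) {μ : MI n N} (hμ : μ.1 ≤ ν) :
    c μ = 0 := by
  classical
  set e : (Fin n → ℕ) ≃ (Fin n →₀ ℕ) := Finsupp.equivFunOnFinite.symm
  set P : MvPolynomial (Fin n) ℝ := ∑ μ : MI n N, if μ.1 ≤ ν then
    MvPolynomial.monomial (e (ν - μ.1)) (c μ / ∏ i, ((ν i - μ.1 i).factorial : ℝ)) else 0 with hP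
  have hP0 : P = 0 := by
    refine MvPolynomial.funext fun x => ?_
    rw [map_zero, ← h x, hP, map_sum]
    refine Finset.sum_congr rfl fun μ _ => ?_
    split_ifs with hle
    · rw [MvPolynomial.eval_monomial, Finsupp.prod_fintype _ _ fun _ => pow_zero _,
        dpow.eq_prod hle, Finset.prod_div_distrib]
      change _ * ∏ i, x i ^ (ν i - μ.1 i) = _
      ring
    · rw [dpow.eq_zero hle, zero_mul, map_zero]
  have hc := congrArg (MvPolynomial.coeff (e (ν - μ.1))) hP0
  rw [hP, MvPolynomial.coeff_sum, Finset.sum_eq_single μ, if_pos hμ, MvPolynomial.coeff_monomial,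
    if_pos rfl, MvPolynomial.coeff_zero, div_eq_zero_iff] at hc
  · exact hc.resolve_right (Finset.prod_ne_zero_iff.2 fun i _ => by positivity)
  · intro κ _ hκ
    split_ifs with hle
    · rw [MvPolynomial.coeff_monomial, if_neg]
      intro he
      have := e.injective he
      refine hκ (Subtype.ext (funext fun i => ?_))
      have h1 : ν i - κ.1 i = ν i - μ.1 i := congrFun this i
      have h2 : κ.1 i ≤ ν i := hle i
      have h3 : μ.1 i ≤ ν i := hμ i
      omega
    · exact MvPolynomial.coeff_zero _
  · simp

theorem span_taylorRho_vec (hn : 1 ≤ n) : Submodule.span ℝ (Set.range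
    fun p : (Fin n → ℝ) × (MT n N × Fin m) => taylorRho n m N p.1 (taylorVec n m N p.2)) = ⊤ := by
  classical
  by_contra hne
  obtain ⟨ℓ, hℓ, hle⟩ := Submodule.exists_le_ker_of_lt_top _ (lt_top_iff_ne_top.2 hne)
  refine hℓ (LinearMap.ext fun q => ?_)
  rw [LinearMap.pi_apply_eq_sum_univ, LinearMap.zero_apply]
  refine Finset.sum_eq_zero fun p _ => ?_
  obtain ⟨ν, hν⟩ := MI.exists_le hn p.1
  set c : MI n N → ℝ := fun μ => ℓ fun j => if (μ, p.2) = j then 1 else 0 with hc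
  have hk : c p.1 = 0 := by
    refine eq_zero_of_sum_dpow_eq_zero ν.1 c (fun x => ?_) hν
    have h0 : ℓ (taylorRho n m N x (taylorVec n m N (ν, p.2))) = 0 :=
      hle (Submodule.subset_span ⟨(x, (ν, p.2)), rfl⟩)
    rw [LinearMap.pi_apply_eq_sum_univ, Fintype.sum_prod_type] at h0
    have hs : (Real.sqrt (N.factorial * ∏ i, ((ν.1 i).factorial : ℝ))) ≠ 0 :=
      (Real.sqrt_pos.2 (mul_pos (by positivity)
        (Finset.prod_pos fun i _ => by positivity))).ne'
    refine (mul_eq_zero.1 ((?_ : _ = _).trans h0)).resolve_left hs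
    rw [Finset.mul_sum]
    refine Finset.sum_congr rfl fun μ _ => ?_
    rw [Finset.sum_eq_single p.2]
    · rw [taylorRho_vec, if_pos rfl, smul_eq_mul, mul_assoc]
    · intro k _ hk
      rw [taylorRho_vec, if_neg hk, zero_smul]
    · simp
  change q p • c p.1 = 0
  rw [hk, smul_zero]

/-- The shear action of `ℝⁿ` on Taylor coefficients, with its generating family. -/
noncomputable def taylorShear (n m N : ℕ) (hn : 1 ≤ n) :
    Shear n (MI n N × Fin m) (MT n N × Fin m) where
  ρ := taylorRho n m N
  zero q := by
    ext p
    rw [taylorRho_apply, Finset.sum_eq_single p.1]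
    · rw [dpow.self, one_mul]
    · intro κ _ hκ
      rw [dpow.at_zero, if_neg fun h => hκ (Subtype.ext h.symm), zero_mul]
    · simp
  add x y q := by
    ext p
    simp only [taylorRho_apply, dpow.add, Finset.sum_mul, Finset.mul_sum]
    rw [Finset.sum_comm]
    simp only [mul_assoc]
  smooth := by
    refine contDiff_clm_apply_iff.2 fun q => contDiff_pi.2 fun p => ?_
    simp only [taylorRho_apply]
    exact ContDiff.sum fun κ _ => (dpow.sm _ _).mul contDiff_const
  w p := N + 1 - ∑ i, p.1.1 i
  w_pos p := by have := p.1.2; omega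
  dil r x q := by
    ext p
    simp only [taylorRho_apply, Finset.mul_sum]
    refine Finset.sum_congr rfl fun κ _ => ?_
    by_cases h : p.1.1 ≤ κ.1
    · have h1 : ∑ i, p.1.1 i ≤ ∑ i, κ.1 i := Finset.sum_le_sum fun i _ => h i
      have h2 := κ.2
      rw [dpow.smul h, show N + 1 - ∑ i, p.1.1 i =
        (∑ i, κ.1 i - ∑ i, p.1.1 i) + (N + 1 - ∑ i, κ.1 i) by omega, pow_add]
      ring
    · rw [dpow.eq_zero h, dpow.eq_zero h]
      ring
  v := taylorVec n m N
  v_hom b r p := by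
    unfold taylorVec
    split_ifs with h
    · have : ∑ i, p.1.1 i = N := by rw [h]; exact b.1.2
      rw [this, Nat.add_sub_cancel_left, pow_one]
    · simp
  span := span_taylorRho_vec hn

end

section

variable {n m N : ℕ} {hn : 1 ≤ n}

/-- The differential at the identity of the orbit map through `z`. -/
noncomputable def orbitLin (z : Pt n m) : Gr (taylorShear n m N hn) →L[ℝ] Pt n m :=
  ContinuousLinearMap.prod (ContinuousLinearMap.fst ℝ (Fin n → ℝ) (MI n N × Fin m → ℝ))
    (ContinuousLinearMap.pi fun k =>
      ((ContinuousLinearMap.proj (R := ℝ) ((⟨0, by simp⟩ : MI n N), k)).comp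
        (taylorRho n m N z.1)).comp
        (ContinuousLinearMap.snd ℝ (Fin n → ℝ) (MI n N × Fin m → ℝ)))

theorem orbitLin_fst (z : Pt n m) (g : Gr (taylorShear n m N hn)) :
    (orbitLin z g).1 = g.1 := rfl

theorem orbitLin_snd (z : Pt n m) (g : Gr (taylorShear n m N hn)) (k : Fin m) :
    (orbitLin z g).2 k = taylorRho n m N z.1 g.2 (⟨0, by simp⟩, k) := rfl

/-- The action of the group on `ℝ^(n+m)`. -/
noncomputable def grusinAct (n m N : ℕ) (hn : 1 ≤ n) : Gr.Act (taylorShear n m N hn) (Pt n m) where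
  act z g := z + orbitLin z g
  sm := by
    have hz : ContDiff ℝ (⊤ : ℕ∞) fun q : Pt n m × Gr (taylorShear n m N hn) => q.1 :=
      contDiff_fst
    have hg : ContDiff ℝ (⊤ : ℕ∞) fun q : Pt n m × Gr (taylorShear n m N hn) => q.2 :=
      contDiff_snd
    refine hz.add (ContDiff.prodMk (Gr.contDiff_fst.comp hg) (contDiff_pi.2 fun k => ?_))
    exact contDiff_pi.1 (Gr.contDiff_rho (taylorShear n m N hn) (contDiff_fst.comp hz)
      (Gr.contDiff_snd.comp hg)) _
  one z := by rw [Gr.one_eq_zero, map_zero, add_zero]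
  mul z g h := by
    refine Prod.ext ?_ (funext fun k => ?_)
    · simp only [Prod.fst_add, orbitLin_fst, Gr.mul_fst, add_assoc]
    · simp only [Prod.snd_add, Prod.fst_add, Pi.add_apply, orbitLin_fst, orbitLin_snd, Gr.mul_snd,
        map_add, add_assoc]
      exact congrArg (z.2 k + ·) (congrArg (_ + ·)
        (congrFun ((taylorShear n m N hn).add z.1 g.1 h.2) _))
  mp g := by
    refine MeasurePreserving.skew_product (f := fun x => x + g.1)
      (g := fun x y => y + (orbitLin (hn := hn) (N := N) (x, (0 : Fin m → ℝ)) g).2)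
      (measurePreserving_add_right volume g.1) ?_
      (.of_forall fun x => (measurePreserving_add_right volume _).map_eq)
    refine (continuous_snd.add (continuous_pi fun k => ?_)).measurable
    change Continuous fun q : Pt n m => taylorRho n m N q.1 g.2 (⟨0, by simp⟩, k)
    exact (continuous_apply (_, k)).comp (((Gr.cont_rho (taylorShear n m N hn)).comp
      continuous_fst).clm_apply (continuous_const (y := g.2)))
  escape K hK z := by
    haveI : Nonempty (Fin n) := ⟨⟨0, hn⟩⟩
    have h0 : ∀ᵐ g : Gr (taylorShear n m N hn), g.1 ≠ 0 :=
      (Measure.quasiMeasurePreserving_fst (μ := (volume : Measure (Fin n → ℝ)))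
        (ν := (volume : Measure (MI n N × Fin m → ℝ)))).ae
        (p := fun x => x ≠ 0) (Measure.ae_ne volume 0)
    filter_upwards [h0] with g hg
    obtain ⟨R, hR⟩ := hK.isBounded.exists_norm_le
    filter_upwards [Filter.eventually_gt_atTop 0,
      Filter.eventually_gt_atTop ((R + ‖z.1‖) / ‖g.1‖)] with t ht0 ht hmem
    have h1 := (norm_fst_le _).trans (hR _ hmem)
    have h2 : ‖t • g.1‖ ≤ ‖(z + orbitLin z (Gr.dil (taylorShear n m N hn) t g)).1‖ + ‖z.1‖ := by
      refine le_trans (le_of_eq ?_) (norm_sub_le _ _)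
      rw [Prod.fst_add, orbitLin_fst, Gr.dil_fst, add_sub_cancel_left]
    rw [norm_smul, Real.norm_of_nonneg ht0.le] at h2
    rw [div_lt_iff₀ (norm_pos_iff.2 hg)] at ht
    linarith

theorem grusinAct_X (b : Fin n ⊕ (MT n N × Fin m)) {φ : Pt n m → ℝ}
    (hφ : ContDiff ℝ (⊤ : ℕ∞) φ) : (grusinAct n m N hn).X b φ = Xop n m N b φ := by
  funext z
  have hd : (grusinAct n m N hn).X b φ z =
      fderiv ℝ φ z (orbitLin z (Gr.bv (taylorShear n m N hn) b)) := by
    have h1 : HasFDerivAt (fun g : Gr (taylorShear n m N hn) => z + orbitLin z g)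
        (orbitLin z : Gr (taylorShear n m N hn) →L[ℝ] Pt n m) 1 :=
      (orbitLin z : Gr (taylorShear n m N hn) →L[ℝ] Pt n m).hasFDerivAt.const_add z
    have h2 : HasFDerivAt φ (fderiv ℝ φ z)
        (z + orbitLin z (1 : Gr (taylorShear n m N hn))) := by
      rw [Gr.one_eq_zero, map_zero, add_zero]
      exact (hφ.differentiable (by simp) z).hasFDerivAt
    have h3 := HasFDerivAt.fderiv (h2.comp (1 : Gr (taylorShear n m N hn)) h1)
    change fderiv ℝ (φ ∘ fun g : Gr (taylorShear n m N hn) => z + orbitLin z g) 1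
      (Gr.fld (Gr.bv (taylorShear n m N hn) b) 1) = _
    rw [h3, ContinuousLinearMap.comp_apply]
    congr 2
    exact Gr.ext' rfl ((taylorShear n m N hn).zero _)
  rw [hd]
  rcases b with j | ⟨ν, k⟩
  · change _ = fderiv ℝ φ z _
    congr 1
    exact Prod.ext rfl (funext fun k => by
      rw [orbitLin_snd]
      exact congrFun (map_zero (taylorRho n m N z.1)) _)
  · change _ = Real.sqrt _ * _ * fderiv ℝ φ z _
    rw [← smul_eq_mul, ← map_smul]
    congr 1
    refine Prod.ext (by rw [orbitLin_fst, Prod.smul_fst, smul_zero]; rfl) (funext fun k' => ?_)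
    rw [orbitLin_snd]
    refine (taylorRho_vec z.1 (ν, k) _).trans ?_
    have hF : (0 : ℝ) < ∏ i, ((ν.1 i).factorial : ℝ) :=
      Finset.prod_pos fun i _ => by positivity
    simp only [Prod.smul_snd, Pi.smul_apply, Pi.single_apply, smul_eq_mul, mul_ite, mul_one,
      mul_zero, dpow.zero_left]
    congr 1
    rw [Real.sqrt_mul (by positivity), Real.sqrt_div (by positivity)]
    have hs := Real.sqrt_pos.2 hF
    have hq := Real.mul_self_sqrt hF.le
    field_simp
    rw [pow_two, hq, mul_comm]

theorem grusinAct_word (l : List (Fin n ⊕ (MT n N × Fin m))) {φ : Pt n m → ℝ}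
    (hφ : ContDiff ℝ (⊤ : ℕ∞) φ) :
    (grusinAct n m N hn).word l φ = compOps (l.map (Xop n m N)) φ := by
  induction l with
  | nil => rfl
  | cons b l ih =>
    rw [Gr.Act.word_cons, grusinAct_X b (Gr.Act.word_sm _ l hφ), ih]
    rfl

theorem Dy_mul_of_fst {u : (Fin n → ℝ) → ℝ} (hu : Differentiable ℝ u) {f : Pt n m → ℝ}
    (hf : Differentiable ℝ f) (k : Fin m) (z : Pt n m) :
    Dy n m k (fun z => u z.1 * f z) z = u z.1 * Dy n m k f z := by
  have h := HasFDerivAt.mul ((hu z.1).hasFDerivAt.comp z hasFDerivAt_fst) (hf z).hasFDerivAt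
  unfold Dy
  rw [HasFDerivAt.fderiv (f := fun z : Pt n m => u z.1 * f z) h]
  simp

theorem sum_factorial_div_mul (x : Fin n → ℝ) :
    ∑ ν : MT n N, ((N.factorial : ℝ) / ∏ i, ((ν.1 i).factorial : ℝ)) * (∏ i, x i ^ ν.1 i) ^ 2 =
      (∑ i, x i ^ 2) ^ N := by
  rw [Finset.sum_pow_eq_sum_piAntidiag]
  rw [Finset.sum_subtype (p := fun ν : Fin n → ℕ => ∑ i, ν i = N) _ (fun ν => by simp)]
  refine Finset.sum_congr rfl fun ν _ => ?_
  have hF : (∏ i, ((ν.1 i).factorial : ℝ)) ≠ 0 :=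
    Finset.prod_ne_zero_iff.2 fun i _ => by positivity
  have hm := Nat.multinomial_spec Finset.univ ν.1
  rw [ν.2] at hm
  rw [← hm, Nat.cast_mul, Nat.cast_prod, mul_div_cancel_left₀ _ hF, ← Finset.prod_pow]
  congr 1
  exact Finset.prod_congr rfl fun i _ => by rw [← pow_mul, ← pow_mul, mul_comm]

theorem grusinAct_L {φ : Pt n m → ℝ} (hφ : ContDiff ℝ (⊤ : ℕ∞) φ) :
    (grusinAct n m N hn).L φ = grusin n m N φ := by
  funext z
  have hy : ∀ k, Differentiable ℝ (Dy n m k φ) := fun k =>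
    ((hφ.fderiv_right (m := (⊤ : ℕ∞)) le_rfl).clm_apply contDiff_const).differentiable (by simp)
  have hX : ∀ b, (grusinAct n m N hn).X b ((grusinAct n m N hn).X b φ) z =
      Xop n m N b (Xop n m N b φ) z := fun b => by
    rw [grusinAct_X b (Gr.Act.X_sm _ b hφ), grusinAct_X b hφ]
  have hr : ∀ ν : MT n N, ∀ k, Xop n m N (Sum.inr (ν, k)) (Xop n m N (Sum.inr (ν, k)) φ) z =
      ((N.factorial : ℝ) / ∏ i, ((ν.1 i).factorial : ℝ)) * (∏ i, z.1 i ^ ν.1 i) ^ 2 *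
        Dy n m k (Dy n m k φ) z := by
    intro ν k
    have hu : Differentiable ℝ fun x : Fin n → ℝ =>
        Real.sqrt ((N.factorial : ℝ) / ∏ i, ((ν.1 i).factorial : ℝ)) * ∏ i, x i ^ ν.1 i :=
      (contDiff_const.mul (contDiff_prod fun i _ =>
        (contDiff_apply ℝ ℝ i).pow _)).differentiable (n := (⊤ : ℕ∞)) (by simp)
    refine (congrArg (_ * ·) (Dy_mul_of_fst hu (hy k) k z)).trans ?_
    have hF : (0 : ℝ) ≤ (N.factorial : ℝ) / ∏ i, ((ν.1 i).factorial : ℝ) :=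
      div_nonneg (by positivity) (Finset.prod_nonneg fun i _ => by positivity)
    nth_rewrite 3 [← Real.mul_self_sqrt hF]
    ring
  unfold Gr.Act.L grusin
  rw [Finset.sum_congr rfl fun b _ => hX b, Fintype.sum_sum_type, Fintype.sum_prod_type,
    ← sum_factorial_div_mul, Finset.sum_mul, neg_add, sub_eq_add_neg]
  refine congrArg₂ _ rfl (congrArg _ (Finset.sum_congr rfl fun ν _ => ?_))
  rw [Finset.mul_sum]
  exact Finset.sum_congr rfl fun k _ => hr ν k

theorem grusinAct_iterate (s : ℕ) {φ : Pt n m → ℝ} (hφ : TF φ) :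
    (grusinAct n m N hn).L^[s] φ = (grusin n m N)^[s] φ := by
  induction s with
  | zero => rfl
  | succ s ih =>
    rw [Function.iterate_succ_apply', Function.iterate_succ_apply', ← ih,
      grusinAct_L (Gr.Act.Lpow_TF _ s hφ).sm]

end

/-- (Boundedness of the even-order Riesz transforms of the Gru\v{s}in
operator.)  For `n, m, N ≥ 1`, `p ∈ (1,∞)`, `s ≥ 1` and any word `α` of elements of `𝒳`
with `|α| = 2s`, there is `c > 0` with `‖X^α φ‖_p ≤ c ‖H_N^s φ‖_p` for all
`φ ∈ C_c^∞(ℝ^(n+m))`. -/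
theorem grusin_riesz_even_order_Lp_bounded
    (n m N : ℕ) (hn : 1 ≤ n) (hm : 1 ≤ m) (hN : 1 ≤ N)
    (p : ℝ) (hp : 1 < p) (s : ℕ) (hs : 1 ≤ s)
    (α : Fin (2 * s) → XIdx n m N) :
    ∃ c > (0 : ℝ), ∀ φ : Pt n m → ℝ, ContDiff ℝ (⊤ : ℕ∞) φ → HasCompactSupport φ →
      eLpNorm (Xw α φ) (ENNReal.ofReal p) volume ≤
        ENNReal.ofReal c * eLpNorm ((grusin n m N)^[s] φ) (ENNReal.ofReal p) volume := by
  haveI : NeZero n := ⟨by omega⟩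
  haveI : Nonempty (MI n N × Fin m) := ⟨(⟨0, by simp⟩, ⟨0, hm⟩)⟩
  let l : List (Fin n ⊕ (MT n N × Fin m)) := List.ofFn α
  obtain ⟨C, hC, h⟩ := (grusinAct n m N hn).exists_riesz_bound hs (l := l)
    (List.length_ofFn (f := α)) hp
  refine ⟨C + 1, by linarith, fun φ hφ hc => ?_⟩
  have hT : TF φ := ⟨hφ, hc⟩
  have hw : (grusinAct n m N hn).word l φ = Xw α φ := by
    rw [grusinAct_word l hφ, Xw]
    exact congrArg (fun l => compOps l φ) List.map_ofFn
  rw [← hw, ← grusinAct_iterate (hn := hn) s hT]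
  refine (h φ hT).trans ?_
  gcongr
  linarith
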